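/- Let D be a reduced essential central hyperplane arrangement in ℂ³ with d > 3 hyperplanes. Then for α ∈ (0,1): α ∈ JC(D) if and only if either (a) there is a 1-dimensional edge V with m := μ_red(V) ≥ 3 such that mα ∈ ℤ and 2 ≤ mα < m, or (b) there is an integer i with 3 ≤ i < d such that α = i/d and C(i−1,2) − Σ_V C(⌈i·μ_red(V)/d⌉ − 1, 2) ≠ 0, where the sum is over all 1-dimensional edges V with μ_red(V) ≥ 3. (Corollary 1.) -/

import Mathlib

open MeasureTheory
open scoped Classical

noncomputable section

/-- A central hyperplane arrangement (with multiplicities) in `ℂ^n`, given by a finite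
nonempty family of pairwise non-proportional nonzero linear forms `g i` with
multiplicities `m i ≥ 1`. -/
structure Arrangement (n : ℕ) where
  ι : Type
  fintypeι : Fintype ι
  nonemptyι : Nonempty ι
  g : ι → ((Fin n → ℂ) →ₗ[ℂ] ℂ)
  m : ι → ℕ
  g_ne : ∀ i, g i ≠ 0
  m_pos : ∀ i, 0 < m i
  nonproportional : ∀ i j : ι, i ≠ j → ∀ c : ℂ, g i ≠ c • g j

attribute [instance] Arrangement.fintypeι

namespace Arrangement

variable {n : ℕ}

/-- The defining polynomial `f = ∏ i, g i ^ m i` of the arrangement, as a function. -/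
def f (D : Arrangement n) (x : Fin n → ℂ) : ℂ :=
  ∏ i, D.g i x ^ D.m i

/-- The degree `d = ∑ i, m i` of the arrangement. -/
def degree (D : Arrangement n) : ℕ := ∑ i, D.m i

/-- The arrangement is essential: the intersection of its hyperplanes is `{0}`. -/
def Essential (D : Arrangement n) : Prop :=
  (⨅ i, LinearMap.ker (D.g i)) = ⊥

/-- The arrangement is reduced: all multiplicities are `1`. -/
def Reduced (D : Arrangement n) : Prop := ∀ i, D.m i = 1

/-- The set of edges `S(D)`: intersections of nonempty subfamilies of the hyperplanes. -/
def edges (D : Arrangement n) : Set (Submodule ℂ (Fin n → ℂ)) :=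
  {V | ∃ I : Set D.ι, I.Nonempty ∧ V = ⨅ i ∈ I, LinearMap.ker (D.g i)}

/-- The codimension `γ(V)` of an edge. -/
def gamma (_D : Arrangement n) (V : Submodule ℂ (Fin n → ℂ)) : ℕ :=
  n - Module.finrank ℂ V

/-- The multiplicity `μ(V) = ∑_{i : V ⊆ D_i} m i` of an edge. -/
def mu (D : Arrangement n) (V : Submodule ℂ (Fin n → ℂ)) : ℕ :=
  ∑ i ∈ Finset.univ.filter fun i => V ≤ LinearMap.ker (D.g i), D.m i

/-- The reduced multiplicity `μ_red(V) = #{i : V ⊆ D_i}` of an edge. -/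
def muRed (D : Arrangement n) (V : Submodule ℂ (Fin n → ℂ)) : ℕ :=
  (Finset.univ.filter fun i => V ≤ LinearMap.ker (D.g i)).card

end Arrangement

/-- `α` is a jumping coefficient of (the divisor of) `f` at the point `x`: there is a
function `g` holomorphic near `x` with `|g|²·|f|^(−2β)` locally integrable at `x` for all
`0 < β < α`, while `|g|²·|f|^(−2α)` is not integrable on any neighborhood of `x`. -/
def JumpingAtOf {k : ℕ} (f : (Fin k → ℂ) → ℂ) (α : ℝ) (x : Fin k → ℂ) : Prop :=
  ∃ (U : Set (Fin k → ℂ)) (g : (Fin k → ℂ) → ℂ), U ∈ nhds x ∧ DifferentiableOn ℂ g U ∧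
    (∀ β : ℝ, 0 < β → β < α →
      ∃ W ∈ nhds x, IntegrableOn (fun y => ‖g y‖ ^ 2 * ‖f y‖ ^ (-2 * β)) W) ∧
    ∀ W ∈ nhds x, ¬ IntegrableOn (fun y => ‖g y‖ ^ 2 * ‖f y‖ ^ (-2 * α)) W

/-- The set `JC(D)` of jumping coefficients of the arrangement `D`. -/
def Arrangement.JC {n : ℕ} (D : Arrangement n) : Set ℝ :=
  {α | 0 < α ∧ ∃ x : Fin n → ℂ, JumpingAtOf D.f α x}

/-- The Cauchy–Riemann operator on the plane. -/
def dbar (f : ℂ → ℂ) (z : ℂ) : ℂ := (fderiv ℝ f z 1 + Complex.I * fderiv ℝ f z Complex.I) / 2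

/-- The conjugate Cauchy–Riemann operator on the plane. -/
def del (f : ℂ → ℂ) (z : ℂ) : ℂ := (fderiv ℝ f z 1 - Complex.I * fderiv ℝ f z Complex.I) / 2

theorem dbar_eq_zero {f : ℂ → ℂ} {z : ℂ} (h : DifferentiableAt ℂ f z) : dbar f z = 0 := by
  have := (differentiableAt_complex_iff_differentiableAt_real.1 h).2
  rw [dbar, this, smul_eq_mul, ← mul_assoc, Complex.I_mul_I]
  ring

theorem differentiableAt_of_dbar {f : ℂ → ℂ} {z : ℂ} (h : DifferentiableAt ℝ f z)
    (h0 : dbar f z = 0) : DifferentiableAt ℂ f z := by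
  refine differentiableAt_complex_iff_differentiableAt_real.2 ⟨h, ?_⟩
  rw [dbar, div_eq_zero_iff] at h0
  have h1 := h0.resolve_right two_ne_zero
  have : Complex.I * (fderiv ℝ f z 1 + Complex.I * fderiv ℝ f z Complex.I) = 0 := by
    rw [h1, mul_zero]
  rw [mul_add, ← mul_assoc, Complex.I_mul_I] at this
  rw [smul_eq_mul]
  linear_combination -this

theorem del_eq_deriv {f : ℂ → ℂ} {z : ℂ} (h : DifferentiableAt ℂ f z) : del f z = deriv f z := by
  have h1 := (differentiableAt_complex_iff_differentiableAt_real.1 h).2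
  have h2 : fderiv ℝ f z 1 = deriv f z := by
    rw [h.fderiv_restrictScalars ℝ]
    simp
  rw [del, h1, smul_eq_mul, ← mul_assoc, Complex.I_mul_I, h2]
  ring

theorem dbar_mul {f g : ℂ → ℂ} {z : ℂ} (hf : DifferentiableAt ℝ f z) (hg : DifferentiableAt ℝ g z) :
    dbar (fun w => f w * g w) z = f z * dbar g z + dbar f z * g z := by
  simp only [dbar, fderiv_fun_mul hf hg]
  simp
  ring

theorem del_mul {f g : ℂ → ℂ} {z : ℂ} (hf : DifferentiableAt ℝ f z) (hg : DifferentiableAt ℝ g z) :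
    del (fun w => f w * g w) z = f z * del g z + del f z * g z := by
  simp only [del, fderiv_fun_mul hf hg]
  simp
  ring

theorem dbar_add {f g : ℂ → ℂ} {z : ℂ} (hf : DifferentiableAt ℝ f z) (hg : DifferentiableAt ℝ g z) :
    dbar (fun w => f w + g w) z = dbar f z + dbar g z := by
  simp only [dbar, fderiv_fun_add hf hg]
  simp
  ring

theorem dbar_sub {f g : ℂ → ℂ} {z : ℂ} (hf : DifferentiableAt ℝ f z) (hg : DifferentiableAt ℝ g z) :
    dbar (fun w => f w - g w) z = dbar f z - dbar g z := by
  simp only [dbar, fderiv_fun_sub hf hg]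
  simp
  ring

theorem del_add {f g : ℂ → ℂ} {z : ℂ} (hf : DifferentiableAt ℝ f z) (hg : DifferentiableAt ℝ g z) :
    del (fun w => f w + g w) z = del f z + del g z := by
  simp only [del, fderiv_fun_add hf hg]
  simp
  ring

theorem dbar_congr {f g : ℂ → ℂ} {z : ℂ} (h : f =ᶠ[nhds z] g) : dbar f z = dbar g z := by
  rw [dbar, dbar, h.fderiv_eq]

theorem del_congr {f g : ℂ → ℂ} {z : ℂ} (h : f =ᶠ[nhds z] g) : del f z = del g z := by
  rw [del, del, h.fderiv_eq]

theorem dbar_const_mul_comp {f : ℂ → ℂ} (hf : Differentiable ℝ f) (c r w z : ℂ) :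
    dbar (fun x => c * f (w + (starRingEnd ℂ) r * x)) z
      = c * r * dbar f (w + (starRingEnd ℂ) r * z) := by
  have h1 : HasFDerivAt (fun x : ℂ => w + (starRingEnd ℂ) r * x)
      ((starRingEnd ℂ) r • ContinuousLinearMap.id ℝ ℂ) z := by
    have := ((hasFDerivAt_id (𝕜 := ℝ) z).const_mul ((starRingEnd ℂ) r)).const_add w
    exact this
  have h2 := (((hf _).hasFDerivAt.comp z h1).const_mul c).fderiv
  have h3 : (fun x => c * f (w + (starRingEnd ℂ) r * x))
    = fun y => c * (f ∘ fun x => w + (starRingEnd ℂ) r * x) y := rfl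
  rw [dbar, h3, h2]
  simp only [smul_apply, ContinuousLinearMap.comp_apply, smul_eq_mul,
    ContinuousLinearMap.id_apply, dbar]
  set L := fderiv ℝ f (w + (starRingEnd ℂ) r * z)
  have key : ∀ x : ℂ, L x = x.re * L 1 + x.im * L Complex.I := by
    intro x
    conv_lhs => rw [show x = x.re • (1 : ℂ) + x.im • Complex.I by
      simp [Complex.re_add_im]]
    rw [map_add, map_smul, map_smul]
    simp
  rw [key ((starRingEnd ℂ) r * 1), key ((starRingEnd ℂ) r * Complex.I)]
  simp
  have hI := Complex.I_mul_I
  conv_rhs => rw [← Complex.re_add_im r]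
  linear_combination (-(c * r.im * L Complex.I / 2)) * hI

theorem hasFDerivAt_normSq (z : ℂ) : HasFDerivAt (fun x : ℂ => (Complex.normSq x))
    ((2 * z.re) • Complex.reCLM + (2 * z.im) • Complex.imCLM) z := by
  have h1 := (Complex.reCLM.hasFDerivAt (x := z))
  have h2 := (Complex.imCLM.hasFDerivAt (x := z))
  have h := (h1.mul h1).add (h2.mul h2)
  refine (h.congr_fderiv ?_).congr_of_eventuallyEq (Filter.Eventually.of_forall fun w => ?_)
  · ext x
    simp
    ring
  · simp [Complex.normSq_apply]

/-- The cutoff profile `x ↦ smoothTransition (2 * x - 1)`. -/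
def cutProfile (x : ℝ) : ℝ := Real.smoothTransition (2 * x - 1)

theorem contDiff_cutProfile : ContDiff ℝ (⊤ : ℕ∞) cutProfile :=
  Real.smoothTransition.contDiff.comp ((contDiff_const.mul contDiff_id).sub contDiff_const)

theorem cutProfile_eq_zero {x : ℝ} (h : x ≤ 1 / 2) : cutProfile x = 0 :=
  Real.smoothTransition.zero_of_nonpos (by linarith)

theorem cutProfile_eq_one {x : ℝ} (h : 1 ≤ x) : cutProfile x = 1 :=
  Real.smoothTransition.one_of_one_le (by linarith)

theorem cutProfile_monotone : Monotone cutProfile := fun x y h =>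
  Real.smoothTransition.monotone (by linarith)

theorem contDiff_deriv_cutProfile : ContDiff ℝ (⊤ : ℕ∞) (deriv cutProfile) :=
  ((contDiff_infty_iff_deriv (𝕜 := ℝ) (f := cutProfile)).1 contDiff_cutProfile).2

theorem deriv_cutProfile_of_one_lt {x : ℝ} (h : 1 < x) : deriv cutProfile x = 0 := by
  have : cutProfile =ᶠ[nhds x] fun _ => 1 := by
    filter_upwards [lt_mem_nhds h] with y hy using cutProfile_eq_one hy.le
  rw [this.deriv_eq]; simp

theorem deriv_cutProfile_nonneg (x : ℝ) : 0 ≤ deriv cutProfile x :=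
  cutProfile_monotone.deriv_nonneg

theorem contDiff_normSq : ContDiff ℝ (⊤ : ℕ∞) (fun z : ℂ => Complex.normSq z) := by
  have : (fun z : ℂ => Complex.normSq z) = fun z => ‖z‖ ^ 2 := by
    ext z; rw [Complex.normSq_eq_norm_sq]
  rw [this]
  exact contDiff_norm_sq ℝ

/-- A smooth truncation of the Cauchy kernel `1/z`. -/
def cauchyTrunc (z : ℂ) : ℂ := (cutProfile (Complex.normSq z) : ℂ) * z⁻¹

/-- The `∂̄`-derivative of the truncated Cauchy kernel. -/
def cauchyBump (z : ℂ) : ℝ := deriv cutProfile (Complex.normSq z)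

theorem contDiff_cauchyTrunc : ContDiff ℝ (⊤ : ℕ∞) cauchyTrunc := by
  rw [contDiff_iff_contDiffAt]
  intro z
  by_cases hz : z = 0
  · subst hz
    have : cauchyTrunc =ᶠ[nhds 0] fun _ => 0 := by
      have h1 : ∀ᶠ w : ℂ in nhds 0, Complex.normSq w < 1 / 2 := by
        exact Complex.continuous_normSq.continuousAt.eventually_lt continuousAt_const (by simp)
      filter_upwards [h1] with w hw
      rw [cauchyTrunc, cutProfile_eq_zero hw.le]; simp
    exact contDiffAt_const.congr_of_eventuallyEq this
  · have h1 : ContDiffAt ℝ (⊤ : ℕ∞) (fun z : ℂ => (cutProfile (Complex.normSq z) : ℂ)) z :=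
      (Complex.ofRealCLM.contDiff.comp (contDiff_cutProfile.comp contDiff_normSq)).contDiffAt
    have h2 : ContDiffAt ℝ (⊤ : ℕ∞) (fun z : ℂ => z⁻¹) z := contDiffAt_inv ℝ hz
    exact h1.mul h2

theorem contDiff_cauchyBump : ContDiff ℝ (⊤ : ℕ∞) cauchyBump :=
  contDiff_deriv_cutProfile.comp contDiff_normSq

theorem dbar_cauchyTrunc (z : ℂ) : dbar cauchyTrunc z = cauchyBump z := by
  by_cases hz : z = 0
  · subst hz
    have : cauchyTrunc =ᶠ[nhds 0] fun _ => 0 := by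
      have h1 : ∀ᶠ w : ℂ in nhds 0, Complex.normSq w < 1 / 2 := by
        exact Complex.continuous_normSq.continuousAt.eventually_lt continuousAt_const (by simp)
      filter_upwards [h1] with w hw
      rw [cauchyTrunc, cutProfile_eq_zero hw.le]; simp
    rw [dbar_congr this]
    have h2 : cutProfile =ᶠ[nhds 0] fun _ => 0 := by
      filter_upwards [gt_mem_nhds (show (0:ℝ) < 1/2 by norm_num)] with y hy
        using cutProfile_eq_zero hy.le
    have h3 : cauchyBump 0 = 0 := by
      rw [cauchyBump, map_zero, h2.deriv_eq]; simp
    rw [h3]; simp [dbar]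
  · have h0 : HasFDerivAt (fun z : ℂ => (cutProfile (Complex.normSq z) : ℂ)) _ z :=
      (Complex.ofRealCLM.hasFDerivAt).comp z
        ((contDiff_cutProfile.differentiable (by simp) _).hasDerivAt.comp_hasFDerivAt z
          (hasFDerivAt_normSq z))
    have h2 : DifferentiableAt ℂ (fun z : ℂ => z⁻¹) z := differentiableAt_inv hz
    have h3 : dbar (fun z : ℂ => (cutProfile (Complex.normSq z) : ℂ)) z = cauchyBump z * z := by
      rw [dbar, h0.fderiv]
      have h4 := Complex.re_add_im z
      simp [cauchyBump]
      linear_combination ((deriv cutProfile (Complex.normSq z) : ℝ) : ℂ) * h4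
    have := dbar_mul h0.differentiableAt (h2.restrictScalars ℝ)
    rw [show cauchyTrunc = fun z => (cutProfile (Complex.normSq z) : ℂ) * z⁻¹ from rfl, this,
      dbar_eq_zero h2, h3]
    field_simp
    simp

theorem cauchyBump_nonneg (z : ℂ) : 0 ≤ cauchyBump z := deriv_cutProfile_nonneg _

theorem cauchyBump_eq_zero {z : ℂ} (h : 1 < ‖z‖) : cauchyBump z = 0 := by
  apply deriv_cutProfile_of_one_lt
  rw [Complex.normSq_eq_norm_sq]
  nlinarith

theorem hasCompactSupport_cauchyBump : HasCompactSupport cauchyBump :=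
  HasCompactSupport.intro (isCompact_closedBall (0 : ℂ) 1) fun z hz =>
    cauchyBump_eq_zero (by simpa using hz)

theorem exists_cauchyBump_le : ∃ M : ℝ, ∀ z, cauchyBump z ≤ M := by
  obtain ⟨M, hM⟩ := contDiff_cauchyBump.continuous.bounded_above_of_compact_support
    hasCompactSupport_cauchyBump
  exact ⟨M, fun z => (le_abs_self _).trans (hM z)⟩

theorem integral_cauchyBump_pos : 0 < ∫ z, cauchyBump z := by
  obtain ⟨x, hx, hx'⟩ := exists_deriv_eq_slope cutProfile (show (0:ℝ) < 1 by norm_num)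
    contDiff_cutProfile.continuous.continuousOn
    (contDiff_cutProfile.differentiable (by simp)).differentiableOn
  rw [cutProfile_eq_one le_rfl, cutProfile_eq_zero (by norm_num)] at hx'
  have hx2 : cauchyBump (Real.sqrt x : ℂ) = 1 := by
    rw [cauchyBump, Complex.normSq_ofReal, Real.mul_self_sqrt hx.1.le, hx']; norm_num
  refine contDiff_cauchyBump.continuous.integral_pos_of_hasCompactSupport_nonneg_nonzero
    hasCompactSupport_cauchyBump cauchyBump_nonneg (x := (Real.sqrt x : ℂ)) ?_
  rw [hx2]; norm_num

/-- Rescaled truncated Cauchy kernel. -/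
def cauchyTruncR (δ : ℝ) (z : ℂ) : ℂ := (δ : ℂ)⁻¹ * cauchyTrunc ((δ : ℂ)⁻¹ * z)

/-- Rescaled bump. -/
def cauchyBumpR (δ : ℝ) (z : ℂ) : ℝ := (δ ^ 2)⁻¹ * cauchyBump ((δ : ℂ)⁻¹ * z)

theorem contDiff_cauchyTruncR (δ : ℝ) : ContDiff ℝ (⊤ : ℕ∞) (cauchyTruncR δ) :=
  contDiff_const.mul (contDiff_cauchyTrunc.comp (contDiff_const.mul contDiff_id))

theorem contDiff_cauchyBumpR (δ : ℝ) : ContDiff ℝ (⊤ : ℕ∞) (cauchyBumpR δ) :=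
  contDiff_const.mul (contDiff_cauchyBump.comp (contDiff_const.mul contDiff_id))

theorem dbar_cauchyTruncR (δ : ℝ) (z : ℂ) : dbar (cauchyTruncR δ) z = cauchyBumpR δ z := by
  have := dbar_const_mul_comp (contDiff_cauchyTrunc.differentiable (by simp)) (δ : ℂ)⁻¹ (δ : ℂ)⁻¹
    0 z
  simp only [map_inv₀, Complex.conj_ofReal, zero_add] at this
  rw [show cauchyTruncR δ = fun x => (δ : ℂ)⁻¹ * cauchyTrunc ((δ : ℂ)⁻¹ * x) from rfl, this,
    dbar_cauchyTrunc, cauchyBumpR]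
  push_cast
  ring

theorem cauchyBumpR_nonneg (δ : ℝ) (z : ℂ) : 0 ≤ cauchyBumpR δ z :=
  mul_nonneg (by positivity) (cauchyBump_nonneg _)

theorem cauchyBumpR_eq_zero {δ : ℝ} (hδ : 0 < δ) {z : ℂ} (h : δ < ‖z‖) : cauchyBumpR δ z = 0 := by
  rw [cauchyBumpR, cauchyBump_eq_zero, mul_zero]
  rw [norm_mul, norm_inv, Complex.norm_real, Real.norm_of_nonneg hδ.le, ← div_eq_inv_mul,
    one_lt_div hδ]
  exact h

theorem hasCompactSupport_cauchyBumpR {δ : ℝ} (hδ : 0 < δ) : HasCompactSupport (cauchyBumpR δ) :=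
  HasCompactSupport.intro (isCompact_closedBall (0 : ℂ) δ) fun z hz =>
    cauchyBumpR_eq_zero hδ (by simpa using hz)

theorem cauchyTruncR_eq {δ : ℝ} (hδ : 0 < δ) {z : ℂ} (h : δ ≤ ‖z‖) : cauchyTruncR δ z = z⁻¹ := by
  have h1 : (1 : ℝ) ≤ Complex.normSq ((δ : ℂ)⁻¹ * z) := by
    rw [Complex.normSq_eq_norm_sq, norm_mul, norm_inv, Complex.norm_real,
      Real.norm_of_nonneg hδ.le, ← div_eq_inv_mul]
    have := (one_le_div hδ).2 h
    nlinarith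
  rw [cauchyTruncR, cauchyTrunc, cutProfile_eq_one h1]
  have : (δ : ℂ) ≠ 0 := by exact_mod_cast hδ.ne'
  push_cast
  rw [mul_inv, inv_inv]
  field_simp

theorem integral_cauchyBumpR {δ : ℝ} (hδ : 0 < δ) :
    ∫ z, cauchyBumpR δ z = ∫ z, cauchyBump z := by
  have := Measure.integral_comp_smul (volume : Measure ℂ) cauchyBump δ⁻¹
  simp only [cauchyBumpR, integral_const_mul]
  have h2 : ∀ z : ℂ, δ⁻¹ • z = (δ : ℂ)⁻¹ * z := by intro z; simp
  simp only [h2, Complex.finrank_real_complex] at this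
  rw [this, smul_eq_mul, ← mul_assoc]
  have : (δ ^ 2)⁻¹ * |((δ⁻¹) ^ 2)⁻¹| = 1 := by
    rw [abs_of_nonneg (by positivity)]
    field_simp
  rw [this, one_mul]

theorem dbar_comp_sub {f : ℂ → ℂ} (hf : Differentiable ℝ f) (z w : ℂ) :
    dbar (fun x => f (z - x)) w = - dbar f (z - w) := by
  have := dbar_const_mul_comp hf 1 (-1) z w
  simpa [sub_eq_add_neg] using this

/-- Convolution of `u` with the rescaled bump. -/
def bumpConv (u : ℂ → ℂ) (δ : ℝ) (z : ℂ) : ℂ := ∫ w, u w * (cauchyBumpR δ (z - w) : ℂ)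

theorem integrable_mul_of_hasCompactSupport {u : ℂ → ℂ} (hu : LocallyIntegrable u) {g : ℂ → ℂ}
    (hg : Continuous g) (hc : HasCompactSupport g) : Integrable (fun w => u w * g w) := by
  have := hu.integrable_smul_left_of_hasCompactSupport hg hc
  simpa [mul_comm] using this

theorem hasCompactSupport_comp_sub {g : ℂ → ℂ} (hc : HasCompactSupport g) (z : ℂ) :
    HasCompactSupport (fun w => g (z - w)) :=
  hc.comp_homeomorph (Homeomorph.subLeft z)

theorem contDiff_dbar {f : ℂ → ℂ} (hf : ContDiff ℝ (⊤ : ℕ∞) f) :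
    ContDiff ℝ (⊤ : ℕ∞) (dbar f) := by
  have h := hf.fderiv_right (m := (⊤ : ℕ∞)) (by simp)
  have h1 := h.clm_apply (contDiff_const (c := (1 : ℂ)))
  have h2 := h.clm_apply (contDiff_const (c := Complex.I))
  exact (h1.add (contDiff_const.mul h2)).div_const 2

theorem tsupport_dbar_subset (f : ℂ → ℂ) : tsupport (dbar f) ⊆ tsupport f := by
  refine closure_minimal (fun z hz => ?_) (isClosed_tsupport _)
  by_contra h
  apply hz
  have : f =ᶠ[nhds z] fun _ => 0 := notMem_tsupport_iff_eventuallyEq.1 h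
  rw [dbar_congr this]; simp [dbar]

theorem closedBall_subset_compl_of_lt_infDist {S : Set ℂ} {z : ℂ} {δ : ℝ}
    (h : δ < Metric.infDist z S) : Metric.closedBall z δ ⊆ Sᶜ := by
  intro w hw hwS
  have := Metric.infDist_le_dist_of_mem (x := z) hwS
  rw [Metric.mem_closedBall, dist_comm] at hw
  linarith

section
variable {u : ℂ → ℂ} {S : Set ℂ}

theorem bumpConv_eq (hu : LocallyIntegrable u)
    (hw : ∀ ψ : ℂ → ℂ, ContDiff ℝ (⊤ : ℕ∞) ψ → HasCompactSupport ψ → tsupport ψ ⊆ Sᶜ →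
      ∫ w, u w * dbar ψ w = 0) {z : ℂ} {δ δ' : ℝ} (hδ : 0 < δ) (hδ' : 0 < δ')
    (h : δ < Metric.infDist z S) (h' : δ' < Metric.infDist z S) :
    bumpConv u δ z = bumpConv u δ' z := by
  set ψ : ℂ → ℂ := fun w => cauchyTruncR δ (z - w) - cauchyTruncR δ' (z - w) with hψ
  have hs : ContDiff ℝ (⊤ : ℕ∞) (fun w : ℂ => z - w) := contDiff_const.sub contDiff_id
  have hz : ∀ w, w ∉ Metric.closedBall z (max δ δ') → ψ w = 0 := by
    intro w hw
    rw [Metric.mem_closedBall, not_le, max_lt_iff, dist_comm, dist_eq_norm] at hw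
    simp only [hψ]
    rw [cauchyTruncR_eq hδ hw.1.le, cauchyTruncR_eq hδ' hw.2.le, sub_self]
  have hsupp : tsupport ψ ⊆ Metric.closedBall z (max δ δ') := by
    refine closure_minimal (fun w hw => ?_) Metric.isClosed_closedBall
    by_contra h
    exact hw (hz w h)
  have hcs : HasCompactSupport ψ := HasCompactSupport.intro (isCompact_closedBall z _) hz
  have hd : ∀ δ, Differentiable ℝ (cauchyTruncR δ) := fun δ =>
    (contDiff_cauchyTruncR δ).differentiable (by simp)
  have h1 : ∀ δ w, DifferentiableAt ℝ (fun w => cauchyTruncR δ (z - w)) w := fun δ w =>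
    ((hd δ).comp (hs.differentiable (by simp))) w
  have key := hw ψ (((contDiff_cauchyTruncR δ).comp hs).sub ((contDiff_cauchyTruncR δ').comp hs))
    hcs (hsupp.trans (closedBall_subset_compl_of_lt_infDist (max_lt h h')))
  have h2 : ∀ w, dbar ψ w = (cauchyBumpR δ' (z - w) : ℂ) - cauchyBumpR δ (z - w) := by
    intro w
    rw [hψ, dbar_sub (h1 _ _) (h1 _ _), dbar_comp_sub (hd _), dbar_comp_sub (hd _),
      dbar_cauchyTruncR, dbar_cauchyTruncR]
    ring
  have hi : ∀ δ, 0 < δ → Integrable (fun w => u w * (cauchyBumpR δ (z - w) : ℂ)) := by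
    intro δ hδ
    refine integrable_mul_of_hasCompactSupport hu ?_ ?_
    · exact Complex.continuous_ofReal.comp
        ((contDiff_cauchyBumpR δ).continuous.comp (continuous_const.sub continuous_id))
    · exact hasCompactSupport_comp_sub
        ((hasCompactSupport_cauchyBumpR hδ).comp_left (g := fun x : ℝ => (x : ℂ)) rfl) z
  simp only [h2, mul_sub] at key
  rw [integral_sub (hi _ hδ') (hi _ hδ), sub_eq_zero] at key
  exact key.symm

theorem differentiableAt_bumpConv (hu : LocallyIntegrable u)
    (hw : ∀ ψ : ℂ → ℂ, ContDiff ℝ (⊤ : ℕ∞) ψ → HasCompactSupport ψ → tsupport ψ ⊆ Sᶜ →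
      ∫ w, u w * dbar ψ w = 0) {z : ℂ} {δ : ℝ} (hδ : 0 < δ)
    (h : δ < Metric.infDist z S) : DifferentiableAt ℂ (bumpConv u δ) z := by
  set ρ : ℂ → ℂ := fun w => (cauchyBumpR δ w : ℂ) with hρ
  have hρs : ContDiff ℝ (⊤ : ℕ∞) ρ := Complex.ofRealCLM.contDiff.comp (contDiff_cauchyBumpR δ)
  have hρc : HasCompactSupport ρ :=
    (hasCompactSupport_cauchyBumpR hδ).comp_left (g := fun x : ℝ => (x : ℂ)) rfl
  have hconv : bumpConv u δ = convolution u ρ (ContinuousLinearMap.mul ℝ ℂ) volume := by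
    ext z
    rfl
  have hD := hρc.hasFDerivAt_convolution_right (ContinuousLinearMap.mul ℝ ℂ) hu
    (hρs.of_le (by simp)) z
  rw [← hconv] at hD
  apply differentiableAt_of_dbar hD.differentiableAt
  have hap : ∀ e : ℂ, fderiv ℝ (bumpConv u δ) z e = ∫ w, u w * fderiv ℝ ρ (z - w) e := by
    intro e
    rw [hD.fderiv, convolution_precompR_apply (ContinuousLinearMap.mul ℝ ℂ) hu
      (hρc.fderiv ℝ) (hρs.continuous_fderiv (by simp))]
    rfl
  have hi : ∀ e : ℂ, Integrable fun w => u w * fderiv ℝ ρ (z - w) e := by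
    intro e
    refine integrable_mul_of_hasCompactSupport hu ?_ ?_
    · exact ((hρs.continuous_fderiv (by simp)).comp (continuous_const.sub continuous_id)).clm_apply
        continuous_const
    · exact hasCompactSupport_comp_sub (g := fun w => fderiv ℝ ρ w e) (hρc.fderiv_apply ℝ e) z
  have hz : ∀ w, w ∉ Metric.closedBall z δ → ρ (z - w) = 0 := by
    intro w hw
    rw [Metric.mem_closedBall, not_le, dist_comm, dist_eq_norm] at hw
    simp only [hρ]
    rw [cauchyBumpR_eq_zero hδ hw, Complex.ofReal_zero]
  have hsupp : tsupport (fun w => ρ (z - w)) ⊆ Metric.closedBall z δ := by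
    refine closure_minimal (fun w hw => ?_) Metric.isClosed_closedBall
    by_contra h
    exact hw (hz w h)
  have hs : ContDiff ℝ (⊤ : ℕ∞) (fun w : ℂ => z - w) := contDiff_const.sub contDiff_id
  have key := hw (fun w => ρ (z - w)) (hρs.comp hs)
    (HasCompactSupport.intro (isCompact_closedBall z _) hz)
    (hsupp.trans (closedBall_subset_compl_of_lt_infDist h))
  simp only [dbar_comp_sub (hρs.differentiable (by simp)), mul_neg, integral_neg,
    neg_eq_zero] at key
  rw [dbar, hap, hap, ← integral_const_mul, ← integral_add (hi _) ((hi _).const_mul _),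
    div_eq_zero_iff]
  left
  have h3 : ∀ w, u w * dbar ρ (z - w) = (1 / 2) * (u w * fderiv ℝ ρ (z - w) 1 +
      Complex.I * (u w * fderiv ℝ ρ (z - w) Complex.I)) := by
    intro w; rw [dbar]; ring
  simp only [h3, integral_const_mul] at key
  simpa using key

theorem tendsto_bumpConv (hu : LocallyIntegrable u) :
    ∀ᵐ z, Filter.Tendsto (fun δ => bumpConv u δ z) (nhdsWithin 0 (Set.Ioi 0))
      (nhds (u z * ((∫ w, cauchyBump w : ℝ) : ℂ))) := by
  obtain ⟨M, hM⟩ := exists_cauchyBump_le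
  have hM0 : 0 ≤ M := (cauchyBump_nonneg 0).trans (hM 0)
  filter_upwards [IsUnifLocDoublingMeasure.ae_tendsto_average_norm_sub volume hu 1] with z hz
  have h1 := hz (l := nhdsWithin (0 : ℝ) (Set.Ioi 0)) (fun _ => z) id Filter.tendsto_id (by
    filter_upwards [self_mem_nhdsWithin] with δ hδ
    have : (0 : ℝ) < δ := hδ
    simp [this.le])
  rw [tendsto_iff_norm_sub_tendsto_zero]
  have h2 := h1.const_mul (M * Real.pi)
  rw [mul_zero] at h2
  refine squeeze_zero' (Filter.Eventually.of_forall fun _ => norm_nonneg _) ?_ h2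
  filter_upwards [self_mem_nhdsWithin] with δ hδ
  have hδ0 : (0 : ℝ) < δ := hδ
  have hcont : Continuous fun w : ℂ => (cauchyBumpR δ (z - w) : ℂ) :=
    Complex.continuous_ofReal.comp
        ((contDiff_cauchyBumpR δ).continuous.comp (continuous_const.sub continuous_id))
  have hcs : HasCompactSupport fun w : ℂ => (cauchyBumpR δ (z - w) : ℂ) :=
    hasCompactSupport_comp_sub
        ((hasCompactSupport_cauchyBumpR hδ0).comp_left (g := fun x : ℝ => (x : ℂ)) rfl) z
  have hi1 := integrable_mul_of_hasCompactSupport hu hcont hcs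
  have hi2 : Integrable fun w : ℂ => u z * (cauchyBumpR δ (z - w) : ℂ) :=
    (hcont.integrable_of_hasCompactSupport hcs).const_mul _
  have e1 : u z * ((∫ w, cauchyBump w : ℝ) : ℂ) = ∫ w : ℂ, u z * (cauchyBumpR δ (z - w) : ℂ) := by
    rw [integral_const_mul, integral_sub_left_eq_self (fun w => (cauchyBumpR δ w : ℂ)),
      integral_complex_ofReal, integral_cauchyBumpR hδ0]
  rw [bumpConv, e1, ← integral_sub hi1 hi2]
  have hb : ∀ w, ‖u w * (cauchyBumpR δ (z - w) : ℂ) - u z * (cauchyBumpR δ (z - w) : ℂ)‖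
      ≤ (Metric.closedBall z δ).indicator (fun w => (M / δ ^ 2) * ‖u w - u z‖) w := by
    intro w
    rw [← sub_mul, norm_mul, Complex.norm_real, Real.norm_of_nonneg (cauchyBumpR_nonneg _ _)]
    by_cases hw : w ∈ Metric.closedBall z δ
    · rw [Set.indicator_of_mem hw, mul_comm]
      gcongr
      rw [cauchyBumpR, div_eq_inv_mul]
      gcongr
      exact hM _
    · rw [Set.indicator_of_notMem hw, cauchyBumpR_eq_zero hδ0, mul_zero]
      rw [Metric.mem_closedBall, not_le, dist_comm, dist_eq_norm] at hw
      exact hw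
  have hi3 : IntegrableOn (fun w => (M / δ ^ 2) * ‖u w - u z‖) (Metric.closedBall z δ) := by
    refine Integrable.const_mul ?_ _
    refine Integrable.norm ?_
    refine Integrable.sub (hu.integrableOn_isCompact (isCompact_closedBall _ _)) ?_
    exact integrableOn_const (measure_closedBall_lt_top).ne
  refine (norm_integral_le_of_norm_le (hi3.integrable_indicator measurableSet_closedBall)
    (Filter.Eventually.of_forall hb)).trans ?_
  rw [integral_indicator measurableSet_closedBall, integral_const_mul, setAverage_eq]
  have hv : (volume (Metric.closedBall z δ)).toReal = Real.pi * δ ^ 2 := by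
    rw [Complex.volume_closedBall]
    simp [ENNReal.toReal_ofReal hδ0.le, mul_comm]
  rw [measureReal_def]
  simp only [id]
  rw [hv, smul_eq_mul]
  apply le_of_eq
  have := Real.pi_pos
  field_simp

/-- Weyl's lemma for the Cauchy–Riemann operator. -/
theorem weyl_dbar (hu : LocallyIntegrable u) (hS : IsClosed S) (hne : S.Nonempty)
    (hw : ∀ ψ : ℂ → ℂ, ContDiff ℝ (⊤ : ℕ∞) ψ → HasCompactSupport ψ → tsupport ψ ⊆ Sᶜ →
      ∫ w, u w * dbar ψ w = 0) :
    ∃ v : ℂ → ℂ, DifferentiableOn ℂ v Sᶜ ∧ ∀ᵐ z, z ∉ S → u z = v z := by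
  set c : ℂ := ((∫ w, cauchyBump w : ℝ) : ℂ) with hc
  have hc0 : c ≠ 0 := by
    rw [hc]; exact_mod_cast integral_cauchyBump_pos.ne'
  have hpos : ∀ z, z ∉ S → 0 < Metric.infDist z S := fun z hz =>
    (hS.notMem_iff_infDist_pos hne).1 hz
  refine ⟨fun z => bumpConv u (Metric.infDist z S / 2) z / c, ?_, ?_⟩
  · intro z hz
    have h0 := hpos z hz
    have hd := (differentiableAt_bumpConv hu hw (z := z) (half_pos h0) (half_lt_self h0)).div_const c
    refine (hd.congr_of_eventuallyEq ?_).differentiableWithinAt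
    have : ∀ᶠ w in nhds z, Metric.infDist z S / 2 < Metric.infDist w S :=
      (Metric.continuous_infDist_pt S).continuousAt.eventually (lt_mem_nhds (half_lt_self h0))
    filter_upwards [this] with w hw'
    have := bumpConv_eq hu hw (z := w) (δ := Metric.infDist w S / 2)
      (δ' := Metric.infDist z S / 2) (by linarith) (by linarith) (by linarith) hw'
    simp only [this]
  · filter_upwards [tendsto_bumpConv hu] with z hz hzS
    have h0 := hpos z hzS
    have : (fun δ => bumpConv u δ z) =ᶠ[nhdsWithin 0 (Set.Ioi 0)]
        fun _ => bumpConv u (Metric.infDist z S / 2) z := by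
      filter_upwards [Ioo_mem_nhdsGT h0] with δ hδ
      exact bumpConv_eq hu hw hδ.1 (half_pos h0) hδ.2 (by linarith)
    have h2 := tendsto_nhds_unique hz ((Filter.tendsto_congr' this).2 tendsto_const_nhds)
    simp only [← h2]
    rw [← hc, mul_div_cancel_right₀ _ hc0]

end

theorem ofReal_norm_sq_le_lintegral_circle {g : ℂ → ℂ}
    (hg : DiffContOnCl ℂ g (Metric.ball 0 1)) :
    ENNReal.ofReal (‖g 0‖ ^ 2) * ENNReal.ofReal (2 * Real.pi) ≤
      ∫⁻ θ in Set.Ioc 0 (2 * Real.pi), ENNReal.ofReal (‖g (circleMap 0 1 θ)‖ ^ 2) := by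
  have hpi := Real.two_pi_pos
  have h2 : DiffContOnCl ℂ (fun z => g z ^ 2) (Metric.ball 0 |(1 : ℝ)|) := by
    rw [abs_one]
    have := hg.smul hg
    simpa [pow_two] using this
  have h := h2.circleAverage
  have hc : Continuous fun θ : ℝ => g (circleMap 0 1 θ) ^ 2 := by
    have h3 : ContinuousOn g (Metric.closedBall 0 1) := by
      have := hg.continuousOn
      rwa [closure_ball _ one_ne_zero] at this
    refine Continuous.pow ?_ 2
    refine h3.comp_continuous (continuous_circleMap _ _) fun θ => ?_
    exact Metric.sphere_subset_closedBall (circleMap_mem_sphere _ zero_le_one θ)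
  rw [Real.circleAverage_def] at h
  have e : ENNReal.ofReal (‖g 0‖ ^ 2) * ENNReal.ofReal (2 * Real.pi)
      = ‖∫ θ in (0 : ℝ)..2 * Real.pi, g (circleMap 0 1 θ) ^ 2‖ₑ := by
    rw [← norm_pow, ← ENNReal.ofReal_mul (norm_nonneg _), ← h, norm_smul,
      Real.norm_of_nonneg (by positivity), ← ofReal_norm]
    congr 1
    field_simp
  rw [e, intervalIntegral.integral_of_le hpi.le]
  refine (enorm_integral_le_lintegral_enorm _).trans (le_of_eq ?_)
  refine lintegral_congr fun θ => ?_
  rw [← ofReal_norm, norm_pow]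

/-- The sub-mean value property of `‖g‖²` on discs. -/
theorem lintegral_ball_ge {g : ℂ → ℂ} {c : ℂ} {ρ : ℝ}
    (hg : DifferentiableOn ℂ g (Metric.ball c ρ)) :
    ENNReal.ofReal (‖g c‖ ^ 2) * volume (Metric.ball c ρ) ≤
      ∫⁻ z in Metric.ball c ρ, ENNReal.ofReal (‖g z‖ ^ 2) := by
  have hpi := Real.two_pi_pos
  set U : ℂ → ENNReal :=
    (Metric.ball c ρ).indicator fun z => ENNReal.ofReal (‖g z‖ ^ 2) with hU
  have hUm : Measurable U := by
    rw [hU, ← Set.piecewise_eq_indicator]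
    refine ContinuousOn.measurable_piecewise ?_ continuousOn_const measurableSet_ball
    exact ENNReal.continuous_ofReal.comp_continuousOn (hg.continuousOn.norm.pow 2)
  have hrot : ∀ θ : ℝ, ∫⁻ z, U (c + circleMap 0 1 θ * z) = ∫⁻ z, U z := by
    intro θ
    have h1 := (rotation (Circle.exp θ)).measurePreserving.lintegral_comp
      (f := fun z => U (c + z)) (hUm.comp (measurable_const_add c))
    have h2 : ∀ z, c + rotation (Circle.exp θ) z = c + circleMap 0 1 θ * z := by
      intro z
      simp [circleMap, rotation_apply]
    simp only [h2] at h1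
    rw [h1, lintegral_add_left_eq_self]
  have hI : ∫⁻ z in Metric.ball c ρ, ENNReal.ofReal (‖g z‖ ^ 2) = ∫⁻ z, U z := by
    rw [hU, lintegral_indicator measurableSet_ball]
  have hswap : ∫⁻ z, ∫⁻ θ in Set.Ioc 0 (2 * Real.pi), U (c + circleMap 0 1 θ * z)
      = (∫⁻ z, U z) * ENNReal.ofReal (2 * Real.pi) := by
    rw [lintegral_lintegral_swap]
    · simp only [hrot, lintegral_const]
      simp
    · refine (hUm.comp ?_).aemeasurable
      have : Continuous fun p : ℂ × ℝ => c + circleMap 0 1 p.2 * p.1 :=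
        continuous_const.add (((continuous_circleMap 0 1).comp continuous_snd).mul continuous_fst)
      exact this.measurable
  have hlow : ENNReal.ofReal (‖g c‖ ^ 2) * ENNReal.ofReal (2 * Real.pi) *
      volume (Metric.ball (0 : ℂ) ρ) ≤
      ∫⁻ z, ∫⁻ θ in Set.Ioc 0 (2 * Real.pi), U (c + circleMap 0 1 θ * z) := by
    rw [← setLIntegral_const]
    refine (setLIntegral_mono' measurableSet_ball (fun z hz => ?_)).trans
      (setLIntegral_le_lintegral _ _)
    have hz' : ‖z‖ < ρ := by simpa using hz
    have hmem : ∀ w : ℂ, ‖w‖ ≤ 1 → c + w * z ∈ Metric.ball c ρ := by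
      intro w hw
      rw [Metric.mem_ball, dist_eq_norm, add_sub_cancel_left, norm_mul]
      nlinarith [norm_nonneg z, norm_nonneg w]
    have hd : DiffContOnCl ℂ (fun w => g (c + w * z)) (Metric.ball 0 1) := by
      have h3 : DifferentiableOn ℂ (fun w => g (c + w * z)) (Metric.closedBall 0 1) := by
        refine hg.comp ?_ fun w hw => hmem w (by simpa using hw)
        exact ((differentiable_id.mul_const z).const_add c).differentiableOn
      exact h3.diffContOnCl_ball subset_rfl
    have h5 := ofReal_norm_sq_le_lintegral_circle hd
    rw [zero_mul, add_zero] at h5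
    refine h5.trans (le_of_eq (lintegral_congr fun θ => ?_))
    rw [hU, Set.indicator_of_mem (hmem _ (by simp))]
  rw [hswap, mul_right_comm] at hlow
  rw [hI]
  have h6 : volume (Metric.ball (0 : ℂ) ρ) = volume (Metric.ball c ρ) := by
    rw [Complex.volume_ball, Complex.volume_ball]
  rw [h6] at hlow
  exact (ENNReal.mul_le_mul_iff_left (by simpa using hpi) ENNReal.ofReal_ne_top).1 hlow

/-- Cauchy estimate in `L²` form. -/
theorem exists_norm_iteratedDeriv_sq_le (k : ℕ) : ∃ C : ℝ, 0 < C ∧ ∀ (g : ℂ → ℂ) (c : ℂ) (ρ : ℝ),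
    0 < ρ → DifferentiableOn ℂ g (Metric.ball c ρ) →
    ENNReal.ofReal (‖iteratedDeriv k g c‖ ^ 2 * ρ ^ (2 * k + 2)) ≤
      ENNReal.ofReal C * ∫⁻ z in Metric.ball c ρ, ENNReal.ofReal (‖g z‖ ^ 2) := by
  refine ⟨k.factorial ^ 2 * 4 ^ k * 4 / Real.pi, by positivity, fun g c ρ hρ hg => ?_⟩
  have hpi := Real.pi_pos
  set I := ∫⁻ z in Metric.ball c ρ, ENNReal.ofReal (‖g z‖ ^ 2) with hI
  by_cases hI0 : I = ⊤
  · rw [hI0, ENNReal.mul_top (by positivity)]; exact le_top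
  obtain ⟨J, hJ0, hJ⟩ : ∃ J : ℝ, 0 ≤ J ∧ I = ENNReal.ofReal J :=
    ⟨I.toReal, ENNReal.toReal_nonneg, (ENNReal.ofReal_toReal hI0).symm⟩
  rw [hJ, ← ENNReal.ofReal_mul (by positivity)]
  apply ENNReal.ofReal_le_ofReal
  have hb : ∀ z ∈ Metric.sphere c (ρ / 2), ‖g z‖ ≤ Real.sqrt (4 * J / (Real.pi * ρ ^ 2)) := by
    intro z hz
    apply Real.le_sqrt_of_sq_le
    have hsub : Metric.ball z (ρ / 2) ⊆ Metric.ball c ρ := by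
      apply Metric.ball_subset_ball'
      rw [Metric.mem_sphere.1 hz]; linarith
    have h1 := (lintegral_ball_ge (hg.mono hsub)).trans (lintegral_mono_set hsub)
    rw [← hI, hJ, Complex.volume_ball, ← ENNReal.ofReal_pow (by positivity),
      show (NNReal.pi : ENNReal) = ENNReal.ofReal Real.pi by
        rw [ENNReal.ofReal, ← NNReal.coe_real_pi, Real.toNNReal_coe], ← ENNReal.ofReal_mul (by positivity),
      ← ENNReal.ofReal_mul (by positivity), ENNReal.ofReal_le_ofReal_iff hJ0] at h1
    rw [le_div_iff₀ (by positivity)]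
    linarith
  have h2 := Complex.norm_iteratedDeriv_le_of_forall_mem_sphere_norm_le k (half_pos hρ)
    (hg.diffContOnCl_ball (Metric.closedBall_subset_ball (half_lt_self hρ))) hb
  have h3 : ‖iteratedDeriv k g c‖ ^ 2 ≤
      (k.factorial * Real.sqrt (4 * J / (Real.pi * ρ ^ 2)) / (ρ / 2) ^ k) ^ 2 := by gcongr
  rw [div_pow, mul_pow, Real.sq_sqrt (by positivity), div_pow ρ] at h3
  calc _ ≤ _ := mul_le_mul_of_nonneg_right h3 (by positivity)
    _ = _ := by
      rw [show (4 : ℝ) ^ k = (2 ^ k) ^ 2 by rw [← pow_mul, mul_comm, pow_mul]; norm_num]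
      field_simp
      ring

theorem isLittleO_of_lintegral_lt_top {v : ℂ → ℂ} {s : ℂ} {r : ℝ} (hr : 0 < r)
    (hv : DifferentiableOn ℂ v (Metric.ball s r \ {s}))
    (hi : ∫⁻ z in Metric.ball s r, ENNReal.ofReal (‖v z‖ ^ 2) ≠ ⊤) :
    v =o[nhdsWithin s {s}ᶜ] fun z => (z - s)⁻¹ := by
  have htend : Filter.Tendsto (fun z : ℂ => ∫⁻ w in Metric.ball s (2 * ‖z - s‖),
      ENNReal.ofReal (‖v w‖ ^ 2) ∂(volume.restrict (Metric.ball s r)))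
      (nhdsWithin s {s}ᶜ) (nhds 0) := by
    apply tendsto_setLIntegral_zero hi
    have h1 : Filter.Tendsto (fun z : ℂ => volume (Metric.ball s (2 * ‖z - s‖)))
        (nhdsWithin s {s}ᶜ) (nhds 0) := by
      simp only [Complex.volume_ball]
      have h2 : Filter.Tendsto (fun z : ℂ => ENNReal.ofReal (2 * ‖z - s‖) ^ 2 * (NNReal.pi : ENNReal))
          (nhds s) (nhds (ENNReal.ofReal (2 * ‖s - s‖) ^ 2 * (NNReal.pi : ENNReal))) := by
        apply ENNReal.Tendsto.mul_const _ (Or.inr (by simp))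
        apply ENNReal.Tendsto.pow
        apply (ENNReal.continuous_ofReal.tendsto _).comp
        exact Continuous.tendsto (by fun_prop) s
      simp only [sub_self, norm_zero, mul_zero, ENNReal.ofReal_zero] at h2
      simp only [ne_eq, OfNat.ofNat_ne_zero, not_false_eq_true, zero_pow, zero_mul] at h2
      exact h2.mono_left nhdsWithin_le_nhds
    exact tendsto_of_tendsto_of_tendsto_of_le_of_le tendsto_const_nhds h1 (fun _ => zero_le)
      (fun z => Measure.restrict_apply_le _ _)
  rw [Asymptotics.isLittleO_iff]
  intro ε hε
  have hε' : (0 : ENNReal) < ENNReal.ofReal (ε ^ 2 * Real.pi / 4) := by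
    have := Real.pi_pos
    simp only [ENNReal.ofReal_pos]; positivity
  have hball : ∀ᶠ z in nhdsWithin s {s}ᶜ, z ∈ Metric.ball s (r / 2) :=
    nhdsWithin_le_nhds (Metric.ball_mem_nhds s (half_pos hr))
  filter_upwards [htend.eventually (gt_mem_nhds hε'), hball, self_mem_nhdsWithin] with z hz hzb hzs
  have hzs' : 0 < ‖z - s‖ := norm_pos_iff.2 (sub_ne_zero.2 hzs)
  rw [Metric.mem_ball, dist_eq_norm] at hzb
  have hsub : Metric.ball z ‖z - s‖ ⊆ Metric.ball s (2 * ‖z - s‖) := by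
    apply Metric.ball_subset_ball'
    rw [dist_eq_norm]; linarith
  have hsub2 : Metric.ball s (2 * ‖z - s‖) ⊆ Metric.ball s r :=
    Metric.ball_subset_ball (by linarith)
  have hd : DifferentiableOn ℂ v (Metric.ball z ‖z - s‖) := by
    refine hv.mono fun w hw => ⟨hsub2 (hsub hw), ?_⟩
    rintro rfl
    rw [Metric.mem_ball, dist_comm, dist_eq_norm] at hw
    exact lt_irrefl _ hw
  have h1 := (lintegral_ball_ge hd).trans (lintegral_mono_set hsub)
  rw [Measure.restrict_restrict measurableSet_ball,
    Set.inter_eq_left.2 hsub2] at hz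
  have h2 := h1.trans_lt hz
  have hpi := Real.pi_pos
  rw [Complex.volume_ball, ← ENNReal.ofReal_pow (by positivity),
      show (NNReal.pi : ENNReal) = ENNReal.ofReal Real.pi by
        rw [ENNReal.ofReal, ← NNReal.coe_real_pi, Real.toNNReal_coe],
      ← ENNReal.ofReal_mul (by positivity),
      ← ENNReal.ofReal_mul (by positivity), ENNReal.ofReal_lt_ofReal_iff (by positivity)] at h2
  rw [norm_inv, ← div_eq_mul_inv, le_div_iff₀ hzs']
  have h3 : (‖v z‖ * ‖z - s‖) ^ 2 * Real.pi < ε ^ 2 * Real.pi := by nlinarith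
  have h4 := lt_of_mul_lt_mul_right h3 hpi.le
  exact (abs_le_of_sq_le_sq' h4.le hε.le).2

theorem exists_entire_of_l2 {v : ℂ → ℂ} {S : Set ℂ} (hS : S.Finite)
    (hv : DifferentiableOn ℂ v Sᶜ)
    (hi : ∀ R : ℝ, ∫⁻ z in Metric.ball 0 R, ENNReal.ofReal (‖v z‖ ^ 2) ≠ ⊤) :
    ∃ e : ℂ → ℂ, Differentiable ℂ e ∧ ∀ z, z ∉ S → e z = v z := by
  refine ⟨fun z => if z ∈ S then (nhdsWithin z {z}ᶜ).limUnder v else v z, fun s => ?_,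
    fun z hz => if_neg hz⟩
  by_cases hs : s ∈ S
  · have h1 : IsClosed (S \ {s}) := (hS.subset Set.sdiff_subset).isClosed
    obtain ⟨r, hr, hsub⟩ := Metric.isOpen_iff.1 h1.isOpen_compl s (by simp)
    have hd : DifferentiableOn ℂ v (Metric.ball s r \ {s}) := by
      refine hv.mono fun w hw hwS => ?_
      exact hsub hw.1 ⟨hwS, hw.2⟩
    have hfin : ∫⁻ z in Metric.ball s r, ENNReal.ofReal (‖v z‖ ^ 2) ≠ ⊤ := by
      refine ne_top_of_le_ne_top (hi (r + ‖s‖)) (lintegral_mono_set ?_)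
      apply Metric.ball_subset_ball'
      simp
    have ho := isLittleO_of_lintegral_lt_top hr hd hfin
    have ho2 : (fun z => v z - v s) =o[nhdsWithin s {s}ᶜ] fun z => (z - s)⁻¹ := by
      refine ho.sub ?_
      refine Asymptotics.isLittleO_const_left.2 (Or.inr ?_)
      have : Filter.Tendsto (fun z : ℂ => (z - s)) (nhdsWithin s {s}ᶜ) (nhdsWithin 0 {0}ᶜ) := by
        refine tendsto_nhdsWithin_of_tendsto_nhds_of_eventually_within _ ?_ ?_
        · refine Filter.Tendsto.mono_left ?_ nhdsWithin_le_nhds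
          have : ContinuousAt (fun z : ℂ => z - s) s := by fun_prop
          simpa [ContinuousAt] using this
        · filter_upwards [self_mem_nhdsWithin] with z hz
          simpa [sub_eq_zero] using hz
      exact tendsto_norm_cobounded_atTop.comp (Filter.tendsto_inv₀_nhdsNE_zero.comp this)
    have hu := Complex.differentiableOn_update_limUnder_of_isLittleO
      (Metric.ball_mem_nhds s hr) hd ho2
    refine (hu.differentiableAt (Metric.ball_mem_nhds s hr)).congr_of_eventuallyEq ?_
    filter_upwards [Metric.ball_mem_nhds s hr] with z hz
    by_cases hzs : z = s
    · subst hzs; simp [hs]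
    · have : z ∉ S := fun h => hsub hz ⟨h, hzs⟩
      simp [this, hzs]
  · have hopen : Sᶜ ∈ nhds s := hS.isClosed.isOpen_compl.mem_nhds hs
    refine (hv.differentiableAt hopen).congr_of_eventuallyEq ?_
    filter_upwards [hopen] with z hz
    exact if_neg hz

/-- The polynomial with coefficient vector `c`. -/
def pol {n : ℕ} (c : Fin (n + 1) → ℂ) (z : ℂ) : ℂ := ∑ k, c k * z ^ (k : ℕ)

section
variable {ι : Type*} [Fintype ι]

/-- The weight `∏ ‖z - aⱼ‖ ^ A`. -/
def rootWt (a : ι → ℂ) (A : ℝ) (z : ℂ) : ℝ := ∏ j, ‖z - a j‖ ^ A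

theorem rootWt_nonneg (a : ι → ℂ) (A : ℝ) (z : ℂ) : 0 ≤ rootWt a A z :=
  Finset.prod_nonneg fun _ _ => Real.rpow_nonneg (norm_nonneg _) _

theorem rootWt_pos (a : ι → ℂ) (A : ℝ) {z : ℂ} (h : z ∉ Set.range a) : 0 < rootWt a A z :=
  Finset.prod_pos fun j _ => Real.rpow_pos_of_pos (norm_pos_iff.2 (sub_ne_zero.2
    fun e => h ⟨j, e.symm⟩)) _

theorem continuous_rootWt (a : ι → ℂ) {A : ℝ} (hA : 0 ≤ A) : Continuous (rootWt a A) := by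
  unfold rootWt
  refine continuous_finsetProd _ fun j _ => ?_
  exact (by fun_prop : Continuous fun z => ‖z - a j‖).rpow_const fun _ => Or.inr hA

theorem rootWt_le (a : ι → ℂ) {A : ℝ} (hA : 0 ≤ A) {R M : ℝ} (hM : ∀ j, ‖a j‖ ≤ M) {z : ℂ}
    (hz : ‖z‖ ≤ R) : rootWt a A z ≤ (R + M) ^ (A * Fintype.card ι) := by
  by_cases hne : Nonempty ι
  · obtain ⟨j0⟩ := hne
    have hRM : 0 ≤ R + M := add_nonneg ((norm_nonneg _).trans hz) ((norm_nonneg _).trans (hM j0))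
    calc rootWt a A z ≤ ∏ _j : ι, (R + M) ^ A := by
          refine Finset.prod_le_prod (fun _ _ => Real.rpow_nonneg (norm_nonneg _) _) fun j _ => ?_
          refine Real.rpow_le_rpow (norm_nonneg _) ?_ hA
          exact (norm_sub_le _ _).trans (add_le_add hz (hM j))
      _ = _ := by
          rw [Finset.prod_const, Finset.card_univ, ← Real.rpow_natCast, ← Real.rpow_mul hRM]
  · rw [not_nonempty_iff] at hne
    simp [rootWt]

theorem lintegral_ball_le_of_rootWt (a : ι → ℂ) {A : ℝ} (hA : 0 ≤ A) {R M : ℝ}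
    (hM : ∀ j, ‖a j‖ ≤ M) (v : ℂ → ℂ) :
    ∫⁻ z in Metric.ball 0 R, ENNReal.ofReal (‖v z‖ ^ 2) ≤
      ENNReal.ofReal (((R + M) ^ (A * Fintype.card ι)) ^ 2) *
        ∫⁻ z, ENNReal.ofReal ((‖v z‖ / rootWt a A z) ^ 2) := by
  rw [← lintegral_const_mul' _ _ ENNReal.ofReal_ne_top]
  refine le_trans ?_ (setLIntegral_le_lintegral (Metric.ball 0 R) _)
  have hae : ∀ᵐ z ∂(volume.restrict (Metric.ball (0 : ℂ) R)), z ∉ Set.range a :=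
    ae_restrict_of_ae ((Set.finite_range a).countable.ae_notMem volume)
  refine lintegral_mono_ae ?_
  filter_upwards [hae, ae_restrict_mem measurableSet_ball] with z hz hzR
  rw [← ENNReal.ofReal_mul (by positivity)]
  apply ENNReal.ofReal_le_ofReal
  have h0 := rootWt_pos a A hz
  have h1 := rootWt_le a hA hM (z := z) (R := R) (by simpa using (Metric.mem_ball.1 hzR).le)
  rw [div_pow, ← mul_div_assoc, le_div_iff₀ (by positivity), mul_comm]
  gcongr

theorem exists_pol_of_l2 {v : ℂ → ℂ} {S : Set ℂ} (hS : S.Finite)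
    (hv : DifferentiableOn ℂ v Sᶜ) (a : ι → ℂ) {A : ℝ} (hA : 0 ≤ A) {n : ℕ}
    (hn : A * Fintype.card ι < n + 2)
    (hi : ∫⁻ z, ENNReal.ofReal ((‖v z‖ / rootWt a A z) ^ 2) ≠ ⊤) :
    ∃ c : Fin (n + 1) → ℂ, ∀ z, z ∉ S → v z = pol c z := by
  obtain ⟨M, hM0, hM⟩ : ∃ M : ℝ, 0 ≤ M ∧ ∀ j, ‖a j‖ ≤ M :=
    ⟨∑ j, ‖a j‖, Finset.sum_nonneg fun _ _ => norm_nonneg _,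
      fun j => Finset.single_le_sum (f := fun j => ‖a j‖) (fun _ _ => norm_nonneg _)
        (Finset.mem_univ j)⟩
  obtain ⟨e, he, hev⟩ := exists_entire_of_l2 hS hv (fun R => by
    refine ne_top_of_le_ne_top (ENNReal.mul_ne_top ENNReal.ofReal_ne_top hi)
      ((lintegral_mono_set ?_).trans
        (lintegral_ball_le_of_rootWt a hA hM (R := max R 0) v))
    exact Metric.ball_subset_ball (le_max_left _ _))
  set I := ∫⁻ z, ENNReal.ofReal ((‖v z‖ / rootWt a A z) ^ 2) with hI
  obtain ⟨J, hJ0, hJ⟩ : ∃ J : ℝ, 0 ≤ J ∧ I = ENNReal.ofReal J :=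
    ⟨I.toReal, ENNReal.toReal_nonneg, (ENNReal.ofReal_toReal hi).symm⟩
  have hzero : ∀ k : ℕ, n + 1 ≤ k → iteratedDeriv k e 0 = 0 := by
    intro k hk
    obtain ⟨C, hC, hCk⟩ := exists_norm_iteratedDeriv_sq_le k
    have hb : ∀ R : ℝ, 1 ≤ R → ‖iteratedDeriv k e 0‖ ^ 2 ≤
        C * J * (1 + M) ^ (2 * (A * Fintype.card ι)) *
          R ^ (-(2 * (k + 1) - 2 * (A * Fintype.card ι))) := by
      intro R hR
      have hR0 : 0 < R := by linarith
      have h1 := hCk e 0 R hR0 he.differentiableOn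
      have h2 : ∫⁻ z in Metric.ball 0 R, ENNReal.ofReal (‖e z‖ ^ 2)
          = ∫⁻ z in Metric.ball 0 R, ENNReal.ofReal (‖v z‖ ^ 2) := by
        refine lintegral_congr_ae ?_
        filter_upwards [ae_restrict_of_ae (hS.countable.ae_notMem volume)] with z hz
        rw [hev z hz]
      rw [h2] at h1
      have h3 := h1.trans (mul_le_mul_right
        (lintegral_ball_le_of_rootWt a hA hM v) _)
      rw [← hI, hJ, ← ENNReal.ofReal_mul (by positivity), ← ENNReal.ofReal_mul (by positivity),
        ENNReal.ofReal_le_ofReal_iff (by positivity)] at h3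
      have h4 : ((R + M) ^ (A * Fintype.card ι)) ^ 2 ≤
          R ^ (2 * (A * Fintype.card ι)) * (1 + M) ^ (2 * (A * Fintype.card ι)) := by
        rw [← Real.rpow_natCast, ← Real.rpow_mul (by positivity),
          ← Real.mul_rpow (by positivity) (by positivity),
          mul_comm (A * (Fintype.card ι : ℝ)) ((2 : ℕ) : ℝ)]
        push_cast
        refine Real.rpow_le_rpow (by positivity) ?_ (by positivity)
        nlinarith
      have h5 : ‖iteratedDeriv k e 0‖ ^ 2 * R ^ (2 * k + 2) ≤
          C * J * (1 + M) ^ (2 * (A * Fintype.card ι)) * R ^ (2 * (A * Fintype.card ι)) := by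
        refine h3.trans ?_
        calc _ ≤ C * (R ^ (2 * (A * Fintype.card ι)) * (1 + M) ^ (2 * (A * Fintype.card ι)) * J) :=
              by gcongr
          _ = _ := by ring
      have h6 : R ^ (-(2 * ((k : ℝ) + 1) - 2 * (A * Fintype.card ι)))
          = R ^ (2 * (A * Fintype.card ι)) / R ^ (2 * k + 2) := by
        rw [← Real.rpow_natCast R, ← Real.rpow_sub hR0]
        congr 1
        push_cast; ring
      rw [h6, ← mul_div_assoc, le_div_iff₀ (by positivity)]
      exact h5
    have hlim : Filter.Tendsto (fun R : ℝ => C * J * (1 + M) ^ (2 * (A * Fintype.card ι)) *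
          R ^ (-(2 * ((k : ℝ) + 1) - 2 * (A * Fintype.card ι)))) Filter.atTop (nhds 0) := by
      have hk' : (n : ℝ) + 1 ≤ k := by exact_mod_cast hk
      have := (tendsto_rpow_neg_atTop (y := 2 * ((k : ℝ) + 1) - 2 * (A * Fintype.card ι))
        (by linarith)).const_mul (C * J * (1 + M) ^ (2 * (A * Fintype.card ι)))
      simpa using this
    have h7 : ‖iteratedDeriv k e 0‖ ^ 2 ≤ 0 := by
      refine ge_of_tendsto hlim ?_
      filter_upwards [Filter.eventually_ge_atTop 1] with R hR using hb R hR
    have h8 : ‖iteratedDeriv k e 0‖ = 0 := by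
      have := norm_nonneg (iteratedDeriv k e 0)
      nlinarith
    exact norm_eq_zero.1 h8
  refine ⟨fun k => (((k : ℕ).factorial : ℂ))⁻¹ * iteratedDeriv k e 0, fun z hz => ?_⟩
  rw [← hev z hz]
  have h1 := Complex.hasSum_taylorSeries_of_entire he 0 z
  have h2 := hasSum_sum_of_ne_finset_zero (L := SummationFilter.unconditional ℕ) (s := Finset.range (n + 1))
    (f := fun k => ((k.factorial : ℂ))⁻¹ • (z - 0) ^ k • iteratedDeriv k e 0) (by
      intro k hk
      simp only [Finset.mem_range, not_lt] at hk
      simp [hzero k hk])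
  rw [h1.unique h2, pol, Finset.sum_range]
  refine Finset.sum_congr rfl fun k _ => ?_
  simp only [smul_eq_mul, sub_zero]
  ring

end

theorem eLpNorm_two_sq {α E : Type*} [MeasurableSpace α] {μ : Measure α} [NormedAddCommGroup E]
    (f : α → E) : eLpNorm f 2 μ ^ 2 = ∫⁻ z, ENNReal.ofReal (‖f z‖ ^ 2) ∂μ := by
  have := eLpNorm_nnreal_pow_eq_lintegral (μ := μ) (f := f) (p := 2) two_ne_zero
  have e : ∀ x : ENNReal, x ^ ((2 : NNReal) : ℝ) = x ^ 2 := fun x => by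
    rw [← ENNReal.rpow_natCast]; norm_num
  simp only [e] at this
  rw [show ((2 : NNReal) : ENNReal) = 2 by norm_num] at this
  rw [this]
  refine lintegral_congr fun z => ?_
  rw [ENNReal.ofReal_pow (norm_nonneg _), ofReal_norm]

theorem lintegral_ne_top_of_memLp_two {α E : Type*} [MeasurableSpace α] {μ : Measure α}
    [NormedAddCommGroup E] {f : α → E} (hf : MemLp f 2 μ) :
    ∫⁻ z, ENNReal.ofReal (‖f z‖ ^ 2) ∂μ ≠ ⊤ := by
  rw [← eLpNorm_two_sq]
  exact ENNReal.pow_ne_top hf.2.ne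

/-- Smooth compactly supported functions with support in the complement of `S`. -/
structure IsTest (S : Set ℂ) (ψ : ℂ → ℂ) : Prop where
  contDiff : ContDiff ℝ (⊤ : ℕ∞) ψ
  hasCompactSupport : HasCompactSupport ψ
  tsupport_subset : tsupport ψ ⊆ Sᶜ

theorem IsTest.zero (S : Set ℂ) : IsTest S (fun _ => 0) :=
  ⟨contDiff_const, HasCompactSupport.zero, by
    rw [show (fun _ : ℂ => (0 : ℂ)) = 0 from rfl, tsupport_zero]; exact Set.empty_subset _⟩

theorem IsTest.add {S : Set ℂ} {f g : ℂ → ℂ} (hf : IsTest S f) (hg : IsTest S g) :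
    IsTest S (fun z => f z + g z) :=
  ⟨hf.contDiff.add hg.contDiff, hf.hasCompactSupport.add hg.hasCompactSupport,
    (tsupport_add f g).trans (Set.union_subset hf.tsupport_subset hg.tsupport_subset)⟩

theorem IsTest.const_mul {S : Set ℂ} {f : ℂ → ℂ} (hf : IsTest S f) (c : ℂ) :
    IsTest S (fun z => c * f z) :=
  ⟨contDiff_const.mul hf.contDiff, hf.hasCompactSupport.mul_left,
    (tsupport_mul_subset_right (f := fun _ => c) (g := f)).trans hf.tsupport_subset⟩

theorem IsTest.differentiable {S : Set ℂ} {f : ℂ → ℂ} (hf : IsTest S f) : Differentiable ℝ f :=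
  hf.contDiff.differentiable (by simp)

theorem continuous_pol {n : ℕ} (c : Fin (n + 1) → ℂ) : Continuous (pol c) := by
  unfold pol; fun_prop

theorem pol_add {n : ℕ} (c d : Fin (n + 1) → ℂ) (z : ℂ) : pol (c + d) z = pol c z + pol d z := by
  simp [pol, add_mul, Finset.sum_add_distrib]

theorem pol_smul {n : ℕ} (r : ℂ) (c : Fin (n + 1) → ℂ) (z : ℂ) :
    pol (r • c) z = r * pol c z := by
  simp [pol, Finset.mul_sum, mul_assoc]

section
variable {ι : Type*} [Fintype ι]

theorem memLp_rootWt_mul_dbar (a : ι → ℂ) {A : ℝ} (hA : 0 ≤ A) {S : Set ℂ} {ψ : ℂ → ℂ}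
    (hψ : IsTest S ψ) :
    MemLp (fun z => (rootWt a A z : ℂ) * (starRingEnd ℂ) (dbar ψ z)) 2 volume := by
  refine Continuous.memLp_of_hasCompactSupport ?_ ?_
  · exact (Complex.continuous_ofReal.comp (continuous_rootWt a hA)).mul
      (Complex.continuous_conj.comp (contDiff_dbar hψ.contDiff).continuous)
  · refine HasCompactSupport.mul_left ?_
    have : HasCompactSupport (dbar ψ) :=
      hψ.hasCompactSupport.mono' ((subset_tsupport _).trans (tsupport_dbar_subset ψ))
    exact this.comp_left (g := (starRingEnd ℂ)) (map_zero _)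

/-- The subspace of `L²` spanned by weighted polynomials and weighted `∂`-exact functions. -/
def approxSpace (a : ι → ℂ) (A : ℝ) (n : ℕ) (S : Set ℂ) : Submodule ℂ (Lp ℂ 2 (volume : Measure ℂ)) where
  carrier := {f | ∃ (c : Fin (n + 1) → ℂ) (ψ : ℂ → ℂ), IsTest S ψ ∧
    f =ᵐ[volume] fun z => pol c z / rootWt a A z + rootWt a A z * (starRingEnd ℂ) (dbar ψ z)}
  zero_mem' := by
    refine ⟨0, fun _ => 0, IsTest.zero S, ?_⟩
    filter_upwards [Lp.coeFn_zero ℂ 2 (volume : Measure ℂ)] with z hz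
    rw [hz]
    simp [pol, dbar]
  add_mem' := by
    rintro f g ⟨c, ψ, hψ, hf⟩ ⟨d, φ, hφ, hg⟩
    refine ⟨c + d, fun z => ψ z + φ z, hψ.add hφ, ?_⟩
    filter_upwards [Lp.coeFn_add f g, hf, hg] with z h1 h2 h3
    rw [h1, Pi.add_apply, h2, h3, pol_add, dbar_add (hψ.differentiable z) (hφ.differentiable z),
      map_add]
    ring
  smul_mem' := by
    rintro r f ⟨c, ψ, hψ, hf⟩
    refine ⟨r • c, fun z => (starRingEnd ℂ) r * ψ z, hψ.const_mul _, ?_⟩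
    filter_upwards [Lp.coeFn_smul r f, hf] with z h1 h2
    rw [h1, Pi.smul_apply, h2, pol_smul,
      dbar_mul (differentiableAt_const _) (hψ.differentiable z), dbar_eq_zero (differentiableAt_const _),
      zero_mul, add_zero, map_mul, Complex.conj_conj, smul_eq_mul]
    ring

theorem approxSpace_orthogonal (a : ι → ℂ) {A : ℝ} (hA : 0 ≤ A) {n : ℕ}
    (hn : A * Fintype.card ι < n + 2) {S : Set ℂ} (hS : S.Finite) (hne : S.Nonempty)
    (haS : Set.range a ⊆ S) :
    (approxSpace a A n S)ᗮ = ⊥ := by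
  rw [Submodule.eq_bot_iff]
  intro u hu
  have hloc : LocallyIntegrable (fun z => u z * (rootWt a A z : ℂ)) := by
    have h1 := (Lp.memLp u).locallyIntegrable one_le_two
    have h2 := h1.smul_continuous (g := fun z => (rootWt a A z : ℂ))
      (Complex.continuous_ofReal.comp (continuous_rootWt a hA))
    simpa using h2
  have hae : ∀ᵐ z : ℂ, z ∉ S := hS.countable.ae_notMem volume
  have htest : ∀ ψ : ℂ → ℂ, ContDiff ℝ (⊤ : ℕ∞) ψ → HasCompactSupport ψ → tsupport ψ ⊆ Sᶜ →
      ∫ w, (u w * (rootWt a A w : ℂ)) * dbar ψ w = 0 := by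
    intro ψ h1 h2 h3
    have hψ : IsTest S ψ := ⟨h1, h2, h3⟩
    have hm := memLp_rootWt_mul_dbar a hA hψ
    have hmem : hm.toLp _ ∈ approxSpace a A n S := by
      refine ⟨0, ψ, hψ, ?_⟩
      filter_upwards [hm.coeFn_toLp] with z hz
      rw [hz]
      simp [pol]
    have h4 := (Submodule.mem_orthogonal _ _).1 hu _ hmem
    rw [L2.inner_def] at h4
    rw [← h4]
    refine integral_congr_ae ?_
    filter_upwards [hm.coeFn_toLp] with z hz
    rw [hz]
    simp
    ring
  obtain ⟨v, hv, huv⟩ := weyl_dbar hloc hS.isClosed hne htest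
  have hu2 : ∀ᵐ z, u z = v z / rootWt a A z := by
    filter_upwards [huv, hae] with z hz hzS
    rw [← hz hzS, mul_div_cancel_right₀]
    exact_mod_cast (rootWt_pos a A fun h => hzS (haS h)).ne'
  have hfin : ∫⁻ z, ENNReal.ofReal ((‖v z‖ / rootWt a A z) ^ 2) ≠ ⊤ := by
    have h1 := lintegral_ne_top_of_memLp_two (Lp.memLp u)
    convert h1 using 1
    refine lintegral_congr_ae ?_
    filter_upwards [hu2] with z hz
    rw [hz, norm_div, Complex.norm_real, Real.norm_of_nonneg (rootWt_nonneg _ _ _)]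
  obtain ⟨c, hc⟩ := exists_pol_of_l2 hS hv a hA hn hfin
  have hmem : u ∈ approxSpace a A n S := by
    refine ⟨c, fun _ => 0, IsTest.zero S, ?_⟩
    filter_upwards [hu2, hae] with z hz hzS
    rw [hz, hc z hzS]
    simp [dbar]
  have := (Submodule.mem_orthogonal _ _).1 hu _ hmem
  exact inner_self_eq_zero.1 this

theorem exists_approx (a : ι → ℂ) {A : ℝ} (hA : 0 ≤ A) {n : ℕ}
    (hn : A * Fintype.card ι < n + 2) {S : Set ℂ} (hS : S.Finite) (hne : S.Nonempty)
    (haS : Set.range a ⊆ S)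
    {K : ℂ → ℂ} (hK : MemLp (fun z => K z / rootWt a A z) 2 volume) {ε : ℝ} (hε : 0 < ε) :
    ∃ (c : Fin (n + 1) → ℂ) (ψ : ℂ → ℂ), IsTest S ψ ∧
      ∫⁻ z, ENNReal.ofReal (‖(K z + pol c z) / rootWt a A z +
        rootWt a A z * (starRingEnd ℂ) (dbar ψ z)‖ ^ 2) ≤ ENNReal.ofReal ε := by
  have htop := Submodule.topologicalClosure_eq_top_iff.2
    (approxSpace_orthogonal a hA hn hS hne haS)
  have hcl : -(hK.toLp _) ∈ closure (approxSpace a A n S : Set (Lp ℂ 2 (volume : Measure ℂ))) := by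
    rw [← Submodule.topologicalClosure_coe, htop]; trivial
  obtain ⟨f, ⟨c, ψ, hψ, hf⟩, hd⟩ := Metric.mem_closure_iff.1 hcl (Real.sqrt ε) (by positivity)
  refine ⟨c, ψ, hψ, ?_⟩
  rw [← eLpNorm_two_sq]
  have h1 : eLpNorm (fun z => (K z + pol c z) / rootWt a A z +
        rootWt a A z * (starRingEnd ℂ) (dbar ψ z)) 2 volume = ‖hK.toLp _ + f‖ₑ := by
    rw [Lp.enorm_def]
    refine eLpNorm_congr_ae ?_
    filter_upwards [Lp.coeFn_add (hK.toLp _) f, hf, hK.coeFn_toLp] with z h1 h2 h3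
    rw [h1, Pi.add_apply, h2, h3]
    ring
  rw [h1, ← ofReal_norm, ← ENNReal.ofReal_pow (norm_nonneg _)]
  apply ENNReal.ofReal_le_ofReal
  rw [dist_eq_norm, ← norm_neg, neg_sub, sub_neg_eq_add] at hd
  rw [add_comm f] at hd
  calc _ ≤ (Real.sqrt ε) ^ 2 := by gcongr
    _ = ε := Real.sq_sqrt hε.le

end

theorem rpow_le_two_rpow_abs {x y s : ℝ} (hx : 0 < x) (hxy : x ≤ y) (hy : y ≤ 2 * x) :
    y ^ s ≤ 2 ^ |s| * x ^ s := by
  rcases le_total 0 s with h | h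
  · rw [abs_of_nonneg h, ← Real.mul_rpow (by norm_num) hx.le]
    exact Real.rpow_le_rpow (hx.le.trans hxy) hy h
  · have h1 : (1 : ℝ) ≤ 2 ^ |s| := Real.one_le_rpow (by norm_num) (abs_nonneg s)
    have h2 := Real.rpow_le_rpow_of_nonpos hx hxy h
    have h3 : 0 ≤ x ^ s := by positivity
    nlinarith

theorem integrable_norm_rpow_mul_one_add {A s : ℝ} (hA : A < 1) (hs : s - 2 * A < -2) :
    Integrable (fun x : ℂ => ‖x‖ ^ (-2 * A) * (1 + ‖x‖) ^ s) := by
  have key := integrable_fun_norm_addHaar (volume : Measure ℂ)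
    (f := fun r : ℝ => r ^ (-2 * A) * (1 + r) ^ s)
  rw [key, Complex.finrank_real_complex]
  have hmeas : Measurable (fun y : ℝ => y ^ (2 - 1) • (y ^ (-2 * A) * (1 + y) ^ s)) := by fun_prop
  rw [← Set.Ioc_union_Ioi_eq_Ioi (zero_le_one' ℝ)]
  refine IntegrableOn.union ?_ ?_
  · have h1 : IntegrableOn (fun y : ℝ => 2 ^ |s| * y ^ (1 - 2 * A)) (Set.Ioc 0 1) :=
      ((intervalIntegrable_iff_integrableOn_Ioc_of_le zero_le_one).1
        (intervalIntegral.intervalIntegrable_rpow' (by linarith))).const_mul _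
    refine Integrable.mono' h1 hmeas.aestronglyMeasurable ?_
    filter_upwards [ae_restrict_mem measurableSet_Ioc] with y hy
    have hy0 : 0 < y := hy.1
    rw [Real.norm_of_nonneg (by positivity)]
    have h2 : (1 + y) ^ s ≤ 2 ^ |s| * 1 ^ s :=
      rpow_le_two_rpow_abs one_pos (by linarith) (by linarith [hy.2])
    rw [Real.one_rpow, mul_one] at h2
    have h3 : y ^ (1 - 2 * A) = y * y ^ (-2 * A) := by
      rw [sub_eq_add_neg, Real.rpow_add hy0, Real.rpow_one]; simp
    rw [h3, smul_eq_mul, Nat.add_one_sub_one, pow_one, ← mul_assoc, mul_comm ((2 : ℝ) ^ |s|)]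
    gcongr
  · have h1 : IntegrableOn (fun y : ℝ => 2 ^ |s| * y ^ (1 - 2 * A + s)) (Set.Ioi 1) :=
      (integrableOn_Ioi_rpow_of_lt (by linarith) one_pos).const_mul _
    refine Integrable.mono' h1 hmeas.aestronglyMeasurable ?_
    filter_upwards [ae_restrict_mem measurableSet_Ioi] with y hy
    have hy1 : 1 < y := hy
    have hy0 : 0 < y := by linarith
    rw [Real.norm_of_nonneg (by positivity)]
    have h2 : (1 + y) ^ s ≤ 2 ^ |s| * y ^ s :=
      rpow_le_two_rpow_abs hy0 (by linarith) (by linarith)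
    have h3 : y ^ (1 - 2 * A + s) = y * y ^ (-2 * A) * y ^ s := by
      rw [Real.rpow_add hy0, sub_eq_add_neg, Real.rpow_add hy0, Real.rpow_one]; simp
    rw [h3, smul_eq_mul, Nat.add_one_sub_one, pow_one, ← mul_assoc, mul_left_comm]
    gcongr

section

variable {ι : Type*} [Fintype ι]

/-- Away from the zeros the reciprocal of `rootWt` is controlled by its nearest factor. -/
theorem exists_inv_rootWt_sq_le {a : ι → ℂ} (ha : Function.Injective a) {A : ℝ} (hA : 0 ≤ A)
    [Nonempty ι] :
    ∃ C > 0, ∀ x, (rootWt a A x)⁻¹ ^ 2 ≤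
      C * ∑ j, ‖x - a j‖ ^ (-2 * A) * (1 + ‖x - a j‖) ^ (-(2 * A * (Fintype.card ι - 1))) := by
  obtain ⟨δ, hδ, hsep⟩ : ∃ δ > 0, ∀ j k, j ≠ k → 2 * δ ≤ ‖a j - a k‖ := by
    have hfin : (Set.range fun p : ι × ι => ‖a p.1 - a p.2‖).Finite := Set.finite_range _
    obtain ⟨δ, hδ, h⟩ : ∃ δ > 0, ∀ p : ι × ι, p.1 ≠ p.2 → δ ≤ ‖a p.1 - a p.2‖ := by
      by_cases hne : ((Finset.univ : Finset (ι × ι)).filter fun p => p.1 ≠ p.2).Nonempty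
      · obtain ⟨p, hp, hmin⟩ := Finset.exists_min_image _ (fun p : ι × ι => ‖a p.1 - a p.2‖) hne
        refine ⟨_, norm_pos_iff.2 (sub_ne_zero.2 fun h => (Finset.mem_filter.1 hp).2 (ha h)),
          fun q hq => hmin q (by simpa using hq)⟩
      · exact ⟨1, one_pos, fun p hp => absurd ⟨p, by simpa using hp⟩ hne⟩
    exact ⟨δ / 2, by positivity, fun j k hjk => by have := h (j, k) hjk; simp at this; linarith⟩
  set κ : ℝ := (1 + 1 / δ)
  have hκ : 0 < κ := by positivity
  set N := Fintype.card ι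
  refine ⟨(κ ^ A) ^ (2 * (N - 1)), by positivity, fun x => ?_⟩
  obtain ⟨j, -, hj⟩ := Finset.exists_min_image Finset.univ (fun j => ‖x - a j‖) Finset.univ_nonempty
  refine le_trans ?_ (mul_le_mul_of_nonneg_left (Finset.single_le_sum
    (f := fun j => ‖x - a j‖ ^ (-2 * A) * (1 + ‖x - a j‖) ^ (-(2 * A * (N - 1 : ℝ))))
    (fun _ _ => by positivity) (Finset.mem_univ j)) (by positivity))
  set u := ‖x - a j‖ with hu
  have hu0 : 0 ≤ u := norm_nonneg _
  have hfar : ∀ k ∈ Finset.univ.erase j, (1 + u) / κ ≤ ‖x - a k‖ := by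
    intro k hk
    have h1 := hj k (Finset.mem_univ k)
    have h2 := hsep j k (Finset.ne_of_mem_erase hk).symm
    have h3 : ‖a j - a k‖ ≤ u + ‖x - a k‖ := by
      rw [hu, norm_sub_rev x (a j)]
      simpa using norm_add_le (a j - x) (x - a k)
    have h4 : δ ≤ ‖x - a k‖ := by linarith
    rw [div_le_iff₀ hκ]
    have h5 : 1 ≤ ‖x - a k‖ * (1 / δ) := by rw [mul_one_div, le_div_iff₀ hδ]; linarith
    simp only [κ]; nlinarith
  have hlow : u ^ A * (((1 + u) / κ) ^ A) ^ (N - 1) ≤ rootWt a A x := by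
    rw [rootWt, ← Finset.mul_prod_erase _ _ (Finset.mem_univ j)]
    have : (((1 + u) / κ) ^ A) ^ (N - 1) ≤ ∏ k ∈ Finset.univ.erase j, ‖x - a k‖ ^ A := by
      rw [show N - 1 = (Finset.univ.erase j).card by
        rw [Finset.card_erase_of_mem (Finset.mem_univ j), Finset.card_univ], ← Finset.prod_const]
      refine Finset.prod_le_prod (fun _ _ => by positivity) fun k hk => ?_
      exact Real.rpow_le_rpow (by positivity) (hfar k hk) hA
    gcongr
  rcases eq_or_lt_of_le hu0 with h0 | h0
  · rcases eq_or_lt_of_le hA with hA0 | hA0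
    · subst hA0; simp [rootWt]
    · have : rootWt a A x = 0 := Finset.prod_eq_zero (Finset.mem_univ j) (by
        rw [← hu, ← h0, Real.zero_rpow hA0.ne'])
      rw [this]; simp; positivity
  have hN : 1 ≤ N := Fintype.card_pos
  calc (rootWt a A x)⁻¹ ^ 2 ≤ (u ^ A * (((1 + u) / κ) ^ A) ^ (N - 1))⁻¹ ^ 2 := by
        have := inv_nonneg.2 (rootWt_nonneg a A x)
        gcongr
    _ = _ := by
        rw [Real.div_rpow (by positivity) hκ.le, div_pow, show (-2 * A) = -(A * (2 : ℕ)) by push_cast; ring,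
          Real.rpow_neg hu0, Real.rpow_mul hu0, Real.rpow_natCast, Real.rpow_neg (by positivity),
          show (2 * A * (N - 1 : ℝ)) = A * ((2 * (N - 1) : ℕ) : ℝ) by push_cast [Nat.cast_sub hN]; ring,
          Real.rpow_mul (by positivity), Real.rpow_natCast]
        have : 0 < κ ^ A := by positivity
        have : 0 < u ^ A := by positivity
        have : 0 < (1 + u) ^ A := by positivity
        field_simp
        ring

theorem memLp_of_le_one_add_pow {a : ι → ℂ} (ha : Function.Injective a) {A : ℝ} (hA : 0 ≤ A)
    (hA1 : A < 1) {n : ℕ} (hn : n + 1 < A * Fintype.card ι) {K : ℂ → ℂ}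
    (hK : AEStronglyMeasurable K volume)
    {C : ℝ} (hKC : ∀ x, ‖K x‖ ≤ C * (1 + ‖x‖) ^ n) :
    MemLp (fun z => K z / rootWt a A z) 2 volume := by
  have : Nonempty ι := by
    by_contra h
    rw [not_nonempty_iff] at h
    rw [Fintype.card_eq_zero] at hn
    norm_num at hn
    have : (0 : ℝ) ≤ n := Nat.cast_nonneg n
    linarith
  obtain ⟨C1, hC1, hle⟩ := exists_inv_rootWt_sq_le ha hA
  have hmw : Measurable (rootWt a A) := (continuous_rootWt a hA).measurable
  have hm : AEStronglyMeasurable (fun z => K z / rootWt a A z) volume := by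
    have : Measurable fun z => ((rootWt a A z : ℂ))⁻¹ := (Complex.measurable_ofReal.comp hmw).inv
    simp only [div_eq_mul_inv]; exact hK.mul this.aestronglyMeasurable
  rw [memLp_two_iff_integrable_sq_norm hm]
  set s : ℝ := 2 * n - 2 * A * (Fintype.card ι - 1)
  have hint : ∀ j, Integrable (fun x : ℂ => ‖x - a j‖ ^ (-2 * A) * (1 + ‖x - a j‖) ^ s) := fun j =>
    (integrable_norm_rpow_mul_one_add (A := A) (s := s) hA1 (by simp only [s]; linarith)).comp_sub_right (a j)
  set D : ℝ := 1 + ∑ j, ‖a j‖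
  have hD : ∀ j x, 1 + ‖x‖ ≤ D * (1 + ‖x - a j‖) := by
    intro j x
    have h1 : ‖a j‖ ≤ ∑ j, ‖a j‖ := Finset.single_le_sum (f := fun j => ‖a j‖) (fun _ _ => norm_nonneg _) (Finset.mem_univ j)
    have h2 : ‖x‖ ≤ ‖x - a j‖ + ‖a j‖ := by simpa using norm_add_le (x - a j) (a j)
    have := norm_nonneg (a j)
    have := norm_nonneg (x - a j)
    simp only [D]; nlinarith
  have hD0 : 0 < D := by positivity
  refine Integrable.mono' ((integrable_finsetSum Finset.univ fun j _ => hint j).const_mul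
    (C ^ 2 * D ^ (2 * n) * C1)) (by fun_prop) ?_
  refine Filter.Eventually.of_forall fun x => ?_
  have hC0 : 0 ≤ C := by
    have := (norm_nonneg _).trans (hKC 0); simpa using this
  rw [Real.norm_of_nonneg (by positivity), norm_div, Complex.norm_real,
    Real.norm_of_nonneg (rootWt_nonneg _ _ _), div_eq_mul_inv, mul_pow]
  calc ‖K x‖ ^ 2 * (rootWt a A x)⁻¹ ^ 2 ≤ (C * (1 + ‖x‖) ^ n) ^ 2 * (C1 * ∑ j, ‖x - a j‖ ^ (-2 * A) *
        (1 + ‖x - a j‖) ^ (-(2 * A * (Fintype.card ι - 1)))) := by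
        gcongr; exacts [hKC x, hle x]
    _ = ∑ j, C ^ 2 * C1 * (‖x - a j‖ ^ (-2 * A) * ((1 + ‖x‖) ^ (2 * n) *
        (1 + ‖x - a j‖) ^ (-(2 * A * (Fintype.card ι - 1))))) := by
        rw [Finset.mul_sum, Finset.mul_sum]
        refine Finset.sum_congr rfl fun j _ => by ring
    _ ≤ ∑ j, C ^ 2 * C1 * (‖x - a j‖ ^ (-2 * A) * (D ^ (2 * n) * (1 + ‖x - a j‖) ^ s)) := by
        refine Finset.sum_le_sum fun j _ => ?_
        have : (1 + ‖x‖) ^ (2 * n) * (1 + ‖x - a j‖) ^ (-(2 * A * (Fintype.card ι - 1)))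
            ≤ D ^ (2 * n) * (1 + ‖x - a j‖) ^ s := by
          have e : (1 + ‖x - a j‖) ^ s = (1 + ‖x - a j‖) ^ (2 * n) *
              (1 + ‖x - a j‖) ^ (-(2 * A * (Fintype.card ι - 1))) := by
            rw [← Real.rpow_natCast _ (2 * n), ← Real.rpow_add (by positivity)]
            simp only [s]; push_cast; ring_nf
          rw [e, ← mul_assoc, ← mul_pow]
          gcongr
          exact hD j x
        gcongr
    _ = _ := by
        rw [Finset.mul_sum]
        refine Finset.sum_congr rfl fun j _ => by ring

theorem norm_pol_le {n : ℕ} (c : Fin (n + 1) → ℂ) (x : ℂ) :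
    ‖pol c x‖ ≤ (∑ k, ‖c k‖) * (1 + ‖x‖) ^ n := by
  rw [pol, Finset.sum_mul]
  refine (norm_sum_le _ _).trans (Finset.sum_le_sum fun k _ => ?_)
  rw [norm_mul, norm_pow]
  gcongr
  calc ‖x‖ ^ (k : ℕ) ≤ (1 + ‖x‖) ^ (k : ℕ) := by gcongr; linarith
    _ ≤ _ := pow_le_pow_right₀ (by linarith [norm_nonneg x]) (by omega)

theorem memLp_pol_div_rootWt {a : ι → ℂ} (ha : Function.Injective a) {A : ℝ} (hA : 0 ≤ A)
    (hA1 : A < 1) {n : ℕ} (hn : n + 1 < A * Fintype.card ι) (c : Fin (n + 1) → ℂ) :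
    MemLp (fun z => pol c z / rootWt a A z) 2 volume :=
  memLp_of_le_one_add_pow ha hA hA1 hn (continuous_pol c).aestronglyMeasurable (norm_pol_le c)

end

/-- Sum over the four points `±r, ±ir`. -/
def sum4 {M : Type*} [Add M] (F : ℂ → M) (r : ℝ) : M :=
  F r + F (r * Complex.I) + F (-r) + F (-(r * Complex.I))

theorem sum4_quadratic (u v w : ℂ) (r : ℝ) :
    sum4 (fun τ => ‖u + v * τ + w * τ ^ 2‖ ^ 2) r =
      4 * (‖u‖ ^ 2 + r ^ 2 * ‖v‖ ^ 2 + r ^ 4 * ‖w‖ ^ 2) := by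
  simp only [sum4, Complex.sq_norm]
  simp only [Complex.normSq_apply, pow_two, Complex.add_re, Complex.mul_re,
    Complex.add_im, Complex.mul_im, Complex.ofReal_re, Complex.ofReal_im, Complex.neg_re,
    Complex.neg_im, Complex.I_re, Complex.I_im]
  ring

theorem norm_dslope_le_three {f : ℂ → ℂ} {R B : ℝ} (hR : 0 < R)
    (hf : DifferentiableOn ℂ f (Metric.ball 0 R)) (hB : ∀ z ∈ Metric.ball 0 R, ‖f z‖ ≤ B) :
    DifferentiableOn ℂ (dslope f 0) (Metric.ball 0 R) ∧
      ∀ z ∈ Metric.ball 0 R, ‖dslope f 0 z‖ ≤ 2 * B / R := by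
  refine ⟨(Complex.differentiableOn_dslope (Metric.ball_mem_nhds 0 hR)).2 hf, fun z hz => ?_⟩
  refine Complex.norm_dslope_le_div_of_mapsTo_ball hf (fun w hw => ?_) hz
  rw [mem_closedBall_iff_norm]
  have := norm_sub_le (f w) (f 0)
  linarith [hB w hw, hB 0 (Metric.mem_ball_self hR)]

theorem abs_sum4_norm_sq_sub_le {f : ℂ → ℂ} {R B : ℝ} (hR : 0 < R)
    (hf : DifferentiableOn ℂ f (Metric.ball 0 R)) (hB : ∀ z ∈ Metric.ball 0 R, ‖f z‖ ≤ B)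
    {r : ℝ} (hr : 0 ≤ r) (hrR : r < R) :
    |sum4 (fun τ => ‖f τ‖ ^ 2) r - 4 * (‖f 0‖ ^ 2 + r ^ 2 * ‖deriv f 0‖ ^ 2)|
      ≤ 1000 / R ^ 3 * B ^ 2 * r ^ 3 := by
  obtain ⟨hd1, hb1⟩ := norm_dslope_le_three hR hf hB
  obtain ⟨hd2, hb2⟩ := norm_dslope_le_three hR hd1 hb1
  obtain ⟨hd3, hb3⟩ := norm_dslope_le_three hR hd2 hb2
  set g1 := dslope f 0
  set g2 := dslope g1 0
  set g3 := dslope g2 0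
  have h0 : (0 : ℂ) ∈ Metric.ball (0 : ℂ) R := Metric.mem_ball_self hR
  have hB0 : 0 ≤ B := (norm_nonneg _).trans (hB 0 h0)
  have hder : deriv f 0 = g1 0 := (dslope_same f 0).symm
  have hdec : ∀ z, f z = f 0 + g1 0 * z + g2 0 * z ^ 2 + g3 z * z ^ 3 := by
    intro z
    have e1 := sub_smul_dslope f 0 z
    have e2 := sub_smul_dslope g1 0 z
    have e3 := sub_smul_dslope g2 0 z
    simp only [sub_zero, smul_eq_mul] at e1 e2 e3
    change z * g1 z = _ at e1
    change z * g2 z = _ at e2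
    change z * g3 z = _ at e3
    linear_combination -e1 - z * e2 - z ^ 2 * e3
  set x := r / R with hx
  have hx0 : 0 ≤ x := by positivity
  have hx1 : x ≤ 1 := (div_le_one hR).2 hrR.le
  have hrx : r = x * R := by rw [hx]; field_simp
  have hx2 : x ^ 2 ≤ 1 := pow_le_one₀ hx0 hx1
  set p : ℂ → ℂ := fun τ => f 0 + g1 0 * τ + g2 0 * τ ^ 2 with hp
  have hg1 : ‖g1 0‖ * r ≤ 2 * B := by
    calc ‖g1 0‖ * r ≤ 2 * B / R * r := by gcongr; exact hb1 0 h0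
      _ = 2 * B * x := by rw [hx]; ring
      _ ≤ 2 * B * 1 := by gcongr
      _ = _ := by ring
  have hg2 : ‖g2 0‖ * r ^ 2 ≤ 4 * B * x ^ 2 := by
    calc ‖g2 0‖ * r ^ 2 ≤ 2 * (2 * B / R) / R * r ^ 2 := by gcongr; exact hb2 0 h0
      _ = 4 * B * x ^ 2 := by rw [hx]; ring
  have hpt : ∀ τ : ℂ, ‖τ‖ = r → |‖f τ‖ ^ 2 - ‖p τ‖ ^ 2| ≤ 176 * B ^ 2 * x ^ 3 := by
    intro τ hτ
    have hτR : τ ∈ Metric.ball (0 : ℂ) R := by simpa [hτ] using hrR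
    have hR3 : ‖f τ - p τ‖ ≤ 8 * B * x ^ 3 := by
      rw [hdec τ, hp]
      simp only [add_sub_cancel_left, norm_mul, norm_pow, hτ]
      calc ‖g3 τ‖ * r ^ 3 ≤ 2 * (2 * (2 * B / R) / R) / R * r ^ 3 := by gcongr; exact hb3 τ hτR
        _ = _ := by rw [hx]; ring
    have hpB : ‖p τ‖ ≤ 7 * B := by
      calc ‖p τ‖ ≤ ‖f 0‖ + ‖g1 0 * τ‖ + ‖g2 0 * τ ^ 2‖ := norm_add₃_le
        _ = ‖f 0‖ + ‖g1 0‖ * r + ‖g2 0‖ * r ^ 2 := by rw [norm_mul, norm_mul, norm_pow, hτ]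
        _ ≤ B + 2 * B + 4 * B * x ^ 2 := by gcongr; exact hB 0 h0
        _ ≤ 7 * B := by nlinarith
    have hfB := hB τ hτR
    have h1 : |‖f τ‖ - ‖p τ‖| ≤ 8 * B * x ^ 3 := (abs_norm_sub_norm_le _ _).trans hR3
    have h2 : ‖f τ‖ ^ 2 - ‖p τ‖ ^ 2 = (‖f τ‖ - ‖p τ‖) * (‖f τ‖ + ‖p τ‖) := by ring
    rw [h2, abs_mul, abs_of_nonneg (by positivity : 0 ≤ ‖f τ‖ + ‖p τ‖)]
    have h3 : 0 ≤ 8 * B * x ^ 3 := by positivity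
    calc _ ≤ 8 * B * x ^ 3 * (B + 7 * B) := by gcongr
      _ ≤ _ := by nlinarith [mul_nonneg (sq_nonneg B) (pow_nonneg hx0 3)]
  have hq := sum4_quadratic (f 0) (g1 0) (g2 0) r
  have n1 : ‖(r : ℂ)‖ = r := by simp [abs_of_nonneg hr]
  have b1 := abs_le.1 (hpt r n1)
  have b2 := abs_le.1 (hpt (r * Complex.I) (by simp [abs_of_nonneg hr]))
  have b3 := abs_le.1 (hpt (-r) (by simp [abs_of_nonneg hr]))
  have b4 := abs_le.1 (hpt (-(r * Complex.I)) (by simp [abs_of_nonneg hr]))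
  have hw : r ^ 4 * ‖g2 0‖ ^ 2 ≤ 16 * B ^ 2 * x ^ 3 := by
    calc r ^ 4 * ‖g2 0‖ ^ 2 = (‖g2 0‖ * r ^ 2) ^ 2 := by ring
      _ ≤ (4 * B * x ^ 2) ^ 2 := by gcongr
      _ = 16 * B ^ 2 * x ^ 3 * x := by ring
      _ ≤ 16 * B ^ 2 * x ^ 3 * 1 := by gcongr
      _ = _ := by ring
  have hw0 : 0 ≤ r ^ 4 * ‖g2 0‖ ^ 2 := by positivity
  have hrhs : 1000 / R ^ 3 * B ^ 2 * r ^ 3 = 1000 * B ^ 2 * x ^ 3 := by rw [hx]; ring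
  rw [hrhs, hder]
  simp only [sum4] at hq ⊢
  simp only [hp] at b1 b2 b3 b4
  have hBx : 0 ≤ B ^ 2 * x ^ 3 := by positivity
  rw [abs_le]
  constructor <;> nlinarith [b1.1, b2.1, b3.1, b4.1, b1.2, b2.2, b3.2, b4.2]

theorem det_complex_clm (L : ℂ →L[ℝ] ℂ) :
    L.det = ‖(L 1 - Complex.I * L Complex.I) / 2‖ ^ 2 - ‖(L 1 + Complex.I * L Complex.I) / 2‖ ^ 2 := by
  rw [ContinuousLinearMap.det, ← LinearMap.det_toMatrix Complex.basisOneI, Matrix.det_fin_two]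
  simp only [LinearMap.toMatrix_apply, Complex.coe_basisOneI_repr, Complex.coe_basisOneI,
    Matrix.cons_val_zero, Matrix.cons_val_one, ContinuousLinearMap.coe_coe, Complex.sq_norm]
  simp [Complex.normSq_apply]
  ring

theorem lintegral_le_of_shear {χ : ℂ → ℂ} (hχ : Differentiable ℝ χ) {M : ℝ}
    (hdel : ∀ y, ‖del χ y‖ ≤ M) (hdbar : ∀ y, ‖dbar χ y‖ ≤ M) {L : NNReal} (hL : LipschitzWith L χ)
    {τ : ℂ} (hτM : ‖τ‖ * M ≤ 1 / 2) (hτL : ‖τ‖ * L < 1) (g : ℂ → ENNReal) :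
    ∫⁻ x, g x ≤ ∫⁻ y, ENNReal.ofReal (‖1 + τ * del χ y‖ ^ 2) * g (y + τ * χ y) := by
  set Φ : ℂ → ℂ := fun y => y + τ * χ y with hΦ
  have happ : ApproximatesLinearOn Φ ((ContinuousLinearEquiv.refl ℝ ℂ : ℂ ≃L[ℝ] ℂ) : ℂ →L[ℝ] ℂ)
      Set.univ (‖τ‖₊ * L) := by
    intro x _ y _
    have : Φ x - Φ y - (x - y) = τ * (χ x - χ y) := by simp only [hΦ]; ring
    simp only [ContinuousLinearEquiv.coe_refl, ContinuousLinearMap.id_apply, this, norm_mul]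
    rw [NNReal.coe_mul, coe_nnnorm, mul_assoc]
    gcongr
    simpa [dist_eq_norm] using hL.dist_le_mul x y
  have hc : Subsingleton ℂ ∨ ‖τ‖₊ * L <
      ‖((ContinuousLinearEquiv.refl ℝ ℂ).symm : ℂ →L[ℝ] ℂ)‖₊⁻¹ := by
    right
    have : ‖((ContinuousLinearEquiv.refl ℝ ℂ).symm : ℂ →L[ℝ] ℂ)‖₊ = 1 := by
      ext; simp
    rw [this, inv_one]
    exact_mod_cast hτL
  have hsurj := happ.surjective hc
  have hinj : Function.Injective Φ := fun x y h => by
    have := happ.injective hc (a₁ := ⟨x, trivial⟩) (a₂ := ⟨y, trivial⟩) h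
    exact congrArg Subtype.val this
  have hder : ∀ y, HasFDerivAt Φ (ContinuousLinearMap.id ℝ ℂ + τ • fderiv ℝ χ y) y := fun y =>
    (hasFDerivAt_id y).add ((hχ y).hasFDerivAt.const_mul τ)
  have key := lintegral_image_eq_lintegral_abs_det_fderiv_mul (volume : Measure ℂ)
    MeasurableSet.univ (fun y _ => (hder y).hasFDerivWithinAt) hinj.injOn g
  rw [Set.image_univ, hsurj.range_eq, setLIntegral_univ, setLIntegral_univ] at key
  rw [key]
  refine lintegral_mono fun y => ?_
  dsimp only
  gcongr
  rw [det_complex_clm]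
  have e1 : ((ContinuousLinearMap.id ℝ ℂ + τ • fderiv ℝ χ y) 1 - Complex.I *
      (ContinuousLinearMap.id ℝ ℂ + τ • fderiv ℝ χ y) Complex.I) / 2 = 1 + τ * del χ y := by
    simp only [add_apply, ContinuousLinearMap.id_apply, del, smul_apply, smul_eq_mul]
    linear_combination (-1 / 2 : ℂ) * Complex.I_mul_I
  have e2 : ((ContinuousLinearMap.id ℝ ℂ + τ • fderiv ℝ χ y) 1 + Complex.I *
      (ContinuousLinearMap.id ℝ ℂ + τ • fderiv ℝ χ y) Complex.I) / 2 = τ * dbar χ y := by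
    simp only [add_apply, ContinuousLinearMap.id_apply, dbar, smul_apply, smul_eq_mul]
    linear_combination (1 / 2 : ℂ) * Complex.I_mul_I
  rw [e1, e2]
  have h1 : ‖τ * dbar χ y‖ ≤ 1 / 2 := by
    rw [norm_mul]; exact (mul_le_mul_of_nonneg_left (hdbar y) (norm_nonneg _)).trans hτM
  have h2 : ‖τ * del χ y‖ ≤ 1 / 2 := by
    rw [norm_mul]; exact (mul_le_mul_of_nonneg_left (hdel y) (norm_nonneg _)).trans hτM
  have h3 : 1 / 2 ≤ ‖1 + τ * del χ y‖ := by
    have := norm_sub_le_norm_add (1 : ℂ) (τ * del χ y)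
    rw [norm_one] at this
    linarith
  rw [abs_of_nonneg]
  · linarith [sq_nonneg ‖τ * dbar χ y‖]
  · have := norm_nonneg (τ * dbar χ y); nlinarith

section

variable {ι : Type*} [Fintype ι]

/-- The weighted Bergman norm on the fibre over `t`. -/
def fiberNorm (a b : ι → ℂ) (A : ℝ) {n : ℕ} (c : Fin (n + 1) → ℂ) (t : ℂ) : ENNReal :=
  ∫⁻ x, ENNReal.ofReal (‖pol c x / rootWt (fun j => a j + b j * t) A x‖ ^ 2)

/-- The pulled back integrand of the fibre norm, holomorphic in the fibre parameter `τ`. -/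
def pullback (a b : ι → ℂ) (A : ℝ) (χ : ℂ → ℂ) {n : ℕ} (c₀ c₁ : Fin (n + 1) → ℂ) (τ y : ℂ) : ℂ :=
  (1 + τ * del χ y) * (pol c₀ (y + τ * χ y) + τ * pol c₁ (y + τ * χ y)) *
    Complex.exp (-A * ∑ j, Complex.log (1 + τ * ((χ y - b j) / (y - a j))))

theorem norm_one_add_ge_half {z : ℂ} (hz : ‖z‖ ≤ 1 / 2) : 1 / 2 ≤ ‖1 + z‖ := by
  have := norm_sub_le_norm_add (1 : ℂ) z
  rw [norm_one] at this
  linarith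

theorem one_add_mem_slitPlane' {z : ℂ} (hz : ‖z‖ ≤ 1 / 2) : 1 + z ∈ Complex.slitPlane :=
  Complex.mem_slitPlane_of_norm_lt_one (by linarith)

theorem norm_exp_neg_sum_log (A : ℝ) {z : ι → ℂ} (hz : ∀ j, ‖z j‖ ≤ 1 / 2) :
    ‖Complex.exp (-A * ∑ j, Complex.log (1 + z j))‖ = (∏ j, ‖1 + z j‖ ^ A)⁻¹ := by
  have h : (-A * ∑ j, Complex.log (1 + z j)).re = ∑ j, -(Real.log ‖1 + z j‖ * A) := by
    rw [← Complex.ofReal_neg, Complex.re_ofReal_mul, Complex.re_sum, Finset.mul_sum]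
    refine Finset.sum_congr rfl fun j _ => ?_
    rw [Complex.log_re]; ring
  rw [Complex.norm_exp, h, Real.exp_sum, ← Finset.prod_inv_distrib]
  refine Finset.prod_congr rfl fun j _ => ?_
  have : 0 < ‖1 + z j‖ := by linarith [norm_one_add_ge_half (hz j)]
  rw [Real.exp_neg, Real.rpow_def_of_pos this]

theorem norm_pullback_div (a b : ι → ℂ) {A : ℝ} {χ : ℂ → ℂ} (hχ : ∀ j, χ (a j) = b j) {n : ℕ}
    (c₀ c₁ : Fin (n + 1) → ℂ) {τ y : ℂ} (hz : ∀ j, ‖τ * ((χ y - b j) / (y - a j))‖ ≤ 1 / 2) :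
    ‖pullback a b A χ c₀ c₁ τ y / rootWt a A y‖ = ‖1 + τ * del χ y‖ *
      ‖pol (c₀ + τ • c₁) (y + τ * χ y) / rootWt (fun j => a j + b j * τ) A (y + τ * χ y)‖ := by
  have hw : rootWt (fun j => a j + b j * τ) A (y + τ * χ y) =
      rootWt a A y * ∏ j, ‖1 + τ * ((χ y - b j) / (y - a j))‖ ^ A := by
    rw [rootWt, rootWt, ← Finset.prod_mul_distrib]
    refine Finset.prod_congr rfl fun j _ => ?_
    rw [← Real.mul_rpow (norm_nonneg _) (norm_nonneg _), ← norm_mul]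
    congr 2
    by_cases h : y = a j
    · subst h; rw [hχ j]; simp; ring
    · have : y - a j ≠ 0 := sub_ne_zero.2 h
      field_simp
      ring
  rw [norm_div, norm_div, pullback, norm_mul, norm_mul, norm_exp_neg_sum_log A hz, pol_add, pol_smul, hw]
  simp only [Complex.ofReal_mul, norm_mul, Complex.norm_real]
  rw [Real.norm_of_nonneg (Finset.prod_nonneg fun j _ =>
    (Real.rpow_nonneg (norm_nonneg (1 + τ * ((χ y - b j) / (y - a j)))) A))]
  ring

theorem fiberNorm_le_pullback (a b : ι → ℂ) {A : ℝ} {χ : ℂ → ℂ} (hχa : ∀ j, χ (a j) = b j)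
    (hχ : Differentiable ℝ χ) {M : ℝ}
    (hdel : ∀ y, ‖del χ y‖ ≤ M) (hdbar : ∀ y, ‖dbar χ y‖ ≤ M)
    (hq : ∀ j y, ‖(χ y - b j) / (y - a j)‖ ≤ M) {L : NNReal} (hL : LipschitzWith L χ) {n : ℕ}
    (c₀ c₁ : Fin (n + 1) → ℂ)
    {τ : ℂ} (hτM : ‖τ‖ * M ≤ 1 / 2) (hτL : ‖τ‖ * L < 1) :
    fiberNorm a b A (c₀ + τ • c₁) τ ≤
      ∫⁻ y, ENNReal.ofReal (‖pullback a b A χ c₀ c₁ τ y / rootWt a A y‖ ^ 2) := by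
  refine (lintegral_le_of_shear hχ hdel hdbar hL hτM hτL _).trans (le_of_eq (lintegral_congr fun y => ?_))
  rw [norm_pullback_div a b hχa c₀ c₁ fun j => ?_, mul_pow, ENNReal.ofReal_mul (by positivity)]
  rw [norm_mul]; exact (mul_le_mul_of_nonneg_left (hq j y) (norm_nonneg _)).trans hτM

theorem differentiable_pol {n : ℕ} (c : Fin (n + 1) → ℂ) : Differentiable ℂ (pol c) := by
  unfold pol; fun_prop

theorem hasDerivAt_pullback (a b : ι → ℂ) (A : ℝ) (χ : ℂ → ℂ) {n : ℕ} (c₀ c₁ : Fin (n + 1) → ℂ) (y : ℂ) :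
    HasDerivAt (fun τ => pullback a b A χ c₀ c₁ τ y)
      (pol c₁ y + del χ y * pol c₀ y + χ y * deriv (pol c₀) y
        - A * pol c₀ y * ∑ j, (χ y - b j) / (y - a j)) 0 := by
  have h1 : HasDerivAt (fun τ : ℂ => y + τ * χ y) (χ y) 0 := by
    simpa using ((hasDerivAt_id (0 : ℂ)).mul_const (χ y)).const_add y
  have hp : ∀ c : Fin (n + 1) → ℂ, HasDerivAt (fun τ : ℂ => pol c (y + τ * χ y)) (deriv (pol c) y * χ y) 0 := by
    intro c
    have h2 : HasDerivAt (pol c) (deriv (pol c) y) (y + 0 * χ y) := by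
      simpa using (differentiable_pol c y).hasDerivAt
    exact h2.comp 0 h1
  have hl : HasDerivAt (fun τ : ℂ => 1 + τ * del χ y) (del χ y) 0 := by
    simpa using ((hasDerivAt_id (0 : ℂ)).mul_const (del χ y)).const_add 1
  have hs : HasDerivAt (fun τ : ℂ => ∑ j, Complex.log (1 + τ * ((χ y - b j) / (y - a j))))
      (∑ j, (χ y - b j) / (y - a j)) 0 := by
    refine HasDerivAt.fun_sum fun j _ => ?_
    have h3 : HasDerivAt (fun τ : ℂ => 1 + τ * ((χ y - b j) / (y - a j))) ((χ y - b j) / (y - a j)) 0 := by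
      simpa using ((hasDerivAt_id (0 : ℂ)).mul_const ((χ y - b j) / (y - a j))).const_add 1
    simpa using h3.clog (by simp)
  have hE := (hs.const_mul (-A : ℂ)).cexp
  have := (hl.mul ((hp c₀).add ((hasDerivAt_id (0 : ℂ)).mul (hp c₁)))).mul hE
  refine (this.congr_deriv ?_)
  simp
  ring

end

section

variable {ι : Type*} [Fintype ι]

theorem norm_pullback_le (a b : ι → ℂ) {A : ℝ} (hA : 0 ≤ A) {χ : ℂ → ℂ} {M : ℝ}
    (hχM : ∀ y, ‖χ y‖ ≤ M) (hdel : ∀ y, ‖del χ y‖ ≤ M)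
    (hq : ∀ j y, ‖(χ y - b j) / (y - a j)‖ ≤ M) {n : ℕ} (c₀ c₁ : Fin (n + 1) → ℂ)
    {τ : ℂ} (hτM : ‖τ‖ * M ≤ 1 / 2) (hτ : ‖τ‖ ≤ 1) (y : ℂ) :
    ‖pullback a b A χ c₀ c₁ τ y‖ ≤
      (2 * (∑ k, ‖c₀ k‖ + ∑ k, ‖c₁ k‖) * 2 ^ n * (((1 / 2 : ℝ) ^ A) ^ Fintype.card ι)⁻¹) * (1 + ‖y‖) ^ n := by
  have hz : ∀ j, ‖τ * ((χ y - b j) / (y - a j))‖ ≤ 1 / 2 := fun j => by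
    rw [norm_mul]; exact (mul_le_mul_of_nonneg_left (hq j y) (norm_nonneg _)).trans hτM
  have hχ1 : ‖τ * χ y‖ ≤ 1 / 2 := by
    rw [norm_mul]; exact (mul_le_mul_of_nonneg_left (hχM y) (norm_nonneg _)).trans hτM
  have hd1 : ‖τ * del χ y‖ ≤ 1 / 2 := by
    rw [norm_mul]; exact (mul_le_mul_of_nonneg_left (hdel y) (norm_nonneg _)).trans hτM
  have hp : ∀ c : Fin (n + 1) → ℂ, ‖pol c (y + τ * χ y)‖ ≤ (∑ k, ‖c k‖) * (2 ^ n * (1 + ‖y‖) ^ n) := by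
    intro c
    refine (norm_pol_le c _).trans ?_
    rw [← mul_pow]
    gcongr
    have := norm_add_le y (τ * χ y)
    have := norm_nonneg y
    linarith
  rw [pullback, norm_mul, norm_mul, norm_exp_neg_sum_log A hz]
  have h1 : ‖1 + τ * del χ y‖ ≤ 2 := by
    have := norm_add_le (1 : ℂ) (τ * del χ y)
    rw [norm_one] at this; linarith
  have h2 : ‖pol c₀ (y + τ * χ y) + τ * pol c₁ (y + τ * χ y)‖ ≤
      (∑ k, ‖c₀ k‖ + ∑ k, ‖c₁ k‖) * (2 ^ n * (1 + ‖y‖) ^ n) := by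
    refine (norm_add_le _ _).trans ?_
    rw [add_mul, norm_mul]
    refine add_le_add (hp c₀) (le_trans ?_ (hp c₁))
    exact mul_le_of_le_one_left (norm_nonneg _) hτ
  have h3 : (∏ j, ‖1 + τ * ((χ y - b j) / (y - a j))‖ ^ A)⁻¹ ≤ (((1 / 2 : ℝ) ^ A) ^ Fintype.card ι)⁻¹ := by
    refine inv_anti₀ (by positivity) ?_
    rw [← Finset.card_univ, ← Finset.prod_const]
    refine Finset.prod_le_prod (fun _ _ => by positivity) fun j _ => ?_
    exact Real.rpow_le_rpow (by norm_num) (norm_one_add_ge_half (hz j)) hA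
  calc _ ≤ 2 * ((∑ k, ‖c₀ k‖ + ∑ k, ‖c₁ k‖) * (2 ^ n * (1 + ‖y‖) ^ n)) *
        (((1 / 2 : ℝ) ^ A) ^ Fintype.card ι)⁻¹ := by gcongr
    _ = _ := by ring

theorem differentiableOn_pullback (a b : ι → ℂ) {A : ℝ} {χ : ℂ → ℂ} {M R : ℝ} (hR : R * M ≤ 1 / 2)
    (hq : ∀ j y, ‖(χ y - b j) / (y - a j)‖ ≤ M) {n : ℕ} (c₀ c₁ : Fin (n + 1) → ℂ) (y : ℂ) :
    DifferentiableOn ℂ (fun τ => pullback a b A χ c₀ c₁ τ y) (Metric.ball 0 R) := by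
  have hp : ∀ c : Fin (n + 1) → ℂ, Differentiable ℂ (fun τ : ℂ => pol c (y + τ * χ y)) := fun c =>
    (differentiable_pol c).comp (by fun_prop)
  have hl : ∀ j, DifferentiableOn ℂ (fun τ : ℂ => Complex.log (1 + τ * ((χ y - b j) / (y - a j))))
      (Metric.ball 0 R) := fun j => by
    refine DifferentiableOn.clog (by fun_prop) fun τ hτ => one_add_mem_slitPlane' ?_
    rw [mem_ball_zero_iff] at hτ
    rw [norm_mul]
    exact (mul_le_mul hτ.le (hq j y) (norm_nonneg _) ((norm_nonneg _).trans hτ.le)).trans hR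
  unfold pullback
  have hs : DifferentiableOn ℂ (fun τ : ℂ => ∑ j, Complex.log (1 + τ * ((χ y - b j) / (y - a j))))
      (Metric.ball 0 R) := DifferentiableOn.fun_sum fun j _ => hl j
  have h0 := (hp c₀).differentiableOn (s := Metric.ball 0 R)
  have h1 := (hp c₁).differentiableOn (s := Metric.ball 0 R)
  fun_prop

theorem exists_norm_quotient_le {χ : ℂ → ℂ} {a b : ℂ} {B : ℝ} (hB : ∀ y, ‖χ y‖ ≤ B)
    (hloc : ∀ᶠ y in nhds a, χ y = b) : ∃ C, ∀ y, ‖(χ y - b) / (y - a)‖ ≤ C := by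
  obtain ⟨ρ, hρ, h⟩ := Metric.eventually_nhds_iff.1 hloc
  have hB0 : 0 ≤ B := (norm_nonneg _).trans (hB 0)
  refine ⟨(B + ‖b‖) / ρ, fun y => ?_⟩
  by_cases hy : dist y a < ρ
  · rw [h hy]; simp; positivity
  · rw [norm_div]
    rw [dist_eq_norm, not_lt] at hy
    gcongr
    exact (norm_sub_le _ _).trans (by gcongr; exact hB y)

theorem sum4_fiberNorm_le {a : ι → ℂ} (ha : Function.Injective a) (b : ι → ℂ) {A : ℝ} (hA : 0 ≤ A)
    (hA1 : A < 1) {n : ℕ} (hn : n + 1 < A * Fintype.card ι) {χ : ℂ → ℂ}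
    (hχ : ContDiff ℝ (⊤ : ℕ∞) χ) (hcs : HasCompactSupport χ) (hloc : ∀ j, ∀ᶠ y in nhds (a j), χ y = b j)
    (c₀ c₁ : Fin (n + 1) → ℂ) :
    ∃ R > 0, ∃ C ≥ 0, ∀ r, 0 < r → r < R →
      sum4 (fun τ => fiberNorm a b A (c₀ + τ • c₁) τ) r ≤ 4 * fiberNorm a b A c₀ 0 +
        ENNReal.ofReal (4 * r ^ 2) * (∫⁻ y, ENNReal.ofReal (‖(pol c₁ y + del χ y * pol c₀ y
          + χ y * deriv (pol c₀) y - A * pol c₀ y * ∑ j, (χ y - b j) / (y - a j)) /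
            rootWt a A y‖ ^ 2)) + ENNReal.ofReal (C * r ^ 3) := by
  obtain ⟨B1, hB1⟩ := hcs.exists_bound_of_continuous hχ.continuous
  have hfd : Continuous (fderiv ℝ χ) := hχ.continuous_fderiv (by simp)
  obtain ⟨B2, hB2⟩ := (hcs.fderiv ℝ).exists_bound_of_continuous hfd
  obtain ⟨L, hL⟩ := ContDiff.lipschitzWith_of_hasCompactSupport hcs hχ (by simp)
  choose Bq hBq using fun j => exists_norm_quotient_le hB1 (hloc j)
  have hB2' : 0 ≤ B2 := (norm_nonneg _).trans (hB2 0)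
  have hB1' : 0 ≤ B1 := (norm_nonneg _).trans (hB1 0)
  have hBq' : ∀ j, 0 ≤ Bq j := fun j => (norm_nonneg _).trans (hBq j 0)
  have happ : ∀ y v, ‖v‖ = 1 → ‖fderiv ℝ χ y v‖ ≤ B2 := fun y v hv =>
    ((fderiv ℝ χ y).le_opNorm v).trans (by rw [hv, mul_one]; exact hB2 y)
  set M := 1 + B1 + B2 + ∑ j, Bq j with hMdef
  have hsum : 0 ≤ ∑ j, Bq j := Finset.sum_nonneg fun j _ => hBq' j
  have hM : 0 < M := by positivity
  have hχM : ∀ y, ‖χ y‖ ≤ M := fun y => (hB1 y).trans (by linarith)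
  have hq : ∀ j y, ‖(χ y - b j) / (y - a j)‖ ≤ M := fun j y => (hBq j y).trans (by
    have := Finset.single_le_sum (f := Bq) (fun j _ => hBq' j) (Finset.mem_univ j); linarith)
  have hdel : ∀ y, ‖del χ y‖ ≤ M := fun y => by
    have h1 := happ y 1 (by simp)
    have h2 := happ y Complex.I (by simp)
    have h3 := norm_sub_le (fderiv ℝ χ y 1) (Complex.I * fderiv ℝ χ y Complex.I)
    rw [norm_mul, Complex.norm_I, one_mul] at h3
    rw [del, norm_div, Complex.norm_ofNat]
    linarith
  have hdbar : ∀ y, ‖dbar χ y‖ ≤ M := fun y => by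
    have h1 := happ y 1 (by simp)
    have h2 := happ y Complex.I (by simp)
    have h3 := norm_add_le (fderiv ℝ χ y 1) (Complex.I * fderiv ℝ χ y Complex.I)
    rw [norm_mul, Complex.norm_I, one_mul] at h3
    rw [dbar, norm_div, Complex.norm_ofNat]
    linarith
  set R := 1 / (2 * (M + L)) with hR
  have hL0 : (0 : ℝ) ≤ L := L.2
  have hR0 : 0 < R := by positivity
  have hRM : R * M ≤ 1 / 2 := by
    rw [hR, div_mul_eq_mul_div, one_mul, div_le_div_iff₀ (by positivity) (by norm_num)]; linarith
  have hR1 : R ≤ 1 := by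
    rw [hR, div_le_one (by positivity)]; linarith
  have hRL : R * L < 1 := by
    rw [hR, div_mul_eq_mul_div, one_mul, div_lt_one (by positivity)]; linarith
  set E := (2 * (∑ k, ‖c₀ k‖ + ∑ k, ‖c₁ k‖) * 2 ^ n * (((1 / 2 : ℝ) ^ A) ^ Fintype.card ι)⁻¹) with hE
  set G : ℂ → ℂ := fun y => ((E * (1 + ‖y‖) ^ n : ℝ) : ℂ) with hG
  have hE0 : 0 ≤ E := by positivity
  have hGmem : MemLp (fun y => G y / rootWt a A y) 2 volume := by
    refine memLp_of_le_one_add_pow ha hA hA1 hn (C := E) (Continuous.aestronglyMeasurable (by fun_prop)) fun y => ?_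
    rw [hG, Complex.norm_real, Real.norm_of_nonneg (by positivity)]
  have hGint := lintegral_ne_top_of_memLp_two hGmem
  set J := ∫⁻ y, ENNReal.ofReal (‖G y / rootWt a A y‖ ^ 2) with hJ
  set K1 : ℂ → ℂ := fun y => (pol c₁ y + del χ y * pol c₀ y
          + χ y * deriv (pol c₀) y - A * pol c₀ y * ∑ j, (χ y - b j) / (y - a j)) with hK1
  refine ⟨R, hR0, 1000 / R ^ 3 * J.toReal, by positivity, fun r hr hrR => ?_⟩
  have hle : ∀ τ : ℂ, ‖τ‖ = r → fiberNorm a b A (c₀ + τ • c₁) τ ≤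
      ∫⁻ y, ENNReal.ofReal (‖pullback a b A χ c₀ c₁ τ y / rootWt a A y‖ ^ 2) := by
    intro τ hτ
    refine fiberNorm_le_pullback a b (fun j => (hloc j).self_of_nhds) (hχ.differentiable (by simp)) hdel hdbar hq hL c₀ c₁ ?_ ?_
    · rw [hτ]; exact le_trans (by gcongr) hRM
    · rw [hτ]; exact lt_of_le_of_lt (by gcongr) hRL
  have hsup : sum4 (fun τ => fiberNorm a b A (c₀ + τ • c₁) τ) r ≤
      ∫⁻ y, ENNReal.ofReal (sum4 (fun τ => ‖pullback a b A χ c₀ c₁ τ y / rootWt a A y‖ ^ 2) r) := by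
    simp only [sum4]
    have n1 := hle r (by simp [abs_of_pos hr])
    have n2 := hle (r * Complex.I) (by simp [abs_of_pos hr])
    have n3 := hle (-r) (by simp [abs_of_pos hr])
    have n4 := hle (-(r * Complex.I)) (by simp [abs_of_pos hr])
    refine (add_le_add (add_le_add (add_le_add n1 n2) n3) n4).trans ?_
    refine (add_le_add (add_le_add (le_lintegral_add _ _) le_rfl) le_rfl).trans ?_
    refine (add_le_add (le_lintegral_add _ _) le_rfl).trans ((le_lintegral_add _ _).trans (le_of_eq ?_))
    refine lintegral_congr fun y => ?_
    rw [ENNReal.ofReal_add (by positivity) (by positivity), ENNReal.ofReal_add (by positivity) (by positivity),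
      ENNReal.ofReal_add (by positivity) (by positivity)]
  have hpt : ∀ y, sum4 (fun τ => ‖pullback a b A χ c₀ c₁ τ y / rootWt a A y‖ ^ 2) r ≤
      4 * ‖pol c₀ y / rootWt a A y‖ ^ 2 + (4 * r ^ 2 * ‖K1 y / rootWt a A y‖ ^ 2 +
        1000 / R ^ 3 * r ^ 3 * ‖G y / rootWt a A y‖ ^ 2) := by
    intro y
    have hd : DifferentiableOn ℂ (fun τ => pullback a b A χ c₀ c₁ τ y / rootWt a A y) (Metric.ball 0 R) :=
      (differentiableOn_pullback a b hRM hq c₀ c₁ y).div_const _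
    have hb : ∀ τ ∈ Metric.ball (0 : ℂ) R, ‖pullback a b A χ c₀ c₁ τ y / rootWt a A y‖ ≤ ‖G y / rootWt a A y‖ := by
      intro τ hτ
      rw [mem_ball_zero_iff] at hτ
      rw [norm_div, norm_div]
      gcongr
      rw [hG, Complex.norm_real, Real.norm_of_nonneg (by positivity)]
      exact norm_pullback_le a b hA hχM hdel hq c₀ c₁ (le_trans (by gcongr) hRM) (hτ.le.trans hR1) y
    have h0 : pullback a b A χ c₀ c₁ 0 y = pol c₀ y := by simp [pullback]
    have h1 : deriv (fun τ => pullback a b A χ c₀ c₁ τ y / rootWt a A y) 0 = K1 y / rootWt a A y :=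
      ((hasDerivAt_pullback a b A χ c₀ c₁ y).div_const _).deriv
    have := (abs_le.1 (abs_sum4_norm_sq_sub_le hR0 hd hb hr.le hrR)).2
    rw [h1, h0] at this
    nlinarith
  refine hsup.trans ((lintegral_mono fun y => ENNReal.ofReal_le_ofReal (hpt y)).trans ?_)
  have hmw : Measurable (rootWt a A) := (continuous_rootWt a hA).measurable
  have hm0 : Measurable fun y => ENNReal.ofReal (4 * ‖pol c₀ y / rootWt a A y‖ ^ 2) := by
    have := (continuous_pol c₀).measurable
    fun_prop
  have hmG : Measurable fun y => ENNReal.ofReal (1000 / R ^ 3 * r ^ 3 * ‖G y / rootWt a A y‖ ^ 2) := by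
    have : Measurable G := Continuous.measurable (by fun_prop)
    fun_prop
  have hsplit : ∀ y, ENNReal.ofReal (4 * ‖pol c₀ y / rootWt a A y‖ ^ 2 + (4 * r ^ 2 * ‖K1 y / rootWt a A y‖ ^ 2 +
        1000 / R ^ 3 * r ^ 3 * ‖G y / rootWt a A y‖ ^ 2)) = ENNReal.ofReal (4 * ‖pol c₀ y / rootWt a A y‖ ^ 2) +
        (ENNReal.ofReal (4 * r ^ 2 * ‖K1 y / rootWt a A y‖ ^ 2) +
        ENNReal.ofReal (1000 / R ^ 3 * r ^ 3 * ‖G y / rootWt a A y‖ ^ 2)) := fun y => by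
    rw [ENNReal.ofReal_add (by positivity) (by positivity), ENNReal.ofReal_add (by positivity) (by positivity)]
  simp only [hsplit]
  rw [lintegral_add_left hm0, lintegral_add_right _ hmG, ← add_assoc]
  refine add_le_add (add_le_add (le_of_eq ?_) (le_of_eq ?_)) (le_of_eq ?_)
  · simp only [ENNReal.ofReal_mul (show (0:ℝ) ≤ 4 by norm_num), fiberNorm, mul_zero, add_zero]
    rw [lintegral_const_mul' _ _ ENNReal.ofReal_ne_top]
    simp
  · simp only [ENNReal.ofReal_mul (show (0:ℝ) ≤ 4 * r ^ 2 by positivity)]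
    rw [lintegral_const_mul' _ _ ENNReal.ofReal_ne_top]
  · simp only [ENNReal.ofReal_mul (show (0:ℝ) ≤ 1000 / R ^ 3 * r ^ 3 by positivity)]
    rw [lintegral_const_mul' _ _ ENNReal.ofReal_ne_top, ← hJ,
      show 1000 / R ^ 3 * J.toReal * r ^ 3 = 1000 / R ^ 3 * r ^ 3 * J.toReal by ring,
      ENNReal.ofReal_mul (show (0:ℝ) ≤ 1000 / R ^ 3 * r ^ 3 by positivity), ENNReal.ofReal_toReal hGint]

end

theorem exists_separated {ι : Type*} [Fintype ι] {a : ι → ℂ} (ha : Function.Injective a) :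
    ∃ δ > 0, ∀ j k, j ≠ k → δ ≤ ‖a j - a k‖ := by
  by_cases hne : ((Finset.univ : Finset (ι × ι)).filter fun p => p.1 ≠ p.2).Nonempty
  · obtain ⟨p, hp, hmin⟩ := Finset.exists_min_image _ (fun p : ι × ι => ‖a p.1 - a p.2‖) hne
    exact ⟨_, norm_pos_iff.2 (sub_ne_zero.2 fun h => (Finset.mem_filter.1 hp).2 (ha h)),
      fun j k hq => hmin (j, k) (by simpa using hq)⟩
  · exact ⟨1, one_pos, fun j k hp => absurd ⟨(j, k), by simpa using hp⟩ hne⟩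

section

variable {ι : Type*} [Fintype ι]

theorem exists_interpolating_bump {a : ι → ℂ} (ha : Function.Injective a) (b : ι → ℂ) :
    ∃ χ : ℂ → ℂ, ContDiff ℝ (⊤ : ℕ∞) χ ∧ HasCompactSupport χ ∧ ∀ j, ∀ᶠ y in nhds (a j), χ y = b j := by
  obtain ⟨δ, hδ, hsep⟩ := exists_separated ha
  let F : ∀ j, ContDiffBump (a j) := fun j => ⟨δ / 3, δ / 2, by positivity, by linarith⟩
  refine ⟨fun y => ∑ j, ((F j y : ℝ) : ℂ) * b j, ?_, ?_, fun j => ?_⟩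
  · refine ContDiff.sum fun j _ => ContDiff.mul ?_ contDiff_const
    exact Complex.ofRealCLM.contDiff.comp (F j).contDiff
  · refine HasCompactSupport.intro (isCompact_iUnion fun j => isCompact_closedBall (a j) (δ / 2)) fun y hy => ?_
    refine Finset.sum_eq_zero fun j _ => ?_
    simp only [Set.mem_iUnion, not_exists, Metric.mem_closedBall, not_le] at hy
    rw [(F j).zero_of_le_dist (hy j).le]; simp
  · filter_upwards [Metric.ball_mem_nhds (a j) (show 0 < δ / 3 by positivity)] with y hy
    rw [Finset.sum_eq_single j]
    · rw [(F j).one_of_mem_closedBall (Metric.ball_subset_closedBall hy)]; simp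
    · intro k _ hk
      rw [(F k).zero_of_le_dist]
      · simp
      · rw [Metric.mem_ball] at hy
        have h1 := hsep j k hk.symm
        have h2 := dist_triangle_left (a j) (a k) y
        rw [dist_eq_norm (a j)] at h2
        change δ / 2 ≤ _
        linarith
    · simp

/-- The square of `rootWt` in exponential form. -/
def rootWtExp (a : ι → ℂ) (A : ℝ) (y : ℂ) : ℂ :=
  ((Real.exp (A * ∑ j, Real.log (Complex.normSq (y - a j))) : ℝ) : ℂ)

theorem rootWtExp_eq (a : ι → ℂ) (A : ℝ) {y : ℂ} (hy : y ∉ Set.range a) :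
    rootWtExp a A y = (rootWt a A y : ℂ) ^ 2 := by
  rw [rootWtExp, rootWt, ← Complex.ofReal_pow, Finset.mul_sum, Real.exp_sum, ← Finset.prod_pow]
  congr 1
  refine Finset.prod_congr rfl fun j _ => ?_
  have : 0 < ‖y - a j‖ := norm_pos_iff.2 (sub_ne_zero.2 fun h => hy ⟨j, h.symm⟩)
  rw [Complex.normSq_eq_norm_sq, Real.log_pow, Real.rpow_def_of_pos this, ← Real.exp_nat_mul]
  congr 1
  push_cast; ring

theorem contDiffAt_rootWtExp (a : ι → ℂ) (A : ℝ) {y : ℂ} (hy : y ∉ Set.range a) :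
    ContDiffAt ℝ (⊤ : ℕ∞) (rootWtExp a A) y := by
  refine Complex.ofRealCLM.contDiff.contDiffAt.comp y ?_
  refine ContDiffAt.exp (contDiffAt_const.mul (ContDiffAt.sum fun j _ => ?_))
  refine ContDiffAt.log ?_ ?_
  · exact (contDiff_normSq.comp (contDiff_id.sub contDiff_const)).contDiffAt
  · rw [Ne, Complex.normSq_eq_zero, sub_eq_zero]; exact fun h => hy ⟨j, h.symm⟩

theorem del_rootWtExp (a : ι → ℂ) (A : ℝ) {y : ℂ} (hy : y ∉ Set.range a) :
    del (rootWtExp a A) y = rootWtExp a A y * (A * ∑ j, 1 / (y - a j)) := by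
  have h1 : ∀ j, HasFDerivAt (fun x : ℂ => Complex.normSq (x - a j))
      ((2 * (y - a j).re) • Complex.reCLM + (2 * (y - a j).im) • Complex.imCLM) y := fun j => by
    have := (hasFDerivAt_normSq (y - a j)).comp y ((hasFDerivAt_id (𝕜 := ℝ) y).sub_const (a j))
    simpa [Function.comp_def] using this
  have hne : ∀ j, y - a j ≠ 0 := fun j => sub_ne_zero.2 fun h => hy ⟨j, h.symm⟩
  have hN : ∀ j, Complex.normSq (y - a j) ≠ 0 := fun j => by
    rw [Ne, Complex.normSq_eq_zero]; exact hne j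
  have h2 := ((HasFDerivAt.fun_sum fun j (_ : j ∈ Finset.univ) => (h1 j).log (hN j)).const_mul A).exp
  have h3 := Complex.ofRealCLM.hasFDerivAt.comp y h2
  have h4 : fderiv ℝ (rootWtExp a A) y = _ := h3.fderiv
  rw [del, h4]
  simp only [ContinuousLinearMap.comp_apply, smul_apply, sum_apply, add_apply, Complex.reCLM_apply,
    Complex.imCLM_apply, Complex.one_re, Complex.one_im, Complex.I_re, Complex.I_im, smul_eq_mul,
    Complex.ofRealCLM_apply, mul_zero, mul_one, add_zero, zero_add]
  have h5 : ∀ j, 1 / (y - a j) = ((Complex.normSq (y - a j))⁻¹ * (y - a j).re : ℝ) -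
      Complex.I * ((Complex.normSq (y - a j))⁻¹ * (y - a j).im : ℝ) := fun j => by
    rw [one_div, Complex.inv_def]
    conv_lhs => rw [← Complex.re_add_im (y - a j), map_add, map_mul, Complex.conj_ofReal, Complex.conj_ofReal, Complex.conj_I]
    simp only [Complex.re_add_im]
    push_cast; ring
  simp only [h5, rootWtExp]
  rw [Finset.sum_sub_distrib, ← Finset.mul_sum]
  push_cast
  simp only [← mul_assoc, mul_comm _ (2 : ℂ)]
  simp only [mul_assoc, ← Finset.mul_sum]
  ring

end

theorem del_conj {ψ : ℂ → ℂ} {z : ℂ} (h : DifferentiableAt ℝ ψ z) :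
    del (fun w => (starRingEnd ℂ) (ψ w)) z = (starRingEnd ℂ) (dbar ψ z) := by
  have h1 := (Complex.conjCLE : ℂ →L[ℝ] ℂ).hasFDerivAt.comp z h.hasFDerivAt
  have h2 : fderiv ℝ (fun w => (starRingEnd ℂ) (ψ w)) z = _ := h1.fderiv
  simp only [del, dbar, h2]
  simp [sub_eq_add_neg, Complex.conj_ofNat]

/-- The polynomial with coefficients `c`. -/
def toPoly {n : ℕ} (c : Fin (n + 1) → ℂ) : Polynomial ℂ :=
  ∑ k : Fin (n + 1), Polynomial.monomial (k : ℕ) (c k)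

theorem eval_toPoly {n : ℕ} (c : Fin (n + 1) → ℂ) (z : ℂ) : (toPoly c).eval z = pol c z := by
  simp [toPoly, pol, Polynomial.eval_finsetSum]

theorem coeff_toPoly {n : ℕ} (c : Fin (n + 1) → ℂ) (k : Fin (n + 1)) : (toPoly c).coeff k = c k := by
  simp only [toPoly, Polynomial.finsetSum_coeff, Polynomial.coeff_monomial]
  rw [Finset.sum_eq_single k] <;> simp +contextual [Fin.val_inj]

theorem finite_pol_eq_zero {n : ℕ} {c : Fin (n + 1) → ℂ} (hc : c ≠ 0) : {z | pol c z = 0}.Finite := by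
  have h0 : toPoly c ≠ 0 := fun h => hc (funext fun k => by rw [← coeff_toPoly c k, h]; simp)
  refine (toPoly c).roots.toFinset.finite_toSet.subset fun z hz => ?_
  simp only [Finset.mem_coe, Multiset.mem_toFinset, Polynomial.mem_roots h0, Polynomial.IsRoot, eval_toPoly]
  exact hz

section

variable {ι : Type*} [Fintype ι]

/-- The correction vector field attached to a test function `ψ`. -/
def shearCorrection (a : ι → ℂ) (A : ℝ) {n : ℕ} (c : Fin (n + 1) → ℂ) (ψ : ℂ → ℂ) (y : ℂ) : ℂ :=
  (starRingEnd ℂ) (ψ y) * rootWtExp a A y / pol c y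

theorem shearCorrection_contDiff (a : ι → ℂ) (A : ℝ) {n : ℕ} (c : Fin (n + 1) → ℂ) {ψ : ℂ → ℂ} {S : Set ℂ}
    (hψ : IsTest S ψ) (haS : Set.range a ⊆ S) (hcS : {z | pol c z = 0} ⊆ S) :
    ContDiff ℝ (⊤ : ℕ∞) (shearCorrection a A c ψ) := by
  rw [contDiff_iff_contDiffAt]
  intro y
  by_cases hy : y ∈ tsupport ψ
  · have hyS := hψ.tsupport_subset hy
    have hp : ContDiff ℝ (⊤ : ℕ∞) (pol c) := by unfold pol; fun_prop
    refine ContDiffAt.mul (ContDiffAt.mul ?_ (contDiffAt_rootWtExp a A fun h => hyS (haS h)))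
      (hp.contDiffAt.inv fun h => hyS (hcS h))
    exact (Complex.conjCLE : ℂ →L[ℝ] ℂ).contDiff.contDiffAt.comp y hψ.contDiff.contDiffAt
  · refine (contDiffAt_const (c := (0 : ℂ))).congr_of_eventuallyEq ?_
    filter_upwards [notMem_tsupport_iff_eventuallyEq.1 hy] with z hz
    simp [shearCorrection, hz]

theorem shearCorrection_eventually (a : ι → ℂ) (A : ℝ) {n : ℕ} (c : Fin (n + 1) → ℂ) {ψ : ℂ → ℂ} {S : Set ℂ}
    (hψ : IsTest S ψ) {y : ℂ} (hy : y ∈ S) : ∀ᶠ z in nhds y, shearCorrection a A c ψ z = 0 := by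
  have : y ∉ tsupport ψ := fun h => hψ.tsupport_subset h hy
  filter_upwards [notMem_tsupport_iff_eventuallyEq.1 this] with z hz
  simp [shearCorrection, hz]

theorem del_shearCorrection (a : ι → ℂ) (A : ℝ) {n : ℕ} (c : Fin (n + 1) → ℂ) {ψ : ℂ → ℂ} {S : Set ℂ}
    (hψ : IsTest S ψ) (haS : Set.range a ⊆ S) (hcS : {z | pol c z = 0} ⊆ S) (hS : S.Finite) {y : ℂ} (hy : y ∉ S) :
    del (shearCorrection a A c ψ) y * pol c y + shearCorrection a A c ψ y * deriv (pol c) y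
      - A * pol c y * ∑ j, shearCorrection a A c ψ y / (y - a j) =
      (rootWt a A y : ℂ) ^ 2 * (starRingEnd ℂ) (dbar ψ y) := by
  have hv := (shearCorrection_contDiff a A c hψ haS hcS).differentiable (by simp) y
  have hya : y ∉ Set.range a := fun h => hy (haS h)
  have hp := differentiable_pol c y
  have hpR : DifferentiableAt ℝ (pol c) y := hp.restrictScalars ℝ
  have h1 := del_mul hv hpR
  rw [del_eq_deriv hp] at h1
  have h2 : (fun w => shearCorrection a A c ψ w * pol c w) =ᶠ[nhds y]
      fun w => (starRingEnd ℂ) (ψ w) * rootWtExp a A w := by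
    filter_upwards [hS.isClosed.isOpen_compl.mem_nhds hy] with w hw
    rw [shearCorrection, div_mul_cancel₀]
    exact fun h => hw (hcS h)
  have h3 : DifferentiableAt ℝ (fun w => (starRingEnd ℂ) (ψ w)) y :=
    (Complex.conjCLE : ℂ →L[ℝ] ℂ).differentiableAt.comp y (hψ.differentiable y)
  rw [del_congr h2, del_mul h3 ((contDiffAt_rootWtExp a A hya).differentiableAt (by simp)),
    del_conj (hψ.differentiable y), del_rootWtExp a A hya] at h1
  have hpy : pol c y ≠ 0 := fun h => hy (hcS h)
  have h4 : A * pol c y * ∑ j, shearCorrection a A c ψ y / (y - a j) =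
      (starRingEnd ℂ) (ψ y) * (rootWtExp a A y * (A * ∑ j, 1 / (y - a j))) := by
    have : ∀ j, shearCorrection a A c ψ y / (y - a j) = shearCorrection a A c ψ y * (1 / (y - a j)) := fun j => by ring
    simp only [this]
    rw [← Finset.mul_sum, shearCorrection]
    field_simp
  rw [h4, ← rootWtExp_eq a A hya]
  linear_combination -h1

theorem exists_variation [Nonempty ι] {a : ι → ℂ} (ha : Function.Injective a) (b : ι → ℂ) {A : ℝ} (hA : 0 ≤ A) (hA1 : A < 1)
    {n : ℕ} (hn : n + 1 < A * Fintype.card ι) (hn2 : A * Fintype.card ι < n + 2)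
    {c₀ : Fin (n + 1) → ℂ} (hc : c₀ ≠ 0) {η : ℝ} (hη : 0 < η) :
    ∃ c₁ : Fin (n + 1) → ℂ, ∃ R > 0, ∃ C ≥ 0, ∀ r, 0 < r → r < R →
      sum4 (fun τ => fiberNorm a b A (c₀ + τ • c₁) τ) r ≤
        4 * fiberNorm a b A c₀ 0 + ENNReal.ofReal (4 * r ^ 2) * ENNReal.ofReal η + ENNReal.ofReal (C * r ^ 3) := by
  obtain ⟨χ, hχ, hcs, hloc⟩ := exists_interpolating_bump ha b
  obtain ⟨B, hB⟩ := hcs.exists_bound_of_continuous hχ.continuous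
  have hdelc : Continuous (del χ) := by
    have h := hχ.continuous_fderiv (by simp)
    unfold del
    fun_prop
  have hdelcs : HasCompactSupport (del χ) := by
    have := hcs.fderiv (𝕜 := ℝ)
    refine this.mono' ?_
    refine (Function.support_subset_iff'.2 fun x hx => ?_).trans (subset_tsupport _)
    rw [Function.notMem_support] at hx
    simp [del, hx]
  obtain ⟨B1, hB1⟩ := hdelcs.exists_bound_of_continuous hdelc
  have hdp : Continuous (deriv (pol c₀)) :=
    ((differentiable_pol c₀).contDiff (n := 1)).continuous_deriv (by simp)
  obtain ⟨B2, hB2⟩ := (hcs.mul_right (f' := deriv (pol c₀))).exists_bound_of_continuous (hχ.continuous.mul hdp)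
  choose Q hQ using fun j => exists_norm_quotient_le hB (hloc j)
  set K : ℂ → ℂ := fun y => del χ y * pol c₀ y + χ y * deriv (pol c₀) y
      - A * pol c₀ y * ∑ j, (χ y - b j) / (y - a j) with hK
  have hKm : Measurable K := by
    have h1 := hdelc.measurable
    have h2 := (continuous_pol c₀).measurable
    have h3 := hdp.measurable
    have h4 := hχ.continuous.measurable
    fun_prop
  have hKb : ∀ y, ‖K y‖ ≤ (B1 * (∑ k, ‖c₀ k‖) + B2 + A * (∑ k, ‖c₀ k‖) * ∑ j, Q j) * (1 + ‖y‖) ^ n := by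
    intro y
    have e1 : (1 : ℝ) ≤ (1 + ‖y‖) ^ n := one_le_pow₀ (by linarith [norm_nonneg y])
    have p := norm_pol_le c₀ y
    have hB10 := (norm_nonneg _).trans (hB1 y)
    have hB20 := (norm_nonneg _).trans (hB2 y)
    have t1 : ‖del χ y * pol c₀ y‖ ≤ B1 * ((∑ k, ‖c₀ k‖) * (1 + ‖y‖) ^ n) := by
      rw [norm_mul]; have := hB1 y; gcongr
    have t2 : ‖χ y * deriv (pol c₀) y‖ ≤ B2 * (1 + ‖y‖) ^ n := by
      have : ‖χ y * deriv (pol c₀) y‖ ≤ B2 := hB2 y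
      nlinarith
    have t3 : ‖A * pol c₀ y * ∑ j, (χ y - b j) / (y - a j)‖ ≤
        A * ((∑ k, ‖c₀ k‖) * (1 + ‖y‖) ^ n) * ∑ j, Q j := by
      rw [norm_mul, norm_mul, Complex.norm_real, Real.norm_of_nonneg hA]
      have : ‖∑ j, (χ y - b j) / (y - a j)‖ ≤ ∑ j, Q j := norm_sum_le_of_le _ fun j _ => hQ j y
      gcongr
    calc ‖K y‖ ≤ _ := (norm_sub_le _ _).trans (add_le_add_left (norm_add_le _ _) _)
      _ ≤ _ := by linarith
  have hKL := memLp_of_le_one_add_pow ha hA hA1 hn hKm.aestronglyMeasurable hKb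
  set S : Set ℂ := Set.range a ∪ {z | pol c₀ z = 0} with hSdef
  have hS : S.Finite := (Set.finite_range a).union (finite_pol_eq_zero hc)
  have haS : Set.range a ⊆ S := Set.subset_union_left
  have hcS : {z | pol c₀ z = 0} ⊆ S := Set.subset_union_right
  obtain ⟨c₁, ψ, hψ, happ⟩ := exists_approx a hA hn2 hS ((Set.range_nonempty a).mono haS) haS hKL hη
  set v := shearCorrection a A c₀ ψ with hv
  have hvs := shearCorrection_contDiff a A c₀ hψ haS hcS
  have hvcs : HasCompactSupport v := by
    refine hψ.hasCompactSupport.mono' ?_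
    refine (Function.support_subset_iff'.2 fun x hx => ?_).trans (subset_tsupport _)
    rw [Function.notMem_support] at hx
    simp [hv, shearCorrection, hx]
  have hloc2 : ∀ j, ∀ᶠ y in nhds (a j), (fun y => χ y + v y) y = b j := fun j => by
    filter_upwards [hloc j, shearCorrection_eventually a A c₀ hψ (haS ⟨j, rfl⟩)] with y h1 h2
    simp [h1, hv, h2]
  obtain ⟨R, hR, C, hC, hmain⟩ := sum4_fiberNorm_le ha b hA hA1 hn (hχ.add hvs) (hcs.add hvcs) hloc2 c₀ c₁
  refine ⟨c₁, R, hR, C, hC, fun r hr hrR => (hmain r hr hrR).trans ?_⟩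
  gcongr
  refine le_trans (le_of_eq (lintegral_congr_ae ?_)) happ
  have hnull : ∀ᵐ y ∂(volume : Measure ℂ), y ∉ S := hS.measure_zero volume |> measure_eq_zero_iff_ae_notMem.1
  filter_upwards [hnull] with y hy
  have h1 := del_shearCorrection a A c₀ hψ haS hcS hS hy
  have h2 : del (fun y => χ y + v y) y = del χ y + del v y :=
    del_add (hχ.differentiable (by simp) y) (hvs.differentiable (by simp) y)
  have h3 : ∑ j, (χ y + v y - b j) / (y - a j) = ∑ j, (χ y - b j) / (y - a j) + ∑ j, v y / (y - a j) := by
    rw [← Finset.sum_add_distrib]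
    exact Finset.sum_congr rfl fun j _ => by ring
  have hw : (rootWt a A y : ℂ) ≠ 0 := by
    exact_mod_cast (rootWt_pos a A fun h => hy (haS h)).ne'
  congr 3
  change (pol c₁ y + del (fun y => χ y + v y) y * pol c₀ y + (χ y + v y) * deriv (pol c₀) y -
    A * pol c₀ y * ∑ j, (χ y + v y - b j) / (y - a j)) / _ = _
  rw [h2, h3, div_eq_iff hw, add_mul _ _ (rootWt a A y : ℂ), div_mul_cancel₀ _ hw, hK]
  linear_combination h1

end

section

variable {ι : Type*} [Fintype ι]

theorem fiberNorm_recenter (a b : ι → ℂ) (A : ℝ) {n : ℕ} (c : Fin (n + 1) → ℂ) (t τ : ℂ) :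
    fiberNorm (fun j => a j + b j * t) b A c τ = fiberNorm a b A c (t + τ) := by
  simp only [fiberNorm, mul_add, add_assoc]

theorem fiberNorm_smul (a b : ι → ℂ) (A : ℝ) {n : ℕ} (r : ℂ) (c : Fin (n + 1) → ℂ) (t : ℂ) :
    fiberNorm a b A (r • c) t = ENNReal.ofReal (‖r‖ ^ 2) * fiberNorm a b A c t := by
  rw [fiberNorm, fiberNorm, ← lintegral_const_mul' _ _ ENNReal.ofReal_ne_top]
  refine lintegral_congr fun x => ?_
  rw [← ENNReal.ofReal_mul (by positivity), pol_smul, mul_div_assoc, norm_mul, mul_pow]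

/-- The `k`-th Taylor coefficient at `x` of the polynomial with coefficients `c`. -/
def taylorCoeff {n : ℕ} (c : Fin (n + 1) → ℂ) (k : ℕ) (x : ℂ) : ℂ := (Polynomial.taylor x (toPoly c)).coeff k

theorem iteratedDeriv_pol {n : ℕ} (c : Fin (n + 1) → ℂ) (k : ℕ) (x : ℂ) :
    iteratedDeriv k (pol c) x = k.factorial * taylorCoeff c k x := by
  have h1 : pol c = fun z => (toPoly c).eval z := funext fun z => (eval_toPoly c z).symm
  have h2 : iteratedDeriv k (fun z => (toPoly c).eval z) = fun z => (Polynomial.derivative^[k] (toPoly c)).eval z := by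
    generalize toPoly c = p
    induction k generalizing p with
    | zero => simp
    | succ k ih =>
      rw [iteratedDeriv_succ', Function.iterate_succ_apply]
      rw [show deriv (fun z => p.eval z) = fun z => p.derivative.eval z from funext fun z => p.deriv]
      exact ih _
  rw [h1, h2, taylorCoeff, Polynomial.taylor_coeff, ← Polynomial.factorial_smul_hasseDeriv]
  simp

theorem exists_taylorCoeff_le (k : ℕ) : ∃ C > 0, ∀ {n : ℕ} (c : Fin (n + 1) → ℂ) (a b : ι → ℂ) {A : ℝ}, 0 ≤ A →
    ∀ (t x : ℂ) {ρ W : ℝ}, 0 < ρ → (∀ z ∈ Metric.ball x ρ, rootWt (fun j => a j + b j * t) A z ≤ W) →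
    ENNReal.ofReal (‖taylorCoeff c k x‖ ^ 2 * ρ ^ (2 * k + 2)) ≤ ENNReal.ofReal (C * W ^ 2) * fiberNorm a b A c t := by
  obtain ⟨C, hC, h⟩ := exists_norm_iteratedDeriv_sq_le k
  refine ⟨C, hC, fun {n} c a b A hA t x ρ W hρ hW => ?_⟩
  have h1 := h (pol c) x ρ hρ (differentiable_pol c).differentiableOn
  have hk : (1 : ℝ) ≤ k.factorial := by exact_mod_cast k.factorial_pos
  have hle : ‖taylorCoeff c k x‖ ≤ ‖iteratedDeriv k (pol c) x‖ := by
    rw [iteratedDeriv_pol, norm_mul, Complex.norm_natCast]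
    nlinarith [norm_nonneg (taylorCoeff c k x)]
  refine (ENNReal.ofReal_le_ofReal (show _ ≤ ‖iteratedDeriv k (pol c) x‖ ^ 2 * ρ ^ (2 * k + 2) by gcongr)).trans (h1.trans ?_)
  rw [ENNReal.ofReal_mul hC.le, mul_assoc]
  gcongr
  rw [fiberNorm, ← lintegral_const_mul' _ _ ENNReal.ofReal_ne_top]
  refine le_trans ?_ (setLIntegral_le_lintegral (Metric.ball x ρ) _)
  refine lintegral_mono_ae ?_
  have hnull : ∀ᵐ y ∂(volume : Measure ℂ), y ∉ Set.range (fun j => a j + b j * t) :=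
    measure_eq_zero_iff_ae_notMem.1 ((Set.finite_range _).measure_zero volume)
  filter_upwards [ae_restrict_of_ae hnull, ae_restrict_mem Metric.isOpen_ball.measurableSet] with y hy hyb
  rw [← ENNReal.ofReal_mul (by positivity)]
  refine ENNReal.ofReal_le_ofReal ?_
  have hw := rootWt_pos _ A hy
  rw [norm_div, Complex.norm_real, Real.norm_of_nonneg hw.le, div_pow, mul_div_assoc', le_div_iff₀ (by positivity), mul_comm]
  have := hW y hyb
  gcongr

theorem taylorCoeff_zero {n : ℕ} (c : Fin (n + 1) → ℂ) (k : Fin (n + 1)) : taylorCoeff c k 0 = c k := by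
  rw [taylorCoeff, Polynomial.taylor_zero, coeff_toPoly]

theorem exists_rootWt_le_ball (a : ι → ℂ) {A : ℝ} (hA : 0 ≤ A) (x : ℂ) (ρ : ℝ) :
    ∃ W, ∀ z ∈ Metric.ball x ρ, rootWt a A z ≤ W := by
  obtain ⟨W, hW⟩ := (isCompact_closedBall x ρ).exists_bound_of_continuousOn (continuous_rootWt a hA).continuousOn
  exact ⟨W, fun z hz => (le_abs_self _).trans (hW z (Metric.ball_subset_closedBall hz))⟩

theorem fiberNorm_pos (a b : ι → ℂ) {A : ℝ} (hA : 0 ≤ A) {n : ℕ} {c : Fin (n + 1) → ℂ} (hc : c ≠ 0) (t : ℂ) :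
    0 < fiberNorm a b A c t := by
  obtain ⟨k, hk⟩ := Function.ne_iff.1 hc
  obtain ⟨C, hC, h⟩ := exists_taylorCoeff_le (ι := ι) k
  obtain ⟨W, hW⟩ := exists_rootWt_le_ball (fun j => a j + b j * t) hA 0 1
  have h1 := h c a b hA t 0 one_pos hW
  rw [taylorCoeff_zero] at h1
  rw [pos_iff_ne_zero]
  intro h0
  rw [h0, mul_zero, nonpos_iff_eq_zero, ENNReal.ofReal_eq_zero] at h1
  have : 0 < ‖c k‖ := norm_pos_iff.2 hk
  have : 0 < ‖c k‖ ^ 2 * 1 ^ (2 * (k : ℕ) + 2) := by positivity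
  linarith

theorem fiberNorm_le_of_tendsto (a b : ι → ℂ) {A : ℝ} (hA : 0 ≤ A) {n : ℕ} {c : ℕ → Fin (n + 1) → ℂ} {t : ℕ → ℂ}
    {c₀ : Fin (n + 1) → ℂ} {t₀ : ℂ} (hc : Filter.Tendsto c Filter.atTop (nhds c₀))
    (ht : Filter.Tendsto t Filter.atTop (nhds t₀)) {q : ℕ → ENNReal} {q₀ : ENNReal}
    (hq : Filter.Tendsto q Filter.atTop (nhds q₀)) (h : ∀ k, fiberNorm a b A (c k) (t k) ≤ q k) :
    fiberNorm a b A c₀ t₀ ≤ q₀ := by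
  have hmeas : ∀ k, Measurable fun x => ENNReal.ofReal (‖pol (c k) x / rootWt (fun j => a j + b j * t k) A x‖ ^ 2) := fun k => by
    have h1 := (continuous_pol (c k)).measurable
    have h2 := (continuous_rootWt (fun j => a j + b j * t k) hA).measurable
    fun_prop
  have hnull : ∀ᵐ y ∂(volume : Measure ℂ), y ∉ Set.range (fun j => a j + b j * t₀) :=
    measure_eq_zero_iff_ae_notMem.1 ((Set.finite_range _).measure_zero volume)
  calc fiberNorm a b A c₀ t₀ ≤ ∫⁻ x, Filter.liminf (fun k => ENNReal.ofReal (‖pol (c k) x / rootWt (fun j => a j + b j * t k) A x‖ ^ 2)) Filter.atTop := by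
        refine lintegral_mono_ae ?_
        filter_upwards [hnull] with x hx
        refine le_of_eq (Filter.Tendsto.liminf_eq ?_).symm
        refine (ENNReal.continuous_ofReal.tendsto _).comp ((Filter.Tendsto.norm (Filter.Tendsto.div ?_ ?_ ?_)).pow 2)
        · simp only [pol]
          exact tendsto_finsetSum _ fun k _ => ((tendsto_pi_nhds.1 hc) k).mul tendsto_const_nhds
        · refine (Complex.continuous_ofReal.tendsto _).comp ?_
          simp only [rootWt]
          refine tendsto_finsetProd _ fun j _ => Filter.Tendsto.rpow_const ?_ (Or.inr hA)
          exact (tendsto_const_nhds.sub (tendsto_const_nhds.add (tendsto_const_nhds.mul ht))).norm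
        · exact_mod_cast (rootWt_pos _ A hx).ne'
    _ ≤ _ := lintegral_liminf_le hmeas
    _ ≤ Filter.liminf q Filter.atTop := Filter.liminf_le_liminf (Filter.Eventually.of_forall h)
    _ = q₀ := hq.liminf_eq

end

section

variable {ι : Type*} [Fintype ι]

set_option maxHeartbeats 1000000 in
theorem exists_maximizer (a b : ι → ℂ) {A : ℝ} (hA : 0 ≤ A) {n : ℕ} {T : Set ℂ} {s : ℂ → (Fin (n + 1) → ℂ) → ℂ}
    (hhom : ∀ t (r : ℂ) c, s t (r • c) = r * s t c)
    (hcont : ContinuousOn (fun q : ℂ × (Fin (n + 1) → ℂ) => s q.1 q.2) (Tᶜ ×ˢ Set.univ))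
    (hfin : ∀ t ∉ T, ∀ c : Fin (n + 1) → ℂ, fiberNorm a b A c t ≠ ⊤)
    {u w : ℂ → ℝ} {C : ℝ} (hC : 0 < C) (hu : ∀ t, 0 < u t)
    (hbd : ∀ t ∉ T, ∀ c, ‖s t c‖ ^ 2 * u t ≤ C * (fiberNorm a b A c t).toReal)
    (hw : Continuous w) (hwT : ∀ t ∈ T, w t = 0) (hwpos : ∀ t ∉ T, 0 < w t) (hucont : Continuous u)
    (hlim : Filter.Tendsto (fun t => w t / u t) (Filter.cocompact ℂ) (nhds 0))
    (hne : ∃ t ∉ T, ∃ c, s t c ≠ 0) :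
    ∃ M > 0, ∃ t₀ ∉ T, ∃ c₀ ≠ 0, (∀ t ∉ T, ∀ c, ‖s t c‖ ^ 2 * w t ≤ M * (fiberNorm a b A c t).toReal) ∧
      M * (fiberNorm a b A c₀ t₀).toReal ≤ ‖s t₀ c₀‖ ^ 2 * w t₀ := by
  set N : ℂ → (Fin (n + 1) → ℂ) → ℝ := fun t c => (fiberNorm a b A c t).toReal with hN
  have hNpos : ∀ t ∉ T, ∀ c ≠ 0, 0 < N t c := fun t ht c hc =>
    ENNReal.toReal_pos (fiberNorm_pos a b hA hc t).ne' (hfin t ht c)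
  set Ψ : ℂ × (Fin (n + 1) → ℂ) → ℝ := fun q => ‖s q.1 q.2‖ ^ 2 * w q.1 / N q.1 q.2 with hΨ
  set Y : Set (ℂ × (Fin (n + 1) → ℂ)) := {q | q.1 ∉ T ∧ ‖q.2‖ = 1} with hY
  have hv : Continuous fun t => w t / u t := hw.div hucont fun t => (hu t).ne'
  have hΨv : ∀ q ∈ Y, Ψ q ≤ C * (w q.1 / u q.1) := by
    rintro ⟨t, c⟩ ⟨ht, hc⟩
    have hc0 : c ≠ 0 := by rintro rfl; simp at hc
    have h1 := hbd t ht c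
    have h2 := hNpos t ht c hc0
    have h3 := hu t
    have h4 := hwpos t ht
    simp only [hΨ]
    rw [div_le_iff₀ h2, show C * (w t / u t) * N t c = (C * N t c) * w t / u t by ring, le_div_iff₀ h3]
    nlinarith
  obtain ⟨B, hB⟩ : ∃ B, ∀ t, w t / u t ≤ B := by
    have h1 := hlim.eventually (gt_mem_nhds one_pos)
    obtain ⟨K, hK, hKs⟩ := Filter.mem_cocompact.1 h1
    obtain ⟨B, hB⟩ := hK.exists_bound_of_continuousOn hv.continuousOn
    refine ⟨max B 1, fun t => ?_⟩
    by_cases ht : t ∈ K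
    · exact ((le_abs_self _).trans (hB t ht)).trans (le_max_left _ _)
    · exact (show w t / u t < 1 from hKs ht).le.trans (le_max_right _ _)
  have hbdd : BddAbove (Ψ '' Y) := by
    refine ⟨C * B, ?_⟩
    rintro _ ⟨q, hq, rfl⟩
    exact (hΨv q hq).trans (by have := hB q.1; gcongr)
  obtain ⟨t₁, ht₁, c₁, hs₁⟩ := hne
  have hc₁ : c₁ ≠ 0 := by
    rintro rfl
    exact hs₁ (by simpa using hhom t₁ 0 0)
  have hnorm : ∀ c : Fin (n + 1) → ℂ, c ≠ 0 → ‖((‖c‖⁻¹ : ℝ) : ℂ) • c‖ = 1 := fun c hc => by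
    rw [norm_smul, Complex.norm_real, norm_inv, norm_norm, inv_mul_cancel₀ (norm_ne_zero_iff.2 hc)]
  have hΨhom : ∀ t ∉ T, ∀ c ≠ 0, Ψ (t, ((‖c‖⁻¹ : ℝ) : ℂ) • c) = Ψ (t, c) := fun t ht c hc => by
    have h0 : 0 < ‖c‖ := norm_pos_iff.2 hc
    simp only [hΨ, hN, hhom, fiberNorm_smul, ENNReal.toReal_mul]
    rw [ENNReal.toReal_ofReal (by positivity), norm_mul, mul_pow, mul_assoc, mul_div_mul_left]
    have : ‖((‖c‖⁻¹ : ℝ) : ℂ)‖ ≠ 0 := by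
      rw [Complex.norm_real, norm_inv, norm_norm]; exact inv_ne_zero h0.ne'
    exact pow_ne_zero 2 this
  have hle : ∀ t ∉ T, ∀ c ≠ 0, Ψ (t, c) ≤ sSup (Ψ '' Y) := fun t ht c hc => by
    rw [← hΨhom t ht c hc]
    exact le_csSup hbdd ⟨_, ⟨ht, hnorm c hc⟩, rfl⟩
  set M := sSup (Ψ '' Y) with hM
  have hMpos : 0 < M := by
    refine lt_of_lt_of_le ?_ (hle t₁ ht₁ c₁ hc₁)
    have h1 := hNpos t₁ ht₁ c₁ hc₁
    have h2 := hwpos t₁ ht₁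
    have h3 := norm_pos_iff.2 hs₁
    simp only [hΨ]
    positivity
  obtain ⟨m, -, hm, hmem⟩ := exists_seq_tendsto_sSup (S := Ψ '' Y)
    ⟨_, (t₁, ((‖c₁‖⁻¹ : ℝ) : ℂ) • c₁), ⟨ht₁, hnorm c₁ hc₁⟩, rfl⟩ hbdd
  choose q hqY hqm using hmem
  set K : Set (ℂ × (Fin (n + 1) → ℂ)) := {t | M / (2 * C) ≤ w t / u t} ×ˢ Metric.sphere 0 1 with hK
  have hKc : IsCompact K := by
    refine IsCompact.prod ?_ (isCompact_sphere _ _)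
    have h1 := hlim.eventually (gt_mem_nhds (show 0 < M / (2 * C) by positivity))
    obtain ⟨K', hK', hKs⟩ := Filter.mem_cocompact.1 h1
    refine hK'.of_isClosed_subset (isClosed_le continuous_const hv) fun t ht => ?_
    by_contra h
    exact absurd (show w t / u t < _ from hKs h) (not_lt.2 ht)
  have hev : ∀ᶠ k in Filter.atTop, M / 2 < m k := hm.eventually (lt_mem_nhds (by linarith))
  have hqK : ∀ᶠ k in Filter.atTop, q k ∈ K := by
    filter_upwards [hev] with k hk
    refine ⟨?_, by simpa using (hqY k).2⟩
    have h1 := hΨv _ (hqY k)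
    rw [hqm k] at h1
    simp only [Set.mem_ofPred_eq]
    rw [div_le_iff₀ (by positivity)]
    linarith
  obtain ⟨⟨t₀, c₀⟩, hq₀, φ, hφ, hlimq⟩ := hKc.tendsto_subseq' hqK.frequently
  have ht₀ : t₀ ∉ T := fun h => by
    have h1 : M / (2 * C) ≤ w t₀ / u t₀ := hq₀.1
    rw [hwT t₀ h, zero_div] at h1
    exact absurd h1 (not_le.2 (by positivity))
  have hc₀ : c₀ ≠ 0 := by
    rintro rfl
    have := hq₀.2
    simp at this
  refine ⟨M, hMpos, t₀, ht₀, c₀, hc₀, fun t ht c => ?_, ?_⟩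
  · by_cases hc : c = 0
    · have h0 : s t 0 = 0 := by simpa using hhom t 0 0
      rw [hc, h0]; simp; positivity
    · have := hle t ht c hc
      simp only [hΨ] at this
      rwa [div_le_iff₀ (hNpos t ht c hc)] at this
  · have hs : Filter.Tendsto (fun k => s (q (φ k)).1 (q (φ k)).2) Filter.atTop (nhds (s t₀ c₀)) := by
      have h1 := hcont (t₀, c₀) ⟨ht₀, trivial⟩
      refine h1.tendsto.comp (tendsto_nhdsWithin_iff.2 ⟨hlimq, Filter.Eventually.of_forall fun k => ⟨(hqY _).1, trivial⟩⟩)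
    have htl : Filter.Tendsto (fun k => (q (φ k)).1) Filter.atTop (nhds t₀) := (continuous_fst.tendsto _).comp hlimq
    have hcl : Filter.Tendsto (fun k => (q (φ k)).2) Filter.atTop (nhds c₀) := (continuous_snd.tendsto _).comp hlimq
    have hnum : Filter.Tendsto (fun k => ENNReal.ofReal (‖s (q (φ k)).1 (q (φ k)).2‖ ^ 2 * w (q (φ k)).1 / m (φ k)))
        Filter.atTop (nhds (ENNReal.ofReal (‖s t₀ c₀‖ ^ 2 * w t₀ / M))) := by
      refine (ENNReal.continuous_ofReal.tendsto _).comp (Filter.Tendsto.div ?_ (hm.comp hφ.tendsto_atTop) hMpos.ne')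
      exact (hs.norm.pow 2).mul ((hw.tendsto _).comp htl)
    obtain ⟨k₀, hk₀⟩ := Filter.eventually_atTop.1 (hφ.tendsto_atTop.eventually hev)
    have hsh : Filter.Tendsto (fun k : ℕ => k + k₀) Filter.atTop Filter.atTop := Filter.tendsto_add_atTop_nat k₀
    have key := fiberNorm_le_of_tendsto a b hA (hcl.comp hsh) (htl.comp hsh) (hnum.comp hsh) fun k => by
      have h1 := hk₀ (k + k₀) (by omega)
      have hY1 := hqY (φ (k + k₀))
      have hcne : (q (φ (k + k₀))).2 ≠ 0 := fun h => by have := hY1.2; rw [h] at this; simp at this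
      have h2 : ‖s (q (φ (k + k₀))).1 (q (φ (k + k₀))).2‖ ^ 2 * w (q (φ (k + k₀))).1 / N (q (φ (k + k₀))).1 (q (φ (k + k₀))).2 = m (φ (k + k₀)) := hqm _
      have h3 := hNpos _ hY1.1 _ hcne
      rw [div_eq_iff h3.ne'] at h2
      simp only [Function.comp_apply]
      rw [h2, mul_div_cancel_left₀ _ (by linarith), hN, ENNReal.ofReal_toReal (hfin _ hY1.1 _)]
    have hnn : 0 ≤ ‖s t₀ c₀‖ ^ 2 * w t₀ / M := by
      have := hwpos t₀ ht₀
      positivity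
    have h5 := ENNReal.toReal_mono ENNReal.ofReal_ne_top key
    rw [ENNReal.toReal_ofReal hnn, le_div_iff₀ hMpos] at h5
    linarith

end

/-- A weight vanishing on `T` whose logarithm is strictly subharmonic elsewhere. -/
def baseWt (T : Finset ℂ) (δ η : ℝ) (t : ℂ) : ℝ := (1 + ‖t‖ ^ 2) ^ δ * ∏ t' ∈ T, ‖t - t'‖ ^ η

theorem continuous_baseWt (T : Finset ℂ) (δ : ℝ) {η : ℝ} (hη : 0 ≤ η) : Continuous (baseWt T δ η) := by
  unfold baseWt
  refine Continuous.mul (Continuous.rpow_const (by fun_prop) fun t => Or.inl (by positivity)) ?_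
  exact continuous_finsetProd _ fun t' _ => Continuous.rpow_const (by fun_prop) fun t => Or.inr hη

theorem baseWt_pos {T : Finset ℂ} (δ η : ℝ) {t : ℂ} (ht : t ∉ T) : 0 < baseWt T δ η t := by
  refine mul_pos (by positivity) (Finset.prod_pos fun t' ht' => Real.rpow_pos_of_pos (norm_pos_iff.2 (sub_ne_zero.2 ?_)) _)
  rintro rfl; exact ht ht'

theorem baseWt_eq_zero {T : Finset ℂ} (δ : ℝ) {η : ℝ} (hη : 0 < η) {t : ℂ} (ht : t ∈ T) : baseWt T δ η t = 0 := by
  rw [baseWt, Finset.prod_eq_zero ht, mul_zero]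
  simp [Real.zero_rpow hη.ne']

theorem one_add_le_rpow {x δ : ℝ} (hx : 0 ≤ x) (hx1 : x ≤ 1) (hδ : 0 ≤ δ) : 1 + δ * x / 2 ≤ (1 + x) ^ δ := by
  have h1 : x / 2 ≤ Real.log (1 + x) := by
    have := Real.one_sub_inv_le_log_of_pos (show 0 < 1 + x by linarith)
    refine le_trans ?_ this
    rw [show 1 - (1 + x)⁻¹ = x / (1 + x) by field_simp; ring]
    gcongr; linarith
  rw [Real.rpow_def_of_pos (by linarith)]
  have := Real.add_one_le_exp (Real.log (1 + x) * δ)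
  nlinarith

theorem norm_exp_log {z : ℂ} (hz : ‖z‖ ≤ 1 / 2) (η : ℝ) : ‖Complex.exp (η * Complex.log (1 + z))‖ = ‖1 + z‖ ^ η := by
  have : 0 < ‖1 + z‖ := by linarith [norm_one_add_ge_half hz]
  rw [Complex.norm_exp, Complex.re_ofReal_mul, Complex.log_re, Real.rpow_def_of_pos this, mul_comm]

theorem exists_baseWt_factor (T : Finset ℂ) {δ η : ℝ} (hδ : 0 < δ) {t₀ : ℂ} (ht₀ : t₀ ∉ T) :
    ∃ R > 0, ∃ c > 0, ∃ E : ℂ → ℂ, DifferentiableOn ℂ E (Metric.ball 0 R) ∧ E 0 = 1 ∧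
      ∀ τ ∈ Metric.ball (0 : ℂ) R, baseWt T δ η t₀ * ‖E τ‖ ^ 2 * (1 + c * ‖τ‖ ^ 2) ≤ baseWt T δ η (t₀ + τ) := by
  obtain ⟨ρ, hρ, hρT⟩ := Metric.isOpen_iff.1 (T.finite_toSet.isClosed.isOpen_compl) t₀ (by simpa using ht₀)
  have hdist : ∀ t' ∈ T, ρ ≤ ‖t₀ - t'‖ := fun t' ht' => by
    by_contra h
    have : t' ∈ Metric.ball t₀ ρ := by rw [Metric.mem_ball, dist_comm, dist_eq_norm]; linarith
    exact hρT this ht'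
  set L : ℝ := 1 + ‖t₀‖ ^ 2 with hL
  have hL1 : 1 ≤ L := by rw [hL]; nlinarith [norm_nonneg t₀]
  set k : ℂ := (starRingEnd ℂ) t₀ / L with hk
  have hkn : ‖k‖ ≤ 1 / 2 := by
    rw [hk, norm_div, RCLike.norm_conj, Complex.norm_real, Real.norm_of_nonneg (by linarith), div_le_iff₀ (by linarith)]
    nlinarith [sq_nonneg (‖t₀‖ - 1)]
  set R : ℝ := min 1 (ρ / 2) with hR
  have hRpos : 0 < R := lt_min one_pos (by linarith)
  have hz : ∀ τ ∈ Metric.ball (0 : ℂ) R, ‖k * τ‖ ≤ 1 / 2 ∧ ∀ t' ∈ T, ‖τ / (t₀ - t')‖ ≤ 1 / 2 := by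
    intro τ hτ
    rw [mem_ball_zero_iff] at hτ
    have h1 := hτ.le.trans (min_le_left _ _)
    have h2 := hτ.le.trans (min_le_right _ _)
    refine ⟨by rw [norm_mul]; nlinarith [norm_nonneg τ, norm_nonneg k], fun t' ht' => ?_⟩
    have h3 := hdist t' ht'
    rw [norm_div, div_le_iff₀ (by linarith)]
    linarith
  set E : ℂ → ℂ := fun τ => Complex.exp (δ * Complex.log (1 + k * τ)) *
    ∏ t' ∈ T, Complex.exp ((η / 2 : ℝ) * Complex.log (1 + τ / (t₀ - t'))) with hE
  refine ⟨R, hRpos, δ / (8 * L ^ 2), by positivity, E, ?_, by simp [hE], ?_⟩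
  · intro τ hτ
    obtain ⟨h1, h2⟩ := hz τ hτ
    refine DifferentiableAt.differentiableWithinAt (DifferentiableAt.mul ?_ ?_)
    · exact (((differentiableAt_id.const_mul k).const_add 1).clog (one_add_mem_slitPlane' h1)).const_mul _ |>.cexp
    · refine DifferentiableAt.fun_finsetProd fun t' ht' => ?_
      exact ((DifferentiableAt.clog (f := fun τ => 1 + τ / (t₀ - t')) (by fun_prop)
        (one_add_mem_slitPlane' (h2 t' ht'))).const_mul _).cexp
  · intro τ hτ
    obtain ⟨h1, h2⟩ := hz τ hτ
    have hp : ∏ t' ∈ T, ‖t₀ + τ - t'‖ ^ η = (∏ t' ∈ T, ‖t₀ - t'‖ ^ η) *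
        ‖∏ t' ∈ T, Complex.exp ((η / 2 : ℝ) * Complex.log (1 + τ / (t₀ - t')))‖ ^ 2 := by
      rw [norm_prod, ← Finset.prod_pow, ← Finset.prod_mul_distrib]
      refine Finset.prod_congr rfl fun t' ht' => ?_
      have h3 := hdist t' ht'
      have h4 : t₀ - t' ≠ 0 := norm_pos_iff.1 (by linarith)
      rw [norm_exp_log (h2 t' ht'), ← Real.rpow_natCast, ← Real.rpow_mul (norm_nonneg _),
        show η / 2 * ((2 : ℕ) : ℝ) = η by push_cast; ring, ← Real.mul_rpow (norm_nonneg _) (norm_nonneg _), ← norm_mul]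
      congr 2
      field_simp
      ring
    have hnn := norm_one_add_ge_half h1
    have hn2 : ‖1 + k * τ‖ ≤ 2 := by
      have := norm_add_le 1 (k * τ)
      rw [norm_one] at this; linarith
    have hid : 1 + ‖t₀ + τ‖ ^ 2 = L * (‖1 + k * τ‖ ^ 2 + ‖τ‖ ^ 2 / L ^ 2) := by
      have hLc : L = 1 + (t₀.re * t₀.re + t₀.im * t₀.im) := by rw [hL, Complex.sq_norm, Complex.normSq_apply]
      have h5 : 1 + k * τ = ((L : ℂ) + (starRingEnd ℂ) t₀ * τ) / L := by
        rw [hk]; have : (L : ℂ) ≠ 0 := by exact_mod_cast (by linarith : L ≠ 0)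
        field_simp
      rw [h5, norm_div, Complex.norm_real, Real.norm_of_nonneg (by linarith), div_pow]
      have hL0 : L ≠ 0 := by linarith
      field_simp
      simp only [Complex.sq_norm, Complex.normSq_apply, Complex.add_re, Complex.add_im, Complex.mul_re, Complex.mul_im,
        Complex.ofReal_re, Complex.ofReal_im, Complex.conj_re, Complex.conj_im]
      rw [hLc]; ring
    have hbase : L * ‖1 + k * τ‖ ^ 2 * (1 + ‖τ‖ ^ 2 / (4 * L ^ 2)) ≤ 1 + ‖t₀ + τ‖ ^ 2 := by
      rw [hid, mul_assoc, mul_add, mul_one]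
      gcongr
      rw [mul_div_assoc', div_le_div_iff₀ (by positivity) (by positivity)]
      have : ‖1 + k * τ‖ ^ 2 ≤ 4 := by nlinarith
      nlinarith [mul_nonneg (sq_nonneg ‖τ‖) (sq_nonneg L)]
    have hτ1 : ‖τ‖ ≤ 1 := by rw [mem_ball_zero_iff] at hτ; exact hτ.le.trans (min_le_left _ _)
    have hx1 : ‖τ‖ ^ 2 / (4 * L ^ 2) ≤ 1 := by
      rw [div_le_one (by positivity)]; nlinarith [norm_nonneg τ]
    have hδ2 := one_add_le_rpow (by positivity) hx1 hδ.le
    have hfin := Real.rpow_le_rpow (by positivity) hbase hδ.le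
    rw [Real.mul_rpow (by positivity) (by positivity), Real.mul_rpow (by positivity) (by positivity)] at hfin
    have hsq : (‖1 + k * τ‖ ^ 2) ^ δ = (‖1 + k * τ‖ ^ δ) ^ 2 := by
      rw [← Real.rpow_natCast, ← Real.rpow_natCast, ← Real.rpow_mul (norm_nonneg _), ← Real.rpow_mul (norm_nonneg _), mul_comm δ]
    rw [baseWt, baseWt, hp, hE]
    simp only [norm_mul]
    rw [norm_exp_log h1, mul_pow, ← hsq]
    have hcomb : L ^ δ * (‖1 + k * τ‖ ^ 2) ^ δ * (1 + δ / (8 * L ^ 2) * ‖τ‖ ^ 2) ≤ (1 + ‖t₀ + τ‖ ^ 2) ^ δ := by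
      refine le_trans ?_ hfin
      gcongr
      refine le_trans (le_of_eq ?_) hδ2
      field_simp
      ring
    set P := ∏ t' ∈ T, ‖t₀ - t'‖ ^ η
    set Q := ‖∏ t' ∈ T, Complex.exp ((η / 2 : ℝ) * Complex.log (1 + τ / (t₀ - t')))‖ ^ 2
    have hP : 0 ≤ P := Finset.prod_nonneg fun _ _ => by positivity
    have hQ : 0 ≤ Q := by positivity
    calc L ^ δ * P * ((‖1 + k * τ‖ ^ 2) ^ δ * Q) * (1 + δ / (8 * L ^ 2) * ‖τ‖ ^ 2)
        = L ^ δ * (‖1 + k * τ‖ ^ 2) ^ δ * (1 + δ / (8 * L ^ 2) * ‖τ‖ ^ 2) * (P * Q) := by ring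
      _ ≤ _ := by gcongr

theorem tendsto_baseWt_div (T : Finset ℂ) {κ : ℝ} (hκ : 0 < κ) :
    Filter.Tendsto (fun t => baseWt T (κ / 2) (κ / (2 * (T.card + 1))) t / (1 + ‖t‖ ^ 2) ^ κ) (Filter.cocompact ℂ) (nhds 0) := by
  set η := κ / (2 * ((T.card : ℝ) + 1)) with hη
  have hη0 : 0 < η := by positivity
  have hηc : η * T.card ≤ κ / 2 := by
    rw [hη, div_mul_eq_mul_div, div_le_div_iff₀ (by positivity) (by positivity)]
    nlinarith
  have hf : ∀ t' t : ℂ, ‖t - t'‖ ^ η ≤ (2 * (1 + ‖t'‖)) ^ η * (1 + ‖t‖ ^ 2) ^ (η / 2) := by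
    intro t' t
    have h1 : ‖t - t'‖ ≤ 2 * (1 + ‖t'‖) * (1 + ‖t‖ ^ 2) ^ (1 / 2 : ℝ) := by
      have h2 : ‖t‖ ≤ (1 + ‖t‖ ^ 2) ^ (1 / 2 : ℝ) := by
        rw [← Real.sqrt_eq_rpow]; exact Real.le_sqrt_of_sq_le (by linarith)
      have h3 : 1 ≤ (1 + ‖t‖ ^ 2) ^ (1 / 2 : ℝ) := Real.one_le_rpow (by nlinarith [norm_nonneg t]) (by norm_num)
      have := norm_sub_le t t'
      nlinarith [norm_nonneg t']
    calc ‖t - t'‖ ^ η ≤ (2 * (1 + ‖t'‖) * (1 + ‖t‖ ^ 2) ^ (1 / 2 : ℝ)) ^ η := by gcongr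
      _ = _ := by rw [Real.mul_rpow (by positivity) (by positivity), ← Real.rpow_mul (by positivity)]; congr 2; ring
  have hprod : ∀ t : ℂ, ∏ t' ∈ T, ‖t - t'‖ ^ η ≤ (∏ t' ∈ T, (2 * (1 + ‖t'‖)) ^ η) * (1 + ‖t‖ ^ 2) ^ (κ / 4) := by
    intro t
    refine (Finset.prod_le_prod (fun _ _ => by positivity) fun t' _ => hf t' t).trans ?_
    rw [Finset.prod_mul_distrib, Finset.prod_const, ← Real.rpow_natCast ((1 + ‖t‖ ^ 2) ^ (η / 2)), ← Real.rpow_mul (by positivity)]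
    gcongr
    · nlinarith [norm_nonneg t]
    · linarith
  set B := ∏ t' ∈ T, (2 * (1 + ‖t'‖)) ^ η with hB
  have hlim : Filter.Tendsto (fun t : ℂ => B * (1 + ‖t‖ ^ 2) ^ (-(κ / 4))) (Filter.cocompact ℂ) (nhds 0) := by
    rw [show (0 : ℝ) = B * 0 by ring]
    refine Filter.Tendsto.const_mul _ ((tendsto_rpow_neg_atTop (by positivity)).comp ?_)
    refine Filter.tendsto_atTop_add_const_left _ _ ?_
    exact (Filter.tendsto_pow_atTop two_ne_zero).comp (tendsto_norm_cocompact_atTop (E := ℂ))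
  refine squeeze_zero (fun t => div_nonneg (mul_nonneg (by positivity) (Finset.prod_nonneg fun _ _ => by positivity)) (by positivity)) (fun t => ?_) hlim
  rw [div_le_iff₀ (by positivity), baseWt, mul_assoc, ← Real.rpow_add (by positivity)]
  calc (1 + ‖t‖ ^ 2) ^ (κ / 2) * ∏ t' ∈ T, ‖t - t'‖ ^ η ≤ (1 + ‖t‖ ^ 2) ^ (κ / 2) * (B * (1 + ‖t‖ ^ 2) ^ (κ / 4)) := by
        have := hprod t
        gcongr
    _ = _ := by
      rw [mul_left_comm, ← Real.rpow_add (by positivity)]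
      congr 2; ring

section

variable {ι : Type*} [Fintype ι]

theorem fiberNorm_ne_top (a b : ι → ℂ) {A : ℝ} (hA : 0 ≤ A) (hA1 : A < 1) {n : ℕ} (hn : n + 1 < A * Fintype.card ι)
    {t : ℂ} (ht : Function.Injective fun j => a j + b j * t) (c : Fin (n + 1) → ℂ) : fiberNorm a b A c t ≠ ⊤ :=
  lintegral_ne_top_of_memLp_two (memLp_pol_div_rootWt ht hA hA1 hn c)

set_option maxHeartbeats 1000000 in
theorem eq_zero_of_fiberNorm_bound [Nonempty ι] (a b : ι → ℂ) {A : ℝ} (hA : 0 ≤ A) (hA1 : A < 1) {n : ℕ}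
    (hn : n + 1 < A * Fintype.card ι) (hn2 : A * Fintype.card ι < n + 2) {T : Finset ℂ}
    (hinj : ∀ t ∉ T, Function.Injective fun j => a j + b j * t) {s : ℂ → (Fin (n + 1) → ℂ) → ℂ}
    (hhom : ∀ t (r : ℂ) c, s t (r • c) = r * s t c)
    (hcont : ContinuousOn (fun q : ℂ × (Fin (n + 1) → ℂ) => s q.1 q.2) ((T : Set ℂ)ᶜ ×ˢ Set.univ))
    (hhol : ∀ t₀ ∉ T, ∀ c₀ c₁, ∃ R > 0, DifferentiableOn ℂ (fun τ => s (t₀ + τ) (c₀ + τ • c₁)) (Metric.ball 0 R))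
    {κ C : ℝ} (hκ : 0 < κ) (hC : 0 < C)
    (hbd : ∀ t ∉ T, ∀ c, ‖s t c‖ ^ 2 * (1 + ‖t‖ ^ 2) ^ κ ≤ C * (fiberNorm a b A c t).toReal) :
    ∀ t ∉ T, ∀ c, s t c = 0 := by
  by_contra! hne
  set δ := κ / 2 with hδ
  set η := κ / (2 * (T.card + 1)) with hη
  have hδ0 : 0 < δ := by positivity
  have hη0 : 0 < η := by positivity
  have hfin : ∀ t ∉ T, ∀ c : Fin (n + 1) → ℂ, fiberNorm a b A c t ≠ ⊤ := fun t ht c =>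
    fiberNorm_ne_top a b hA hA1 hn (hinj t ht) c
  obtain ⟨M, hM, t₀, ht₀, c₀, hc₀, hmax, hmax0⟩ := exists_maximizer a b hA (T := (T : Set ℂ)) (s := s)
    (u := fun t => (1 + ‖t‖ ^ 2) ^ κ) (w := baseWt T δ η) hhom hcont hfin hC (fun t => by positivity) hbd
    (continuous_baseWt T δ hη0.le) (fun t ht => baseWt_eq_zero δ hη0 ht) (fun t ht => baseWt_pos δ η ht)
    (Continuous.rpow_const (by fun_prop) fun t => Or.inl (by positivity)) (tendsto_baseWt_div T hκ) hne
  obtain ⟨R₁, hR₁, c, hc, E, hE, hE0, hEle⟩ := exists_baseWt_factor T (η := η) hδ0 ht₀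
  set w₀ := baseWt T δ η t₀ with hw₀
  have hw₀pos : 0 < w₀ := baseWt_pos δ η ht₀
  set F₀ := (fiberNorm a b A c₀ t₀).toReal with hF₀
  have hF₀pos : 0 < F₀ := ENNReal.toReal_pos (fiberNorm_pos a b hA hc₀ t₀).ne' (hfin t₀ ht₀ c₀)
  set S₀ := ‖s t₀ c₀‖ ^ 2 with hS₀
  have hS₀pos : 0 < S₀ * w₀ := lt_of_lt_of_le (by positivity) hmax0
  obtain ⟨c₁, R₂, hR₂, C₂, hC₂, hvar⟩ := exists_variation (hinj t₀ ht₀) b hA hA1 hn hn2 hc₀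
    (η := c * (S₀ * w₀) / (2 * M)) (by positivity)
  obtain ⟨R₃, hR₃, hs⟩ := hhol t₀ ht₀ c₀ c₁
  obtain ⟨R₄, hR₄, hT⟩ := Metric.isOpen_iff.1 (T.finite_toSet.isClosed.isOpen_compl) t₀ (by simpa using ht₀)
  set R := min (min R₁ R₂) (min R₃ R₄) / 2 with hR
  have hRpos : 0 < R := by rw [hR]; have := lt_min (lt_min hR₁ hR₂) (lt_min hR₃ hR₄); linarith
  have hRlt : R < R₁ ∧ R < R₂ ∧ R < R₃ ∧ R < R₄ := by
    have h1 := min_le_left (min R₁ R₂) (min R₃ R₄)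
    have h2 := min_le_right (min R₁ R₂) (min R₃ R₄)
    have h3 := min_le_left R₁ R₂
    have h4 := min_le_right R₁ R₂
    have h5 := min_le_left R₃ R₄
    have h6 := min_le_right R₃ R₄
    refine ⟨?_, ?_, ?_, ?_⟩ <;> linarith
  set H : ℂ → ℂ := fun τ => s (t₀ + τ) (c₀ + τ • c₁) * E τ with hH
  have hHd : DifferentiableOn ℂ H (Metric.closedBall 0 R) :=
    (hs.mono (Metric.closedBall_subset_ball hRlt.2.2.1)).mul (hE.mono (Metric.closedBall_subset_ball hRlt.1))
  obtain ⟨B, hB⟩ := (isCompact_closedBall (0 : ℂ) R).exists_bound_of_continuousOn hHd.continuousOn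
  have hsum : ∀ r, 0 < r → r < R → |sum4 (fun τ => ‖H τ‖ ^ 2) r - 4 * (‖H 0‖ ^ 2 + r ^ 2 * ‖deriv H 0‖ ^ 2)| ≤ 1000 / R ^ 3 * B ^ 2 * r ^ 3 :=
    fun r hr hrR => abs_sum4_norm_sq_sub_le hRpos (hHd.mono Metric.ball_subset_closedBall)
      (fun z hz => hB z (Metric.ball_subset_closedBall hz)) hr.le hrR
  set K := 1000 / R ^ 3 * B ^ 2 with hK
  have hK0 : 0 ≤ K := by positivity
  have hH0 : ‖H 0‖ ^ 2 = S₀ := by simp [hH, hE0, hS₀]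
  have hpt : ∀ τ : ℂ, ‖τ‖ < R → w₀ * (1 + c * ‖τ‖ ^ 2) * ‖H τ‖ ^ 2 ≤ M * (fiberNorm a b A (c₀ + τ • c₁) (t₀ + τ)).toReal := by
    intro τ hτ
    have h1 : t₀ + τ ∉ T := fun h => hT (show t₀ + τ ∈ Metric.ball t₀ R₄ by simpa using hτ.trans hRlt.2.2.2) h
    refine le_trans ?_ (hmax _ h1 _)
    have h2 := hEle τ (by simpa using hτ.trans hRlt.1)
    calc w₀ * (1 + c * ‖τ‖ ^ 2) * ‖H τ‖ ^ 2 = ‖s (t₀ + τ) (c₀ + τ • c₁)‖ ^ 2 * (w₀ * ‖E τ‖ ^ 2 * (1 + c * ‖τ‖ ^ 2)) := by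
          rw [hH, norm_mul]; ring
      _ ≤ _ := by gcongr
  have hmain : ∀ r, 0 < r → r < R → w₀ * (1 + c * r ^ 2) * (4 * S₀ - K * r ^ 3) ≤
      4 * (S₀ * w₀) + 2 * c * (S₀ * w₀) * r ^ 2 + M * C₂ * r ^ 3 := by
    intro r hr hrR
    have hv := hvar r hr (hrR.trans hRlt.2.1)
    simp only [fiberNorm_recenter, add_zero] at hv
    have hv' := ENNReal.toReal_mono (by
      refine ENNReal.add_ne_top.2 ⟨ENNReal.add_ne_top.2 ⟨ENNReal.mul_ne_top (by simp) (hfin t₀ ht₀ c₀),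
        ENNReal.mul_ne_top ENNReal.ofReal_ne_top ENNReal.ofReal_ne_top⟩, ENNReal.ofReal_ne_top⟩) hv
    have hnt : ∀ τ : ℂ, ‖τ‖ < R → fiberNorm a b A (c₀ + τ • c₁) (t₀ + τ) ≠ ⊤ := fun τ hτ =>
      hfin _ (fun h => hT (show t₀ + τ ∈ Metric.ball t₀ R₄ by simpa using hτ.trans hRlt.2.2.2) h) _
    have e1 : ‖(r : ℂ)‖ = r := by simp [abs_of_pos hr]
    have e2 : ‖(r : ℂ) * Complex.I‖ = r := by simp [abs_of_pos hr]
    have e3 : ‖-(r : ℂ)‖ = r := by simp [abs_of_pos hr]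
    have e4 : ‖-((r : ℂ) * Complex.I)‖ = r := by simp [abs_of_pos hr]
    have n1 := hnt r (by rwa [e1])
    have n2 := hnt (r * Complex.I) (by rwa [e2])
    have n3 := hnt (-r) (by rwa [e3])
    have n4 := hnt (-(r * Complex.I)) (by rwa [e4])
    simp only [sum4] at hv'
    rw [ENNReal.toReal_add (by finiteness) n4, ENNReal.toReal_add (by finiteness) n3, ENNReal.toReal_add n1 n2,
      ENNReal.toReal_add (by
        refine ENNReal.add_ne_top.2 ⟨ENNReal.mul_ne_top (by simp) (hfin t₀ ht₀ c₀),
          ENNReal.mul_ne_top ENNReal.ofReal_ne_top ENNReal.ofReal_ne_top⟩) ENNReal.ofReal_ne_top,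
      ENNReal.toReal_add (ENNReal.mul_ne_top (by simp) (hfin t₀ ht₀ c₀))
        (ENNReal.mul_ne_top ENNReal.ofReal_ne_top ENNReal.ofReal_ne_top), ENNReal.toReal_mul, ENNReal.toReal_mul,
      ENNReal.toReal_ofReal (by positivity), ENNReal.toReal_ofReal (by positivity), ENNReal.toReal_ofReal (by positivity),
      ← hF₀] at hv'
    have h4 : (4 : ENNReal).toReal = 4 := by simp
    rw [h4] at hv'
    have p1 := hpt r (by rwa [e1])
    have p2 := hpt (r * Complex.I) (by rwa [e2])
    have p3 := hpt (-r) (by rwa [e3])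
    have p4 := hpt (-(r * Complex.I)) (by rwa [e4])
    rw [e1] at p1
    rw [e2] at p2
    rw [e3] at p3
    rw [e4] at p4
    have hlow := (abs_le.1 (hsum r hr hrR)).1
    simp only [sum4, hH0] at hlow
    have hd : 0 ≤ r ^ 2 * ‖deriv H 0‖ ^ 2 := by positivity
    have hlow2 : 4 * S₀ - K * r ^ 3 ≤ ‖H r‖ ^ 2 + ‖H (r * Complex.I)‖ ^ 2 + ‖H (-r)‖ ^ 2 + ‖H (-(r * Complex.I))‖ ^ 2 := by linarith
    have hpos : 0 ≤ w₀ * (1 + c * r ^ 2) := by positivity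
    have h5 := mul_le_mul_of_nonneg_left hlow2 hpos
    have h6 := mul_le_mul_of_nonneg_left hv' hM.le
    rw [mul_add, mul_add, mul_add] at h5
    rw [mul_add, mul_add, mul_add, mul_add, mul_add] at h6
    have h7 : M * (4 * r ^ 2 * (c * (S₀ * w₀) / (2 * M))) = 2 * c * (S₀ * w₀) * r ^ 2 := by field_simp; ring
    rw [h7] at h6
    have h8 : M * (4 * F₀) = 4 * (M * F₀) := by ring
    have h9 : M * (C₂ * r ^ 3) = M * C₂ * r ^ 3 := by ring
    have h10 : 4 * (M * F₀) ≤ 4 * (S₀ * w₀) := by linarith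
    rw [h8, h9] at h6
    linarith
  have hfinal : ∀ r, 0 < r → r < min R 1 → 2 * c * (S₀ * w₀) ≤ (M * C₂ + w₀ * (1 + c) * K) * r := by
    intro r hr hrR
    have h1 := hmain r hr (hrR.trans_le (min_le_left _ _))
    have hr1 : r < 1 := hrR.trans_le (min_le_right _ _)
    have h2 : w₀ * (1 + c * r ^ 2) * (K * r ^ 3) ≤ w₀ * (1 + c) * K * r ^ 3 := by
      have hr2 : r ^ 2 ≤ 1 := by nlinarith
      have hcr : c * r ^ 2 ≤ c := mul_le_of_le_one_right hc.le hr2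
      have : w₀ * (1 + c * r ^ 2) ≤ w₀ * (1 + c) := by gcongr
      calc _ ≤ w₀ * (1 + c) * (K * r ^ 3) := by gcongr
        _ = _ := by ring
    have h3 : 2 * c * (S₀ * w₀) * r ^ 2 ≤ (M * C₂ + w₀ * (1 + c) * K) * r * r ^ 2 := by nlinarith
    exact le_of_mul_le_mul_right h3 (by positivity)
  set L := M * C₂ + w₀ * (1 + c) * K with hL
  have hL0 : 0 ≤ L := by positivity
  set r := min (min R 1 / 2) (c * (S₀ * w₀) / (L + 1)) with hr
  have hRm : 0 < min R 1 := lt_min hRpos one_pos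
  have hr0 : 0 < r := lt_min (by linarith) (by positivity)
  have h1 := hfinal r hr0 ((min_le_left _ _).trans_lt (by linarith))
  have h2 : r ≤ c * (S₀ * w₀) / (L + 1) := min_le_right _ _
  rw [le_div_iff₀ (by positivity)] at h2
  have h3 : 0 < c * (S₀ * w₀) := by positivity
  nlinarith

end

theorem taylorCoeff_eq_sum {n : ℕ} (c : Fin (n + 1) → ℂ) (k : ℕ) (x : ℂ) :
    taylorCoeff c k x = ∑ k' : Fin (n + 1), c k' * (((k' : ℕ).choose k : ℂ) * x ^ ((k' : ℕ) - k)) := by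
  rw [taylorCoeff, Polynomial.taylor_coeff, toPoly, map_sum, Polynomial.eval_finsetSum]
  refine Finset.sum_congr rfl fun k' _ => ?_
  rw [Polynomial.hasseDeriv_monomial, Polynomial.eval_monomial]
  ring

theorem choose_mul_pow_succ (q : ℂ) (J l : ℕ) :
    ((J + 1).choose (l + 1) : ℂ) * q ^ (J + 1 - (l + 1)) =
      q * ((J.choose (l + 1) : ℂ) * q ^ (J - (l + 1))) + (J.choose l : ℂ) * q ^ (J - l) := by
  rw [Nat.choose_succ_succ, Nat.add_sub_add_right]
  rcases lt_or_ge l J with h | h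
  · obtain ⟨r, rfl⟩ := Nat.exists_eq_add_of_lt h
    rw [show l + r + 1 - l = r + 1 by omega, show l + r + 1 - (l + 1) = r by omega]
    push_cast
    ring
  · rw [Nat.choose_eq_zero_of_lt (by omega : J < l + 1)]
    push_cast
    ring

/-- The principal part of `t ^ J * v ^ (l + 1)` in powers of `v = (t - q)⁻¹`. -/
def principalPart (q v : ℂ) (J l : ℕ) : ℂ :=
  ∑ l' ∈ Finset.range (l + 1), ((J.choose l' : ℂ) * q ^ (J - l')) * v ^ (l - l' + 1)

theorem principalPart_succ (q v : ℂ) (J l : ℕ) :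
    principalPart q v J (l + 1) = v * principalPart q v J l + ((J.choose (l + 1) : ℂ) * q ^ (J - (l + 1))) * v := by
  rw [principalPart, Finset.sum_range_succ, principalPart, Finset.mul_sum]
  congr 1
  · refine Finset.sum_congr rfl fun l' hl' => ?_
    rw [Finset.mem_range] at hl'
    rw [show l + 1 - l' = l - l' + 1 by omega]
    ring
  · simp

theorem mul_principalPart {t q v : ℂ} (h : t * v = 1 + q * v) (J l : ℕ) :
    t * principalPart q v J l = principalPart q v (J + 1) l + (J.choose l : ℂ) * q ^ (J - l) := by
  induction l with
  | zero =>
    simp only [principalPart, zero_add, Finset.sum_range_one, Nat.choose_zero_right, Nat.cast_one, tsub_zero]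
    linear_combination q ^ J * h
  | succ l ih =>
    rw [principalPart_succ, principalPart_succ, choose_mul_pow_succ]
    linear_combination v * ih + ((J.choose (l + 1) : ℂ) * q ^ (J - (l + 1))) * h

theorem pow_mul_inv_pow_eq {t q v : ℂ} (h : t * v = 1 + q * v) (J l : ℕ) :
    t ^ J * v ^ (l + 1) =
      ∑ j ∈ Finset.range J, ((j.choose l : ℂ) * q ^ (j - l)) * t ^ (J - 1 - j) + principalPart q v J l := by
  induction J with
  | zero =>
    rw [Finset.range_zero, Finset.sum_empty, zero_add, principalPart, Finset.sum_eq_single 0]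
    · simp
    · intro b _ h0
      rw [Nat.choose_eq_zero_of_lt (Nat.pos_of_ne_zero h0)]
      simp
    · simp
  | succ J ih =>
    rw [pow_succ', mul_assoc, ih, mul_add, mul_principalPart h, Finset.sum_range_succ, Finset.mul_sum]
    have : ∑ j ∈ Finset.range J, t * (((j.choose l : ℂ) * q ^ (j - l)) * t ^ (J - 1 - j)) =
        ∑ j ∈ Finset.range J, ((j.choose l : ℂ) * q ^ (j - l)) * t ^ (J + 1 - 1 - j) := by
      refine Finset.sum_congr rfl fun j hj => ?_
      rw [Finset.mem_range] at hj
      rw [show J + 1 - 1 - j = J - 1 - j + 1 by omega]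
      ring
    rw [this]
    simp only [Nat.add_sub_cancel, Nat.sub_self, pow_zero, mul_one]
    ring

theorem exists_principalPart_le (q : ℂ) (J l : ℕ) :
    ∃ C > 0, ∀ t : ℂ, 2 * ‖q‖ + 2 ≤ ‖t‖ → ‖principalPart q (t - q)⁻¹ J l‖ * ‖t‖ ≤ C := by
  refine ⟨1 + ∑ l' ∈ Finset.range (l + 1), ‖(J.choose l' : ℂ) * q ^ (J - l')‖ * 2, by positivity, fun t ht => ?_⟩
  have hq := norm_nonneg q
  have h1 : ‖t‖ / 2 ≤ ‖t - q‖ := by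
    have := norm_sub_norm_le t q
    linarith
  have h2 : 1 ≤ ‖t - q‖ := by linarith
  have hpos : 0 < ‖t - q‖ := by linarith
  have hv1 : ‖(t - q)⁻¹‖ ≤ 1 := by rw [norm_inv]; exact inv_le_one_of_one_le₀ h2
  have hv2 : ‖(t - q)⁻¹‖ * ‖t‖ ≤ 2 := by
    rw [norm_inv, inv_mul_le_iff₀ hpos]
    linarith
  calc ‖principalPart q (t - q)⁻¹ J l‖ * ‖t‖
      ≤ (∑ l' ∈ Finset.range (l + 1), ‖(J.choose l' : ℂ) * q ^ (J - l')‖ * ‖(t - q)⁻¹‖) * ‖t‖ := by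
        refine mul_le_mul_of_nonneg_right ((norm_sum_le _ _).trans (Finset.sum_le_sum fun l' _ => ?_)) (norm_nonneg t)
        rw [norm_mul, norm_pow]
        refine mul_le_mul_of_nonneg_left ?_ (norm_nonneg _)
        rw [pow_succ]
        exact mul_le_of_le_one_left (norm_nonneg _) (pow_le_one₀ (norm_nonneg _) hv1)
    _ = ∑ l' ∈ Finset.range (l + 1), ‖(J.choose l' : ℂ) * q ^ (J - l')‖ * (‖(t - q)⁻¹‖ * ‖t‖) := by
        rw [Finset.sum_mul]; simp only [mul_assoc]
    _ ≤ ∑ l' ∈ Finset.range (l + 1), ‖(J.choose l' : ℂ) * q ^ (J - l')‖ * 2 := by gcongr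
    _ ≤ _ := by linarith

section

variable {ι : Type*} [Fintype ι]

/-- Near a point where `m` lines meet, the weight on the disc of radius `‖t - q‖` is `O(‖t - q‖ ^ (A * m))`. -/
theorem exists_rootWt_le_near (a b : ι → ℂ) {A : ℝ} (hA : 0 ≤ A) (q x : ℂ) (R : ℝ) :
    ∃ C > 0, ∀ t : ℂ, t ≠ q → ‖t‖ ≤ R → ∀ z ∈ Metric.ball x ‖t - q‖,
      rootWt (fun j => a j + b j * t) A z ≤
        C * ‖t - q‖ ^ (A * (Finset.univ.filter fun j => x = a j + b j * q).card) := by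
  set K : ℝ := 1 + ‖x‖ + (|R| + ‖q‖) + ∑ j, (‖a j‖ + ‖b j‖ * |R| + ‖b j‖) with hK
  have hK0 : 0 < K := by positivity
  refine ⟨∏ _j : ι, K ^ A, by positivity, fun t ht htR z hz => ?_⟩
  have hρ : 0 < ‖t - q‖ := norm_pos_iff.2 (sub_ne_zero.2 ht)
  have htR' : ‖t‖ ≤ |R| := htR.trans (le_abs_self R)
  rw [Metric.mem_ball, dist_eq_norm] at hz
  have hj : ∀ j, ‖z - (a j + b j * t)‖ ^ A ≤ K ^ A * (if x = a j + b j * q then ‖t - q‖ ^ A else 1) := by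
    intro j
    have hle : ‖a j‖ + ‖b j‖ * |R| + ‖b j‖ ≤ ∑ j, (‖a j‖ + ‖b j‖ * |R| + ‖b j‖) :=
      Finset.single_le_sum (f := fun j => ‖a j‖ + ‖b j‖ * |R| + ‖b j‖) (fun i _ => by positivity) (Finset.mem_univ j)
    have hbR : 0 ≤ ‖b j‖ * |R| := by positivity
    have h0a := norm_nonneg (a j)
    have h0b := norm_nonneg (b j)
    have h0x := norm_nonneg x
    have h0q := norm_nonneg q
    have h0R := abs_nonneg R
    split_ifs with hx
    · rw [← Real.mul_rpow hK0.le hρ.le]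
      refine Real.rpow_le_rpow (norm_nonneg _) ?_ hA
      have : z - (a j + b j * t) = (z - x) - b j * (t - q) := by rw [hx]; ring
      rw [this]
      calc _ ≤ ‖z - x‖ + ‖b j * (t - q)‖ := norm_sub_le _ _
        _ ≤ ‖t - q‖ + ‖b j‖ * ‖t - q‖ := by rw [norm_mul]; linarith
        _ = (1 + ‖b j‖) * ‖t - q‖ := by ring
        _ ≤ K * ‖t - q‖ := by gcongr; linarith
    · rw [mul_one]
      refine Real.rpow_le_rpow (norm_nonneg _) ?_ hA
      have h1 : ‖t - q‖ ≤ |R| + ‖q‖ := (norm_sub_le _ _).trans (by linarith)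
      have h2 : ‖b j * t‖ ≤ ‖b j‖ * |R| := by rw [norm_mul]; gcongr
      have : z - (a j + b j * t) = (z - x) + x - a j - b j * t := by ring
      rw [this]
      have h3 := norm_sub_le ((z - x) + x - a j) (b j * t)
      have h4 := norm_sub_le ((z - x) + x) (a j)
      have h5 := norm_add_le (z - x) x
      linarith
  calc rootWt (fun j => a j + b j * t) A z ≤ ∏ j, (K ^ A * (if x = a j + b j * q then ‖t - q‖ ^ A else 1)) :=
        Finset.prod_le_prod (fun j _ => by positivity) fun j _ => hj j
    _ = _ := by
        rw [Finset.prod_mul_distrib, Finset.prod_ite, Finset.prod_const, Finset.prod_const, Finset.prod_const_one, mul_one,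
          Real.rpow_mul hρ.le, Real.rpow_natCast]

theorem exists_rootWt_le_far (a b : ι → ℂ) {A : ℝ} (hA : 0 ≤ A) :
    ∃ C > 0, ∀ t : ℂ, 1 ≤ ‖t‖ → ∀ z ∈ Metric.ball (0 : ℂ) ‖t‖,
      rootWt (fun j => a j + b j * t) A z ≤ C * ‖t‖ ^ (A * Fintype.card ι) := by
  refine ⟨∏ j, (1 + ‖a j‖ + ‖b j‖) ^ A, by positivity, fun t ht z hz => ?_⟩
  rw [mem_ball_zero_iff] at hz
  have ht0 : 0 ≤ ‖t‖ := norm_nonneg t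
  calc rootWt (fun j => a j + b j * t) A z ≤ ∏ j, ((1 + ‖a j‖ + ‖b j‖) ^ A * ‖t‖ ^ A) := by
        refine Finset.prod_le_prod (fun j _ => by positivity) fun j _ => ?_
        rw [← Real.mul_rpow (by positivity) ht0]
        refine Real.rpow_le_rpow (norm_nonneg _) ?_ hA
        have h1 := norm_sub_le z (a j + b j * t)
        have h2 := norm_add_le (a j) (b j * t)
        rw [norm_mul] at h2
        have h3 : ‖a j‖ ≤ ‖a j‖ * ‖t‖ := le_mul_of_one_le_right (norm_nonneg _) ht
        nlinarith
    _ = _ := by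
        rw [Finset.prod_mul_distrib, Finset.prod_const, Real.rpow_mul ht0, Real.rpow_natCast, Finset.card_univ]

end

section

variable {ι : Type*} [Fintype ι]

theorem norm_taylorCoeff_sq_le (k : ℕ) : ∃ C > 0, ∀ {n : ℕ} (c : Fin (n + 1) → ℂ) (a b : ι → ℂ) {A : ℝ}, 0 ≤ A →
    ∀ (t x : ℂ) {ρ W : ℝ}, 0 < ρ → (∀ z ∈ Metric.ball x ρ, rootWt (fun j => a j + b j * t) A z ≤ W) →
    fiberNorm a b A c t ≠ ⊤ →
    ‖taylorCoeff c k x‖ ^ 2 * ρ ^ (2 * k + 2) ≤ C * W ^ 2 * (fiberNorm a b A c t).toReal := by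
  obtain ⟨C, hC, h⟩ := exists_taylorCoeff_le (ι := ι) k
  refine ⟨C, hC, fun {n} c a b A hA t x ρ W hρ hW hN => ?_⟩
  have h1 := h c a b hA t x hρ hW
  have h2 := ENNReal.toReal_mono (ENNReal.mul_ne_top ENNReal.ofReal_ne_top hN) h1
  rwa [ENNReal.toReal_ofReal (by positivity), ENNReal.toReal_mul, ENNReal.toReal_ofReal (by positivity)] at h2

theorem exists_polar_term_le_near (a b : ι → ℂ) {A : ℝ} (hA : 0 ≤ A) (q x : ℂ) (R : ℝ) {n l k : ℕ}
    (h : (l + k + 2 : ℝ) ≤ A * (Finset.univ.filter fun j => x = a j + b j * q).card) :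
    ∃ C > 0, ∀ t : ℂ, t ≠ q → ‖t‖ ≤ R → ∀ c : Fin (n + 1) → ℂ, fiberNorm a b A c t ≠ ⊤ →
      ‖taylorCoeff c k x * ((t - q) ^ (l + 1))⁻¹‖ ^ 2 ≤ C * (fiberNorm a b A c t).toReal := by
  obtain ⟨C₁, hC₁, h1⟩ := norm_taylorCoeff_sq_le (ι := ι) k
  obtain ⟨C₂, hC₂, h2⟩ := exists_rootWt_le_near a b hA q x R
  set M : ℝ := A * (Finset.univ.filter fun j => x = a j + b j * q).card with hM
  set R' : ℝ := |R| + ‖q‖ + 1 with hR'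
  have hR'0 : 0 < R' := by positivity
  refine ⟨C₁ * C₂ ^ 2 * (R' ^ (M - (l + k + 2))) ^ 2, by positivity, fun t ht htR c hN => ?_⟩
  have hρ : 0 < ‖t - q‖ := norm_pos_iff.2 (sub_ne_zero.2 ht)
  have hρR : ‖t - q‖ ≤ R' := (norm_sub_le _ _).trans (by linarith [le_abs_self R])
  have h3 := h1 c a b hA t x hρ (h2 t ht htR) hN
  set ρ := ‖t - q‖ with hρdef
  set N := (fiberNorm a b A c t).toReal
  have hN0 : 0 ≤ N := ENNReal.toReal_nonneg
  have h4 : ρ ^ M = ρ ^ (M - (l + k + 2)) * ρ ^ (l + k + 2) := by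
    rw [← Real.rpow_natCast, ← Real.rpow_add hρ]
    push_cast
    ring_nf
  have h5 : ‖taylorCoeff c k x * ((t - q) ^ (l + 1))⁻¹‖ ^ 2 = ‖taylorCoeff c k x‖ ^ 2 * ρ ^ (2 * k + 2) / (ρ ^ (l + k + 2)) ^ 2 := by
    rw [norm_mul, norm_inv, norm_pow, ← hρdef]
    field_simp
    ring
  rw [h5, div_le_iff₀ (by positivity)]
  refine h3.trans ?_
  rw [h4]
  have h6 : ρ ^ (M - (l + k + 2)) ≤ R' ^ (M - (l + k + 2)) := Real.rpow_le_rpow hρ.le hρR (by linarith)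
  have h7 : (ρ ^ (M - (l + k + 2))) ^ 2 ≤ (R' ^ (M - (l + k + 2))) ^ 2 := by gcongr
  calc _ = C₁ * C₂ ^ 2 * (ρ ^ (M - (l + k + 2))) ^ 2 * N * (ρ ^ (l + k + 2)) ^ 2 := by ring
    _ ≤ _ := by gcongr

theorem exists_coeff_le_far (a b : ι → ℂ) {A : ℝ} (hA : 0 ≤ A) {n : ℕ} (k : Fin (n + 1)) :
    ∃ C > 0, ∀ t : ℂ, 1 ≤ ‖t‖ → ∀ c : Fin (n + 1) → ℂ, fiberNorm a b A c t ≠ ⊤ →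
      ‖c k‖ ^ 2 * ‖t‖ ^ (2 * (k : ℕ) + 2) ≤ C * (‖t‖ ^ (A * Fintype.card ι)) ^ 2 * (fiberNorm a b A c t).toReal := by
  obtain ⟨C₁, hC₁, h1⟩ := norm_taylorCoeff_sq_le (ι := ι) (k : ℕ)
  obtain ⟨C₂, hC₂, h2⟩ := exists_rootWt_le_far a b hA
  refine ⟨C₁ * C₂ ^ 2, by positivity, fun t ht c hN => ?_⟩
  have h3 := h1 c a b hA t 0 (by linarith) (h2 t ht) hN
  rw [taylorCoeff_zero] at h3
  refine h3.trans (le_of_eq ?_)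
  ring

section
variable {Q : Type*} [Fintype Q]

/-- The sum of the polar parts attached to Taylor functionals at finitely many points. -/
def polarSum (tq xq : Q → ℂ) (lq kq : Q → ℕ) (lam : Q → ℂ) {n : ℕ} (t : ℂ) (c : Fin (n + 1) → ℂ) : ℂ :=
  ∑ q, lam q * (taylorCoeff c (kq q) (xq q) * ((t - tq q) ^ (lq q + 1))⁻¹)

/-- The coefficient of `c k'` in `polarSum`. -/
def polarCoeff (tq xq : Q → ℂ) (lq kq : Q → ℕ) (lam : Q → ℂ) (t : ℂ) (k' : ℕ) : ℂ :=
  ∑ q, lam q * ((k'.choose (kq q) : ℂ) * xq q ^ (k' - kq q)) * ((t - tq q) ^ (lq q + 1))⁻¹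

theorem polarSum_eq (tq xq : Q → ℂ) (lq kq : Q → ℕ) (lam : Q → ℂ) {n : ℕ} (t : ℂ) (c : Fin (n + 1) → ℂ) :
    polarSum tq xq lq kq lam t c = ∑ k', c k' * polarCoeff tq xq lq kq lam t k' := by
  simp only [polarSum, polarCoeff, taylorCoeff_eq_sum, Finset.mul_sum, Finset.sum_mul]
  rw [Finset.sum_comm]
  exact Finset.sum_congr rfl fun k' _ => Finset.sum_congr rfl fun q _ => by ring

theorem exists_polarCoeff_le_far (tq xq : Q → ℂ) (lq kq : Q → ℕ) (lam : Q → ℂ) {n : ℕ}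
    (hmom : ∀ j k' : ℕ, j + k' + 1 ≤ n → ∑ q, lam q * (((j.choose (lq q) : ℂ) * tq q ^ (j - lq q)) *
      ((k'.choose (kq q) : ℂ) * xq q ^ (k' - kq q))) = 0) {k' : ℕ} (hk' : k' ≤ n) :
    ∃ C > 0, ∃ R, ∀ t : ℂ, R ≤ ‖t‖ → ‖t‖ ^ (n + 1 - k') * ‖polarCoeff tq xq lq kq lam t k'‖ ≤ C := by
  obtain ⟨J, rfl⟩ := Nat.exists_eq_add_of_le hk'
  choose C hC h using fun q => exists_principalPart_le (tq q) J (lq q)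
  set w : Q → ℂ := fun q => lam q * ((k'.choose (kq q) : ℂ) * xq q ^ (k' - kq q)) with hw
  refine ⟨1 + ∑ q, ‖w q‖ * C q, ?_, 1 + ∑ q, (2 * ‖tq q‖ + 2), fun t ht => ?_⟩
  · have : 0 ≤ ∑ q, ‖w q‖ * C q := Finset.sum_nonneg fun q _ => mul_nonneg (norm_nonneg _) (hC q).le
    linarith
  have htq : ∀ q, 2 * ‖tq q‖ + 2 ≤ ‖t‖ := fun q =>
    (Finset.single_le_sum (f := fun q => 2 * ‖tq q‖ + 2) (fun i _ => by positivity) (Finset.mem_univ q)).trans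
      (by linarith)
  have hkey : t ^ J * polarCoeff tq xq lq kq lam t k' = ∑ q, w q * principalPart (tq q) (t - tq q)⁻¹ J (lq q) := by
    have h1 : ∀ q, t ^ J * ((t - tq q) ^ (lq q + 1))⁻¹ =
        ∑ j ∈ Finset.range J, ((j.choose (lq q) : ℂ) * tq q ^ (j - lq q)) * t ^ (J - 1 - j) +
          principalPart (tq q) (t - tq q)⁻¹ J (lq q) := by
      intro q
      rw [← inv_pow]
      refine pow_mul_inv_pow_eq ?_ J (lq q)
      have hne : t - tq q ≠ 0 := by
        intro h0
        have := htq q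
        rw [sub_eq_zero.1 h0] at this
        linarith [norm_nonneg (tq q)]
      field_simp
      ring
    calc _ = ∑ q, w q * (t ^ J * ((t - tq q) ^ (lq q + 1))⁻¹) := by
          rw [polarCoeff, Finset.mul_sum]
          exact Finset.sum_congr rfl fun q _ => by simp only [hw]; ring
      _ = ∑ q, w q * ∑ j ∈ Finset.range J, ((j.choose (lq q) : ℂ) * tq q ^ (j - lq q)) * t ^ (J - 1 - j) +
          ∑ q, w q * principalPart (tq q) (t - tq q)⁻¹ J (lq q) := by
          rw [← Finset.sum_add_distrib]
          exact Finset.sum_congr rfl fun q _ => by rw [h1, mul_add]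
      _ = _ := by
          rw [add_eq_right]
          simp only [Finset.mul_sum]
          rw [Finset.sum_comm]
          refine Finset.sum_eq_zero fun j hj => ?_
          rw [Finset.mem_range] at hj
          have h2 := hmom j k' (by omega)
          calc _ = (∑ q, lam q * (((j.choose (lq q) : ℂ) * tq q ^ (j - lq q)) *
                ((k'.choose (kq q) : ℂ) * xq q ^ (k' - kq q)))) * t ^ (J - 1 - j) := by
                rw [Finset.sum_mul]
                exact Finset.sum_congr rfl fun q _ => by simp only [hw]; ring
            _ = 0 := by rw [h2, zero_mul]
  calc ‖t‖ ^ (k' + J + 1 - k') * ‖polarCoeff tq xq lq kq lam t k'‖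
      = ‖t ^ J * polarCoeff tq xq lq kq lam t k'‖ * ‖t‖ := by
        rw [show k' + J + 1 - k' = J + 1 by omega, norm_mul, norm_pow]
        ring
    _ ≤ (∑ q, ‖w q‖ * ‖principalPart (tq q) (t - tq q)⁻¹ J (lq q)‖) * ‖t‖ := by
        rw [hkey]
        refine mul_le_mul_of_nonneg_right ((norm_sum_le _ _).trans (le_of_eq ?_)) (norm_nonneg t)
        simp only [norm_mul]
    _ ≤ ∑ q, ‖w q‖ * C q := by
        rw [Finset.sum_mul]
        refine Finset.sum_le_sum fun q _ => ?_
        rw [mul_assoc]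
        exact mul_le_mul_of_nonneg_left (h q t (htq q)) (norm_nonneg _)
    _ ≤ _ := by linarith

end

variable {Q : Type*} [Fintype Q]

theorem norm_sum_sq_le {α : Type*} (s : Finset α) (f : α → ℂ) : ‖∑ i ∈ s, f i‖ ^ 2 ≤ s.card * ∑ i ∈ s, ‖f i‖ ^ 2 :=
  (pow_le_pow_left₀ (norm_nonneg _) (norm_sum_le _ _) 2).trans sq_sum_le_card_mul_sum_sq

set_option maxHeartbeats 800000 in
theorem exists_polarSum_bound (a b : ι → ℂ) {A : ℝ} (hA : 0 ≤ A) (tq xq : Q → ℂ) (lq kq : Q → ℕ) (lam : Q → ℂ) {n : ℕ}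
    (hmom : ∀ j k' : ℕ, j + k' + 1 ≤ n → ∑ q, lam q * (((j.choose (lq q) : ℂ) * tq q ^ (j - lq q)) *
      ((k'.choose (kq q) : ℂ) * xq q ^ (k' - kq q))) = 0)
    (hm : ∀ q, (lq q + kq q + 2 : ℝ) ≤ A * (Finset.univ.filter fun j => xq q = a j + b j * tq q).card)
    (hκ : 0 ≤ n + 2 - A * Fintype.card ι) :
    ∃ C > 0, ∀ t : ℂ, (∀ q, t ≠ tq q) → ∀ c : Fin (n + 1) → ℂ, fiberNorm a b A c t ≠ ⊤ →
      ‖polarSum tq xq lq kq lam t c‖ ^ 2 * (1 + ‖t‖ ^ 2) ^ (n + 2 - A * Fintype.card ι) ≤ C * (fiberNorm a b A c t).toReal := by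
  set κ := n + 2 - A * Fintype.card ι with hκdef
  choose C₁ hC₁ R₁ h1 using fun k' : Fin (n + 1) => exists_polarCoeff_le_far tq xq lq kq lam hmom (Nat.lt_succ_iff.1 k'.2)
  choose C₂ hC₂ h2 using fun k' : Fin (n + 1) => exists_coeff_le_far a b hA k'
  set R : ℝ := 1 + ∑ k', |R₁ k'| with hR
  have hRge : ∀ k', R₁ k' ≤ R := fun k' => (le_abs_self _).trans
    ((Finset.single_le_sum (f := fun k' => |R₁ k'|) (fun i _ => abs_nonneg _) (Finset.mem_univ k')).trans (by linarith))
  have hR1 : 1 ≤ R := by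
    have : 0 ≤ ∑ k', |R₁ k'| := Finset.sum_nonneg fun i _ => abs_nonneg _
    linarith
  choose C₃ hC₃ h3 using fun q => exists_polar_term_le_near (n := n) a b hA (tq q) (xq q) R (hm q)
  set D₁ : ℝ := (Finset.univ : Finset Q).card * (∑ q, ‖lam q‖ ^ 2 * C₃ q) * (1 + R ^ 2) ^ κ with hD₁
  set D₂ : ℝ := (Finset.univ : Finset (Fin (n + 1))).card * (∑ k', C₂ k' * C₁ k' ^ 2) * 2 ^ κ with hD₂
  have hD₁0 : 0 ≤ D₁ := by
    have : 0 ≤ ∑ q, ‖lam q‖ ^ 2 * C₃ q := Finset.sum_nonneg fun q _ => mul_nonneg (by positivity) (hC₃ q).le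
    positivity
  have hD₂0 : 0 ≤ D₂ := by
    have : 0 ≤ ∑ k', C₂ k' * C₁ k' ^ 2 := Finset.sum_nonneg fun q _ => mul_nonneg (hC₂ q).le (by positivity)
    positivity
  refine ⟨1 + D₁ + D₂, by linarith, fun t ht c hN => ?_⟩
  set N := (fiberNorm a b A c t).toReal with hNdef
  have hN0 : 0 ≤ N := ENNReal.toReal_nonneg
  rcases le_total ‖t‖ R with hle | hge
  · have hs : ‖polarSum tq xq lq kq lam t c‖ ^ 2 ≤ (Finset.univ : Finset Q).card * (∑ q, ‖lam q‖ ^ 2 * C₃ q) * N := by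
      refine (norm_sum_sq_le _ _).trans ?_
      rw [mul_assoc, Finset.sum_mul]
      refine mul_le_mul_of_nonneg_left (Finset.sum_le_sum fun q _ => ?_) (Nat.cast_nonneg _)
      rw [norm_mul, mul_pow, mul_assoc]
      exact mul_le_mul_of_nonneg_left (h3 q t (ht q) hle c hN) (by positivity)
    have hw : (1 + ‖t‖ ^ 2) ^ κ ≤ (1 + R ^ 2) ^ κ := Real.rpow_le_rpow (by positivity) (by gcongr) hκ
    calc _ ≤ (Finset.univ : Finset Q).card * (∑ q, ‖lam q‖ ^ 2 * C₃ q) * N * (1 + R ^ 2) ^ κ := by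
          refine mul_le_mul hs hw (by positivity) ((by positivity : (0:ℝ) ≤ _).trans hs)
      _ = D₁ * N := by rw [hD₁]; ring
      _ ≤ _ := by nlinarith
  · have ht1 : 1 ≤ ‖t‖ := hR1.trans hge
    have ht0 : 0 < ‖t‖ := by linarith
    set Y := ‖t‖ ^ (A * Fintype.card ι) with hY
    have hterm : ∀ k' : Fin (n + 1), ‖c k' * polarCoeff tq xq lq kq lam t k'‖ ^ 2 * (‖t‖ ^ (n + 2)) ^ 2 ≤
        C₂ k' * C₁ k' ^ 2 * Y ^ 2 * N := by
      intro k'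
      have e1 := h2 k' t ht1 c hN
      have e2 := h1 k' t ((hRge k').trans hge)
      have e3 : (‖t‖ ^ (n + 1 - (k' : ℕ)) * ‖polarCoeff tq xq lq kq lam t k'‖) ^ 2 ≤ C₁ k' ^ 2 := by gcongr
      have e4 : ‖t‖ ^ (n + 2) = ‖t‖ ^ ((k' : ℕ) + 1) * ‖t‖ ^ (n + 1 - (k' : ℕ)) := by
        rw [← pow_add]
        congr 1
        have := k'.2
        omega
      calc _ = (‖c k'‖ ^ 2 * ‖t‖ ^ (2 * (k' : ℕ) + 2)) * (‖t‖ ^ (n + 1 - (k' : ℕ)) * ‖polarCoeff tq xq lq kq lam t k'‖) ^ 2 := by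
            rw [e4, norm_mul]; ring
        _ ≤ (C₂ k' * Y ^ 2 * N) * C₁ k' ^ 2 := mul_le_mul e1 e3 (by positivity) ((by positivity : (0:ℝ) ≤ _).trans e1)
        _ = _ := by ring
    have hs : ‖polarSum tq xq lq kq lam t c‖ ^ 2 * (‖t‖ ^ (n + 2)) ^ 2 ≤
        (Finset.univ : Finset (Fin (n + 1))).card * (∑ k', C₂ k' * C₁ k' ^ 2) * (Y ^ 2 * N) := by
      rw [polarSum_eq]
      refine (mul_le_mul_of_nonneg_right (norm_sum_sq_le _ _) (by positivity)).trans ?_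
      rw [mul_assoc, mul_assoc, Finset.sum_mul, Finset.sum_mul]
      refine mul_le_mul_of_nonneg_left (Finset.sum_le_sum fun k' _ => ?_) (Nat.cast_nonneg _)
      exact (hterm k').trans (le_of_eq (by ring))
    have hpow : (‖t‖ ^ (n + 2)) ^ 2 = Y ^ 2 * (‖t‖ ^ 2) ^ κ := by
      have e1 : (‖t‖ ^ 2) ^ κ = (‖t‖ ^ κ) ^ 2 := by
        rw [← Real.rpow_natCast, ← Real.rpow_natCast, ← Real.rpow_mul ht0.le, ← Real.rpow_mul ht0.le, mul_comm]
      have e2 : ‖t‖ ^ (n + 2) = Y * ‖t‖ ^ κ := by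
        rw [hY, ← Real.rpow_add ht0, hκdef, ← Real.rpow_natCast]
        push_cast
        ring_nf
      rw [e1, e2, mul_pow]
    have hY0 : 0 < Y := Real.rpow_pos_of_pos ht0 _
    have hw : (1 + ‖t‖ ^ 2) ^ κ ≤ 2 ^ κ * (‖t‖ ^ 2) ^ κ := by
      rw [← Real.mul_rpow (by norm_num) (by positivity)]
      exact Real.rpow_le_rpow (by positivity) (by nlinarith) hκ
    have hs' : ‖polarSum tq xq lq kq lam t c‖ ^ 2 * (‖t‖ ^ 2) ^ κ ≤
        (Finset.univ : Finset (Fin (n + 1))).card * (∑ k', C₂ k' * C₁ k' ^ 2) * N := by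
      rw [hpow] at hs
      have hY2 : 0 < Y ^ 2 := by positivity
      refine le_of_mul_le_mul_left ?_ hY2
      calc _ = _ := by ring
        _ ≤ _ := hs
        _ = _ := by ring
    calc _ ≤ ‖polarSum tq xq lq kq lam t c‖ ^ 2 * (2 ^ κ * (‖t‖ ^ 2) ^ κ) := by gcongr
      _ = ‖polarSum tq xq lq kq lam t c‖ ^ 2 * (‖t‖ ^ 2) ^ κ * 2 ^ κ := by ring
      _ ≤ (Finset.univ : Finset (Fin (n + 1))).card * (∑ k', C₂ k' * C₁ k' ^ 2) * N * 2 ^ κ := by gcongr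
      _ = D₂ * N := by rw [hD₂]; ring
      _ ≤ _ := by nlinarith

end

theorem polar_parts_eq_zero {Q : Type*} [Fintype Q] (T : Finset ℂ) (tq : Q → ℂ) (lq : Q → ℕ) (μ : Q → ℂ)
    (h : ∀ t ∉ T, ∑ q, μ q * ((t - tq q) ^ (lq q + 1))⁻¹ = 0) (t₀ : ℂ)
    (hinj : ∀ q q', μ q ≠ 0 → μ q' ≠ 0 → tq q = t₀ → tq q' = t₀ → lq q = lq q' → q = q') :
    ∀ q, tq q = t₀ → μ q = 0 := by
  by_contra! hne
  set S : Finset Q := Finset.univ.filter fun q => tq q = t₀ ∧ μ q ≠ 0 with hS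
  have hSne : S.Nonempty := by
    obtain ⟨q, hq, hq0⟩ := hne
    exact ⟨q, by simp [hS, hq, hq0]⟩
  obtain ⟨p, hp, hmax⟩ := S.exists_max_image lq hSne
  have hpS : tq p = t₀ ∧ μ p ≠ 0 := by simpa [hS] using hp
  have hterm : ∀ q, Filter.Tendsto (fun t => (t - t₀) ^ (lq p + 1) * (μ q * ((t - tq q) ^ (lq q + 1))⁻¹))
      (nhdsWithin t₀ {t₀}ᶜ) (nhds (if q = p then μ p else 0)) := by
    intro q
    have hpow : ∀ r : ℕ, Filter.Tendsto (fun t : ℂ => (t - t₀) ^ (r + 1)) (nhdsWithin t₀ {t₀}ᶜ) (nhds 0) := fun r => by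
      have : ContinuousAt (fun t : ℂ => (t - t₀) ^ (r + 1)) t₀ := by fun_prop
      have h2 := this.tendsto.mono_left (nhdsWithin_le_nhds (s := {t₀}ᶜ))
      simpa using h2
    by_cases hμ : μ q = 0
    · have : (if q = p then μ p else 0) = 0 := by
        split_ifs with hqp
        · rw [← hqp, hμ]
        · rfl
      simp only [hμ, zero_mul, mul_zero, this]
      exact tendsto_const_nhds
    by_cases hq : tq q = t₀
    · have hqS : q ∈ S := by simp [hS, hq, hμ]
      have hle := hmax q hqS
      have hev : ∀ᶠ t in nhdsWithin t₀ {t₀}ᶜ, μ q * (t - t₀) ^ (lq p - lq q) =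
          (t - t₀) ^ (lq p + 1) * (μ q * ((t - tq q) ^ (lq q + 1))⁻¹) := by
        filter_upwards [self_mem_nhdsWithin] with t ht
        have hne : t - t₀ ≠ 0 := sub_ne_zero.2 ht
        rw [hq, show lq p + 1 = (lq p - lq q) + (lq q + 1) by omega, pow_add]
        field_simp
      refine Filter.Tendsto.congr' hev ?_
      split_ifs with hqp
      · simp only [hqp, Nat.sub_self, pow_zero, mul_one]
        exact tendsto_const_nhds
      · have hlt : lq q < lq p := lt_of_le_of_ne hle fun he => hqp (hinj q p hμ hpS.2 hq hpS.1 he)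
        obtain ⟨r, hr⟩ := Nat.exists_eq_add_of_lt hlt
        rw [show lq p - lq q = r + 1 by omega]
        simpa using (hpow r).const_mul (μ q)
    · rw [if_neg (by rintro rfl; exact hq hpS.1)]
      have hc : Filter.Tendsto (fun t : ℂ => μ q * ((t - tq q) ^ (lq q + 1))⁻¹) (nhdsWithin t₀ {t₀}ᶜ)
          (nhds (μ q * ((t₀ - tq q) ^ (lq q + 1))⁻¹)) := by
        have : ContinuousAt (fun t : ℂ => μ q * ((t - tq q) ^ (lq q + 1))⁻¹) t₀ := by
          refine continuousAt_const.mul (ContinuousAt.inv₀ (by fun_prop) (pow_ne_zero _ (sub_ne_zero.2 (Ne.symm hq))))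
        exact this.tendsto.mono_left nhdsWithin_le_nhds
      simpa using (hpow (lq p)).mul hc
  have hsum := tendsto_finsetSum (Finset.univ : Finset Q) fun q _ => hterm q
  simp only [Finset.sum_ite_eq', Finset.mem_univ, if_true] at hsum
  have hzero : Filter.Tendsto (fun t => ∑ q, (t - t₀) ^ (lq p + 1) * (μ q * ((t - tq q) ^ (lq q + 1))⁻¹))
      (nhdsWithin t₀ {t₀}ᶜ) (nhds 0) := by
    refine Filter.Tendsto.congr' ?_ tendsto_const_nhds
    have hfin : ∀ᶠ t in nhdsWithin t₀ {t₀}ᶜ, t ∉ T := by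
      have h1 : ((T.erase t₀ : Finset ℂ) : Set ℂ)ᶜ ∈ nhds t₀ :=
        (T.erase t₀).finite_toSet.isClosed.isOpen_compl.mem_nhds (by simp)
      filter_upwards [nhdsWithin_le_nhds h1, self_mem_nhdsWithin] with t ht ht' hT
      exact ht (Finset.mem_coe.2 (Finset.mem_erase.2 ⟨ht', hT⟩))
    filter_upwards [hfin] with t ht
    rw [← Finset.mul_sum, h t ht, mul_zero]
  exact hpS.2 (tendsto_nhds_unique hsum hzero)

theorem exists_taylorCoeff_eq_ite {n : ℕ} (x : ℂ) {k₀ : ℕ} (hk₀ : k₀ ≤ n) :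
    ∃ c : Fin (n + 1) → ℂ, ∀ k, taylorCoeff c k x = if k = k₀ then 1 else 0 := by
  refine ⟨fun k => ((Polynomial.X - Polynomial.C x) ^ k₀).coeff k, fun k => ?_⟩
  have h1 : toPoly (fun k : Fin (n + 1) => ((Polynomial.X - Polynomial.C x) ^ k₀ : Polynomial ℂ).coeff k) =
      (Polynomial.X - Polynomial.C x) ^ k₀ := by
    conv_rhs => rw [Polynomial.as_sum_range_C_mul_X_pow' (n := n + 1) (p := (Polynomial.X - Polynomial.C x) ^ k₀)
      (by rw [Polynomial.natDegree_pow, Polynomial.natDegree_X_sub_C]; omega)]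
    rw [toPoly, ← Fin.sum_univ_eq_sum_range (fun i => Polynomial.C (((Polynomial.X - Polynomial.C x) ^ k₀ : Polynomial ℂ).coeff i) * Polynomial.X ^ i)]
    simp only [Polynomial.C_mul_X_pow_eq_monomial]
  rw [taylorCoeff, h1, Polynomial.taylor_pow, map_sub, Polynomial.taylor_X, Polynomial.taylor_C, add_sub_cancel_right,
    Polynomial.coeff_X_pow]

section

variable {ι : Type*} [Fintype ι]

/-- The values of `t` at which two of the lines `x = a j + b j * t` meet. -/
def collisions (a b : ι → ℂ) : Finset ℂ :=
  Finset.univ.image fun p : ι × ι => (a p.1 - a p.2) / (b p.2 - b p.1)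

theorem injective_of_notMem_collisions {a b : ι → ℂ} (hab : ∀ j k, a j = a k → b j = b k → j = k) {t : ℂ}
    (ht : t ∉ collisions a b) : Function.Injective fun j => a j + b j * t := by
  intro j k hjk
  by_contra hne
  have hb : b k - b j ≠ 0 := by
    intro h0
    have hb : b j = b k := (sub_eq_zero.1 h0).symm
    refine hne (hab j k ?_ hb)
    simpa [hb] using hjk
  refine ht (Finset.mem_image.2 ⟨(j, k), Finset.mem_univ _, ?_⟩)
  rw [div_eq_iff hb]
  simp only at hjk
  linear_combination hjk

theorem exists_exponent {Q : Type*} [Fintype Q] {α : ℝ} (v M : Q → ℝ) (h : ∀ q, v q < α * M q) {d w : ℝ}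
    (hw : w < α * d) (h0 : 0 < α) : ∃ A, 0 ≤ A ∧ A < α ∧ (∀ q, v q ≤ A * M q) ∧ w < A * d := by
  have hev : ∀ᶠ A in nhdsWithin α (Set.Iio α), 0 < A ∧ (∀ q, v q < A * M q) ∧ w < A * d ∧ A < α := by
    have h1 : ∀ᶠ A in nhds α, 0 < A ∧ (∀ q, v q < A * M q) ∧ w < A * d := by
      refine (lt_mem_nhds h0).and (((Filter.eventually_all).2 fun q => ?_).and ?_)
      · have : ContinuousAt (fun A => A * M q) α := by fun_prop
        exact this.eventually (lt_mem_nhds (h q))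
      · have : ContinuousAt (fun A => A * d) α := by fun_prop
        exact this.eventually (lt_mem_nhds hw)
    filter_upwards [nhdsWithin_le_nhds h1, self_mem_nhdsWithin] with A hA hlt
    exact ⟨hA.1, hA.2.1, hA.2.2, hlt⟩
  obtain ⟨A, h1, h2, h3, h4⟩ := hev.exists
  exact ⟨A, h1.le, h4, fun q => (h2 q).le, h3⟩

/-- Independence of the conditions imposed on plane curves of degree less than `n` by the multiplicities of a line
arrangement. -/
theorem jet_functionals_independent [Nonempty ι] (a b : ι → ℂ) (hab : ∀ j k, a j = a k → b j = b k → j = k) {n : ℕ} {α : ℝ}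
    (hα1 : α < 1) (hα : α * Fintype.card ι = n + 2) {Q : Type*} [Fintype Q] (tq xq : Q → ℂ) (lq kq : Q → ℕ) (lam : Q → ℂ)
    (hx : ∀ q q', tq q = tq q' → xq q = xq q')
    (hinj : ∀ q q', tq q = tq q' → lq q = lq q' → kq q = kq q' → q = q')
    (hm : ∀ q, (lq q + kq q + 2 : ℝ) < α * (Finset.univ.filter fun j => xq q = a j + b j * tq q).card)
    (hmom : ∀ j k' : ℕ, j + k' + 1 ≤ n → ∑ q, lam q * (((j.choose (lq q) : ℂ) * tq q ^ (j - lq q)) *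
      ((k'.choose (kq q) : ℂ) * xq q ^ (k' - kq q))) = 0) : ∀ q, lam q = 0 := by
  have hcard : (0 : ℝ) < Fintype.card ι := by exact_mod_cast Fintype.card_pos
  have hα0 : 0 < α := by
    by_contra hle
    nlinarith
  obtain ⟨A, hA, hAα, hA1, hA2⟩ := exists_exponent (fun q => (lq q + kq q + 2 : ℝ))
    (fun q => ((Finset.univ.filter fun j => xq q = a j + b j * tq q).card : ℝ)) hm
    (d := Fintype.card ι) (w := n + 1) (by linarith) hα0
  have hA3 : A * Fintype.card ι < n + 2 := by nlinarith
  set T : Finset ℂ := collisions a b ∪ Finset.univ.image tq with hT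
  have hTq : ∀ t ∉ T, ∀ q, t ≠ tq q := by
    rintro t ht q rfl
    exact ht (Finset.mem_union_right _ (Finset.mem_image_of_mem _ (Finset.mem_univ q)))
  have hTinj : ∀ t ∉ T, Function.Injective fun j => a j + b j * t := fun t ht =>
    injective_of_notMem_collisions hab fun h => ht (Finset.mem_union_left _ h)
  obtain ⟨C, hC, hbd⟩ := exists_polarSum_bound a b hA tq xq lq kq lam hmom hA1 (by linarith)
  have hvan : ∀ t ∉ T, ∀ c : Fin (n + 1) → ℂ, polarSum tq xq lq kq lam t c = 0 := by
    refine eq_zero_of_fiberNorm_bound a b hA (hAα.trans hα1) hA2 hA3 hTinj ?_ ?_ ?_ (κ := n + 2 - A * Fintype.card ι)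
      (by linarith) hC fun t ht c => hbd t (hTq t ht) c (fiberNorm_ne_top a b hA (hAα.trans hα1) hA2 (hTinj t ht) c)
    · intro t r c
      simp only [polarSum_eq, Finset.mul_sum, Pi.smul_apply, smul_eq_mul, mul_assoc]
    · simp only [polarSum_eq, polarCoeff]
      refine continuousOn_finsetSum _ fun k' _ => ContinuousOn.mul (by fun_prop) (continuousOn_finsetSum _ fun q _ => ?_)
      refine continuousOn_const.mul (ContinuousOn.inv₀ (by fun_prop) fun p hp => ?_)
      exact pow_ne_zero _ (sub_ne_zero.2 (hTq p.1 hp.1 q))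
    · intro t₀ ht₀ c₀ c₁
      have hopen : ((T : Set ℂ)ᶜ) ∈ nhds t₀ := T.finite_toSet.isClosed.isOpen_compl.mem_nhds ht₀
      obtain ⟨R, hR, hball⟩ := Metric.mem_nhds_iff.1 hopen
      refine ⟨R, hR, ?_⟩
      simp only [polarSum_eq, polarCoeff]
      refine DifferentiableOn.fun_sum fun k' _ => DifferentiableOn.mul ?_ (DifferentiableOn.fun_sum fun q _ => ?_)
      · simp only [Pi.add_apply, Pi.smul_apply, smul_eq_mul]
        fun_prop
      · refine (differentiableOn_const _).mul (DifferentiableOn.inv (by fun_prop) fun τ hτ => ?_)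
        refine pow_ne_zero _ (sub_ne_zero.2 (hTq _ (fun hmem => hball (a := t₀ + τ) ?_ hmem) q))
        simpa [dist_eq_norm] using hτ
  intro q₀
  have hk : kq q₀ ≤ n := by
    have h1 := hm q₀
    have h2 : ((Finset.univ.filter fun j => xq q₀ = a j + b j * tq q₀).card : ℝ) ≤ Fintype.card ι := by
      exact_mod_cast Finset.card_le_univ _
    have h3 : (lq q₀ + kq q₀ + 2 : ℝ) < n + 2 := by nlinarith
    have h4 : lq q₀ + kq q₀ + 2 < n + 2 := by exact_mod_cast h3
    omega
  obtain ⟨c, hc⟩ := exists_taylorCoeff_eq_ite (xq q₀) hk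
  have h1 := polar_parts_eq_zero T tq lq (fun q => lam q * taylorCoeff c (kq q) (xq q)) (fun t ht => by
    simpa only [polarSum, mul_assoc] using hvan t ht c) (tq q₀) (fun q q' h h' hq hq' hl => by
      refine hinj q q' (hq.trans hq'.symm) hl ?_
      have e1 := right_ne_zero_of_mul h
      have e2 := right_ne_zero_of_mul h'
      rw [hx q q₀ hq, hc] at e1
      rw [hx q' q₀ hq', hc] at e2
      simp only [ne_eq, ite_eq_right_iff, one_ne_zero, imp_false, not_not] at e1 e2
      rw [e1, e2]) q₀ rfl
  simpa [hc] using h1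

end

theorem lintegral_comp_mul_complex (F : ℂ → ENNReal) {w : ℂ} (hw : w ≠ 0) :
    ∫⁻ y, F y = ENNReal.ofReal (‖w‖ ^ 2) * ∫⁻ σ, F (w * σ) := by
  set f : ℂ →ₗ[ℂ] ℂ := w • LinearMap.id with hf
  have hdet : LinearMap.det ((f : ℂ →ₗ[ℂ] ℂ).restrictScalars ℝ) = ‖w‖ ^ 2 := by
    rw [LinearMap.det_restrictScalars, hf, LinearMap.det_smul]
    simp [Algebra.norm_complex_apply, Complex.normSq_eq_norm_sq]
  have hpos : 0 < ‖w‖ ^ 2 := by positivity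
  have h1 := Measure.map_linearMap_addHaar_eq_smul_addHaar (volume : Measure ℂ)
    (f := (f : ℂ →ₗ[ℂ] ℂ).restrictScalars ℝ) (by rw [hdet]; exact hpos.ne')
  rw [hdet, abs_of_pos (inv_pos.2 hpos)] at h1
  have h2 : ∫⁻ σ, F (w * σ) = ∫⁻ y, F y ∂(Measure.map ((f : ℂ →ₗ[ℂ] ℂ).restrictScalars ℝ) volume) := by
    have := lintegral_map_equiv (μ := (volume : Measure ℂ)) F (Homeomorph.mulLeft₀ w hw).toMeasurableEquiv
    rw [Homeomorph.toMeasurableEquiv_coe] at this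
    exact this.symm
  rw [h2, h1, lintegral_smul_measure, smul_eq_mul, ← mul_assoc, ← ENNReal.ofReal_mul hpos.le,
    mul_inv_cancel₀ hpos.ne', ENNReal.ofReal_one, one_mul]

/-- The cone chart attached to a basis. -/
def coneMap (e : Module.Basis (Fin 3) ℂ (Fin 3 → ℂ)) (p : ℂ × ℂ × ℂ) : Fin 3 → ℂ :=
  p.1 • (e 0 + p.2.1 • (e 1 + p.2.2 • e 2))

theorem continuous_coneMap (e : Module.Basis (Fin 3) ℂ (Fin 3 → ℂ)) : Continuous (coneMap e) := by
  unfold coneMap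
  fun_prop

theorem exists_lintegral_eq_linearCoord (e : Module.Basis (Fin 3) ℂ (Fin 3 → ℂ)) :
    ∃ c : ENNReal, c ≠ 0 ∧ c ≠ ⊤ ∧ ∀ F : (Fin 3 → ℂ) → ENNReal,
      ∫⁻ x, F x = c * ∫⁻ p : ℂ × ℂ × ℂ, F (p.1 • e 0 + p.2.1 • e 1 + p.2.2 • e 2) := by
  let L₀ : (ℂ × ℂ × ℂ) ≃ₗ[ℂ] (Fin 3 → ℂ) :=
    { toFun := fun p => p.1 • e 0 + p.2.1 • e 1 + p.2.2 • e 2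
      map_add' := fun p q => by simp only [Prod.fst_add, Prod.snd_add, add_smul]; abel
      map_smul' := fun r p => by simp [mul_smul, smul_add]
      invFun := fun x => (e.repr x 0, e.repr x 1, e.repr x 2)
      left_inv := fun p => by
        simp
      right_inv := fun x => by
        conv_rhs => rw [← e.sum_repr x, Fin.sum_univ_three] }
  let L := L₀.toContinuousLinearEquiv
  have h2 : (volume : Measure (ℂ × ℂ)).IsAddHaarMeasure := by rw [Measure.volume_eq_prod]; infer_instance
  have h3 : (volume : Measure (ℂ × ℂ × ℂ)).IsAddHaarMeasure := by rw [Measure.volume_eq_prod]; infer_instance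
  have hH : (Measure.map L (volume : Measure (ℂ × ℂ × ℂ))).IsAddHaarMeasure :=
    ContinuousLinearEquiv.isAddHaarMeasure_map L volume
  have h1 := Measure.isAddLeftInvariant_eq_smul (volume : Measure (Fin 3 → ℂ)) (Measure.map L (volume : Measure (ℂ × ℂ × ℂ)))
  set c := (volume : Measure (Fin 3 → ℂ)).addHaarScalarFactor (Measure.map L (volume : Measure (ℂ × ℂ × ℂ))) with hc
  have hc0 : c ≠ 0 := (Measure.addHaarScalarFactor_pos_of_isAddHaarMeasure _ _).ne'
  refine ⟨c, by simpa using hc0, ENNReal.coe_ne_top, fun F => ?_⟩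
  have h3 : ∫⁻ x, F x ∂(Measure.map L (volume : Measure (ℂ × ℂ × ℂ))) = ∫⁻ p : ℂ × ℂ × ℂ, F (L p) := by
    have := lintegral_map_equiv (μ := (volume : Measure (ℂ × ℂ × ℂ))) F L.toHomeomorph.toMeasurableEquiv
    rw [Homeomorph.toMeasurableEquiv_coe] at this
    exact this
  conv_lhs => rw [h1]
  rw [lintegral_smul_measure, h3]
  rfl

theorem exists_lintegral_eq_coneMap (e : Module.Basis (Fin 3) ℂ (Fin 3 → ℂ)) :
    ∃ c : ENNReal, c ≠ 0 ∧ c ≠ ⊤ ∧ ∀ F : (Fin 3 → ℂ) → ENNReal, Measurable F →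
      ∫⁻ x, F x = c * ∫⁻ p : ℂ × ℂ × ℂ, F (coneMap e p) * ENNReal.ofReal (‖p.1‖ ^ 4 * ‖p.2.1‖ ^ 2) := by
  obtain ⟨c, hc0, hct, h⟩ := exists_lintegral_eq_linearCoord e
  refine ⟨c, hc0, hct, fun F hF => ?_⟩
  rw [h F]
  congr 1
  have hm1 : Measurable fun p : ℂ × ℂ × ℂ => F (p.1 • e 0 + p.2.1 • e 1 + p.2.2 • e 2) := hF.comp (by fun_prop)
  have hm2 : Measurable fun p : ℂ × ℂ × ℂ => F (coneMap e p) * ENNReal.ofReal (‖p.1‖ ^ 4 * ‖p.2.1‖ ^ 2) :=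
    (hF.comp (continuous_coneMap e).measurable).mul (by fun_prop)
  rw [Measure.volume_eq_prod, lintegral_prod _ hm1.aemeasurable, lintegral_prod _ hm2.aemeasurable]
  have h0 : ∀ᵐ z : ℂ, z ≠ 0 := by simp [ae_iff, measure_singleton]
  refine lintegral_congr_ae ?_
  filter_upwards [h0] with ζ hζ
  have hm1' : Measurable fun p : ℂ × ℂ => F (ζ • e 0 + p.1 • e 1 + p.2 • e 2) := hm1.comp (measurable_prodMk_left (x := ζ))
  have hm2' : Measurable fun p : ℂ × ℂ => F (coneMap e (ζ, p)) * ENNReal.ofReal (‖ζ‖ ^ 4 * ‖p.1‖ ^ 2) :=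
    hm2.comp (measurable_prodMk_left (x := ζ))
  rw [Measure.volume_eq_prod, lintegral_prod _ hm1'.aemeasurable, lintegral_prod _ hm2'.aemeasurable, lintegral_comp_mul_complex _ hζ,
    ← lintegral_const_mul' _ _ ENNReal.ofReal_ne_top]
  refine lintegral_congr_ae ?_
  filter_upwards [h0] with s hs
  rw [lintegral_comp_mul_complex _ (mul_ne_zero hζ hs), ← mul_assoc, ← ENNReal.ofReal_mul (by positivity),
    ← lintegral_const_mul' _ _ ENNReal.ofReal_ne_top]
  refine lintegral_congr fun σ => ?_
  rw [mul_comm, norm_mul]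
  congr 2
  · simp only [coneMap, smul_add, smul_smul, mul_assoc]
    rw [add_assoc]
  · ring

theorem lintegral_ball_norm_rpow_ne_top_iff (w : ℝ) {r : ℝ} (hr : 0 < r) :
    ∫⁻ s in Metric.ball (0 : ℂ) r, ENNReal.ofReal (‖s‖ ^ w) ≠ ⊤ ↔ -2 < w := by
  have hm : Measurable fun s : ℂ => ‖s‖ ^ w := by fun_prop
  have h1 : ∫⁻ s in Metric.ball (0 : ℂ) r, ENNReal.ofReal (‖s‖ ^ w) ≠ ⊤ ↔
      IntegrableOn (fun s : ℂ => ‖s‖ ^ w) (Metric.ball 0 r) := by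
    rw [lintegral_ofReal_ne_top_iff_integrable hm.aestronglyMeasurable (ae_of_all _ fun s => by positivity)]
    rfl
  have h2 : (Metric.ball (0 : ℂ) r).indicator (fun s : ℂ => ‖s‖ ^ w) = fun s => (Set.Iio r).indicator (fun y => y ^ w) ‖s‖ := by
    funext s
    simp [Set.indicator]
  rw [h1, ← integrable_indicator_iff measurableSet_ball, h2, integrable_fun_norm_addHaar, Complex.finrank_real_complex]
  have h3 : IntegrableOn (fun y : ℝ => y ^ (2 - 1) • (Set.Iio r).indicator (fun y => y ^ w) y) (Set.Ioi 0) ↔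
      IntegrableOn (fun y : ℝ => y ^ (w + 1)) (Set.Ioo 0 r) := by
    have : (fun y : ℝ => y ^ (2 - 1) • (Set.Iio r).indicator (fun y => y ^ w) y) = (Set.Iio r).indicator (fun y => y * y ^ w) := by
      funext y
      by_cases hy : y ∈ Set.Iio r <;> simp [hy]
    rw [this, IntegrableOn, integrable_indicator_iff measurableSet_Iio, IntegrableOn, Measure.restrict_restrict measurableSet_Iio,
      Set.inter_comm, Set.Ioi_inter_Iio]
    refine integrableOn_congr_fun (fun y hy => ?_) measurableSet_Ioo
    rw [Real.rpow_add_one hy.1.ne', mul_comm]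
  rw [h3, intervalIntegral.integrableOn_Ioo_rpow_iff hr]
  constructor <;> intro h <;> linarith

/-- A weighted square integrability condition forces vanishing at the origin, with Schwarz bounds. -/
theorem norm_le_mul_pow_of_lintegral {R : ℝ} (hR : 0 < R) (k : ℕ) : ∀ {φ : ℂ → ℂ} {M w : ℝ},
    DifferentiableOn ℂ φ (Metric.ball 0 R) → (∀ s ∈ Metric.ball (0 : ℂ) R, ‖φ s‖ ≤ M) → (k = 0 ∨ w ≤ -2 * k) →
    (k ≠ 0 → ∫⁻ s in Metric.ball (0 : ℂ) R, ENNReal.ofReal (‖φ s‖ ^ 2 * ‖s‖ ^ w) ≠ ⊤) →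
    ∀ s ∈ Metric.ball (0 : ℂ) R, ‖φ s‖ ≤ M * (‖s‖ / R) ^ k := by
  induction k with
  | zero =>
    intro φ M w _ hM _ _ s hs
    simpa using hM s hs
  | succ k ih =>
    intro φ M w hφ hM hw hint s hs
    have hw' : w ≤ -2 * (k + 1 : ℕ) := hw.resolve_left (Nat.succ_ne_zero k)
    push_cast at hw'
    have hint' := hint (Nat.succ_ne_zero k)
    have hball : Metric.ball (0 : ℂ) R ∈ nhds (0 : ℂ) := Metric.ball_mem_nhds _ hR
    have h0 : φ 0 = 0 := by
      by_contra hne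
      have hpos : 0 < ‖φ 0‖ / 2 := by positivity
      have hc : ContinuousAt φ 0 := hφ.continuousOn.continuousAt hball
      have hev : ∀ᶠ s in nhds (0 : ℂ), ‖φ 0‖ / 2 < ‖φ s‖ := hc.norm.eventually (lt_mem_nhds (by linarith))
      obtain ⟨r, hr, hrs⟩ := Metric.eventually_nhds_iff_ball.1 (hev.and hball)
      have h1 : ∫⁻ s in Metric.ball (0 : ℂ) r, ENNReal.ofReal ((‖φ 0‖ / 2) ^ 2) * ENNReal.ofReal (‖s‖ ^ w) ≠ ⊤ := by
        refine ne_top_of_le_ne_top hint' ?_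
        refine (setLIntegral_mono' measurableSet_ball fun s hs => ?_).trans
          (lintegral_mono_set fun s hs => (hrs s hs).2)
        rw [← ENNReal.ofReal_mul (by positivity)]
        refine ENNReal.ofReal_le_ofReal (mul_le_mul_of_nonneg_right ?_ (by positivity))
        exact pow_le_pow_left₀ hpos.le (hrs s hs).1.le 2
      rw [lintegral_const_mul' _ _ ENNReal.ofReal_ne_top] at h1
      have h2 : ∫⁻ s in Metric.ball (0 : ℂ) r, ENNReal.ofReal (‖s‖ ^ w) ≠ ⊤ := by
        intro htop
        rw [htop, ENNReal.mul_top (by simpa using hne)] at h1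
        exact h1 rfl
      rw [lintegral_ball_norm_rpow_ne_top_iff w hr] at h2
      have : (0 : ℝ) ≤ k := Nat.cast_nonneg k
      linarith
    set ψ := dslope φ 0 with hψ
    have hφψ : ∀ s, φ s = s * ψ s := fun s => by
      have := sub_smul_dslope φ 0 s
      rw [h0, sub_zero, sub_zero, smul_eq_mul] at this
      exact this.symm
    have hψd : DifferentiableOn ℂ ψ (Metric.ball 0 R) := (Complex.differentiableOn_dslope hball).2 hφ
    have hψM : ∀ s ∈ Metric.ball (0 : ℂ) R, ‖ψ s‖ ≤ M / R := by
      intro z hz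
      exact Complex.norm_dslope_le_div_of_mapsTo_ball hφ (fun z hz => by rw [h0]; simpa using hM z hz) hz
    have h1 := ih (φ := ψ) (M := M / R) (w := w + 2) hψd hψM (Or.inr (by linarith)) (fun _ => by
      refine ne_top_of_le_ne_top hint' (lintegral_mono_ae ?_)
      have hne : ∀ᵐ s : ℂ ∂(volume.restrict (Metric.ball 0 R)), s ≠ 0 :=
        ae_restrict_of_ae (by simp [ae_iff, measure_singleton])
      filter_upwards [hne] with s hs
      refine ENNReal.ofReal_le_ofReal (le_of_eq ?_)
      have hs' : 0 < ‖s‖ := norm_pos_iff.2 hs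
      rw [hφψ, norm_mul, Real.rpow_add hs', Real.rpow_two]
      ring) s hs
    rw [hφψ, norm_mul]
    calc ‖s‖ * ‖ψ s‖ ≤ ‖s‖ * (M / R * (‖s‖ / R) ^ k) := by gcongr
      _ = _ := by rw [pow_succ]; field_simp

theorem forall_le_of_ae_restrict {Y : Type*} [TopologicalSpace Y] [MeasurableSpace Y] {μ : Measure Y}
    [μ.IsOpenPosMeasure] {O : Set Y} (hO : IsOpen O) {a b : Y → ℝ} (ha : ContinuousOn a O) (hb : ContinuousOn b O)
    (h : ∀ᵐ y ∂(μ.restrict O), a y ≤ b y) : ∀ y ∈ O, a y ≤ b y := by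
  have h1 : (fun y => max (a y) (b y)) =ᵐ[μ.restrict O] b := by
    filter_upwards [h] with y hy using max_eq_right hy
  intro y hy
  have := Measure.eqOn_open_of_ae_eq h1 hO (ContinuousOn.sup ha hb) hb hy
  exact max_eq_right_iff.1 this

/-- A family version of `norm_le_mul_pow_of_lintegral`, valid at every parameter by continuity. -/
theorem norm_le_mul_pow_of_ae {Y : Type*} [TopologicalSpace Y] [MeasurableSpace Y] [OpensMeasurableSpace Y]
    {μ : Measure Y} [μ.IsOpenPosMeasure] {O : Set Y} (hO : IsOpen O) {h : Y → ℂ → ℂ} {M : Y → ℝ} {R w : ℝ} {k : ℕ}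
    (hR : 0 < R) (hd : ∀ y ∈ O, DifferentiableOn ℂ (h y) (Metric.ball 0 R))
    (hc : ∀ s ∈ Metric.ball (0 : ℂ) R, ContinuousOn (fun y => h y s) O) (hM : ContinuousOn M O)
    (hb : ∀ y ∈ O, ∀ s ∈ Metric.ball (0 : ℂ) R, ‖h y s‖ ≤ M y) (hk : k = 0 ∨ w ≤ -2 * k)
    (hfin : k ≠ 0 → ∀ᵐ y ∂(μ.restrict O), ∫⁻ s in Metric.ball (0 : ℂ) R, ENNReal.ofReal (‖h y s‖ ^ 2 * ‖s‖ ^ w) ≠ ⊤) :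
    ∀ y ∈ O, ∀ s ∈ Metric.ball (0 : ℂ) R, ‖h y s‖ ≤ M y * (‖s‖ / R) ^ k := by
  rcases eq_or_ne k 0 with rfl | hk0
  · simpa using hb
  intro y hy s hs
  refine forall_le_of_ae_restrict (μ := μ) hO (hc s hs).norm (hM.mul continuousOn_const) ?_ y hy
  filter_upwards [hfin hk0, ae_restrict_mem hO.measurableSet] with y hy1 hy2
  exact norm_le_mul_pow_of_lintegral hR k (hd y hy2) (hb y hy2) hk (fun _ => hy1) s hs

theorem ae_lintegral_prod_ne_top {X Y : Type*} [MeasurableSpace X] [MeasurableSpace Y] {μ : Measure X}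
    {ν : Measure Y} [SFinite μ] [SFinite ν] {F : X × Y → ENNReal} (hF : AEMeasurable F (μ.prod ν))
    (h : ∫⁻ p, F p ∂(μ.prod ν) ≠ ⊤) :
    (∀ᵐ x ∂μ, ∫⁻ y, F (x, y) ∂ν ≠ ⊤) ∧ ∀ᵐ y ∂ν, ∫⁻ x, F (x, y) ∂μ ≠ ⊤ := by
  constructor
  · rw [lintegral_prod _ hF] at h
    filter_upwards [ae_lt_top' hF.lintegral_prod_right' h] with x hx using hx.ne
  · rw [lintegral_prod_symm _ hF] at h
    filter_upwards [ae_lt_top' hF.lintegral_prod_left' h] with x hx using hx.ne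

theorem volume_restrict_prod {X Y : Type*} [MeasureSpace X] [MeasureSpace Y] [SFinite (volume : Measure X)]
    [SFinite (volume : Measure Y)] (A : Set X) (B : Set Y) :
    (volume : Measure (X × Y)).restrict (A ×ˢ B) = (volume.restrict A).prod (volume.restrict B) := by
  rw [Measure.volume_eq_prod, Measure.prod_restrict]

/-- Vanishing of a weighted square integrable function along the first coordinate. -/
theorem norm_le_mul_pow_fst {h : ℂ × ℂ × ℂ → ℂ} {Z S : Set ℂ} {ε w₀ w₁ : ℝ} (hZ : IsOpen Z) (hS : IsOpen S) 
  (hh : DifferentiableOn ℂ h (Z ×ˢ Metric.ball (0 : ℂ) ε ×ˢ S))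
  (hfin : ∫⁻ p in Z ×ˢ Metric.ball (0 : ℂ) ε ×ˢ S, ENNReal.ofReal (‖h p‖ ^ 2 * (‖p.1‖ ^ w₀ * ‖p.2.1‖ ^ w₁)) ≠ ⊤)
    {r M : ℝ} (hr : 0 < r) (hZr : Z = Metric.ball 0 r)
    (hM : ∀ p ∈ Z ×ˢ Metric.ball (0 : ℂ) ε ×ˢ S, ‖h p‖ ≤ M) {k : ℕ} (hk : k = 0 ∨ w₀ ≤ -2 * k) :
    ∀ p ∈ Z ×ˢ Metric.ball (0 : ℂ) ε ×ˢ S, ‖h p‖ ≤ M * (‖p.1‖ / r) ^ k := by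
  subst hZr
  have hO : IsOpen (Metric.ball (0 : ℂ) ε ×ˢ S) := Metric.isOpen_ball.prod hS
  have hF : AEMeasurable (fun p : ℂ × ℂ × ℂ => ENNReal.ofReal (‖h p‖ ^ 2 * (‖p.1‖ ^ w₀ * ‖p.2.1‖ ^ w₁)))
      (volume.restrict (Metric.ball 0 r ×ˢ Metric.ball (0 : ℂ) ε ×ˢ S)) := by
    have h1 : AEMeasurable h (volume.restrict (Metric.ball 0 r ×ˢ Metric.ball (0 : ℂ) ε ×ˢ S)) :=
      hh.continuousOn.aemeasurable (hZ.prod hO).measurableSet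
    have h2 : Measurable fun p : ℂ × ℂ × ℂ => ‖p.1‖ ^ w₀ * ‖p.2.1‖ ^ w₁ := by fun_prop
    exact ((h1.norm.pow_const 2).mul h2.aemeasurable).ennreal_ofReal
  rw [volume_restrict_prod] at hF hfin
  have h1 := (ae_lintegral_prod_ne_top hF hfin).2
  have key := norm_le_mul_pow_of_ae (μ := volume) hO (h := fun y ζ => h (ζ, y)) (M := fun _ => M) (w := w₀) (k := k) hr
    (fun y hy => hh.comp (by fun_prop) fun ζ hζ => ⟨hζ, hy⟩)
    (fun ζ hζ => hh.continuousOn.comp (by fun_prop) fun y hy => ⟨hζ, hy⟩) continuousOn_const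
    (fun y hy ζ hζ => hM _ ⟨hζ, hy⟩) hk (fun _ => by
      have hne : ∀ᵐ y : ℂ × ℂ, y.1 ≠ 0 :=
        Measure.quasiMeasurePreserving_fst.ae (p := fun s : ℂ => s ≠ 0) (by simp [ae_iff, measure_singleton])
      filter_upwards [h1, ae_restrict_of_ae hne] with y hy hy0
      have hpos : 0 < ‖y.1‖ ^ w₁ := Real.rpow_pos_of_pos (norm_pos_iff.2 hy0) _
      have : ∫⁻ ζ in Metric.ball (0 : ℂ) r, ENNReal.ofReal (‖h (ζ, y)‖ ^ 2 * ‖ζ‖ ^ w₀) * ENNReal.ofReal (‖y.1‖ ^ w₁) ≠ ⊤ := by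
        refine ne_of_eq_of_ne (lintegral_congr fun ζ => ?_) hy
        rw [← ENNReal.ofReal_mul (by positivity)]
        congr 1; ring
      rw [lintegral_mul_const' _ _ ENNReal.ofReal_ne_top] at this
      intro htop
      rw [htop, ENNReal.top_mul (by simpa using hpos)] at this
      exact this rfl)
  exact fun p hp => key p.2 hp.2 p.1 hp.1

/-- Vanishing of a weighted square integrable function along the second coordinate. -/
theorem norm_le_mul_pow_snd {h : ℂ × ℂ × ℂ → ℂ} {Z S : Set ℂ} {ε w₀ w₁ : ℝ} (hZ : IsOpen Z) (hS : IsOpen S) (hε : 0 < ε)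
  (hh : DifferentiableOn ℂ h (Z ×ˢ Metric.ball (0 : ℂ) ε ×ˢ S))
  (hfin : ∫⁻ p in Z ×ˢ Metric.ball (0 : ℂ) ε ×ˢ S, ENNReal.ofReal (‖h p‖ ^ 2 * (‖p.1‖ ^ w₀ * ‖p.2.1‖ ^ w₁)) ≠ ⊤)
    {M : ℂ → ℝ} (hMc : ContinuousOn M Z)
    (hM : ∀ p ∈ Z ×ˢ Metric.ball (0 : ℂ) ε ×ˢ S, ‖h p‖ ≤ M p.1) {k : ℕ} (hk : k = 0 ∨ w₁ ≤ -2 * k) :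
    ∀ p ∈ Z ×ˢ Metric.ball (0 : ℂ) ε ×ˢ S, ‖h p‖ ≤ M p.1 * (‖p.2.1‖ / ε) ^ k := by
  have hO : IsOpen (Metric.ball (0 : ℂ) ε ×ˢ S) := Metric.isOpen_ball.prod hS
  have hF : AEMeasurable (fun p : ℂ × ℂ × ℂ => ENNReal.ofReal (‖h p‖ ^ 2 * (‖p.1‖ ^ w₀ * ‖p.2.1‖ ^ w₁)))
      (volume.restrict (Z ×ˢ Metric.ball (0 : ℂ) ε ×ˢ S)) := by
    have h1 : AEMeasurable h (volume.restrict (Z ×ˢ Metric.ball (0 : ℂ) ε ×ˢ S)) :=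
      hh.continuousOn.aemeasurable (hZ.prod hO).measurableSet
    have h2 : Measurable fun p : ℂ × ℂ × ℂ => ‖p.1‖ ^ w₀ * ‖p.2.1‖ ^ w₁ := by fun_prop
    exact ((h1.norm.pow_const 2).mul h2.aemeasurable).ennreal_ofReal
  rw [volume_restrict_prod] at hF hfin
  have h1 := (ae_lintegral_prod_ne_top hF hfin).1
  have hne : ∀ᵐ y : ℂ, y ≠ 0 := by simp [ae_iff, measure_singleton]
  suffices H : ∀ y ∈ Metric.ball (0 : ℂ) ε ×ˢ S, ∀ ζ ∈ Z, ‖h (ζ, y)‖ ≤ M ζ * (‖y.1‖ / ε) ^ k from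
    fun p hp => H p.2 hp.2 p.1 hp.1
  intro y hy
  refine forall_le_of_ae_restrict (μ := volume) hZ
    (hh.continuousOn.comp (f := fun ζ => (ζ, y)) (by fun_prop) fun ζ hζ => ⟨hζ, hy⟩).norm (hMc.mul continuousOn_const) ?_
  filter_upwards [h1, ae_restrict_of_ae hne, ae_restrict_mem hZ.measurableSet] with ζ hζ hζ0 hζZ
  have hpos : 0 < ‖ζ‖ ^ w₀ := Real.rpow_pos_of_pos (norm_pos_iff.2 hζ0) _
  have hcζ : ContinuousOn (fun y => h (ζ, y)) (Metric.ball (0 : ℂ) ε ×ˢ S) :=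
    hh.continuousOn.comp (by fun_prop) fun y hy => ⟨hζZ, hy⟩
  have hF2 : AEMeasurable (fun y : ℂ × ℂ => ENNReal.ofReal (‖h (ζ, y)‖ ^ 2 * (‖ζ‖ ^ w₀ * ‖y.1‖ ^ w₁)))
      (volume.restrict (Metric.ball (0 : ℂ) ε ×ˢ S)) := by
    have h2 : Measurable fun p : ℂ × ℂ => ‖ζ‖ ^ w₀ * ‖p.1‖ ^ w₁ := by fun_prop
    exact (((hcζ.aemeasurable hO.measurableSet).norm.pow_const 2).mul h2.aemeasurable).ennreal_ofReal
  rw [volume_restrict_prod] at hF2 hζ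
  have h3 := (ae_lintegral_prod_ne_top hF2 hζ).2
  refine norm_le_mul_pow_of_ae (μ := volume) hS (h := fun σ s => h (ζ, s, σ)) (M := fun _ => M ζ) (w := w₁) (k := k) hε
    (fun σ hσ => hh.comp (by fun_prop) fun s hs => ⟨hζZ, hs, hσ⟩)
    (fun s hs => hcζ.comp (by fun_prop) fun σ hσ => ⟨hs, hσ⟩) continuousOn_const
    (fun σ hσ s hs => hM _ ⟨hζZ, hs, hσ⟩) hk (fun _ => ?_) y.2 hy.2 y.1 hy.1
  filter_upwards [h3] with σ hσ
  have : ∫⁻ s in Metric.ball (0 : ℂ) ε, ENNReal.ofReal (‖ζ‖ ^ w₀) * ENNReal.ofReal (‖h (ζ, s, σ)‖ ^ 2 * ‖s‖ ^ w₁) ≠ ⊤ := by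
    refine ne_of_eq_of_ne (lintegral_congr fun s => ?_) hσ
    rw [← ENNReal.ofReal_mul (by positivity)]
    congr 1; ring
  rw [lintegral_const_mul' _ _ ENNReal.ofReal_ne_top] at this
  intro htop
  rw [htop, ENNReal.mul_top (by simpa using hpos)] at this
  exact this rfl

section
variable {ι : Type*} [Fintype ι] (ℓ : ι → ((Fin 3 → ℂ) →ₗ[ℂ] ℂ))

/-- The product of a family of linear forms. -/
def formProd (x : Fin 3 → ℂ) : ℂ := ∏ i, ℓ i x

/-- The forms of the family vanishing at `x`. -/
def formsAt (x : Fin 3 → ℂ) : Finset ι := Finset.univ.filter fun i => ℓ i x = 0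

/-- The angular factor of a product of linear forms in a cone chart. -/
def angular (e : Module.Basis (Fin 3) ℂ (Fin 3 → ℂ)) (σ : ℂ) : ℝ :=
  ∏ i ∈ formsAt ℓ (e 0), ‖ℓ i (e 1) + σ * ℓ i (e 2)‖

variable {ℓ}

theorem mem_formsAt {x : Fin 3 → ℂ} {i : ι} : i ∈ formsAt ℓ x ↔ ℓ i x = 0 := by simp [formsAt]

theorem continuous_formProd : Continuous (formProd ℓ) :=
  continuous_finsetProd _ fun i _ => (ℓ i).continuous_of_finiteDimensional

theorem angular_nonneg (e : Module.Basis (Fin 3) ℂ (Fin 3 → ℂ)) (σ : ℂ) : 0 ≤ angular ℓ e σ :=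
  Finset.prod_nonneg fun _ _ => norm_nonneg _

theorem measurable_angular (e : Module.Basis (Fin 3) ℂ (Fin 3 → ℂ)) : Measurable (angular ℓ e) := by
  have : Continuous (angular ℓ e) := continuous_finsetProd _ fun i _ => by fun_prop
  exact this.measurable

theorem norm_formProd_coneMap (e : Module.Basis (Fin 3) ℂ (Fin 3 → ℂ)) (ζ s σ : ℂ) :
    ‖formProd ℓ (coneMap e (ζ, s, σ))‖ = ‖ζ‖ ^ Fintype.card ι * ‖s‖ ^ (formsAt ℓ (e 0)).card * angular ℓ e σ *
      ∏ i ∈ (formsAt ℓ (e 0))ᶜ, ‖ℓ i (e 0) + s * (ℓ i (e 1) + σ * ℓ i (e 2))‖ := by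
  have h1 : ∀ i, ℓ i (coneMap e (ζ, s, σ)) = ζ * (ℓ i (e 0) + s * (ℓ i (e 1) + σ * ℓ i (e 2))) := fun i => by
    simp [coneMap]; ring
  rw [formProd, norm_prod]
  simp only [h1, norm_mul]
  rw [Finset.prod_mul_distrib, Finset.prod_const, Finset.card_univ,
    ← Finset.prod_mul_prod_compl (formsAt ℓ (e 0)) fun i => ‖ℓ i (e 0) + s * (ℓ i (e 1) + σ * ℓ i (e 2))‖]
  have h2 : ∏ i ∈ formsAt ℓ (e 0), ‖ℓ i (e 0) + s * (ℓ i (e 1) + σ * ℓ i (e 2))‖ =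
      ‖s‖ ^ (formsAt ℓ (e 0)).card * angular ℓ e σ := by
    rw [angular, ← Finset.prod_const, ← Finset.prod_mul_distrib]
    refine Finset.prod_congr rfl fun i hi => ?_
    rw [mem_formsAt.1 hi, zero_add, norm_mul]
  rw [h2]
  ring

/-- In a small cone chart the product is a monomial times the angular factor times a unit. -/
theorem exists_norm_formProd_coneMap_eq (ℓ : ι → ((Fin 3 → ℂ) →ₗ[ℂ] ℂ)) (e : Module.Basis (Fin 3) ℂ (Fin 3 → ℂ)) :
    ∃ ε > 0, ∃ c > 0, ∃ C > 0, (∀ σ ∈ Metric.ball (0 : ℂ) 2, angular ℓ e σ ≤ C) ∧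
      ∀ ζ, ∀ s ∈ Metric.ball (0 : ℂ) ε, ∀ σ ∈ Metric.ball (0 : ℂ) 2, ∃ Y, c ≤ Y ∧ Y ≤ C ∧
        ‖formProd ℓ (coneMap e (ζ, s, σ))‖ =
          ‖ζ‖ ^ Fintype.card ι * ‖s‖ ^ (formsAt ℓ (e 0)).card * angular ℓ e σ * Y := by
  set B : ℝ := 1 + ∑ i, (‖ℓ i (e 0)‖ + (‖ℓ i (e 1)‖ + 2 * ‖ℓ i (e 2)‖)) with hB
  have hBi : ∀ i, ‖ℓ i (e 0)‖ + (‖ℓ i (e 1)‖ + 2 * ‖ℓ i (e 2)‖) ≤ B := fun i => by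
    have := Finset.single_le_sum (f := fun i => ‖ℓ i (e 0)‖ + (‖ℓ i (e 1)‖ + 2 * ‖ℓ i (e 2)‖)) (fun _ _ => by positivity)
      (Finset.mem_univ i)
    linarith
  have hB1 : 1 ≤ B := by
    have : 0 ≤ ∑ i, (‖ℓ i (e 0)‖ + (‖ℓ i (e 1)‖ + 2 * ‖ℓ i (e 2)‖)) := Finset.sum_nonneg fun _ _ => by positivity
    linarith
  obtain ⟨δ, hδ, hδi⟩ : ∃ δ > 0, ∀ i ∈ (formsAt ℓ (e 0))ᶜ, δ ≤ ‖ℓ i (e 0)‖ := by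
    by_cases hne : ((formsAt ℓ (e 0))ᶜ).Nonempty
    · obtain ⟨i, hi, hmin⟩ := Finset.exists_min_image _ (fun i => ‖ℓ i (e 0)‖) hne
      refine ⟨_, norm_pos_iff.2 fun h => ?_, hmin⟩
      simp [mem_formsAt, h] at hi
    · exact ⟨1, one_pos, fun i hi => absurd ⟨i, hi⟩ hne⟩
  have hlin : ∀ i, ∀ σ ∈ Metric.ball (0 : ℂ) 2, ‖ℓ i (e 1) + σ * ℓ i (e 2)‖ ≤ B - ‖ℓ i (e 0)‖ := fun i σ hσ => by
    have h1 := norm_add_le (ℓ i (e 1)) (σ * ℓ i (e 2))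
    rw [norm_mul] at h1
    have h2 : ‖σ‖ ≤ 2 := by simpa using (mem_ball_zero_iff.1 hσ).le
    have h3 := mul_le_mul_of_nonneg_right h2 (norm_nonneg (ℓ i (e 2)))
    have := hBi i
    linarith
  have hε : 0 < min 1 (δ / (2 * B)) := by positivity
  refine ⟨min 1 (δ / (2 * B)), hε, (δ / 2) ^ ((formsAt ℓ (e 0))ᶜ).card, by positivity, B ^ Fintype.card ι, by positivity,
    fun σ hσ => ?_, fun ζ s hs σ hσ => ⟨_, ?_, ?_, norm_formProd_coneMap e ζ s σ⟩⟩
  · calc angular ℓ e σ ≤ ∏ i ∈ formsAt ℓ (e 0), B :=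
          Finset.prod_le_prod (fun _ _ => norm_nonneg _) fun i _ => (hlin i σ hσ).trans (by linarith [norm_nonneg (ℓ i (e 0))])
      _ ≤ _ := by rw [Finset.prod_const]; exact pow_le_pow_right₀ hB1 (Finset.card_le_univ _)
  · rw [← Finset.prod_const]
    refine Finset.prod_le_prod (fun _ _ => by positivity) fun i hi => ?_
    have h1 := norm_sub_le (ℓ i (e 0) + s * (ℓ i (e 1) + σ * ℓ i (e 2))) (s * (ℓ i (e 1) + σ * ℓ i (e 2)))
    rw [add_sub_cancel_right, norm_mul] at h1
    have h2 : ‖s‖ ≤ δ / (2 * B) := (mem_ball_zero_iff.1 hs).le.trans (min_le_right _ _)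
    have h3 : ‖s‖ * ‖ℓ i (e 1) + σ * ℓ i (e 2)‖ ≤ δ / (2 * B) * B :=
      mul_le_mul h2 ((hlin i σ hσ).trans (by linarith [norm_nonneg (ℓ i (e 0))])) (norm_nonneg _) (by positivity)
    have h4 : δ / (2 * B) * B = δ / 2 := by field_simp
    have := hδi i hi
    linarith
  · calc _ ≤ ∏ i ∈ (formsAt ℓ (e 0))ᶜ, B := by
          refine Finset.prod_le_prod (fun _ _ => norm_nonneg _) fun i _ => ?_
          have h1 := norm_add_le (ℓ i (e 0)) (s * (ℓ i (e 1) + σ * ℓ i (e 2)))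
          rw [norm_mul] at h1
          have h2 : ‖s‖ ≤ 1 := (mem_ball_zero_iff.1 hs).le.trans (min_le_left _ _)
          have h3 := mul_le_mul h2 (hlin i σ hσ) (norm_nonneg _) zero_le_one
          linarith
      _ ≤ _ := by rw [Finset.prod_const]; exact pow_le_pow_right₀ hB1 (Finset.card_le_univ _)

theorem form_eq_zero_of_basis (e : Module.Basis (Fin 3) ℂ (Fin 3 → ℂ)) {φ : (Fin 3 → ℂ) →ₗ[ℂ] ℂ}
    (h0 : φ (e 0) = 0) (h1 : φ (e 1) = 0) (h2 : φ (e 2) = 0) : φ = 0 := by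
  refine e.ext fun i => ?_
  fin_cases i <;> simpa

theorem finite_angular_eq_zero (hne : ∀ i, ℓ i ≠ 0) (e : Module.Basis (Fin 3) ℂ (Fin 3 → ℂ)) :
    {σ | angular ℓ e σ = 0}.Finite := by
  have : {σ | angular ℓ e σ = 0} ⊆ ⋃ i : ι, {σ | i ∈ formsAt ℓ (e 0) ∧ ℓ i (e 1) + σ * ℓ i (e 2) = 0} := by
    intro σ hσ
    obtain ⟨i, hi, h⟩ := Finset.prod_eq_zero_iff.1 (show ∏ i ∈ formsAt ℓ (e 0), _ = (0 : ℝ) from hσ)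
    exact Set.mem_iUnion.2 ⟨i, hi, norm_eq_zero.1 h⟩
  refine (Set.finite_iUnion fun i => ?_).subset this
  refine Set.Subsingleton.finite fun σ hσ τ hτ => ?_
  by_cases h2 : ℓ i (e 2) = 0
  · have h1 : ℓ i (e 1) = 0 := by simpa [h2] using hσ.2
    exact absurd (form_eq_zero_of_basis e (mem_formsAt.1 hσ.1) h1 h2) (hne i)
  · have := hσ.2.trans hτ.2.symm
    exact mul_right_cancel₀ h2 (add_left_cancel this)

theorem lintegral_angular_rpow_ne_top (hnp : ∀ i j, i ≠ j → ∀ c : ℂ, ℓ i ≠ c • ℓ j)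
    (e : Module.Basis (Fin 3) ℂ (Fin 3 → ℂ)) {α : ℝ} (hα0 : 0 ≤ α) (hα1 : α < 1) :
    ∫⁻ σ in Metric.ball (0 : ℂ) 2, ENNReal.ofReal (angular ℓ e σ ^ (-2 * α)) ≠ ⊤ := by
  set J := (formsAt ℓ (e 0)).filter fun i => ℓ i (e 2) ≠ 0 with hJ
  set c : ℝ := (∏ i ∈ J, ‖ℓ i (e 2)‖) * ∏ i ∈ (formsAt ℓ (e 0)).filter (fun i => ¬ ℓ i (e 2) ≠ 0), ‖ℓ i (e 1)‖ with hc
  let a : J → ℂ := fun i => -(ℓ i (e 1) / ℓ i (e 2))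
  have hJ2 : ∀ i : J, ℓ i (e 2) ≠ 0 := fun i => (Finset.mem_filter.1 i.2).2
  have hJ0 : ∀ i : J, ℓ i (e 0) = 0 := fun i => mem_formsAt.1 (Finset.mem_filter.1 i.2).1
  have hang : ∀ σ, angular ℓ e σ = c * ∏ i : J, ‖σ - a i‖ := by
    intro σ
    have h1 : ∏ i : J, ‖σ - a i‖ = ∏ i ∈ J, ‖σ - -(ℓ i (e 1) / ℓ i (e 2))‖ :=
      Finset.prod_coe_sort J fun i => ‖σ - -(ℓ i (e 1) / ℓ i (e 2))‖
    rw [angular, ← Finset.prod_filter_mul_prod_filter_not _ (fun i => ℓ i (e 2) ≠ 0), h1, hc, mul_right_comm,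
      ← Finset.prod_mul_distrib]
    congr 1
    · refine Finset.prod_congr rfl fun i hi => ?_
      have := (Finset.mem_filter.1 hi).2
      rw [← norm_mul]
      congr 1
      field_simp
      ring
    · refine Finset.prod_congr rfl fun i hi => ?_
      have := (Finset.mem_filter.1 hi).2
      push Not at this
      simp [this]
  have ha : Function.Injective a := by
    intro i j hij
    by_contra hne'
    have hi : (i : ι) ≠ j := fun h => hne' (Subtype.ext h)
    refine hnp i j hi (ℓ i (e 2) / ℓ j (e 2)) (sub_eq_zero.1 (form_eq_zero_of_basis e ?_ ?_ ?_))
    · simp [hJ0]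
    · have h3 : ℓ i (e 1) / ℓ i (e 2) = ℓ j (e 1) / ℓ j (e 2) := neg_injective hij
      have := hJ2 i; have := hJ2 j
      simp
      field_simp at h3 ⊢
      linear_combination h3
    · simp [hJ2 j]
  have hrp : ∀ σ, angular ℓ e σ ^ (-2 * α) = c ^ (-2 * α) * (rootWt a α σ)⁻¹ ^ 2 := by
    intro σ
    rw [hang, Real.mul_rpow (by positivity) (by positivity), rootWt, Real.finsetProd_rpow _ _ (fun _ _ => norm_nonneg _),
      show -2 * α = -(α * 2) by ring, Real.rpow_neg (Finset.prod_nonneg fun _ _ => norm_nonneg _), Real.rpow_mul (Finset.prod_nonneg fun _ _ => norm_nonneg _), Real.rpow_two, inv_pow]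
  have hcn : 0 ≤ c ^ (-2 * α) := by positivity
  simp_rw [hrp, ENNReal.ofReal_mul hcn]
  rw [lintegral_const_mul' _ _ ENNReal.ofReal_ne_top]
  refine ENNReal.mul_ne_top ENNReal.ofReal_ne_top ?_
  rcases isEmpty_or_nonempty J with hE | hN
  · simp [rootWt]
    finiteness
  · obtain ⟨C, hC, hle⟩ := exists_inv_rootWt_sq_le ha hα0
    have hcard : (1 : ℝ) ≤ Fintype.card J := by exact_mod_cast Fintype.card_pos
    have h1 : ∀ σ, ENNReal.ofReal ((rootWt a α σ)⁻¹ ^ 2) ≤ ENNReal.ofReal C * ∑ j, ENNReal.ofReal (‖σ - a j‖ ^ (-2 * α)) := by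
      intro σ
      rw [← ENNReal.ofReal_sum_of_nonneg (fun _ _ => by positivity), ← ENNReal.ofReal_mul hC.le]
      refine ENNReal.ofReal_le_ofReal ((hle σ).trans (mul_le_mul_of_nonneg_left (Finset.sum_le_sum fun j _ => ?_) hC.le))
      refine mul_le_of_le_one_right (by positivity) (Real.rpow_le_one_of_one_le_of_nonpos (by linarith [norm_nonneg (σ - a j)]) ?_)
      have : 0 ≤ 2 * α * (Fintype.card J - 1 : ℝ) := by
        have : (0 : ℝ) ≤ Fintype.card J - 1 := by linarith
        positivity
      linarith
    refine ne_top_of_le_ne_top ?_ (lintegral_mono h1)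
    rw [lintegral_const_mul' _ _ ENNReal.ofReal_ne_top, lintegral_finsetSum _ fun j _ => by fun_prop]
    refine ENNReal.mul_ne_top ENNReal.ofReal_ne_top (ENNReal.sum_ne_top.2 fun j _ => ?_)
    have h2 := (lintegral_ball_norm_rpow_ne_top_iff (-2 * α) (r := 2 + ‖a j‖) (by positivity)).2 (by linarith)
    refine ne_top_of_le_ne_top h2 ?_
    rw [← lintegral_indicator measurableSet_ball, ← lintegral_indicator measurableSet_ball,
      ← lintegral_sub_right_eq_self (Set.indicator (Metric.ball 0 (2 + ‖a j‖)) _) (a j)]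
    refine lintegral_mono fun σ => ?_
    by_cases hσ : σ ∈ Metric.ball (0 : ℂ) 2
    · have : σ - a j ∈ Metric.ball (0 : ℂ) (2 + ‖a j‖) := by
        rw [mem_ball_zero_iff] at hσ ⊢
        linarith [norm_sub_le σ (a j)]
      rw [Set.indicator_of_mem hσ, Set.indicator_of_mem this]
    · rw [Set.indicator_of_notMem hσ]
      exact bot_le
end

section
variable {ι : Type*} [Fintype ι]

/-- A radius on which a cone chart splits the product of forms as in `exists_norm_formProd_coneMap_eq`. -/
def ConeRadius (ℓ : ι → ((Fin 3 → ℂ) →ₗ[ℂ] ℂ)) (e : Module.Basis (Fin 3) ℂ (Fin 3 → ℂ)) (ε : ℝ) : Prop :=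
  0 < ε ∧ ∃ c > 0, ∃ C > 0, (∀ σ ∈ Metric.ball (0 : ℂ) 2, angular ℓ e σ ≤ C) ∧
    ∀ ζ, ∀ s ∈ Metric.ball (0 : ℂ) ε, ∀ σ ∈ Metric.ball (0 : ℂ) 2, ∃ Y, c ≤ Y ∧ Y ≤ C ∧
      ‖formProd ℓ (coneMap e (ζ, s, σ))‖ =
        ‖ζ‖ ^ Fintype.card ι * ‖s‖ ^ (formsAt ℓ (e 0)).card * angular ℓ e σ * Y

/-- The weighted square of `g`. -/
def wSq (ℓ : ι → ((Fin 3 → ℂ) →ₗ[ℂ] ℂ)) (β : ℝ) (g : (Fin 3 → ℂ) → ℂ) (x : Fin 3 → ℂ) : ENNReal :=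
  ENNReal.ofReal (‖g x‖ ^ 2 * ‖formProd ℓ x‖ ^ (-2 * β))

/-- The image of a cone chart over `Z`, with slope at most `ε`. -/
def coneSet (e : Module.Basis (Fin 3) ℂ (Fin 3 → ℂ)) (Z : Set ℂ) (ε : ℝ) : Set (Fin 3 → ℂ) :=
  {x | e.coord 0 x ∈ Z ∧ ‖e.coord 1 x‖ < ε * ‖e.coord 0 x‖ ∧ ‖e.coord 2 x‖ ≤ ‖e.coord 1 x‖}

variable {ℓ : ι → ((Fin 3 → ℂ) →ₗ[ℂ] ℂ)} {e : Module.Basis (Fin 3) ℂ (Fin 3 → ℂ)} {ε : ℝ}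

theorem exists_coneRadius (ℓ : ι → ((Fin 3 → ℂ) →ₗ[ℂ] ℂ)) (e : Module.Basis (Fin 3) ℂ (Fin 3 → ℂ)) :
    ∃ ε, ConeRadius ℓ e ε :=
  let ⟨ε, hε, h⟩ := exists_norm_formProd_coneMap_eq ℓ e
  ⟨ε, hε, h⟩

theorem ConeRadius.mono {δ : ℝ} (h : ConeRadius ℓ e ε) (hδ : 0 < δ) (hle : δ ≤ ε) : ConeRadius ℓ e δ := by
  obtain ⟨_, c, hc, C, hC, h1, h2⟩ := h
  exact ⟨hδ, c, hc, C, hC, h1, fun ζ s hs => h2 ζ s (Metric.ball_subset_ball hle hs)⟩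

theorem measurable_wSq {g : (Fin 3 → ℂ) → ℂ} (hg : Measurable g) (β : ℝ) : Measurable (wSq ℓ β g) := by
  have h1 : Measurable (formProd ℓ) := continuous_formProd.measurable
  unfold wSq
  fun_prop

theorem coord_coneMap (e : Module.Basis (Fin 3) ℂ (Fin 3 → ℂ)) (p : ℂ × ℂ × ℂ) :
    e.coord 0 (coneMap e p) = p.1 ∧ e.coord 1 (coneMap e p) = p.1 * p.2.1 ∧
      e.coord 2 (coneMap e p) = p.1 * (p.2.1 * p.2.2) := by
  simp [coneMap]

theorem ae_ne_zero_prod : ∀ᵐ p : ℂ × ℂ × ℂ, p.1 ≠ 0 ∧ p.2.1 ≠ 0 := by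
  have h0 : ∀ᵐ y : ℂ, y ≠ 0 := by simp [ae_iff, measure_singleton]
  have h1 : ∀ᵐ p : ℂ × ℂ × ℂ, p.1 ≠ 0 := Measure.quasiMeasurePreserving_fst.ae (p := fun s : ℂ => s ≠ 0) h0
  have h2 : ∀ᵐ p : ℂ × ℂ, p.1 ≠ 0 := Measure.quasiMeasurePreserving_fst.ae (p := fun s : ℂ => s ≠ 0) h0
  have h3 : ∀ᵐ p : ℂ × ℂ × ℂ, p.2.1 ≠ 0 := Measure.quasiMeasurePreserving_snd.ae (p := fun s : ℂ × ℂ => s.1 ≠ 0) h2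
  filter_upwards [h1, h3] with p hp hq using ⟨hp, hq⟩

theorem lintegral_coneMap_ne_top (hne : ∀ i, ℓ i ≠ 0) (hε : ConeRadius ℓ e ε) {β : ℝ} (hβ : 0 ≤ β)
    {g : (Fin 3 → ℂ) → ℂ} (hg : Measurable g) {Z : Set ℂ} (hZ : IsOpen Z) {W : Set (Fin 3 → ℂ)} (hW : MeasurableSet W)
    (hsub : ∀ p ∈ Z ×ˢ Metric.ball (0 : ℂ) ε ×ˢ Metric.ball (0 : ℂ) 2, coneMap e p ∈ W)
    (hfin : ∫⁻ x in W, wSq ℓ β g x ≠ ⊤) :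
    ∫⁻ p in Z ×ˢ Metric.ball (0 : ℂ) ε ×ˢ Metric.ball (0 : ℂ) 2, ENNReal.ofReal (‖g (coneMap e p)‖ ^ 2 *
      (‖p.1‖ ^ (4 - 2 * β * Fintype.card ι) * ‖p.2.1‖ ^ (2 - 2 * β * (formsAt ℓ (e 0)).card))) ≠ ⊤ := by
  obtain ⟨hε0, c, hc, C, hC, hang, hfac⟩ := hε
  obtain ⟨κ, hκ0, hκ, hint⟩ := exists_lintegral_eq_coneMap e
  rw [← lintegral_indicator hW, hint _ ((measurable_wSq hg β).indicator hW)] at hfin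
  have hfin' : ∫⁻ p : ℂ × ℂ × ℂ, W.indicator (wSq ℓ β g) (coneMap e p) * ENNReal.ofReal (‖p.1‖ ^ 4 * ‖p.2.1‖ ^ 2) ≠ ⊤ :=
    fun h => hfin (by rw [h, ENNReal.mul_top hκ0])
  have hangne : ∀ᵐ p : ℂ × ℂ × ℂ, angular ℓ e p.2.2 ≠ 0 := by
    have h1 : ∀ᵐ σ : ℂ, angular ℓ e σ ≠ 0 := by
      rw [ae_iff]; simpa using (finite_angular_eq_zero hne e).measure_zero volume
    have h2 : ∀ᵐ p : ℂ × ℂ, angular ℓ e p.2 ≠ 0 := Measure.quasiMeasurePreserving_snd.ae (p := fun s : ℂ => angular ℓ e s ≠ 0) h1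
    exact Measure.quasiMeasurePreserving_snd.ae (p := fun s : ℂ × ℂ => angular ℓ e s.2 ≠ 0) h2
  have hR : MeasurableSet (Z ×ˢ Metric.ball (0 : ℂ) ε ×ˢ Metric.ball (0 : ℂ) 2) :=
    (hZ.prod (Metric.isOpen_ball.prod Metric.isOpen_ball)).measurableSet
  have hCC : (0 : ℝ) ≤ (C * C) ^ (2 * β) := by positivity
  have hle : ∫⁻ p in Z ×ˢ Metric.ball (0 : ℂ) ε ×ˢ Metric.ball (0 : ℂ) 2, ENNReal.ofReal (‖g (coneMap e p)‖ ^ 2 *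
      (‖p.1‖ ^ (4 - 2 * β * Fintype.card ι) * ‖p.2.1‖ ^ (2 - 2 * β * (formsAt ℓ (e 0)).card))) ≤
      ∫⁻ p : ℂ × ℂ × ℂ, ENNReal.ofReal ((C * C) ^ (2 * β)) *
        (W.indicator (wSq ℓ β g) (coneMap e p) * ENNReal.ofReal (‖p.1‖ ^ 4 * ‖p.2.1‖ ^ 2)) := by
    rw [← lintegral_indicator hR]
    refine lintegral_mono_ae ?_
    filter_upwards [hangne, ae_ne_zero_prod] with p hp hq
    by_cases hpR : p ∈ Z ×ˢ Metric.ball (0 : ℂ) ε ×ˢ Metric.ball (0 : ℂ) 2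
    swap
    · rw [Set.indicator_of_notMem hpR]; exact bot_le
    obtain ⟨Y, hcY, hYC, hY⟩ := hfac p.1 p.2.1 hpR.2.1 p.2.2 hpR.2.2
    rw [Set.indicator_of_mem hpR, Set.indicator_of_mem (hsub p hpR), wSq, ← ENNReal.ofReal_mul (by positivity),
      ← ENNReal.ofReal_mul hCC]
    refine ENNReal.ofReal_le_ofReal ?_
    have hz : 0 < ‖p.1‖ := norm_pos_iff.2 hq.1
    have hs : 0 < ‖p.2.1‖ := norm_pos_iff.2 hq.2
    have hA : 0 < angular ℓ e p.2.2 := lt_of_le_of_ne (angular_nonneg e _) (Ne.symm hp)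
    have hYp : 0 < Y := hc.trans_le hcY
    have h1 : (C * C) ^ (-2 * β) ≤ (angular ℓ e p.2.2 * Y) ^ (-2 * β) :=
      Real.rpow_le_rpow_of_nonpos (by positivity) (mul_le_mul (hang _ hpR.2.2) hYC hYp.le hC.le) (by linarith)
    have h2 : (C * C) ^ (2 * β) * (C * C) ^ (-2 * β) = 1 := by
      rw [← Real.rpow_add (by positivity)]; simp
    have h3 : ‖p.1‖ ^ (4 - 2 * β * Fintype.card ι) = ‖p.1‖ ^ 4 * (‖p.1‖ ^ Fintype.card ι) ^ (-2 * β) := by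
      rw [← Real.rpow_natCast, ← Real.rpow_natCast, ← Real.rpow_mul hz.le, ← Real.rpow_add hz]
      congr 1; push_cast; ring
    have h4 : ‖p.2.1‖ ^ (2 - 2 * β * (formsAt ℓ (e 0)).card) = ‖p.2.1‖ ^ 2 * (‖p.2.1‖ ^ (formsAt ℓ (e 0)).card) ^ (-2 * β) := by
      rw [← Real.rpow_natCast, ← Real.rpow_natCast, ← Real.rpow_mul hs.le, ← Real.rpow_add hs]
      congr 1; push_cast; ring
    rw [show coneMap e p = coneMap e (p.1, p.2.1, p.2.2) from rfl, hY, mul_assoc (_ * _) (angular ℓ e p.2.2) Y,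
      Real.mul_rpow (y := angular ℓ e p.2.2 * Y) (by positivity) (by positivity),
      Real.mul_rpow (x := ‖p.1‖ ^ Fintype.card ι) (by positivity) (by positivity), h3, h4]
    set X := ‖g (coneMap e (p.1, p.2.1, p.2.2))‖ ^ 2
    set A := (‖p.1‖ ^ Fintype.card ι) ^ (-2 * β)
    set B := (‖p.2.1‖ ^ (formsAt ℓ (e 0)).card) ^ (-2 * β)
    set T := (angular ℓ e p.2.2 * Y) ^ (-2 * β)
    have h5 : 1 ≤ (C * C) ^ (2 * β) * T := h2 ▸ mul_le_mul_of_nonneg_left h1 hCC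
    have h6 : 0 ≤ X * (‖p.1‖ ^ 4 * A * (‖p.2.1‖ ^ 2 * B)) := by positivity
    nlinarith [mul_le_mul_of_nonneg_left h5 h6]
  refine ne_top_of_le_ne_top ?_ hle
  rw [lintegral_const_mul' _ _ ENNReal.ofReal_ne_top]
  exact ENNReal.mul_ne_top ENNReal.ofReal_ne_top hfin'

theorem measurableSet_coneSet {Z : Set ℂ} (hZ : IsOpen Z) : MeasurableSet (coneSet e Z ε) := by
  have h : ∀ i, Measurable (e.coord i) := fun i => (e.coord i).continuous_of_finiteDimensional.measurable
  refine (h 0 hZ.measurableSet).inter ((measurableSet_lt (h 1).norm ((h 0).norm.const_mul ε)).inter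
    (measurableSet_le (h 2).norm (h 1).norm))

theorem lintegral_coneSet_ne_top (hnp : ∀ i j, i ≠ j → ∀ c : ℂ, ℓ i ≠ c • ℓ j)
    (hε : ConeRadius ℓ e ε) {α : ℝ} (hα0 : 0 ≤ α) (hα1 : α < 1)
    {g : (Fin 3 → ℂ) → ℂ} (hg : Measurable g) {Z : Set ℂ} (hZ : IsOpen Z) {k n : ℕ} {M : ℝ}
    (hM : ∀ ζ ∈ Z, ∀ s ∈ Metric.ball (0 : ℂ) ε, ∀ σ : ℂ, ‖σ‖ ≤ 1 → ‖g (coneMap e (ζ, s, σ))‖ ≤ M * ‖ζ‖ ^ k * ‖s‖ ^ n)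
    (hk : ∫⁻ ζ in Z, ENNReal.ofReal (‖ζ‖ ^ (2 * k + 4 - 2 * α * Fintype.card ι)) ≠ ⊤)
    (hn : α * (formsAt ℓ (e 0)).card < n + 2) :
    ∫⁻ x in coneSet e Z ε, wSq ℓ α g x ≠ ⊤ := by
  obtain ⟨hε0, c, hc, C, hC, hang, hfac⟩ := hε
  obtain ⟨κ, hκ0, hκ, hint⟩ := exists_lintegral_eq_coneMap e
  have hS := measurableSet_coneSet (e := e) (ε := ε) hZ
  rw [← lintegral_indicator hS, hint _ ((measurable_wSq hg α).indicator hS)]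
  refine ENNReal.mul_ne_top hκ ?_
  have hR : MeasurableSet (Z ×ˢ Metric.ball (0 : ℂ) ε ×ˢ Metric.ball (0 : ℂ) 2) :=
    (hZ.prod (Metric.isOpen_ball.prod Metric.isOpen_ball)).measurableSet
  let a : ℂ → ENNReal := fun ζ => ENNReal.ofReal (‖ζ‖ ^ (2 * k + 4 - 2 * α * Fintype.card ι))
  let b : ℂ → ENNReal := fun s => ENNReal.ofReal (‖s‖ ^ (2 * n + 2 - 2 * α * (formsAt ℓ (e 0)).card))
  let t : ℂ → ENNReal := fun σ => ENNReal.ofReal (angular ℓ e σ ^ (-2 * α))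
  have hcc : (0 : ℝ) ≤ M ^ 2 * c ^ (-2 * α) := by positivity
  have hle : ∫⁻ p : ℂ × ℂ × ℂ, (coneSet e Z ε).indicator (wSq ℓ α g) (coneMap e p) * ENNReal.ofReal (‖p.1‖ ^ 4 * ‖p.2.1‖ ^ 2)
      ≤ ∫⁻ p in Z ×ˢ Metric.ball (0 : ℂ) ε ×ˢ Metric.ball (0 : ℂ) 2,
        ENNReal.ofReal (M ^ 2 * c ^ (-2 * α)) * (a p.1 * (b p.2.1 * t p.2.2)) := by
    rw [← lintegral_indicator hR]
    refine lintegral_mono_ae ?_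
    filter_upwards [ae_ne_zero_prod] with p hq
    by_cases hpS : coneMap e p ∈ coneSet e Z ε
    swap
    · rw [Set.indicator_of_notMem hpS, zero_mul]; exact bot_le
    obtain ⟨h0, h1, h2⟩ := coord_coneMap e p
    have hz : 0 < ‖p.1‖ := norm_pos_iff.2 hq.1
    have hs : 0 < ‖p.2.1‖ := norm_pos_iff.2 hq.2
    have hp1 : p.1 ∈ Z := h0 ▸ hpS.1
    have hp2 : p.2.1 ∈ Metric.ball (0 : ℂ) ε := by
      have := hpS.2.1
      rw [h0, h1, norm_mul, mul_comm ε] at this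
      exact mem_ball_zero_iff.2 (lt_of_mul_lt_mul_left this hz.le)
    have hp3 : ‖p.2.2‖ ≤ 1 := by
      have := hpS.2.2
      rw [h1, h2, norm_mul, norm_mul, norm_mul] at this
      have := le_of_mul_le_mul_left this hz
      exact le_of_mul_le_mul_left (by linarith) hs
    have hp4 : p.2.2 ∈ Metric.ball (0 : ℂ) 2 := mem_ball_zero_iff.2 (by linarith)
    obtain ⟨Y, hcY, hYC, hY⟩ := hfac p.1 p.2.1 hp2 p.2.2 hp4
    rw [Set.indicator_of_mem hpS, Set.indicator_of_mem (show p ∈ Z ×ˢ Metric.ball (0 : ℂ) ε ×ˢ Metric.ball (0 : ℂ) 2 from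
      ⟨hp1, hp2, hp4⟩), wSq, ← ENNReal.ofReal_mul (by positivity)]
    have hA := angular_nonneg (ℓ := ℓ) e p.2.2
    simp only [a, b, t]
    rw [← ENNReal.ofReal_mul (by positivity), ← ENNReal.ofReal_mul (by positivity), ← ENNReal.ofReal_mul hcc]
    refine ENNReal.ofReal_le_ofReal ?_
    have hYp : 0 < Y := hc.trans_le hcY
    have h1 : Y ^ (-2 * α) ≤ c ^ (-2 * α) := Real.rpow_le_rpow_of_nonpos hc hcY (by linarith)
    have h3 : ‖p.1‖ ^ (2 * k + 4 - 2 * α * Fintype.card ι) = (‖p.1‖ ^ k) ^ 2 * ‖p.1‖ ^ 4 * (‖p.1‖ ^ Fintype.card ι) ^ (-2 * α) := by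
      rw [← pow_mul, ← Real.rpow_natCast, ← Real.rpow_natCast, ← Real.rpow_natCast, ← Real.rpow_mul hz.le, ← Real.rpow_add hz, ← Real.rpow_add hz]
      congr 1; push_cast; ring
    have h4 : ‖p.2.1‖ ^ (2 * n + 2 - 2 * α * (formsAt ℓ (e 0)).card) = (‖p.2.1‖ ^ n) ^ 2 * ‖p.2.1‖ ^ 2 * (‖p.2.1‖ ^ (formsAt ℓ (e 0)).card) ^ (-2 * α) := by
      rw [← pow_mul, ← Real.rpow_natCast, ← Real.rpow_natCast, ← Real.rpow_natCast, ← Real.rpow_mul hs.le, ← Real.rpow_add hs, ← Real.rpow_add hs]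
      congr 1; push_cast; ring
    have h5 := pow_le_pow_left₀ (norm_nonneg _) (hM p.1 hp1 p.2.1 hp2 p.2.2 hp3) 2
    rw [show coneMap e p = coneMap e (p.1, p.2.1, p.2.2) from rfl, hY, Real.mul_rpow (by positivity) hYp.le,
      Real.mul_rpow (by positivity) (by positivity), Real.mul_rpow (by positivity) (by positivity), h3, h4]
    set X := ‖g (coneMap e (p.1, p.2.1, p.2.2))‖ ^ 2
    set A := (‖p.1‖ ^ Fintype.card ι) ^ (-2 * α)
    set B := (‖p.2.1‖ ^ (formsAt ℓ (e 0)).card) ^ (-2 * α)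
    set T := angular ℓ e p.2.2 ^ (-2 * α)
    have hT : 0 ≤ T := by positivity
    calc X * (A * B * T * Y ^ (-2 * α)) * (‖p.1‖ ^ 4 * ‖p.2.1‖ ^ 2)
        ≤ (M * ‖p.1‖ ^ k * ‖p.2.1‖ ^ n) ^ 2 * (A * B * T * c ^ (-2 * α)) * (‖p.1‖ ^ 4 * ‖p.2.1‖ ^ 2) := by gcongr
      _ = _ := by ring
  refine ne_top_of_le_ne_top ?_ hle
  have hma : Measurable a := by fun_prop
  have hmb : Measurable b := by fun_prop
  have hmt : Measurable t := by have := measurable_angular (ℓ := ℓ) e; fun_prop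
  rw [lintegral_const_mul' _ _ ENNReal.ofReal_ne_top, volume_restrict_prod, volume_restrict_prod,
    lintegral_prod_mul (f := a) (g := fun q : ℂ × ℂ => b q.1 * t q.2) hma.aemeasurable (by fun_prop),
    lintegral_prod_mul hmb.aemeasurable hmt.aemeasurable]
  exact ENNReal.mul_ne_top ENNReal.ofReal_ne_top (ENNReal.mul_ne_top hk (ENNReal.mul_ne_top
    ((lintegral_ball_norm_rpow_ne_top_iff _ hε0).2 (by linarith)) (lintegral_angular_rpow_ne_top hnp e hα0 hα1)))
end

section
variable {ι : Type*} [Fintype ι] {ℓ : ι → ((Fin 3 → ℂ) →ₗ[ℂ] ℂ)}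

theorem exists_coneMap_mem_ball (e : Module.Basis (Fin 3) ℂ (Fin 3 → ℂ)) (z : ℂ) {ρ : ℝ} (hρ : 0 < ρ) :
    ∃ δ > 0, ∀ p ∈ Metric.ball z δ ×ˢ Metric.ball (0 : ℂ) δ ×ˢ Metric.ball (0 : ℂ) 2,
      coneMap e p ∈ Metric.ball (z • e 0) ρ := by
  set K : ℝ := ‖e 0‖ + (‖z‖ + 1) * (‖e 1‖ + 2 * ‖e 2‖) + 1 with hK
  have hK0 : 0 < K := by positivity
  refine ⟨min 1 (ρ / (2 * K)), by positivity, fun p hp => ?_⟩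
  have h1 : ‖p.1 - z‖ < min 1 (ρ / (2 * K)) := mem_ball_iff_norm.1 hp.1
  have h2 : ‖p.2.1‖ < min 1 (ρ / (2 * K)) := mem_ball_zero_iff.1 hp.2.1
  have h3 : ‖p.2.2‖ < 2 := mem_ball_zero_iff.1 hp.2.2
  have h4 : ‖p.1‖ ≤ ‖z‖ + 1 := by
    have := norm_add_le (p.1 - z) z
    rw [sub_add_cancel] at this
    linarith [min_le_left 1 (ρ / (2 * K))]
  have h5 : coneMap e p - z • e 0 = (p.1 - z) • e 0 + (p.1 * p.2.1) • (e 1 + p.2.2 • e 2) := by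
    unfold coneMap
    module
  have h6 : ‖e 1 + p.2.2 • e 2‖ ≤ ‖e 1‖ + 2 * ‖e 2‖ := by
    refine (norm_add_le _ _).trans ?_
    rw [norm_smul]
    gcongr
  rw [mem_ball_iff_norm, h5]
  have hm := min_le_right 1 (ρ / (2 * K))
  have hr : 0 < ρ / (2 * K) := by positivity
  calc ‖(p.1 - z) • e 0 + (p.1 * p.2.1) • (e 1 + p.2.2 • e 2)‖
      ≤ ‖p.1 - z‖ * ‖e 0‖ + ‖p.1‖ * ‖p.2.1‖ * ‖e 1 + p.2.2 • e 2‖ := by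
        refine (norm_add_le _ _).trans ?_
        rw [norm_smul, norm_smul, norm_mul]
    _ ≤ ρ / (2 * K) * ‖e 0‖ + (‖z‖ + 1) * (ρ / (2 * K)) * (‖e 1‖ + 2 * ‖e 2‖) := by
        gcongr
        · linarith
        · linarith
    _ = ρ / (2 * K) * (K - 1) := by rw [hK]; ring
    _ < ρ / (2 * K) * (2 * K) := mul_lt_mul_of_pos_left (by linarith) hr
    _ = ρ := by field_simp

theorem differentiable_coneMap (e : Module.Basis (Fin 3) ℂ (Fin 3 → ℂ)) : Differentiable ℂ (coneMap e) := by
  unfold coneMap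
  fun_prop

theorem exists_norm_le_of_differentiableOn {g : (Fin 3 → ℂ) → ℂ} {x : Fin 3 → ℂ} {ρ : ℝ} (hρ : 0 < ρ)
    (hg : DifferentiableOn ℂ g (Metric.ball x ρ)) : ∃ ρ' > 0, ∃ M > 0, ρ' ≤ ρ ∧ ∀ y ∈ Metric.ball x ρ', ‖g y‖ ≤ M := by
  have hc : ContinuousAt g x := hg.continuousOn.continuousAt (Metric.ball_mem_nhds x hρ)
  obtain ⟨r, hr, h⟩ := Metric.eventually_nhds_iff_ball.1 (hc.norm.eventually (gt_mem_nhds (lt_add_one ‖g x‖)))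
  exact ⟨min r ρ, lt_min hr hρ, ‖g x‖ + 1, by positivity, min_le_right _ _,
    fun y hy => (h y (Metric.ball_subset_ball (min_le_left _ _) hy)).le⟩

/-- Common preparation for the pointwise bounds in cone charts. -/
theorem exists_chart (hne : ∀ i, ℓ i ≠ 0) (e : Module.Basis (Fin 3) ℂ (Fin 3 → ℂ)) (z : ℂ) {ρ β : ℝ} (hρ : 0 < ρ)
    (hβ : 0 ≤ β) {g : (Fin 3 → ℂ) → ℂ} (hg : Measurable g) (hd : DifferentiableOn ℂ g (Metric.ball (z • e 0) ρ))
    (hfin : ∫⁻ x in Metric.ball (z • e 0) ρ, wSq ℓ β g x ≠ ⊤) :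
    ∃ δ > 0, ∃ M > 0, ∀ ε, 0 < ε → ε ≤ δ → ConeRadius ℓ e ε ∧
      DifferentiableOn ℂ (fun p => g (coneMap e p)) (Metric.ball z ε ×ˢ Metric.ball (0 : ℂ) ε ×ˢ Metric.ball (0 : ℂ) 2) ∧
      (∀ p ∈ Metric.ball z ε ×ˢ Metric.ball (0 : ℂ) ε ×ˢ Metric.ball (0 : ℂ) 2, ‖g (coneMap e p)‖ ≤ M) ∧
      ∫⁻ p in Metric.ball z ε ×ˢ Metric.ball (0 : ℂ) ε ×ˢ Metric.ball (0 : ℂ) 2, ENNReal.ofReal (‖g (coneMap e p)‖ ^ 2 *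
      (‖p.1‖ ^ (4 - 2 * β * Fintype.card ι) * ‖p.2.1‖ ^ (2 - 2 * β * (formsAt ℓ (e 0)).card))) ≠ ⊤ := by
  obtain ⟨ρ', hρ', M, hM, hρρ, hb⟩ := exists_norm_le_of_differentiableOn hρ hd
  obtain ⟨δ, hδ, hcone⟩ := exists_coneMap_mem_ball e z hρ'
  obtain ⟨ε₀, hε₀⟩ := exists_coneRadius ℓ e
  refine ⟨min δ ε₀, lt_min hδ hε₀.1, M, hM, fun ε hε hle => ?_⟩
  have hcr : ConeRadius ℓ e ε := hε₀.mono hε (hle.trans (min_le_right _ _))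
  have hsub : ∀ p ∈ Metric.ball z ε ×ˢ Metric.ball (0 : ℂ) ε ×ˢ Metric.ball (0 : ℂ) 2, coneMap e p ∈ Metric.ball (z • e 0) ρ' :=
    fun p hp => hcone p ⟨Metric.ball_subset_ball (hle.trans (min_le_left _ _)) hp.1,
      Metric.ball_subset_ball (hle.trans (min_le_left _ _)) hp.2.1, hp.2.2⟩
  exact ⟨hcr, hd.comp (differentiable_coneMap e).differentiableOn fun p hp => Metric.ball_subset_ball hρρ (hsub p hp),
    fun p hp => hb _ (hsub p hp), lintegral_coneMap_ne_top hne hcr hβ hg Metric.isOpen_ball measurableSet_ball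
      (fun p hp => Metric.ball_subset_ball hρρ (hsub p hp)) hfin⟩

/-- Divisibility of `g` by `ζ ^ k * s ^ n` in all small cone charts over neighborhoods of `z`. -/
def ChartBound (ℓ : ι → ((Fin 3 → ℂ) →ₗ[ℂ] ℂ)) (g : (Fin 3 → ℂ) → ℂ) (e : Module.Basis (Fin 3) ℂ (Fin 3 → ℂ)) (z : ℂ)
    (k n : ℕ) : Prop :=
  ∃ δ > 0, ∀ ε, 0 < ε → ε ≤ δ → ConeRadius ℓ e ε ∧ ∃ C > 0, ∀ ζ ∈ Metric.ball z ε, ∀ s ∈ Metric.ball (0 : ℂ) ε,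
    ∀ σ ∈ Metric.ball (0 : ℂ) 2, ‖g (coneMap e (ζ, s, σ))‖ ≤ C * ‖ζ‖ ^ k * ‖s‖ ^ n

/-- Divisibility in a cone chart at the origin. -/
theorem exists_chart_bound_zero (hne : ∀ i, ℓ i ≠ 0) (e : Module.Basis (Fin 3) ℂ (Fin 3 → ℂ)) {ρ β : ℝ} (hρ : 0 < ρ)
    (hβ : 0 ≤ β) {g : (Fin 3 → ℂ) → ℂ} (hg : Measurable g) (hd : DifferentiableOn ℂ g (Metric.ball 0 ρ))
    (hfin : ∫⁻ x in Metric.ball 0 ρ, wSq ℓ β g x ≠ ⊤) {k n : ℕ} (hk : k = 0 ∨ k + 2 ≤ β * Fintype.card ι)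
    (hn : n = 0 ∨ n + 1 ≤ β * (formsAt ℓ (e 0)).card) :
    ChartBound ℓ g e 0 k n := by
  rw [← zero_smul ℂ (e 0)] at hd hfin
  obtain ⟨δ, hδ, M, hM, h⟩ := exists_chart hne e 0 hρ hβ hg hd hfin
  refine ⟨δ, hδ, fun ε hε hle => ?_⟩
  obtain ⟨hcr, hdd, hbd, hi⟩ := h ε hε hle
  have h1 := norm_le_mul_pow_fst (w₀ := 4 - 2 * β * Fintype.card ι) Metric.isOpen_ball Metric.isOpen_ball hdd hi hε rfl hbd (k := k)
    (hk.imp_right fun h => by linarith)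
  have h2 := norm_le_mul_pow_snd (w₁ := 2 - 2 * β * (formsAt ℓ (e 0)).card) Metric.isOpen_ball Metric.isOpen_ball hε hdd hi
    (M := fun ζ => M * (‖ζ‖ / ε) ^ k) (by fun_prop) h1 (k := n) (hn.imp_right fun h => by linarith)
  refine ⟨hcr, M * (ε⁻¹) ^ k * (ε⁻¹) ^ n, by positivity, fun ζ hζ s hs σ hσ => (h2 (ζ, s, σ) ⟨hζ, hs, hσ⟩).trans (le_of_eq ?_)⟩
  simp only [div_eq_mul_inv, mul_pow]
  ring

/-- Divisibility in a cone chart away from the origin. -/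
theorem exists_chart_bound_ne (hne : ∀ i, ℓ i ≠ 0) (e : Module.Basis (Fin 3) ℂ (Fin 3 → ℂ)) {ρ β : ℝ} (hρ : 0 < ρ)
    (hβ : 0 ≤ β) {g : (Fin 3 → ℂ) → ℂ} (hg : Measurable g) (hd : DifferentiableOn ℂ g (Metric.ball (e 0) ρ))
    (hfin : ∫⁻ x in Metric.ball (e 0) ρ, wSq ℓ β g x ≠ ⊤) {n : ℕ}
    (hn : n = 0 ∨ n + 1 ≤ β * (formsAt ℓ (e 0)).card) :
    ChartBound ℓ g e 1 0 n := by
  rw [← one_smul ℂ (e 0)] at hd hfin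
  obtain ⟨δ, hδ, M, hM, h⟩ := exists_chart hne e 1 hρ hβ hg hd hfin
  refine ⟨δ, hδ, fun ε hε hle => ?_⟩
  obtain ⟨hcr, hdd, hbd, hi⟩ := h ε hε hle
  have h2 := norm_le_mul_pow_snd (w₁ := 2 - 2 * β * (formsAt ℓ (e 0)).card) Metric.isOpen_ball Metric.isOpen_ball hε hdd hi
    (M := fun ζ => M) (by fun_prop) hbd (k := n) (hn.imp_right fun h => by linarith)
  refine ⟨hcr, M * (ε⁻¹) ^ n, by positivity, fun ζ hζ s hs σ hσ => (h2 (ζ, s, σ) ⟨hζ, hs, hσ⟩).trans (le_of_eq ?_)⟩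
  simp only [div_eq_mul_inv, mul_pow, pow_zero]
  ring
end

section
variable {ι : Type*} [Fintype ι] {ℓ : ι → ((Fin 3 → ℂ) →ₗ[ℂ] ℂ)}

/-- The basis with its last two vectors exchanged. -/
def swapBasis (e : Module.Basis (Fin 3) ℂ (Fin 3 → ℂ)) : Module.Basis (Fin 3) ℂ (Fin 3 → ℂ) :=
  e.reindex (Equiv.swap 1 2)

theorem swapBasis_zero (e : Module.Basis (Fin 3) ℂ (Fin 3 → ℂ)) : swapBasis e 0 = e 0 := by
  rw [swapBasis, Module.Basis.reindex_apply]; rfl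

theorem swapBasis_one (e : Module.Basis (Fin 3) ℂ (Fin 3 → ℂ)) : swapBasis e 1 = e 2 := by
  rw [swapBasis, Module.Basis.reindex_apply]; rfl

theorem swapBasis_two (e : Module.Basis (Fin 3) ℂ (Fin 3 → ℂ)) : swapBasis e 2 = e 1 := by
  rw [swapBasis, Module.Basis.reindex_apply]; rfl

theorem coord_swapBasis (e : Module.Basis (Fin 3) ℂ (Fin 3 → ℂ)) (x : Fin 3 → ℂ) :
    (swapBasis e).coord 0 x = e.coord 0 x ∧ (swapBasis e).coord 1 x = e.coord 2 x ∧
      (swapBasis e).coord 2 x = e.coord 1 x := by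
  simp only [swapBasis, Module.Basis.coord_apply, Module.Basis.repr_reindex_apply]
  exact ⟨rfl, rfl, rfl⟩

theorem mem_coneSet_or_swap {e : Module.Basis (Fin 3) ℂ (Fin 3 → ℂ)} {Z : Set ℂ} {ε : ℝ} {x : Fin 3 → ℂ}
    (h0 : e.coord 0 x ∈ Z) (h1 : ‖e.coord 1 x‖ < ε * ‖e.coord 0 x‖) (h2 : ‖e.coord 2 x‖ < ε * ‖e.coord 0 x‖) :
    x ∈ coneSet e Z ε ∪ coneSet (swapBasis e) Z ε := by
  obtain ⟨c0, c1, c2⟩ := coord_swapBasis e x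
  rcases le_total ‖e.coord 2 x‖ ‖e.coord 1 x‖ with h | h
  · exact Or.inl ⟨h0, h1, h⟩
  · refine Or.inr ⟨?_, ?_, ?_⟩
    · rwa [c0]
    · rwa [c0, c1]
    · rwa [c1, c2]

theorem lintegral_union_ne_top {X : Type*} [MeasurableSpace X] {μ : Measure X} {F : X → ENNReal} {A B : Set X}
    (hA : ∫⁻ x in A, F x ∂μ ≠ ⊤) (hB : ∫⁻ x in B, F x ∂μ ≠ ⊤) : ∫⁻ x in A ∪ B, F x ∂μ ≠ ⊤ :=
  ne_top_of_le_ne_top (ENNReal.add_ne_top.2 ⟨hA, hB⟩) (lintegral_union_le _ _ _)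

theorem continuous_coord (e : Module.Basis (Fin 3) ℂ (Fin 3 → ℂ)) (i : Fin 3) : Continuous (e.coord i) :=
  (e.coord i).continuous_of_finiteDimensional

/-- Integrability away from the origin from bounds in the two cone charts. -/
theorem exists_lintegral_ball_ne_top_of_chartBound_ne (hnp : ∀ i j, i ≠ j → ∀ c : ℂ, ℓ i ≠ c • ℓ j)
    {e : Module.Basis (Fin 3) ℂ (Fin 3 → ℂ)} {α : ℝ} (hα0 : 0 ≤ α) (hα1 : α < 1)
    {g : (Fin 3 → ℂ) → ℂ} (hg : Measurable g) {n : ℕ} (h1 : ChartBound ℓ g e 1 0 n) (h2 : ChartBound ℓ g (swapBasis e) 1 0 n)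
    (hn : α * (formsAt ℓ (e 0)).card < n + 2) :
    ∃ ρ > 0, ∫⁻ x in Metric.ball (e 0) ρ, wSq ℓ α g x ≠ ⊤ := by
  obtain ⟨δ1, hδ1, H1⟩ := h1
  obtain ⟨δ2, hδ2, H2⟩ := h2
  set ε := min (1 / 2) (min δ1 δ2) with hε
  have hε0 : 0 < ε := by positivity
  obtain ⟨hr1, C1, -, hC1⟩ := H1 ε hε0 ((min_le_right _ _).trans (min_le_left _ _))
  obtain ⟨hr2, C2, -, hC2⟩ := H2 ε hε0 ((min_le_right _ _).trans (min_le_right _ _))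
  have hk : ∫⁻ ζ in Metric.ball (1 : ℂ) ε, ENNReal.ofReal (‖ζ‖ ^ (2 * (0 : ℕ) + 4 - 2 * α * Fintype.card ι)) ≠ ⊤ := by
    have hsub : Metric.ball (1 : ℂ) ε ⊆ Metric.closedBall 1 (1 / 2) :=
      Metric.ball_subset_closedBall.trans (Metric.closedBall_subset_closedBall (min_le_left _ _))
    refine ne_top_of_le_ne_top ?_ (lintegral_mono_set hsub)
    rw [lintegral_ofReal_ne_top_iff_integrable (Measurable.aestronglyMeasurable (by fun_prop)) (ae_of_all _ fun _ => by positivity)]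
    refine ContinuousOn.integrableOn_compact (isCompact_closedBall _ _) (ContinuousOn.rpow_const (by fun_prop) fun ζ hζ => Or.inl ?_)
    intro h0
    rw [norm_eq_zero.1 h0, Metric.mem_closedBall, dist_zero_left] at hζ
    norm_num at hζ
  have hlt : ∀ σ : ℂ, ‖σ‖ ≤ 1 → σ ∈ Metric.ball (0 : ℂ) 2 := fun σ h => mem_ball_zero_iff.2 (by linarith)
  have i1 := lintegral_coneSet_ne_top hnp hr1 hα0 hα1 hg Metric.isOpen_ball (k := 0) (n := n)
    (fun ζ hζ s hs σ hσ => hC1 ζ hζ s hs σ (hlt σ hσ)) hk hn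
  have i2 := lintegral_coneSet_ne_top hnp hr2 hα0 hα1 hg Metric.isOpen_ball (k := 0) (n := n)
    (fun ζ hζ s hs σ hσ => hC2 ζ hζ s hs σ (hlt σ hσ)) hk (by rwa [swapBasis_zero])
  have hN : ∀ᶠ x in nhds (e 0), e.coord 0 x ∈ Metric.ball (1 : ℂ) ε ∧ ‖e.coord 1 x‖ < ε * ‖e.coord 0 x‖ ∧
      ‖e.coord 2 x‖ < ε * ‖e.coord 0 x‖ := by
    have c0 : e.coord 0 (e 0) = 1 := by simp
    have c1 : e.coord 1 (e 0) = 0 := by simp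
    have c2 : e.coord 2 (e 0) = 0 := by simp
    refine ((continuous_coord e 0).continuousAt.eventually (by rw [c0]; exact Metric.ball_mem_nhds _ hε0)).and
      ((ContinuousAt.eventually_lt (continuous_coord e 1).norm.continuousAt
        ((continuous_coord e 0).norm.const_mul ε).continuousAt (by rw [c0, c1]; simpa)).and
      (ContinuousAt.eventually_lt (continuous_coord e 2).norm.continuousAt
        ((continuous_coord e 0).norm.const_mul ε).continuousAt (by rw [c0, c2]; simpa)))
  obtain ⟨ρ, hρ, h⟩ := Metric.eventually_nhds_iff_ball.1 hN
  exact ⟨ρ, hρ, ne_top_of_le_ne_top (lintegral_union_ne_top i1 i2)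
    (lintegral_mono_set fun x hx => mem_coneSet_or_swap (h x hx).1 (h x hx).2.1 (h x hx).2.2)⟩

/-- Integrability at the origin from bounds in cone charts in all directions. -/
theorem exists_lintegral_ball_ne_top_of_chartBound_zero (hnp : ∀ i j, i ≠ j → ∀ c : ℂ, ℓ i ≠ c • ℓ j)
    {α : ℝ} (hα0 : 0 ≤ α) (hα1 : α < 1) {g : (Fin 3 → ℂ) → ℂ} (hg : Measurable g) {k : ℕ}
    (hk : α * Fintype.card ι < k + 3)
    (H : ∀ x : Fin 3 → ℂ, x ≠ 0 → ∃ e : Module.Basis (Fin 3) ℂ (Fin 3 → ℂ), ∃ c : ℂ, x = c • e 0 ∧ ∃ n : ℕ,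
      ChartBound ℓ g e 0 k n ∧ ChartBound ℓ g (swapBasis e) 0 k n ∧ α * (formsAt ℓ (e 0)).card < n + 2) :
    ∃ ρ > 0, ∫⁻ x in Metric.ball 0 ρ, wSq ℓ α g x ≠ ⊤ := by
  suffices h : ∃ ρ > 0, ∫⁻ x in {y : Fin 3 → ℂ | y ∈ Metric.ball 0 ρ ∧ y ≠ 0 ∧
      ((‖y‖⁻¹ : ℝ) : ℂ) • y ∈ Metric.sphere (0 : Fin 3 → ℂ) 1}, wSq ℓ α g x ≠ ⊤ by
    obtain ⟨ρ, hρ, h⟩ := h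
    have h0 : ∫⁻ x in {(0 : Fin 3 → ℂ)}, wSq ℓ α g x ≠ ⊤ := by
      rw [setLIntegral_measure_zero _ _ (measure_singleton _)]; exact ENNReal.zero_ne_top
    refine ⟨ρ, hρ, ne_top_of_le_ne_top (lintegral_union_ne_top h0 h) (lintegral_mono_set fun y hy => ?_)⟩
    by_cases hy0 : y = 0
    · exact Or.inl hy0
    · refine Or.inr ⟨hy, hy0, ?_⟩
      have : ‖y‖ ≠ 0 := norm_ne_zero_iff.2 hy0
      rw [mem_sphere_zero_iff_norm, norm_smul, Complex.norm_real, norm_inv, norm_norm, inv_mul_cancel₀ this]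
  refine IsCompact.induction_on (p := fun s : Set (Fin 3 → ℂ) => ∃ ρ > 0, ∫⁻ x in {y : Fin 3 → ℂ | y ∈ Metric.ball 0 ρ ∧ y ≠ 0 ∧
      ((‖y‖⁻¹ : ℝ) : ℂ) • y ∈ s}, wSq ℓ α g x ≠ ⊤) (isCompact_sphere (0 : Fin 3 → ℂ) 1) ?_ ?_ ?_ ?_
  · exact ⟨1, one_pos, by simp⟩
  · rintro s t hst ⟨ρ, hρ, h⟩
    exact ⟨ρ, hρ, ne_top_of_le_ne_top h (lintegral_mono_set fun y hy => ⟨hy.1, hy.2.1, hst hy.2.2⟩)⟩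
  · rintro s t ⟨ρ, hρ, h⟩ ⟨ρ', hρ', h'⟩
    refine ⟨min ρ ρ', lt_min hρ hρ', ne_top_of_le_ne_top (lintegral_union_ne_top h h') (lintegral_mono_set fun y hy => ?_)⟩
    rcases hy.2.2 with hs | ht
    · exact Or.inl ⟨Metric.ball_subset_ball (min_le_left _ _) hy.1, hy.2.1, hs⟩
    · exact Or.inr ⟨Metric.ball_subset_ball (min_le_right _ _) hy.1, hy.2.1, ht⟩
  · intro x hx
    have hx0 : x ≠ 0 := by rintro rfl; simp at hx
    obtain ⟨e, c, hxc, n, ⟨δ1, hδ1, H1⟩, ⟨δ2, hδ2, H2⟩, hn⟩ := H x hx0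
    have hc0 : c ≠ 0 := by rintro rfl; exact hx0 (by simpa using hxc)
    set ε := min δ1 δ2 with hε
    have hε0 : 0 < ε := by positivity
    obtain ⟨hr1, C1, -, hC1⟩ := H1 ε hε0 (min_le_left _ _)
    obtain ⟨hr2, C2, -, hC2⟩ := H2 ε hε0 (min_le_right _ _)
    have hk : ∫⁻ ζ in Metric.ball (0 : ℂ) ε, ENNReal.ofReal (‖ζ‖ ^ (2 * k + 4 - 2 * α * Fintype.card ι)) ≠ ⊤ :=
      (lintegral_ball_norm_rpow_ne_top_iff _ hε0).2 (by linarith)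
    have hlt : ∀ σ : ℂ, ‖σ‖ ≤ 1 → σ ∈ Metric.ball (0 : ℂ) 2 := fun σ h => mem_ball_zero_iff.2 (by linarith)
    have i1 := lintegral_coneSet_ne_top hnp hr1 hα0 hα1 hg Metric.isOpen_ball (k := k) (n := n)
      (fun ζ hζ s hs σ hσ => hC1 ζ hζ s hs σ (hlt σ hσ)) hk hn
    have i2 := lintegral_coneSet_ne_top hnp hr2 hα0 hα1 hg Metric.isOpen_ball (k := k) (n := n)
      (fun ζ hζ s hs σ hσ => hC2 ζ hζ s hs σ (hlt σ hσ)) hk (by rwa [swapBasis_zero])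
    have c0 : e.coord 0 x = c := by rw [hxc]; simp
    have c1 : e.coord 1 x = 0 := by rw [hxc]; simp
    have c2 : e.coord 2 x = 0 := by rw [hxc]; simp
    have hcn : 0 < ‖c‖ := norm_pos_iff.2 hc0
    have hN : ∀ᶠ y in nhds x, ‖e.coord 1 y‖ < ε * ‖e.coord 0 y‖ ∧ ‖e.coord 2 y‖ < ε * ‖e.coord 0 y‖ :=
      (ContinuousAt.eventually_lt (continuous_coord e 1).norm.continuousAt
        ((continuous_coord e 0).norm.const_mul ε).continuousAt (by rw [c0, c1, norm_zero]; positivity)).and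
      (ContinuousAt.eventually_lt (continuous_coord e 2).norm.continuousAt
        ((continuous_coord e 0).norm.const_mul ε).continuousAt (by rw [c0, c2, norm_zero]; positivity))
    have hZ : ∀ᶠ y in nhds (0 : Fin 3 → ℂ), e.coord 0 y ∈ Metric.ball (0 : ℂ) ε :=
      (continuous_coord e 0).continuousAt.eventually (by rw [map_zero]; exact Metric.ball_mem_nhds _ hε0)
    obtain ⟨ρ, hρ, h⟩ := Metric.eventually_nhds_iff_ball.1 hZ
    refine ⟨_, mem_nhdsWithin_of_mem_nhds hN, ρ, hρ, ne_top_of_le_ne_top (lintegral_union_ne_top i1 i2)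
      (lintegral_mono_set fun y hy => ?_)⟩
    have hy0 : 0 < ‖y‖⁻¹ := inv_pos.2 (norm_pos_iff.2 hy.2.1)
    obtain ⟨h1, h2⟩ := hy.2.2
    simp only [map_smul, smul_eq_mul, norm_mul, Complex.norm_real, norm_inv, norm_norm] at h1 h2
    exact mem_coneSet_or_swap (h y hy.1)
      (lt_of_mul_lt_mul_left (by linarith) hy0.le) (lt_of_mul_lt_mul_left (by linarith) hy0.le)
end

section
variable {ι : Type*} [Fintype ι] {ℓ : ι → ((Fin 3 → ℂ) →ₗ[ℂ] ℂ)}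

/-- A measurable function, holomorphic near `x`, witnessing that `α` is a jumping coefficient at `x`. -/
structure JumpWitness (ℓ : ι → ((Fin 3 → ℂ) →ₗ[ℂ] ℂ)) (α : ℝ) (x : Fin 3 → ℂ) (ρ : ℝ) (g : (Fin 3 → ℂ) → ℂ) : Prop where
  pos : 0 < ρ
  measurable : Measurable g
  diff : DifferentiableOn ℂ g (Metric.ball x ρ)
  fin : ∀ β, 0 < β → β < α → ∃ r > 0, ∫⁻ y in Metric.ball x r, wSq ℓ β g y ≠ ⊤
  inf : ∀ r > 0, ∫⁻ y in Metric.ball x r, wSq ℓ α g y = ⊤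

theorem integrableOn_iff_wSq {g : (Fin 3 → ℂ) → ℂ} (hg : Measurable g) (β : ℝ) (s : Set (Fin 3 → ℂ)) :
    IntegrableOn (fun y => ‖g y‖ ^ 2 * ‖formProd ℓ y‖ ^ (-2 * β)) s ↔ ∫⁻ y in s, wSq ℓ β g y ≠ ⊤ := by
  have hm : Measurable fun y => ‖g y‖ ^ 2 * ‖formProd ℓ y‖ ^ (-2 * β) :=
    (hg.norm.pow_const 2).mul ((continuous_formProd (ℓ := ℓ)).norm.measurable.pow_const _)
  exact (lintegral_ofReal_ne_top_iff_integrable hm.aestronglyMeasurable (ae_of_all _ fun _ => by positivity)).symm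

theorem jumpingAtOf_iff {α : ℝ} {x : Fin 3 → ℂ} :
    JumpingAtOf (formProd ℓ) α x ↔ ∃ ρ g, JumpWitness ℓ α x ρ g := by
  constructor
  · rintro ⟨U, g, hU, hd, hfin, hinf⟩
    obtain ⟨ρ, hρ, hsub⟩ := Metric.mem_nhds_iff.1 hU
    have hd' := hd.mono hsub
    have hgm : Measurable ((Metric.ball x ρ).indicator g) :=
      Set.piecewise_eq_indicator (s := Metric.ball x ρ) (f := g) ▸
        hd'.continuousOn.measurable_piecewise continuousOn_const measurableSet_ball
    have heq : ∀ r ≤ ρ, ∀ β, IntegrableOn (fun y => ‖g y‖ ^ 2 * ‖formProd ℓ y‖ ^ (-2 * β)) (Metric.ball x r) ↔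
        ∫⁻ y in Metric.ball x r, wSq ℓ β ((Metric.ball x ρ).indicator g) y ≠ ⊤ := fun r hr β => by
      rw [← integrableOn_iff_wSq hgm]
      refine integrableOn_congr_fun (fun y hy => ?_) measurableSet_ball
      rw [Set.indicator_of_mem (Metric.ball_subset_ball hr hy)]
    refine ⟨ρ, (Metric.ball x ρ).indicator g, hρ, hgm, hd'.congr fun y hy => Set.indicator_of_mem hy g, fun β h0 h1 => ?_,
      fun r hr => ?_⟩
    · obtain ⟨W, hW, hi⟩ := hfin β h0 h1
      obtain ⟨r, hr, hrW⟩ := Metric.mem_nhds_iff.1 hW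
      exact ⟨min r ρ, lt_min hr hρ, (heq _ (min_le_right _ _) β).1
        (hi.mono_set ((Metric.ball_subset_ball (min_le_left _ _)).trans hrW))⟩
    · by_contra h
      have h' : ∫⁻ y in Metric.ball x (min r ρ), wSq ℓ α ((Metric.ball x ρ).indicator g) y ≠ ⊤ :=
        ne_top_of_le_ne_top h (lintegral_mono_set (Metric.ball_subset_ball (min_le_left _ _)))
      exact hinf _ (Metric.ball_mem_nhds x (lt_min hr hρ)) ((heq _ (min_le_right _ _) α).2 h')
  · rintro ⟨ρ, g, hρ, hgm, hd, hfin, hinf⟩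
    refine ⟨Metric.ball x ρ, g, Metric.ball_mem_nhds x hρ, hd, fun β h0 h1 => ?_, fun W hW hi => ?_⟩
    · obtain ⟨r, hr, h⟩ := hfin β h0 h1
      exact ⟨Metric.ball x r, Metric.ball_mem_nhds x hr, (integrableOn_iff_wSq hgm β _).2 h⟩
    · obtain ⟨r, hr, hrW⟩ := Metric.mem_nhds_iff.1 hW
      exact (integrableOn_iff_wSq hgm α _).1 (hi.mono_set hrW) (hinf r hr)

theorem exists_basis_zero_eq {x : Fin 3 → ℂ} (hx : x ≠ 0) : ∃ e : Module.Basis (Fin 3) ℂ (Fin 3 → ℂ), e 0 = x := by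
  have h1 : LinearIndependent ℂ ![x] := by
    rw [linearIndependent_unique_iff]; exact hx
  obtain ⟨y, hy⟩ := exists_linearIndependent_cons_of_lt_finrank (n := 1) h1 (by simp)
  obtain ⟨z, hz⟩ := exists_linearIndependent_cons_of_lt_finrank (n := 2) hy (by simp)
  have hz' : LinearIndependent ℂ (![x, y, z]) := by
    have := hz.comp ![2, 1, 0] (by intro i j; fin_cases i <;> fin_cases j <;> simp)
    have h : (Fin.cons z (Fin.cons y ![x]) : Fin 3 → Fin 3 → ℂ) ∘ ![2, 1, 0] = ![x, y, z] := by
      ext i : 1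
      fin_cases i <;> rfl
    rwa [h] at this
  refine ⟨basisOfLinearIndependentOfCardEqFinrank hz' (by simp), ?_⟩
  rw [basisOfLinearIndependentOfCardEqFinrank, Module.Basis.mk_apply]
  rfl

theorem exists_lt_of_strict {α d m : ℝ} (hα : 0 < α) {k n : ℕ} (hk : k = 0 ∨ k + 2 < α * d) (hn : n = 0 ∨ n + 1 < α * m) :
    ∃ β, 0 < β ∧ β < α ∧ (k = 0 ∨ k + 2 ≤ β * d) ∧ (n = 0 ∨ n + 1 ≤ β * m) := by
  have t : ∀ c : ℝ, Filter.Tendsto (fun β => β * c) (nhdsWithin α (Set.Iio α)) (nhds (α * c)) := fun c =>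
    ((continuous_mul_const c).tendsto α).mono_left nhdsWithin_le_nhds
  have h0 : ∀ᶠ β in nhdsWithin α (Set.Iio α), 0 < β := nhdsWithin_le_nhds (lt_mem_nhds hα)
  have h1 : ∀ᶠ β in nhdsWithin α (Set.Iio α), k = 0 ∨ k + 2 ≤ β * d := by
    rcases hk with h | h
    · exact Filter.Eventually.of_forall fun _ => Or.inl h
    · exact ((t d).eventually (lt_mem_nhds h)).mono fun _ h => Or.inr h.le
  have h2 : ∀ᶠ β in nhdsWithin α (Set.Iio α), n = 0 ∨ n + 1 ≤ β * m := by
    rcases hn with h | h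
    · exact Filter.Eventually.of_forall fun _ => Or.inl h
    · exact ((t m).eventually (lt_mem_nhds h)).mono fun _ h => Or.inr h.le
  have h3 : ∀ᶠ β in nhdsWithin α (Set.Iio α), β < α := self_mem_nhdsWithin
  obtain ⟨β, ha, hb, hc, hd⟩ := (h0.and (h3.and (h1.and h2))).exists
  exact ⟨β, ha, hb, hc, hd⟩

variable {α ρ : ℝ} {g : (Fin 3 → ℂ) → ℂ} {e : Module.Basis (Fin 3) ℂ (Fin 3 → ℂ)}

theorem JumpWitness.exists_ball (hα : 0 < α) {x : Fin 3 → ℂ} (h : JumpWitness ℓ α x ρ g) {d m : ℝ} {k n : ℕ}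
    (hk : k = 0 ∨ k + 2 < α * d) (hn : n = 0 ∨ n + 1 < α * m) :
    ∃ β, 0 ≤ β ∧ (k = 0 ∨ k + 2 ≤ β * d) ∧ (n = 0 ∨ n + 1 ≤ β * m) ∧ ∃ r > 0,
      DifferentiableOn ℂ g (Metric.ball x r) ∧ ∫⁻ y in Metric.ball x r, wSq ℓ β g y ≠ ⊤ := by
  obtain ⟨β, h0, h1, hk, hn⟩ := exists_lt_of_strict hα hk hn
  obtain ⟨r, hr, hfin⟩ := h.fin β h0 h1
  exact ⟨β, h0.le, hk, hn, min r ρ, lt_min hr h.pos, h.diff.mono (Metric.ball_subset_ball (min_le_right _ _)),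
    ne_top_of_le_ne_top hfin (lintegral_mono_set (Metric.ball_subset_ball (min_le_left _ _)))⟩

theorem JumpWitness.chartBound_zero (hne : ∀ i, ℓ i ≠ 0) (hα : 0 < α) (h : JumpWitness ℓ α 0 ρ g)
    (e : Module.Basis (Fin 3) ℂ (Fin 3 → ℂ)) {k n : ℕ}
    (hk : k = 0 ∨ k + 2 < α * Fintype.card ι) (hn : n = 0 ∨ n + 1 < α * (formsAt ℓ (e 0)).card) :
    ChartBound ℓ g e 0 k n := by
  obtain ⟨β, h0, hk, hn, r, hr, hd, hfin⟩ := h.exists_ball hα hk hn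
  exact exists_chart_bound_zero hne e hr h0 h.measurable hd hfin hk hn

theorem JumpWitness.chartBound_ne (hne : ∀ i, ℓ i ≠ 0) (hα : 0 < α) (h : JumpWitness ℓ α (e 0) ρ g) {n : ℕ}
    (hn : n = 0 ∨ n + 1 < α * (formsAt ℓ (e 0)).card) :
    ChartBound ℓ g e 1 0 n := by
  obtain ⟨β, h0, -, hn, r, hr, hd, hfin⟩ := h.exists_ball (d := 0) (k := 0) hα (Or.inl rfl) hn
  exact exists_chart_bound_ne hne e hr h0 h.measurable hd hfin hn

/-- Either `t` is an integer at least `c`, or it lies strictly between consecutive integers (up to truncation). -/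
theorem exists_nat_of_real (t : ℝ) (c : ℕ) : (∃ k : ℕ, t = k + c) ∨ ∃ n : ℕ, t < n + c ∧ (n = 0 ∨ n + c < t + 1) := by
  by_cases h : t < c
  · exact Or.inr ⟨0, by simpa, Or.inl rfl⟩
  · push Not at h
    by_cases h2 : ((⌊t - c⌋₊ : ℕ) : ℝ) = t - c
    · exact Or.inl ⟨⌊t - c⌋₊, by rw [h2]; ring⟩
    · refine Or.inr ⟨⌊t - c⌋₊ + 1, ?_, Or.inr ?_⟩
      · push_cast; linarith [Nat.lt_floor_add_one (t - c)]
      · push_cast; linarith [(Nat.floor_le (sub_nonneg.2 h)).lt_of_ne h2]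

/-- At a nonzero point, a jumping coefficient has integral product with the multiplicity. -/
theorem JumpWitness.exists_eq_of_ne_zero (hne : ∀ i, ℓ i ≠ 0) (hnp : ∀ i j, i ≠ j → ∀ c : ℂ, ℓ i ≠ c • ℓ j)
    (hα : 0 < α) (hα1 : α < 1) {x : Fin 3 → ℂ} (hx : x ≠ 0) (h : JumpWitness ℓ α x ρ g) :
    ∃ k : ℕ, α * (formsAt ℓ x).card = k + 2 := by
  obtain ⟨e, rfl⟩ := exists_basis_zero_eq hx
  rcases exists_nat_of_real (α * (formsAt ℓ (e 0)).card) 2 with h1 | ⟨n, h1, h2⟩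
  · exact_mod_cast h1
  · have hn : n = 0 ∨ n + 1 < α * (formsAt ℓ (e 0)).card := h2.imp_right fun h => by push_cast at h; linarith
    obtain ⟨r, hr, hfin⟩ := exists_lintegral_ball_ne_top_of_chartBound_ne hnp hα.le hα1 h.measurable
      (h.chartBound_ne hne hα hn) (JumpWitness.chartBound_ne (e := swapBasis e) hne hα (by rwa [swapBasis_zero])
        (by rwa [swapBasis_zero])) (by exact_mod_cast h1)
    exact absurd (h.inf r hr) hfin
end

section
/-- A function of one variable vanishing to order `k` at the centre of a disc: Schwarz bound and leading coefficient. -/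
theorem exists_leading_coeff {R : ℝ} (hR : 0 < R) (k : ℕ) : ∀ {φ : ℂ → ℂ} {M : ℝ},
    DifferentiableOn ℂ φ (Metric.ball 0 R) → (∀ s ∈ Metric.ball (0 : ℂ) R, ‖φ s‖ ≤ M) →
    (∃ C ε : ℝ, 0 < ε ∧ ∀ s ∈ Metric.ball (0 : ℂ) ε, ‖φ s‖ ≤ C * ‖s‖ ^ k) →
    (∀ s ∈ Metric.ball (0 : ℂ) R, ‖φ s‖ ≤ M * (‖s‖ / R) ^ k) ∧
    ∃ c : ℂ, ‖c‖ ≤ M / R ^ k ∧ ∀ s ∈ Metric.ball (0 : ℂ) R, ‖φ s - c * s ^ k‖ ≤ 2 * M * (‖s‖ / R) ^ (k + 1) := by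
  induction k with
  | zero =>
    intro φ M hφ hM _
    have h0 : ‖φ 0‖ ≤ M := hM 0 (Metric.mem_ball_self hR)
    refine ⟨by simpa using hM, φ 0, by simpa using h0, fun s hs => ?_⟩
    have h1 := Complex.norm_dslope_le_div_of_mapsTo_ball (c := 0) (R₁ := R) (R₂ := 2 * M) hφ (fun z hz => by
      rw [mem_closedBall_iff_norm]
      exact (norm_sub_le _ _).trans (by linarith [hM z hz])) hs
    have h2 := sub_smul_dslope φ 0 s
    rw [pow_zero, mul_one, ← h2, sub_zero, norm_smul, zero_add, pow_one]
    calc ‖s‖ * ‖dslope φ 0 s‖ ≤ ‖s‖ * (2 * M / R) := by gcongr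
      _ = _ := by ring
  | succ k ih =>
    rintro φ M hφ hM ⟨C, ε, hε, hO⟩
    have hball : Metric.ball (0 : ℂ) R ∈ nhds (0 : ℂ) := Metric.ball_mem_nhds _ hR
    have h0 : φ 0 = 0 := by
      have := hO 0 (Metric.mem_ball_self hε)
      simpa using this
    set ψ := dslope φ 0 with hψ
    have hφψ : ∀ s, φ s = s * ψ s := fun s => by
      have := sub_smul_dslope φ 0 s
      rw [h0, sub_zero, sub_zero, smul_eq_mul] at this
      exact this.symm
    have hψd : DifferentiableOn ℂ ψ (Metric.ball 0 R) := (Complex.differentiableOn_dslope hball).2 hφ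
    have hψM : ∀ s ∈ Metric.ball (0 : ℂ) R, ‖ψ s‖ ≤ M / R := fun z hz =>
      Complex.norm_dslope_le_div_of_mapsTo_ball hφ (fun z hz => by rw [h0]; simpa using hM z hz) hz
    have hδ : 0 < min ε R := lt_min hε hR
    have hψO : ∀ s ∈ Metric.ball (0 : ℂ) (min ε R), s ≠ 0 → ‖ψ s‖ ≤ C * ‖s‖ ^ k := fun s hs hs0 => by
      have h1 := hO s (Metric.ball_subset_ball (min_le_left _ _) hs)
      rw [hφψ, norm_mul, pow_succ, ← mul_assoc, mul_comm] at h1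
      exact le_of_mul_le_mul_right h1 (norm_pos_iff.2 hs0)
    have hψ0 : ‖ψ 0‖ ≤ C * ‖(0 : ℂ)‖ ^ k := by
      have hc : ContinuousAt ψ 0 := hψd.continuousOn.continuousAt hball
      refine le_of_tendsto_of_tendsto (b := nhdsWithin (0 : ℂ) {0}ᶜ) (hc.norm.mono_left nhdsWithin_le_nhds)
        (Continuous.tendsto (f := fun s : ℂ => C * ‖s‖ ^ k) (by fun_prop) 0 |>.mono_left nhdsWithin_le_nhds) ?_
      filter_upwards [self_mem_nhdsWithin, nhdsWithin_le_nhds (Metric.ball_mem_nhds (0 : ℂ) hδ)] with s hs0 hs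
      exact hψO s hs hs0
    obtain ⟨h1, c, hc, h2⟩ := ih hψd hψM ⟨C, min ε R, hδ, fun s hs => by
      by_cases hs0 : s = 0
      · rw [hs0]; exact hψ0
      · exact hψO s hs hs0⟩
    refine ⟨fun s hs => ?_, c, hc.trans (le_of_eq (by rw [pow_succ]; field_simp)), fun s hs => ?_⟩
    · rw [hφψ, norm_mul]
      calc ‖s‖ * ‖ψ s‖ ≤ ‖s‖ * (M / R * (‖s‖ / R) ^ k) := mul_le_mul_of_nonneg_left (h1 s hs) (norm_nonneg _)
        _ = _ := by rw [pow_succ]; field_simp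
    · have : φ s - c * s ^ (k + 1) = s * (ψ s - c * s ^ k) := by rw [hφψ]; ring
      rw [this, norm_mul]
      calc ‖s‖ * ‖ψ s - c * s ^ k‖ ≤ ‖s‖ * (2 * (M / R) * (‖s‖ / R) ^ (k + 1)) := mul_le_mul_of_nonneg_left (h2 s hs) (norm_nonneg _)
        _ = _ := by rw [pow_succ (‖s‖ / R) (k + 1)]; field_simp

end

section
variable {ι : Type*} [Fintype ι] {ℓ : ι → ((Fin 3 → ℂ) →ₗ[ℂ] ℂ)}
variable {α ρ : ℝ} {g : (Fin 3 → ℂ) → ℂ} {e : Module.Basis (Fin 3) ℂ (Fin 3 → ℂ)}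

theorem coord_one_coneMap (e : Module.Basis (Fin 3) ℂ (Fin 3 → ℂ)) (ζ s σ : ℂ) :
    e.coord 1 (coneMap e (ζ, s, σ)) = ζ * s ∧ e.coord 1 (coneMap (swapBasis e) (ζ, s, σ)) = ζ * (s * σ) := by
  simp only [coneMap, swapBasis_zero, swapBasis_one, swapBasis_two]
  constructor <;> simp

/-- A point of integral weight at least two is a jumping point. -/
theorem exists_jumpWitness_of_ne_zero (hne : ∀ i, ℓ i ≠ 0) (hnp : ∀ i j, i ≠ j → ∀ c : ℂ, ℓ i ≠ c • ℓ j)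
    (hα : 0 < α) (hα1 : α < 1) {x : Fin 3 → ℂ} (hx : x ≠ 0) {k : ℕ} (hk : α * (formsAt ℓ x).card = k + 2) :
    ∃ ρ g, JumpWitness ℓ α x ρ g := by
  obtain ⟨e, rfl⟩ := exists_basis_zero_eq hx
  have hcont : Continuous fun y => e.coord 1 y ^ k := (continuous_coord e 1).pow k
  have hdiff : Differentiable ℂ fun y => e.coord 1 y ^ k :=
    (LinearMap.toContinuousLinearMap (e.coord 1)).differentiable.pow k
  have hm : 0 < ((formsAt ℓ (e 0)).card : ℝ) := by
    by_contra h
    have : (0 : ℝ) < k + 2 := by positivity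
    nlinarith
  obtain ⟨ε₁, h1⟩ := exists_coneRadius ℓ e
  obtain ⟨ε₂, h2⟩ := exists_coneRadius ℓ (swapBasis e)
  have hζ : ∀ ε, ε ≤ 1 → ∀ ζ ∈ Metric.ball (1 : ℂ) ε, ‖ζ‖ ≤ 2 := fun ε hε ζ hζ => by
    have : ‖ζ - 1‖ < ε := mem_ball_iff_norm.1 hζ
    have h := norm_add_le (ζ - 1) 1
    rw [sub_add_cancel, norm_one] at h
    linarith
  have c1 : ChartBound ℓ (fun y => e.coord 1 y ^ k) e 1 0 k :=
    ⟨min ε₁ 1, lt_min h1.1 one_pos, fun ε hε hle => ⟨h1.mono hε (hle.trans (min_le_left _ _)), 2 ^ k, by positivity,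
      fun ζ hz s _ σ _ => by
        beta_reduce
        rw [(coord_one_coneMap e ζ s σ).1, norm_pow, norm_mul, mul_pow, pow_zero, mul_one]
        gcongr
        exact hζ ε (hle.trans (min_le_right _ _)) ζ hz⟩⟩
  have c2 : ChartBound ℓ (fun y => e.coord 1 y ^ k) (swapBasis e) 1 0 k :=
    ⟨min ε₂ 1, lt_min h2.1 one_pos, fun ε hε hle => ⟨h2.mono hε (hle.trans (min_le_left _ _)), 2 ^ k * 2 ^ k, by positivity,
      fun ζ hz s _ σ hσ => by
        beta_reduce
        rw [(coord_one_coneMap e ζ s σ).2, norm_pow, norm_mul, norm_mul, mul_pow, mul_pow, pow_zero, mul_one, mul_assoc,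
          mul_comm (‖s‖ ^ k)]
        gcongr
        · exact hζ ε (hle.trans (min_le_right _ _)) ζ hz
        · exact (mem_ball_zero_iff.1 hσ).le⟩⟩
  refine ⟨1, fun y => e.coord 1 y ^ k, one_pos, hcont.measurable, hdiff.differentiableOn, fun β h0 hβ => ?_, fun r hr => ?_⟩
  · exact exists_lintegral_ball_ne_top_of_chartBound_ne hnp h0.le (hβ.trans hα1) hcont.measurable c1 c2
      (by rw [← hk]; exact mul_lt_mul_of_pos_right hβ hm)
  · by_contra hfin
    obtain ⟨δ, hδ, H⟩ := exists_chart_bound_ne hne e hr hα.le hcont.measurable hdiff.differentiableOn hfin (n := k + 1)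
      (Or.inr (by rw [hk]; push_cast; linarith))
    obtain ⟨-, C, hC, hb⟩ := H δ hδ le_rfl
    set s : ℝ := min (δ / 2) (1 / (2 * C)) with hs
    have hs0 : 0 < s := by positivity
    have hsδ : s < δ := (min_le_left _ _).trans_lt (by linarith)
    have h := hb 1 (Metric.mem_ball_self hδ) (s : ℂ) (by simpa [abs_of_pos hs0] using hsδ) 0 (by simp)
    beta_reduce at h
    rw [(coord_one_coneMap e 1 s 0).1, one_mul, norm_pow, Complex.norm_real, Real.norm_of_nonneg hs0.le, pow_zero, mul_one,
      pow_succ, ← mul_assoc, mul_comm, ← mul_assoc, mul_comm] at h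
    have h3 : (1 : ℝ) ≤ s * C := by
      have : 0 < s ^ k := by positivity
      nlinarith
    have h4 : s * C ≤ 1 / (2 * C) * C := mul_le_mul_of_nonneg_right (min_le_right _ _) hC.le
    have h5 : 1 / (2 * C) * C = 1 / 2 := by field_simp
    linarith

/-- A nonzero homogeneous function vanishing to the right order along the special lines
makes the origin a jumping point. -/
theorem exists_jumpWitness_zero (hne : ∀ i, ℓ i ≠ 0) (hnp : ∀ i j, i ≠ j → ∀ c : ℂ, ℓ i ≠ c • ℓ j)
    (hα : 0 < α) (hα1 : α < 1) {k : ℕ} (hk : α * Fintype.card ι = k + 3) {G : (Fin 3 → ℂ) → ℂ} (hG : Differentiable ℂ G)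
    (hhom : ∀ (c : ℂ) x, G (c • x) = c ^ k * G x) (hne0 : ∃ x, G x ≠ 0)
    (H : ∀ x : Fin 3 → ℂ, x ≠ 0 → ∃ e : Module.Basis (Fin 3) ℂ (Fin 3 → ℂ), ∃ c : ℂ, x = c • e 0 ∧ ∃ n : ℕ,
      α * (formsAt ℓ (e 0)).card ≤ n + 2 ∧ ∃ M > 0, ∀ s ∈ Metric.ball (0 : ℂ) 1, ∀ σ ∈ Metric.ball (0 : ℂ) 2,
        ‖G (e 0 + s • (e 1 + σ • e 2))‖ ≤ M * ‖s‖ ^ n ∧ ‖G (e 0 + s • (e 2 + σ • e 1))‖ ≤ M * ‖s‖ ^ n) :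
    ∃ ρ g, JumpWitness ℓ α 0 ρ g := by
  have hd : 0 < (Fintype.card ι : ℝ) := by
    by_contra h
    have : (0 : ℝ) < k + 3 := by positivity
    nlinarith
  have hcb : ∀ (e : Module.Basis (Fin 3) ℂ (Fin 3 → ℂ)) (M : ℝ) (n : ℕ), 0 < M → (∀ s ∈ Metric.ball (0 : ℂ) 1,
      ∀ σ ∈ Metric.ball (0 : ℂ) 2, ‖G (e 0 + s • (e 1 + σ • e 2))‖ ≤ M * ‖s‖ ^ n) → ChartBound ℓ G e 0 k n := by
    intro e M n hM h
    obtain ⟨ε₁, h1⟩ := exists_coneRadius ℓ e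
    refine ⟨min ε₁ 1, lt_min h1.1 one_pos, fun ε hε hle => ⟨h1.mono hε (hle.trans (min_le_left _ _)), M, hM,
      fun ζ hz s hs σ hσ => ?_⟩⟩
    have := h s (Metric.ball_subset_ball (hle.trans (min_le_right _ _)) hs) σ hσ
    simp only [coneMap]
    rw [hhom, norm_mul, norm_pow]
    calc ‖ζ‖ ^ k * _ ≤ ‖ζ‖ ^ k * (M * ‖s‖ ^ n) := mul_le_mul_of_nonneg_left this (by positivity)
      _ = _ := by ring
  refine ⟨1, G, one_pos, hG.continuous.measurable, hG.differentiableOn, fun β h0 hβ => ?_, fun r hr => ?_⟩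
  · refine exists_lintegral_ball_ne_top_of_chartBound_zero hnp h0.le (hβ.trans hα1) hG.continuous.measurable (k := k)
      (by rw [← hk]; exact mul_lt_mul_of_pos_right hβ hd) fun x hx => ?_
    obtain ⟨e, c, hx, n, hn, M, hM, hb⟩ := H x hx
    refine ⟨e, c, hx, n, hcb e M n hM fun s hs σ hσ => (hb s hs σ hσ).1, hcb _ M n hM fun s hs σ hσ => ?_, ?_⟩
    · rw [swapBasis_zero, swapBasis_one, swapBasis_two]
      exact (hb s hs σ hσ).2
    · rcases Nat.eq_zero_or_pos (formsAt ℓ (e 0)).card with h | h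
      · rw [h]; push_cast; rw [mul_zero]; positivity
      · exact (mul_lt_mul_of_pos_right hβ (by exact_mod_cast h)).trans_le hn
  · by_contra hfin
    obtain ⟨x, hx⟩ := hne0
    obtain ⟨y, hy0, hy⟩ : ∃ y, y ≠ 0 ∧ G y ≠ 0 := by
      by_cases hx0 : x = 0
      · have := (hG.continuous.continuousAt (x := x)).eventually_ne hx
        subst hx0
        have h2 : ∀ᶠ y in nhdsWithin (0 : Fin 3 → ℂ) {0}ᶜ, y ≠ 0 ∧ G y ≠ 0 :=
          (show ∀ᶠ y in nhdsWithin (0 : Fin 3 → ℂ) {0}ᶜ, y ≠ 0 from self_mem_nhdsWithin).and (nhdsWithin_le_nhds this)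
        exact h2.exists
      · exact ⟨x, hx0, hx⟩
    obtain ⟨e, rfl⟩ := exists_basis_zero_eq hy0
    obtain ⟨δ, hδ, H⟩ := exists_chart_bound_zero hne e hr hα.le hG.continuous.measurable hG.differentiableOn hfin (k := k + 1)
      (n := 0) (Or.inr (by rw [hk]; push_cast; linarith)) (Or.inl rfl)
    obtain ⟨-, C, hC, hb⟩ := H δ hδ le_rfl
    have hG0 : 0 < ‖G (e 0)‖ := norm_pos_iff.2 hy
    set s : ℝ := min (δ / 2) (‖G (e 0)‖ / (2 * C)) with hs
    have hs0 : 0 < s := by positivity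
    have hsδ : s < δ := (min_le_left _ _).trans_lt (by linarith)
    have h := hb s (by simpa [abs_of_pos hs0] using hsδ) 0 (Metric.mem_ball_self hδ) 0 (by simp)
    simp only [coneMap, zero_smul, add_zero] at h
    rw [hhom, norm_mul, norm_pow, Complex.norm_real, Real.norm_of_nonneg hs0.le, pow_zero, mul_one, pow_succ] at h
    have h3 : ‖G (e 0)‖ ≤ s * C := by
      have : 0 < s ^ k := by positivity
      have h' : s ^ k * ‖G (e 0)‖ ≤ s ^ k * (s * C) := by linarith
      exact le_of_mul_le_mul_left h' this
    have h4 : s * C ≤ ‖G (e 0)‖ / (2 * C) * C := mul_le_mul_of_nonneg_right (min_le_right _ _) hC.le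
    have h5 : ‖G (e 0)‖ / (2 * C) * C = ‖G (e 0)‖ / 2 := by field_simp
    linarith
end

section
/-- The leading homogeneous part of order `k` of a function vanishing to order `k` at the origin along all lines. -/
theorem exists_leading_part {r M : ℝ} (hr : 0 < r) {g : (Fin 3 → ℂ) → ℂ} (hd : DifferentiableOn ℂ g (Metric.ball 0 r))
    (hM : ∀ y ∈ Metric.ball 0 r, ‖g y‖ ≤ M) {k : ℕ}
    (hO : ∀ x : Fin 3 → ℂ, ∃ C ε : ℝ, 0 < ε ∧ ∀ s ∈ Metric.ball (0 : ℂ) ε, ‖g (s • x)‖ ≤ C * ‖s‖ ^ k) :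
    ∃ G : (Fin 3 → ℂ) → ℂ, (∀ (c : ℂ) x, G (c • x) = c ^ k * G x) ∧
      (∀ x y, Differentiable ℂ fun τ : ℂ => G (x + τ • y)) ∧
      (∃ C, ∀ x, ‖G x‖ ≤ C * (1 + ‖x‖) ^ k) ∧
      (∀ x, Filter.Tendsto (fun s : ℂ => g (s • x) / s ^ k) (nhdsWithin 0 {0}ᶜ) (nhds (G x))) ∧
      ((∀ x, G x = 0) → ∃ C, ∃ ε > 0, ∀ y ∈ Metric.ball 0 ε, ‖g y‖ ≤ C * ‖y‖ ^ (k + 1)) := by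
  have hM0 : 0 ≤ M := (norm_nonneg _).trans (hM 0 (Metric.mem_ball_self hr))
  have hmem : ∀ (x : Fin 3 → ℂ) (s : ℂ), s ∈ Metric.ball (0 : ℂ) (r / (1 + ‖x‖)) → s • x ∈ Metric.ball 0 r := fun x s hs => by
    rw [mem_ball_zero_iff, norm_smul]
    rw [mem_ball_zero_iff, lt_div_iff₀ (by positivity)] at hs
    nlinarith [norm_nonneg s]
  have key : ∀ x : Fin 3 → ℂ, ∃ c : ℂ, ‖c‖ ≤ M / (r / (1 + ‖x‖)) ^ k ∧ ∀ s ∈ Metric.ball (0 : ℂ) (r / (1 + ‖x‖)),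
      ‖g (s • x) - c * s ^ k‖ ≤ 2 * M * (‖s‖ / (r / (1 + ‖x‖))) ^ (k + 1) := fun x =>
    (exists_leading_coeff (R := r / (1 + ‖x‖)) (by positivity) k (φ := fun s => g (s • x))
      (hd.comp (by fun_prop) fun s hs => hmem x s hs) (fun s hs => hM _ (hmem x s hs)) (hO x)).2
  choose G hG1 hG2 using key
  have hB : ∀ (B : ℝ) (x : Fin 3 → ℂ), 1 + ‖x‖ ≤ B → ∀ s : ℂ, s ≠ 0 → ‖s‖ * B < r →
      ‖g (s • x) / s ^ k - G x‖ ≤ 2 * M * (B / r) ^ (k + 1) * ‖s‖ := fun B x hx s hs0 hs => by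
    have hs' : 0 < ‖s‖ := norm_pos_iff.2 hs0
    have h1 := hG2 x s (by
      rw [mem_ball_zero_iff, lt_div_iff₀ (by positivity)]
      exact (mul_le_mul_of_nonneg_left hx hs'.le).trans_lt hs)
    have h2 : g (s • x) / s ^ k - G x = (g (s • x) - G x * s ^ k) / s ^ k := by field_simp
    rw [h2, norm_div, norm_pow, div_le_iff₀ (by positivity)]
    refine h1.trans ?_
    have h3 : ‖s‖ / (r / (1 + ‖x‖)) ≤ B / r * ‖s‖ := by
      rw [div_div_eq_mul_div, div_mul_eq_mul_div, mul_comm B]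
      gcongr
    calc 2 * M * (‖s‖ / (r / (1 + ‖x‖))) ^ (k + 1) ≤ 2 * M * (B / r * ‖s‖) ^ (k + 1) := by gcongr
      _ = _ := by rw [mul_pow, pow_succ ‖s‖]; ring
  have hunif : ∀ (B : ℝ) (X : Set ℂ) (y : ℂ → Fin 3 → ℂ), (∀ τ ∈ X, 1 + ‖y τ‖ ≤ B) → 0 < B →
      TendstoUniformlyOn (fun (s : ℂ) τ => g (s • y τ) / s ^ k) (fun τ => G (y τ)) (nhdsWithin 0 {0}ᶜ) X := by
    intro B X y hX hB0
    rw [Metric.tendstoUniformlyOn_iff]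
    intro ε hε
    have t1 : Filter.Tendsto (fun s : ℂ => 2 * M * (B / r) ^ (k + 1) * ‖s‖) (nhdsWithin 0 {0}ᶜ) (nhds 0) := by
      refine Filter.Tendsto.mono_left ?_ nhdsWithin_le_nhds
      exact Continuous.tendsto' (by fun_prop) _ _ (by simp)
    have t2 : Filter.Tendsto (fun s : ℂ => ‖s‖ * B) (nhdsWithin 0 {0}ᶜ) (nhds 0) := by
      refine Filter.Tendsto.mono_left ?_ nhdsWithin_le_nhds
      exact Continuous.tendsto' (by fun_prop) _ _ (by simp)
    filter_upwards [t1.eventually (gt_mem_nhds hε), t2.eventually (gt_mem_nhds hr), self_mem_nhdsWithin] with s h1 h2 h3 τ hτ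
    rw [dist_comm, dist_eq_norm]
    exact (hB B (y τ) (hX τ hτ) s h3 h2).trans_lt h1
  have hlim : ∀ x, Filter.Tendsto (fun s : ℂ => g (s • x) / s ^ k) (nhdsWithin 0 {0}ᶜ) (nhds (G x)) := fun x =>
    (hunif (1 + ‖x‖) Set.univ (fun _ => x) (fun _ _ => le_rfl) (by positivity)).tendsto_at (Set.mem_univ (0 : ℂ))
  refine ⟨G, fun c x => ?_, fun x y => ?_, ⟨M / r ^ k, fun x => (hG1 x).trans (le_of_eq ?_)⟩, hlim, fun h0 => ?_⟩
  · by_cases hc : c = 0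
    · subst hc
      have h1 := hlim (0 : Fin 3 → ℂ)
      rw [zero_smul]
      rcases Nat.eq_zero_or_pos k with hk | hk
      · subst hk
        simp only [smul_zero, pow_zero, div_one] at h1
        rw [pow_zero, one_mul, tendsto_nhds_unique h1 tendsto_const_nhds]
        have h2 := hlim x
        simp only [pow_zero, div_one] at h2
        have h3 : Filter.Tendsto (fun s : ℂ => g (s • x)) (nhdsWithin 0 {0}ᶜ) (nhds (g 0)) := by
          have hc : ContinuousAt g 0 := hd.continuousOn.continuousAt (Metric.ball_mem_nhds 0 hr)
          refine hc.tendsto.comp (Filter.Tendsto.mono_left ?_ nhdsWithin_le_nhds)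
          exact Continuous.tendsto' (by fun_prop) _ _ (by simp)
        exact tendsto_nhds_unique h3 h2
      · have hg0 : g 0 = 0 := by
          obtain ⟨C, ε, hε, h⟩ := hO 0
          have := h 0 (Metric.mem_ball_self hε)
          simpa [hk.ne'] using this
        simp only [smul_zero, hg0, zero_div] at h1
        rw [zero_pow hk.ne', zero_mul]
        exact tendsto_nhds_unique h1 tendsto_const_nhds
    · have h1 : Filter.Tendsto (fun s : ℂ => s * c) (nhdsWithin 0 {0}ᶜ) (nhdsWithin 0 {0}ᶜ) := by
        refine tendsto_nhdsWithin_iff.2 ⟨Filter.Tendsto.mono_left ?_ nhdsWithin_le_nhds, ?_⟩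
        · exact Continuous.tendsto' (by fun_prop) _ _ (by simp)
        · filter_upwards [self_mem_nhdsWithin] with s hs
          exact mul_ne_zero hs hc
      have h2 := ((hlim x).comp h1).const_mul (c ^ k)
      refine tendsto_nhds_unique (hlim (c • x)) (h2.congr fun s => ?_)
      simp only [Function.comp_apply, mul_smul, mul_pow]
      field_simp
  · intro τ₀
    set T := ‖τ₀‖ + 1 with hT
    set B := 1 + (‖x‖ + T * ‖y‖) with hB'
    have hT0 : 0 < T := by positivity
    have hBX : ∀ τ ∈ Metric.ball (0 : ℂ) T, 1 + ‖x + τ • y‖ ≤ B := fun τ hτ => by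
      have : ‖x + τ • y‖ ≤ ‖x‖ + ‖τ‖ * ‖y‖ := (norm_add_le _ _).trans (by rw [norm_smul])
      have h2 : ‖τ‖ * ‖y‖ ≤ T * ‖y‖ := mul_le_mul_of_nonneg_right (mem_ball_zero_iff.1 hτ).le (norm_nonneg _)
      linarith
    have hB0 : 0 < B := by positivity
    have hu := hunif B (Metric.ball 0 T) (fun τ => x + τ • y) hBX hB0
    have t2 : Filter.Tendsto (fun s : ℂ => ‖s‖ * B) (nhdsWithin 0 {0}ᶜ) (nhds 0) := by
      refine Filter.Tendsto.mono_left ?_ nhdsWithin_le_nhds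
      exact Continuous.tendsto' (by fun_prop) _ _ (by simp)
    have hdiff := hu.tendstoLocallyUniformlyOn.differentiableOn (by
      filter_upwards [t2.eventually (gt_mem_nhds hr)] with s hs
      refine DifferentiableOn.div_const (hd.comp (by fun_prop) fun τ hτ => ?_) _
      rw [mem_ball_zero_iff, norm_smul]
      refine (mul_le_mul_of_nonneg_left ?_ (norm_nonneg s)).trans_lt hs
      linarith [hBX τ hτ]) Metric.isOpen_ball
    exact hdiff.differentiableAt (Metric.isOpen_ball.mem_nhds (mem_ball_zero_iff.2 (by rw [hT]; linarith)))
  · rw [div_pow]; field_simp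
  · refine ⟨2 * M / (r / 2) ^ (k + 1), r / 2, by positivity, fun y hy => ?_⟩
    by_cases hy0 : y = 0
    · obtain ⟨C, ε, hε, h⟩ := hO 0
      have h1 := hlim 0
      rw [h0] at h1
      have h2 := hG2 (0 : Fin 3 → ℂ) 0 (Metric.mem_ball_self (by positivity))
      rw [h0] at h2
      simpa [hy0] using h2
    · have hn : ‖y‖ ≠ 0 := norm_ne_zero_iff.2 hy0
      have hx : ‖((‖y‖⁻¹ : ℝ) : ℂ) • y‖ = 1 := by
        rw [norm_smul, Complex.norm_real, norm_inv, norm_norm, inv_mul_cancel₀ hn]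
      have h2 := hG2 (((‖y‖⁻¹ : ℝ) : ℂ) • y) (‖y‖ : ℂ) (by
        rw [hx, mem_ball_zero_iff, Complex.norm_real, norm_norm]
        rw [mem_ball_zero_iff] at hy
        linarith)
      have hs : (‖y‖ : ℂ) • ((‖y‖⁻¹ : ℝ) : ℂ) • y = y := by
        rw [smul_smul, ← Complex.ofReal_mul, mul_inv_cancel₀ hn, Complex.ofReal_one, one_smul]
      rw [h0, zero_mul, sub_zero, hs, hx, Complex.norm_real, norm_norm] at h2
      refine h2.trans (le_of_eq ?_)
      rw [div_pow]
      norm_num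
      ring
end

section
variable {ι : Type*} [Fintype ι] {ℓ : ι → ((Fin 3 → ℂ) →ₗ[ℂ] ℂ)}
variable {α ρ : ℝ} {g : (Fin 3 → ℂ) → ℂ} {e : Module.Basis (Fin 3) ℂ (Fin 3 → ℂ)}

theorem ChartBound.add_order {k n : ℕ} (h : ChartBound ℓ g e 0 k n) {r C : ℝ} (hr : 0 < r)
    (hd : DifferentiableOn ℂ g (Metric.ball 0 r)) {k' : ℕ} (hC : ∀ y ∈ Metric.ball 0 r, ‖g y‖ ≤ C * ‖y‖ ^ k') :
    ChartBound ℓ g e 0 k' n := by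
  obtain ⟨δ, hδ, H⟩ := h
  obtain ⟨δ', hδ', hcone⟩ := exists_coneMap_mem_ball e 0 hr
  rw [zero_smul] at hcone
  refine ⟨min δ δ', lt_min hδ hδ', fun ε hε hle => ?_⟩
  obtain ⟨hcr, M, hM, hb⟩ := H ε hε (hle.trans (min_le_left _ _))
  refine ⟨hcr, M * ε ^ k / ε ^ k', by positivity, fun ζ hζ s hs σ hσ => ?_⟩
  have hmem : ∀ ζ ∈ Metric.ball (0 : ℂ) ε, coneMap e (ζ, s, σ) ∈ Metric.ball 0 r := fun ζ hζ =>
    hcone (ζ, s, σ) ⟨Metric.ball_subset_ball (hle.trans (min_le_right _ _)) hζ,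
      Metric.ball_subset_ball (hle.trans (min_le_right _ _)) hs, hσ⟩
  have h1 := (exists_leading_coeff hε k' (φ := fun ζ => g (coneMap e (ζ, s, σ))) (M := M * ε ^ k * ‖s‖ ^ n)
    (hd.comp ((differentiable_coneMap e).comp (by fun_prop)).differentiableOn fun ζ hζ => hmem ζ hζ)
    (fun ζ hζ => (hb ζ hζ s hs σ hσ).trans (by
      have := (mem_ball_zero_iff.1 hζ).le
      gcongr))
    ⟨C * ‖e 0 + s • (e 1 + σ • e 2)‖ ^ k', ε, hε, fun ζ hζ => (hC _ (hmem ζ hζ)).trans (le_of_eq (by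
      rw [coneMap, norm_smul, mul_pow]; ring))⟩).1 ζ hζ
  refine h1.trans (le_of_eq ?_)
  rw [div_pow]
  field_simp
end

section
variable {ι : Type*} [Fintype ι] {ℓ : ι → ((Fin 3 → ℂ) →ₗ[ℂ] ℂ)}
variable {α ρ : ℝ} {g : (Fin 3 → ℂ) → ℂ} {e : Module.Basis (Fin 3) ℂ (Fin 3 → ℂ)}

/-- At the origin, if no other point has integral weight at least two, divisibility to too high an order is impossible. -/
theorem JumpWitness.le_of_chartBound (hnp : ∀ i j, i ≠ j → ∀ c : ℂ, ℓ i ≠ c • ℓ j)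
    (hα : 0 < α) (hα1 : α < 1) (h : JumpWitness ℓ α 0 ρ g)
    (hna : ∀ x : Fin 3 → ℂ, x ≠ 0 → ∀ k : ℕ, α * (formsAt ℓ x).card ≠ k + 2) {K : ℕ}
    (hK : ∀ (e : Module.Basis (Fin 3) ℂ (Fin 3 → ℂ)) (n : ℕ), (n = 0 ∨ n + 1 < α * (formsAt ℓ (e 0)).card) → ChartBound ℓ g e 0 K n) :
    K + 3 ≤ α * Fintype.card ι := by
  by_contra hlt
  push Not at hlt
  obtain ⟨r, hr, hfin⟩ := exists_lintegral_ball_ne_top_of_chartBound_zero hnp hα.le hα1 h.measurable hlt fun x hx => by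
    obtain ⟨e, rfl⟩ := exists_basis_zero_eq hx
    rcases exists_nat_of_real (α * (formsAt ℓ (e 0)).card) 2 with ⟨k, h1⟩ | ⟨n, h1, h2⟩
    · exact absurd (by exact_mod_cast h1) (hna _ hx k)
    · have hn : n = 0 ∨ n + 1 < α * (formsAt ℓ (e 0)).card := h2.imp_right fun h => by push_cast at h; linarith
      exact ⟨e, 1, (one_smul ℂ _).symm, n, hK e n hn, hK _ n (by rwa [swapBasis_zero]), by exact_mod_cast h1⟩
  exact hfin (h.inf r hr)

/-- The leading homogeneous part of a jump witness at the origin. -/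
theorem JumpWitness.exists_leading_part (hne : ∀ i, ℓ i ≠ 0) (hnp : ∀ i j, i ≠ j → ∀ c : ℂ, ℓ i ≠ c • ℓ j)
    (hα : 0 < α) (hα1 : α < 1) (h : JumpWitness ℓ α 0 ρ g)
    (hna : ∀ x : Fin 3 → ℂ, x ≠ 0 → ∀ k : ℕ, α * (formsAt ℓ x).card ≠ k + 2) :
    ∃ k : ℕ, α * Fintype.card ι = k + 3 ∧ ∃ G : (Fin 3 → ℂ) → ℂ, (∀ (c : ℂ) x, G (c • x) = c ^ k * G x) ∧
      (∀ x y, Differentiable ℂ fun τ : ℂ => G (x + τ • y)) ∧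
      (∃ C, ∀ x, ‖G x‖ ≤ C * (1 + ‖x‖) ^ k) ∧ (∃ x, G x ≠ 0) ∧
      ∀ (e : Module.Basis (Fin 3) ℂ (Fin 3 → ℂ)) (n : ℕ), (n = 0 ∨ n + 1 < α * (formsAt ℓ (e 0)).card) →
        ∃ C, ∃ ε > 0, ∀ s ∈ Metric.ball (0 : ℂ) ε, ∀ σ ∈ Metric.ball (0 : ℂ) 2,
          ‖G (e 0 + s • (e 1 + σ • e 2))‖ ≤ C * ‖s‖ ^ n := by
  rcases exists_nat_of_real (α * Fintype.card ι) 3 with ⟨k, h1⟩ | ⟨K, h1, h2⟩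
  · push_cast at h1
    refine ⟨k, h1, ?_⟩
    have hcb : ∀ (e : Module.Basis (Fin 3) ℂ (Fin 3 → ℂ)) (n : ℕ), (n = 0 ∨ n + 1 < α * (formsAt ℓ (e 0)).card) →
        ChartBound ℓ g e 0 k n := fun e n hn => h.chartBound_zero hne hα e (Or.inr (by linarith)) hn
    obtain ⟨r, hr, M, -, hrρ, hM⟩ := exists_norm_le_of_differentiableOn h.pos h.diff
    have hd := h.diff.mono (Metric.ball_subset_ball hrρ)
    have hO0 : ∀ x : Fin 3 → ℂ, x ≠ 0 → ∃ C ε : ℝ, 0 < ε ∧ ∀ s ∈ Metric.ball (0 : ℂ) ε, ‖g (s • x)‖ ≤ C * ‖s‖ ^ k := by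
      intro x hx
      obtain ⟨e, rfl⟩ := exists_basis_zero_eq hx
      obtain ⟨δ, hδ, H⟩ := hcb e 0 (Or.inl rfl)
      obtain ⟨-, C, -, hb⟩ := H δ hδ le_rfl
      refine ⟨C, δ, hδ, fun s hs => ?_⟩
      have := hb s hs 0 (Metric.mem_ball_self hδ) 0 (by simp)
      simpa [coneMap] using this
    have hO : ∀ x : Fin 3 → ℂ, ∃ C ε : ℝ, 0 < ε ∧ ∀ s ∈ Metric.ball (0 : ℂ) ε, ‖g (s • x)‖ ≤ C * ‖s‖ ^ k := by
      intro x
      by_cases hx : x = 0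
      · subst hx
        rcases Nat.eq_zero_or_pos k with hk | hk
        · exact ⟨‖g 0‖, 1, one_pos, fun s _ => by simp [hk]⟩
        · obtain ⟨C, ε, hε, hb⟩ := hO0 (fun _ => 1) (fun h => one_ne_zero (congrFun h 0))
          have h0 := hb 0 (Metric.mem_ball_self hε)
          rw [zero_smul, norm_zero, zero_pow hk.ne', mul_zero, norm_le_zero_iff] at h0
          exact ⟨0, 1, one_pos, fun s _ => by simp [h0]⟩
      · exact hO0 x hx
    obtain ⟨G, hhom, hdiff, hgr, hlim, hz⟩ := _root_.exists_leading_part hr hd hM hO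
    refine ⟨G, hhom, hdiff, hgr, ?_, fun e n hn => ?_⟩
    · by_contra hG
      push Not at hG
      obtain ⟨C, ε, hε, hb⟩ := hz hG
      have := h.le_of_chartBound hnp hα hα1 hna (K := k + 1) fun e n hn =>
        (hcb e n hn).add_order (lt_min hε hr) (hd.mono (Metric.ball_subset_ball (min_le_right _ _)))
          fun y hy => hb y (Metric.ball_subset_ball (min_le_left _ _) hy)
      push_cast at this
      linarith
    · obtain ⟨δ, hδ, H⟩ := hcb e n hn
      obtain ⟨-, C, -, hb⟩ := H δ hδ le_rfl
      refine ⟨C, δ, hδ, fun s hs σ hσ => le_of_tendsto (hlim _).norm ?_⟩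
      filter_upwards [self_mem_nhdsWithin, nhdsWithin_le_nhds (Metric.ball_mem_nhds (0 : ℂ) hδ)] with ζ hζ0 hζ
      rw [norm_div, norm_pow, div_le_iff₀ (pow_pos (norm_pos_iff.2 hζ0) k)]
      refine (hb ζ hζ s hs σ hσ).trans (le_of_eq (by ring))
  · have := h.le_of_chartBound hnp hα hα1 hna (K := K) fun e n hn =>
      h.chartBound_zero hne hα e (h2.imp_right fun h => by push_cast at h; linarith) hn
    push_cast at h1
    linarith
end

/-- Exponent pairs of the monomials in two variables of total degree less than `n`. -/
def tri (n : ℕ) : Finset (ℕ × ℕ) :=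
  (Finset.range n ×ˢ Finset.range n).filter fun p => p.1 + p.2 < n

theorem mem_tri {n : ℕ} {p : ℕ × ℕ} : p ∈ tri n ↔ p.1 + p.2 < n := by
  simp only [tri, Finset.mem_filter, Finset.mem_product, Finset.mem_range]
  omega

theorem card_tri (n : ℕ) : (tri n).card = (n + 1).choose 2 := by
  induction n with
  | zero => rfl
  | succ n ih =>
    have : tri (n + 1) = tri n ∪ Finset.HasAntidiagonal.antidiagonal n := by
      ext p
      simp only [mem_tri, Finset.mem_union, Finset.HasAntidiagonal.mem_antidiagonal]
      omega
    rw [this, Finset.card_union_of_disjoint, ih, Finset.Nat.card_antidiagonal, Nat.choose_succ_succ' (n + 1) 1]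
    · simp [add_comm]
    · rw [Finset.disjoint_left]
      intro p hp hp'
      rw [mem_tri] at hp
      rw [Finset.HasAntidiagonal.mem_antidiagonal] at hp'
      omega

theorem exists_poly_of_growth {φ : ℂ → ℂ} (hφ : Differentiable ℂ φ) {C : ℝ} {k : ℕ}
    (hC : ∀ z, ‖φ z‖ ≤ C * (1 + ‖z‖) ^ k) :
    ∃ c : ℕ → ℂ, ∀ z, φ z = ∑ j ∈ Finset.range (k + 1), c j * z ^ j := by
  have hzero : ∀ n ∉ Finset.range (k + 1), iteratedDeriv n φ 0 = 0 := by
    intro n hn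
    rw [Finset.mem_range, not_lt] at hn
    have hbd : ∀ R : ℝ, 1 ≤ R → ‖iteratedDeriv n φ 0‖ ≤ (n.factorial * C * 2 ^ k) * R⁻¹ := by
      intro R hR
      have hC0 : 0 ≤ C := by simpa using (norm_nonneg _).trans (hC 0)
      have h := Complex.norm_iteratedDeriv_le_of_forall_mem_sphere_norm_le (c := (0:ℂ)) (f := φ) n (by linarith : 0 < R)
        hφ.diffContOnCl (C := C * (2 * R) ^ k) (by
          intro z hz
          rw [mem_sphere_zero_iff_norm] at hz
          refine (hC z).trans ?_
          rw [hz]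
          gcongr
          linarith)
      refine h.trans ?_
      have hp : R ^ (k + 1) ≤ R ^ n := pow_le_pow_right₀ hR hn
      have hR0 : 0 < R := by linarith
      calc (n.factorial : ℝ) * (C * (2 * R) ^ k) / R ^ n ≤ n.factorial * (C * (2 * R) ^ k) / R ^ (k + 1) := by gcongr
        _ = _ := by rw [mul_pow, pow_succ]; field_simp
    have hlim : Filter.Tendsto (fun R : ℝ => (n.factorial * C * 2 ^ k) * R⁻¹) Filter.atTop (nhds 0) := by
      simpa using tendsto_inv_atTop_zero.const_mul (n.factorial * C * 2 ^ k)
    have := ge_of_tendsto hlim (Filter.eventually_atTop.2 ⟨1, hbd⟩)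
    exact norm_le_zero_iff.1 this
  refine ⟨fun j => ((j.factorial : ℂ))⁻¹ * iteratedDeriv j φ 0, fun z => ?_⟩
  have h1 := Complex.hasSum_taylorSeries_of_entire hφ 0 z
  have h2 := hasSum_sum_of_ne_finset_zero (L := SummationFilter.unconditional ℕ) (s := Finset.range (k + 1))
    (f := fun j => ((j.factorial : ℂ))⁻¹ • (z - 0) ^ j • iteratedDeriv j φ 0) (by
      intro j hj
      simp [hzero j hj])
  rw [h1.unique h2]
  refine Finset.sum_congr rfl fun j _ => ?_
  simp only [smul_eq_mul, sub_zero]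
  ring

theorem exists_bipoly_of_growth {P : ℂ → ℂ → ℂ}
    (hP : ∀ a b c d, Differentiable ℂ fun τ : ℂ => P (a + τ * b) (c + τ * d)) {C : ℝ} {k : ℕ}
    (hC : ∀ t x, ‖P t x‖ ≤ C * (1 + ‖t‖ + ‖x‖) ^ k) :
    ∃ c : ℕ × ℕ → ℂ, ∀ t x, P t x = ∑ p ∈ tri (k + 1), c p * (t ^ p.1 * x ^ p.2) := by
  have hC0 : 0 ≤ C := by simpa using (norm_nonneg _).trans (hC 0 0)
  have hcol : ∀ m : ℕ, ∃ c : ℕ → ℂ, ∀ t, P t m = ∑ j ∈ Finset.range (k + 1), c j * t ^ j := by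
    intro m
    refine exists_poly_of_growth (C := C * (1 + m) ^ k) (by simpa using hP 0 1 m 0) fun t => (hC t m).trans ?_
    rw [mul_assoc, ← mul_pow]
    gcongr
    rw [Complex.norm_natCast]
    nlinarith [norm_nonneg t, m.cast_nonneg (α := ℝ), mul_nonneg (norm_nonneg t) (m.cast_nonneg (α := ℝ))]
  choose c hc using hcol
  have hLag : ∀ t x, P t x = ∑ m ∈ Finset.range (k + 1),
      P t m * (Lagrange.basis (Finset.range (k + 1)) (fun m : ℕ => (m : ℂ)) m).eval x := by
    intro t x
    obtain ⟨a, ha⟩ := exists_poly_of_growth (φ := P t) (C := C * (1 + ‖t‖) ^ k) (k := k)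
      (by simpa using hP t 0 0 1) fun x => (hC t x).trans (by
        rw [mul_assoc, ← mul_pow]
        gcongr
        nlinarith [norm_nonneg t, norm_nonneg x, mul_nonneg (norm_nonneg t) (norm_nonneg x)])
    set q : Polynomial ℂ := ∑ j ∈ Finset.range (k + 1), Polynomial.C (a j) * Polynomial.X ^ j with hq
    have hqe : ∀ x, q.eval x = P t x := fun x => by simp [hq, ha, Polynomial.eval_finsetSum]
    have hdeg : q.degree < (Finset.range (k + 1)).card := by
      rw [Finset.card_range, Polynomial.degree_lt_iff_coeff_zero]
      intro m hm
      simp only [hq, Polynomial.finsetSum_coeff, Polynomial.coeff_C_mul_X_pow]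
      refine Finset.sum_eq_zero fun j hj => if_neg ?_
      rw [Finset.mem_range] at hj
      omega
    have hint := Lagrange.eq_interpolate_of_eval_eq (s := Finset.range (k + 1)) (v := fun m : ℕ => (m : ℂ))
      (fun m => P t m) (fun _ _ _ _ h => Nat.cast_injective h) hdeg fun i _ => hqe i
    rw [← hqe x, hint, Lagrange.interpolate_apply, Polynomial.eval_finsetSum]
    simp
  set L : ℕ → Polynomial ℂ := fun m => Lagrange.basis (Finset.range (k + 1)) (fun m : ℕ => (m : ℂ)) m
  have hLd : ∀ m ∈ Finset.range (k + 1), ∀ x, (L m).eval x = ∑ l ∈ Finset.range (k + 1), (L m).coeff l * x ^ l := by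
    intro m hm x
    refine Polynomial.eval_eq_sum_range' ?_ x
    have := Lagrange.natDegree_basis (s := Finset.range (k + 1)) (v := fun m : ℕ => (m : ℂ)) (fun _ _ _ _ h => Nat.cast_injective h) hm
    simp only [L]
    rw [this, Finset.card_range]
    omega
  set d : ℕ × ℕ → ℂ := fun p => ∑ m ∈ Finset.range (k + 1), c m p.1 * (L m).coeff p.2
  set S := Finset.range (k + 1) ×ˢ Finset.range (k + 1)
  have hS : ∀ t x, P t x = ∑ p ∈ S, d p * (t ^ p.1 * x ^ p.2) := by
    intro t x
    rw [hLag]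
    simp only [d, Finset.sum_mul]
    rw [Finset.sum_comm]
    refine Finset.sum_congr rfl fun m hm => ?_
    rw [hc, hLd m hm, Finset.sum_mul_sum, ← Finset.sum_product']
    exact Finset.sum_congr rfl fun p _ => by ring
  refine ⟨d, fun t x => ?_⟩
  obtain ⟨a, ha⟩ := exists_poly_of_growth (φ := fun τ => P (τ * t) (τ * x)) (C := C * (1 + ‖t‖ + ‖x‖) ^ k) (k := k)
    (by simpa using hP 0 t 0 x) fun τ => (hC _ _).trans (by
      rw [mul_assoc, ← mul_pow, norm_mul, norm_mul]
      gcongr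
      nlinarith [norm_nonneg τ, norm_nonneg t, norm_nonneg x])
  have hpoly : (∑ p ∈ S, Polynomial.C (d p * (t ^ p.1 * x ^ p.2)) * Polynomial.X ^ (p.1 + p.2)) =
      ∑ j ∈ Finset.range (k + 1), Polynomial.C (a j) * Polynomial.X ^ j := by
    refine Polynomial.funext fun τ => ?_
    have := ha τ
    rw [hS] at this
    simp only [Polynomial.eval_finsetSum, Polynomial.eval_mul, Polynomial.eval_C, Polynomial.eval_pow, Polynomial.eval_X]
    rw [← this]
    exact Finset.sum_congr rfl fun p _ => by rw [mul_pow, mul_pow, pow_add]; ring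
  have hcoeff : ∀ r ∈ Finset.range (k + 1), a r = ∑ p ∈ S, if r = p.1 + p.2 then d p * (t ^ p.1 * x ^ p.2) else 0 := by
    intro r hr
    have := congrArg (fun q => q.coeff r) hpoly
    simp only [Polynomial.finsetSum_coeff, Polynomial.coeff_C_mul, Polynomial.coeff_X_pow, mul_ite, mul_one, mul_zero] at this
    rw [this, Finset.sum_ite_eq, if_pos hr]
  have h1 := ha 1
  simp only [one_mul, one_pow, mul_one] at h1
  rw [h1, Finset.sum_congr rfl hcoeff, Finset.sum_comm, tri, Finset.sum_filter]
  refine Finset.sum_congr rfl fun p _ => ?_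
  rw [Finset.sum_ite_eq']
  simp

/-- The Taylor coefficient of index `q` at `(t, x)` of the polynomial with coefficients `c`. -/
def bitaylorCoeff (n : ℕ) (c : ℕ × ℕ → ℂ) (t x : ℂ) (q : ℕ × ℕ) : ℂ :=
  ∑ p ∈ tri n, c p * (((p.1.choose q.1 : ℂ) * t ^ (p.1 - q.1)) * ((p.2.choose q.2 : ℂ) * x ^ (p.2 - q.2)))

theorem add_pow_eq_sum_range {n j : ℕ} (hj : j < n) (t s : ℂ) :
    (t + s) ^ j = ∑ l ∈ Finset.range n, (j.choose l : ℂ) * t ^ (j - l) * s ^ l := by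
  rw [add_comm, add_pow]
  have hsub : Finset.range (j + 1) ⊆ Finset.range n := by
    intro i hi
    rw [Finset.mem_range] at *
    omega
  rw [← Finset.sum_subset hsub fun l _ hl => ?_]
  · exact Finset.sum_congr rfl fun l _ => by ring
  · rw [Finset.mem_range, not_lt] at hl
    rw [Nat.choose_eq_zero_of_lt hl]
    simp

theorem bitaylorCoeff_eq_zero {n : ℕ} {c : ℕ × ℕ → ℂ} {t x : ℂ} {q : ℕ × ℕ} (hq : q ∉ tri n) :
    bitaylorCoeff n c t x q = 0 := by
  refine Finset.sum_eq_zero fun p hp => ?_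
  rw [mem_tri] at hp hq
  rcases lt_or_ge p.1 q.1 with h | h
  · simp [Nat.choose_eq_zero_of_lt h]
  · rw [Nat.choose_eq_zero_of_lt (show p.2 < q.2 by omega)]
    simp

theorem bipoly_add (n : ℕ) (c : ℕ × ℕ → ℂ) (t x s y : ℂ) :
    ∑ p ∈ tri n, c p * ((t + s) ^ p.1 * (x + y) ^ p.2) =
      ∑ q ∈ tri n, bitaylorCoeff n c t x q * (s ^ q.1 * y ^ q.2) := by
  have h : ∀ p ∈ tri n, c p * ((t + s) ^ p.1 * (x + y) ^ p.2) = ∑ q ∈ Finset.range n ×ˢ Finset.range n,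
      c p * (((p.1.choose q.1 : ℂ) * t ^ (p.1 - q.1)) * ((p.2.choose q.2 : ℂ) * x ^ (p.2 - q.2))) * (s ^ q.1 * y ^ q.2) := by
    intro p hp
    rw [mem_tri] at hp
    rw [add_pow_eq_sum_range (show p.1 < n by omega), add_pow_eq_sum_range (show p.2 < n by omega), Finset.sum_mul_sum,
      ← Finset.sum_product', Finset.mul_sum]
    exact Finset.sum_congr rfl fun q _ => by ring
  rw [Finset.sum_congr rfl h, Finset.sum_comm]
  simp only [← Finset.sum_mul]
  symm
  refine Finset.sum_subset (Finset.filter_subset _ _) fun q _ hq => ?_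
  have := bitaylorCoeff_eq_zero (c := c) (t := t) (x := x) hq
  rw [bitaylorCoeff] at this
  rw [bitaylorCoeff, this, zero_mul]

theorem norm_bipoly_add_le {n e : ℕ} {c : ℕ × ℕ → ℂ} {t x : ℂ} (h : ∀ q ∈ tri e, bitaylorCoeff n c t x q = 0) :
    ∃ M > 0, ∀ s u v : ℂ, ‖s‖ < 1 → ‖u‖ ≤ 2 * ‖s‖ → ‖v‖ ≤ 2 * ‖s‖ →
      ‖∑ p ∈ tri n, c p * ((t + u) ^ p.1 * (x + v) ^ p.2)‖ ≤ M * ‖s‖ ^ e := by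
  refine ⟨∑ q ∈ tri n, ‖bitaylorCoeff n c t x q‖ * 2 ^ (q.1 + q.2) + 1, by positivity, fun s u v hs hu hv => ?_⟩
  rw [bipoly_add]
  refine (norm_sum_le _ _).trans ?_
  rw [add_mul, Finset.sum_mul]
  refine le_add_of_le_of_nonneg (Finset.sum_le_sum fun q _ => ?_) (by positivity)
  by_cases hq : q ∈ tri e
  · simp [h q hq]
  · rw [mem_tri, not_lt] at hq
    rw [norm_mul, norm_mul, norm_pow, norm_pow, mul_assoc]
    refine mul_le_mul_of_nonneg_left ?_ (norm_nonneg _)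
    calc ‖u‖ ^ q.1 * ‖v‖ ^ q.2 ≤ (2 * ‖s‖) ^ q.1 * (2 * ‖s‖) ^ q.2 := by gcongr
      _ = 2 ^ (q.1 + q.2) * ‖s‖ ^ (q.1 + q.2) := by rw [← pow_add, mul_pow]
      _ ≤ 2 ^ (q.1 + q.2) * ‖s‖ ^ e := by
        refine mul_le_mul_of_nonneg_left ?_ (by positivity)
        exact pow_le_pow_of_le_one (norm_nonneg _) hs.le hq

theorem _root_.Polynomial.coeff_eq_zero_of_norm_le {q : Polynomial ℂ} {C ε : ℝ} {e : ℕ} (hε : 0 < ε)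
    (h : ∀ s ∈ Metric.ball (0 : ℂ) ε, ‖q.eval s‖ ≤ C * ‖s‖ ^ e) : ∀ r < e, q.coeff r = 0 := by
  intro r
  induction r using Nat.strong_induction_on with
  | _ r ih =>
    intro hr
    obtain ⟨q', hq'⟩ := Polynomial.X_pow_dvd_iff.2 fun d hd => ih d hd (hd.trans hr)
    have hc : q.coeff r = q'.eval 0 := by
      rw [hq', Polynomial.coeff_X_pow_mul', if_pos le_rfl, Nat.sub_self, Polynomial.coeff_zero_eq_eval_zero]
    rw [hc]
    have hl : Filter.Tendsto (fun s => ‖q'.eval s‖) (nhdsWithin 0 {0}ᶜ) (nhds ‖q'.eval 0‖) :=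
      (q'.continuous.norm.tendsto 0).mono_left nhdsWithin_le_nhds
    have hr' : Filter.Tendsto (fun s : ℂ => C * ‖s‖ ^ (e - r)) (nhdsWithin 0 {0}ᶜ) (nhds 0) := by
      have : Continuous fun s : ℂ => C * ‖s‖ ^ (e - r) := by fun_prop
      have h0 := (this.tendsto 0).mono_left (nhdsWithin_le_nhds (s := {0}ᶜ))
      simpa [show e - r ≠ 0 by omega] using h0
    have hle := le_of_tendsto_of_tendsto hl hr' (by
      filter_upwards [self_mem_nhdsWithin, nhdsWithin_le_nhds (Metric.ball_mem_nhds 0 hε)] with s hs0 hs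
      have h1 := h s hs
      have hpos : 0 < ‖s‖ ^ r := pow_pos (norm_pos_iff.2 hs0) r
      rw [hq', Polynomial.eval_mul, Polynomial.eval_pow, Polynomial.eval_X, norm_mul, norm_pow,
        show e = (e - r) + r by omega, pow_add] at h1
      nlinarith)
    exact norm_le_zero_iff.1 hle

theorem bitaylorCoeff_eq_zero_of_norm_le {n e : ℕ} {c : ℕ × ℕ → ℂ} {t x : ℂ} {C ε : ℝ} (hε : 0 < ε)
    (h : ∀ s ∈ Metric.ball (0 : ℂ) ε, ∀ σ ∈ Metric.ball (0 : ℂ) 2,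
      ‖∑ p ∈ tri n, c p * ((t + s) ^ p.1 * (x + s * σ) ^ p.2)‖ ≤ C * ‖s‖ ^ e) :
    ∀ q ∈ tri e, bitaylorCoeff n c t x q = 0 := by
  have h1 : ∀ σ ∈ Metric.ball (0 : ℂ) 2, ∀ r < e,
      ∑ q ∈ tri n, (if r = q.1 + q.2 then bitaylorCoeff n c t x q * σ ^ q.2 else 0) = 0 := by
    intro σ hσ r hr
    have := Polynomial.coeff_eq_zero_of_norm_le (e := e) (C := C)
      (q := ∑ q ∈ tri n, Polynomial.C (bitaylorCoeff n c t x q * σ ^ q.2) * Polynomial.X ^ (q.1 + q.2)) hε (fun s hs => by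
        have h2 := h s hs σ hσ
        rw [bipoly_add] at h2
        refine le_of_eq_of_le ?_ h2
        rw [Polynomial.eval_finsetSum]
        congr 1
        refine Finset.sum_congr rfl fun q _ => ?_
        simp only [Polynomial.eval_mul, Polynomial.eval_C, Polynomial.eval_pow, Polynomial.eval_X]
        ring) r hr
    simpa only [Polynomial.finsetSum_coeff, Polynomial.coeff_C_mul_X_pow] using this
  intro q hq
  by_cases hqn : q ∈ tri n
  swap
  · exact bitaylorCoeff_eq_zero hqn
  set r := q.1 + q.2 with hr
  rw [mem_tri] at hq
  have h2 : (∑ p ∈ tri n, Polynomial.C (if r = p.1 + p.2 then bitaylorCoeff n c t x p else 0) * Polynomial.X ^ p.2) =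
      (0 : Polynomial ℂ) := by
    refine Polynomial.eq_of_infinite_eval_eq _ _ ((infinite_of_mem_nhds (0 : ℂ) (Metric.ball_mem_nhds 0 two_pos)).mono
      fun σ hσ => ?_)
    have := h1 σ hσ r hq
    simp only [Set.mem_ofPred_eq, Polynomial.eval_zero, Polynomial.eval_finsetSum, Polynomial.eval_mul, Polynomial.eval_C,
      Polynomial.eval_pow, Polynomial.eval_X, ite_mul, zero_mul]
    exact this
  have h3 := congrArg (fun f => f.coeff q.2) h2
  simp only [Polynomial.finsetSum_coeff, Polynomial.coeff_C_mul_X_pow, Polynomial.coeff_zero] at h3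
  rw [Finset.sum_eq_single_of_mem q hqn fun p _ hp => ?_] at h3
  · simpa [hr] using h3
  · split_ifs with h4 h5
    · exact absurd (Prod.ext (by omega) h4.symm) hp
    · rfl
    · rfl

theorem _root_.Matrix.exists_mulVec_eq_zero_iff_card_ne {Q X : Type*} [Fintype Q] [Fintype X] {A : Matrix Q X ℂ}
    (hA : LinearIndependent ℂ A.row) : (∃ c : X → ℂ, c ≠ 0 ∧ A.mulVec c = 0) ↔ Fintype.card X ≠ Fintype.card Q := by
  have h1 := LinearMap.finrank_range_add_finrank_ker A.mulVecLin
  have h2 : Module.finrank ℂ (LinearMap.range A.mulVecLin) = Fintype.card Q := hA.rank_matrix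
  rw [h2, Module.finrank_pi] at h1
  have h3 : (∃ c : X → ℂ, c ≠ 0 ∧ A.mulVec c = 0) ↔ LinearMap.ker A.mulVecLin ≠ ⊥ := by
    rw [Submodule.ne_bot_iff]
    simp only [LinearMap.mem_ker, Matrix.mulVecLin_apply, ne_eq]
    exact ⟨fun ⟨c, h, h'⟩ => ⟨c, h', h⟩, fun ⟨c, h, h'⟩ => ⟨c, h', h⟩⟩
  rw [h3, ne_eq, ← Submodule.finrank_eq_zero (R := ℂ)]
  omega

theorem exists_bitaylorCoeff_eq_zero_iff {ι : Type*} [Fintype ι] [Nonempty ι] (a b : ι → ℂ)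
    (hab : ∀ j k, a j = a k → b j = b k → j = k) {k : ℕ} {α : ℝ} (hα1 : α < 1)
    (hα : α * Fintype.card ι = k + 3) {T : Type*} [Fintype T] (t x : T → ℂ) (ht : Function.Injective t) (e : T → ℕ)
    (he : ∀ v, e v = 0 ∨ e v + 1 < α * (Finset.univ.filter fun j => x v = a j + b j * t v).card) :
    (∃ c : ℕ × ℕ → ℂ, (∃ p ∈ tri (k + 1), c p ≠ 0) ∧ ∀ v, ∀ q ∈ tri (e v), bitaylorCoeff (k + 1) c (t v) (x v) q = 0) ↔
      (k + 2).choose 2 ≠ ∑ v, (e v + 1).choose 2 := by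
  set Q := Σ v : T, tri (e v)
  set A : Matrix Q (tri (k + 1)) ℂ := fun q p =>
    ((p.1.1.choose q.2.1.1 : ℂ) * t q.1 ^ (p.1.1 - q.2.1.1)) * ((p.1.2.choose q.2.1.2 : ℂ) * x q.1 ^ (p.1.2 - q.2.1.2)) with hAdef
  have hA : LinearIndependent ℂ A.row := by
    rw [Fintype.linearIndependent_iff]
    intro lam hlam
    refine jet_functionals_independent a b hab (n := k + 1) hα1 (by rw [hα]; push_cast; ring) (fun q : Q => t q.1) (fun q => x q.1)
      (fun q => q.2.1.1) (fun q => q.2.1.2) lam (fun q q' h => by rw [ht h]) ?_ ?_ ?_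
    · rintro ⟨v, q⟩ ⟨v', q'⟩ h h1 h2
      obtain rfl := ht h
      have : q = q' := Subtype.ext (Prod.ext h1 h2)
      rw [this]
    · rintro ⟨v, q⟩
      have hq := mem_tri.1 q.2
      have hq' : ((q.1.1 + q.1.2 + 1 : ℕ) : ℝ) ≤ e v := by exact_mod_cast hq
      push_cast at hq'
      rcases he v with h | h
      · omega
      · dsimp only
        linarith
    · intro j k' hjk
      have := congrFun hlam ⟨(j, k'), mem_tri.2 (by dsimp only; omega)⟩
      simpa [A, Matrix.row, Finset.sum_apply] using this
  have hcard : Fintype.card Q = ∑ v, (e v + 1).choose 2 := by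
    rw [Fintype.card_sigma]
    exact Finset.sum_congr rfl fun v _ => by rw [Fintype.card_coe, card_tri]
  have hkey := Matrix.exists_mulVec_eq_zero_iff_card_ne hA
  rw [Fintype.card_coe, card_tri, hcard] at hkey
  rw [← hkey]
  have hconv : ∀ c : ℕ × ℕ → ℂ, ∀ v q (hq : q ∈ tri (e v)),
      A.mulVec (fun p => c p.1) ⟨v, ⟨q, hq⟩⟩ = bitaylorCoeff (k + 1) c (t v) (x v) q := by
    intro c v q hq
    rw [bitaylorCoeff, ← Finset.sum_coe_sort (tri (k + 1))]
    exact Finset.sum_congr rfl fun p _ => mul_comm _ _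
  constructor
  · rintro ⟨c, ⟨p, hp, hp0⟩, hc⟩
    refine ⟨fun p => c p.1, fun h => hp0 (congrFun h ⟨p, hp⟩), ?_⟩
    ext ⟨v, q, hq⟩
    rw [hconv]
    exact hc v q hq
  · rintro ⟨c, hc0, hc⟩
    have hext : (fun p : tri (k + 1) => (fun p => if h : p ∈ tri (k + 1) then c ⟨p, h⟩ else 0 : ℕ × ℕ → ℂ) p.1) = c := by
      ext p
      simp
    refine ⟨fun p => if h : p ∈ tri (k + 1) then c ⟨p, h⟩ else 0, ?_, fun v q hq => ?_⟩
    · obtain ⟨p, hp⟩ := Function.ne_iff.1 hc0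
      exact ⟨p.1, p.2, by simpa using hp⟩
    · rw [← hconv _ v q hq, hext, hc]
      rfl

section
variable {ι : Type*} [Fintype ι] {ℓ : ι → ((Fin 3 → ℂ) →ₗ[ℂ] ℂ)}

theorem exists_notMem_submodules {E : Type*} [AddCommGroup E] [Module ℂ E] {κ : Type*} [Finite κ] {W : κ → Submodule ℂ E}
    (h : ∀ i, W i ≠ ⊤) : ∃ b, ∀ i, b ∉ W i := by
  by_contra! hc
  obtain ⟨i, hi⟩ := Subspace.exists_eq_top_of_iUnion_eq_univ (p := W) (Set.eq_univ_of_forall fun b => Set.mem_iUnion.2 (hc b))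
  exact h i hi

theorem span_pair_ne_top (v w : Fin 3 → ℂ) : Submodule.span ℂ {v, w} ≠ ⊤ := by
  intro h
  have h1 := finrank_span_finset_le_card (R := ℂ) ({v, w} : Finset (Fin 3 → ℂ))
  rw [Set.finrank, Finset.coe_pair, h, finrank_top, Module.finrank_fin_fun] at h1
  have := Finset.card_le_two (a := v) (b := w)
  omega

theorem exists_basis_of_coeff {v : Fin 3 → Fin 3 → ℂ}
    (h : ∀ c0 c1 c2 : ℂ, c0 • v 0 + c1 • v 1 + c2 • v 2 = 0 → c0 = 0 ∧ c1 = 0 ∧ c2 = 0) :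
    ∃ e : Module.Basis (Fin 3) ℂ (Fin 3 → ℂ), ⇑e = v := by
  have hli : LinearIndependent ℂ v := by
    rw [Fintype.linearIndependent_iff]
    intro c hc i
    rw [Fin.sum_univ_three] at hc
    obtain ⟨h0, h1, h2⟩ := h _ _ _ hc
    fin_cases i <;> assumption
  exact ⟨basisOfLinearIndependentOfCardEqFinrank hli (by simp), coe_basisOfLinearIndependentOfCardEqFinrank _ _⟩

theorem basis_coeff_eq_zero (b : Module.Basis (Fin 3) ℂ (Fin 3 → ℂ)) {c0 c1 c2 : ℂ}
    (h : c0 • b 0 + c1 • b 1 + c2 • b 2 = 0) : c0 = 0 ∧ c1 = 0 ∧ c2 = 0 := by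
  have := Fintype.linearIndependent_iff.1 b.linearIndependent ![c0, c1, c2] (by simpa [Fin.sum_univ_three] using h)
  exact ⟨this 0, this 1, this 2⟩

theorem basis_eq_coeffs (b : Module.Basis (Fin 3) ℂ (Fin 3 → ℂ)) (v : Fin 3 → ℂ) :
    v = b.coord 0 v • b 0 + b.coord 1 v • b 1 + b.coord 2 v • b 2 := by
  conv_lhs => rw [← b.sum_repr v]
  rw [Fin.sum_univ_three]
  rfl

theorem exists_generic_basis [Nonempty ι] (hne : ∀ i, ℓ i ≠ 0) {T : Type*} [Finite T] (v : T → Fin 3 → ℂ)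
    (hv0 : ∀ q, v q ≠ 0) (hv : ∀ q q' (c : ℂ), v q = c • v q' → q = q') :
    ∃ (b : Module.Basis (Fin 3) ℂ (Fin 3 → ℂ)) (t x c : T → ℂ), (∀ i, ℓ i (b 1) ≠ 0) ∧ Function.Injective t ∧
      ∀ q, c q ≠ 0 ∧ v q = c q • (b 2 + t q • b 0 + x q • b 1) := by
  obtain ⟨b1, hb1⟩ := exists_notMem_submodules
    (W := Sum.elim (fun i => LinearMap.ker (ℓ i)) fun p : T × T => Submodule.span ℂ {v p.1, v p.2}) (by
      rintro (i | p)
      · simpa [LinearMap.ker_eq_top] using hne i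
      · exact span_pair_ne_top _ _)
  have hb1ℓ : ∀ i, ℓ i b1 ≠ 0 := fun i => hb1 (Sum.inl i)
  have hb1v : ∀ q q' (c c' : ℂ), c • v q + c' • v q' ≠ b1 := fun q q' c c' h =>
    hb1 (Sum.inr (q, q')) (Submodule.mem_span_pair.2 ⟨c, c', h⟩)
  have hb10 : b1 ≠ 0 := fun h => hb1ℓ (Classical.arbitrary ι) (by rw [h, map_zero])
  obtain ⟨b0, hb0⟩ := exists_notMem_submodules (W := fun o : Option T => Submodule.span ℂ {o.elim b1 v, b1})
    fun o => span_pair_ne_top _ _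
  have hb0v : ∀ q (c c' : ℂ), c • v q + c' • b1 ≠ b0 := fun q c c' h => hb0 (some q) (Submodule.mem_span_pair.2 ⟨c, c', h⟩)
  have hb01 : ∀ c : ℂ, c • b1 ≠ b0 := fun c h =>
    hb0 none (Submodule.mem_span_pair.2 ⟨c, 0, by simpa using h⟩)
  obtain ⟨b2, hb2⟩ := exists_notMem_submodules (W := fun _ : Unit => Submodule.span ℂ {b0, b1})
    fun _ => span_pair_ne_top _ _
  have hb2' : ∀ c c' : ℂ, c • b0 + c' • b1 ≠ b2 := fun c c' h => hb2 () (Submodule.mem_span_pair.2 ⟨c, c', h⟩)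
  obtain ⟨b, hb⟩ := exists_basis_of_coeff (v := ![b0, b1, b2]) (fun c0 c1 c2 h => by
    simp only [Matrix.cons_val] at h
    have h2 : c2 = 0 := by
      by_contra h2
      have h' : c2⁻¹ • (-c0 • b0 + -c1 • b1) = b2 := by
        rw [inv_smul_eq_iff₀ h2]
        linear_combination (norm := module) (-1 : ℂ) • h
      rw [smul_add, smul_smul, smul_smul] at h'
      exact hb2' _ _ h'
    rw [h2, zero_smul, add_zero] at h
    have h0 : c0 = 0 := by
      by_contra h0
      have h' : c0⁻¹ • (-c1 • b1) = b0 := by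
        rw [inv_smul_eq_iff₀ h0]
        linear_combination (norm := module) (-1 : ℂ) • h
      rw [smul_smul] at h'
      exact hb01 _ h'
    rw [h0, zero_smul, zero_add] at h
    exact ⟨h0, (smul_eq_zero.1 h).resolve_right hb10, h2⟩)
  have e0 : b 0 = b0 := by rw [hb]; rfl
  have e1 : b 1 = b1 := by rw [hb]; rfl
  have hc : ∀ q, b.coord 2 (v q) ≠ 0 := by
    intro q h
    have h1 := basis_eq_coeffs b (v q)
    rw [h, zero_smul, add_zero, e0, e1] at h1
    set A := b.coord 0 (v q)
    set B := b.coord 1 (v q)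
    by_cases hA : A = 0
    · rw [hA, zero_smul, zero_add] at h1
      have hB : B ≠ 0 := fun hB => hv0 q (by rw [h1, hB, zero_smul])
      refine hb1v q q B⁻¹ 0 ?_
      rw [zero_smul, add_zero, inv_smul_eq_iff₀ hB, h1]
    · have h' : A⁻¹ • ((1 : ℂ) • v q + -B • b1) = b0 := by
        rw [inv_smul_eq_iff₀ hA]
        linear_combination (norm := module) (1 : ℂ) • h1
      rw [smul_add, smul_smul, smul_smul] at h'
      exact hb0v _ _ _ h'
  have hvq : ∀ q, v q = b.coord 2 (v q) • (b 2 + (b.coord 0 (v q) / b.coord 2 (v q)) • b 0 +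
      (b.coord 1 (v q) / b.coord 2 (v q)) • b 1) := by
    intro q
    conv_lhs => rw [basis_eq_coeffs b (v q)]
    rw [smul_add, smul_add, smul_smul, smul_smul, mul_div_cancel₀ _ (hc q), mul_div_cancel₀ _ (hc q)]
    abel
  refine ⟨b, fun q => b.coord 0 (v q) / b.coord 2 (v q), fun q => b.coord 1 (v q) / b.coord 2 (v q),
    fun q => b.coord 2 (v q), fun i => by rw [e1]; exact hb1ℓ i, fun q q' htt => ?_, fun q => ⟨hc q, hvq q⟩⟩
  have h1 := hvq q
  have h2 := hvq q'
  beta_reduce at htt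
  have hq := hc q
  have hq' := hc q'
  rw [htt, e1] at h1
  rw [e1] at h2
  set c := b.coord 2 (v q)
  set c' := b.coord 2 (v q')
  set x := b.coord 1 (v q) / c
  set x' := b.coord 1 (v q') / c'
  rw [eq_comm, ← eq_inv_smul_iff₀ hq] at h1
  rw [eq_comm, ← eq_inv_smul_iff₀ hq'] at h2
  by_cases hx : x = x'
  · rw [hx, h2, eq_comm, inv_smul_eq_iff₀ hq, smul_smul] at h1
    exact hv _ _ _ h1
  · have h' : (x - x')⁻¹ • (c⁻¹ • v q + -c'⁻¹ • v q') = b1 := by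
      rw [inv_smul_eq_iff₀ (sub_ne_zero.2 hx)]
      linear_combination (norm := module) h2 - h1
    rw [smul_add, smul_smul, smul_smul] at h'
    exact absurd h' (hb1v _ _ _ _)

theorem exists_chart_basis (b : Module.Basis (Fin 3) ℂ (Fin 3 → ℂ)) (t x : ℂ) :
    ∃ e : Module.Basis (Fin 3) ℂ (Fin 3 → ℂ), e 0 = b 2 + t • b 0 + x • b 1 ∧ e 1 = b 0 ∧ e 2 = b 1 := by
  obtain ⟨e, he⟩ := exists_basis_of_coeff (v := ![b 2 + t • b 0 + x • b 1, b 0, b 1]) (fun c0 c1 c2 h => by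
    simp only [Matrix.cons_val] at h
    have := basis_coeff_eq_zero b (c0 := c0 * t + c1) (c1 := c0 * x + c2) (c2 := c0) (by
      rw [← h]
      module)
    obtain ⟨h1, h2, h3⟩ := this
    rw [h3] at h1 h2
    exact ⟨h3, by simpa using h1, by simpa using h2⟩)
  exact ⟨e, by rw [he]; rfl, by rw [he]; rfl, by rw [he]; rfl⟩

end

section
variable {ι : Type*} [Fintype ι] {ℓ : ι → ((Fin 3 → ℂ) →ₗ[ℂ] ℂ)}

theorem formsAt_smul {c : ℂ} (hc : c ≠ 0) (x : Fin 3 → ℂ) : formsAt ℓ (c • x) = formsAt ℓ x := by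
  ext i
  simp [mem_formsAt, hc]

theorem bitaylorCoeff_zero {n : ℕ} {c : ℕ × ℕ → ℂ} {q : ℕ × ℕ} (hq : q ∈ tri n) : bitaylorCoeff n c 0 0 q = c q := by
  rw [bitaylorCoeff, Finset.sum_eq_single_of_mem q hq fun p _ hpq => ?_]
  · simp
  · rcases lt_trichotomy p.1 q.1 with h | h | h
    · simp [Nat.choose_eq_zero_of_lt h]
    · rcases lt_trichotomy p.2 q.2 with h' | h' | h'
      · simp [Nat.choose_eq_zero_of_lt h']
      · exact absurd (Prod.ext h h') hpq
      · simp [zero_pow (Nat.sub_ne_zero_of_lt h')]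
    · simp [zero_pow (Nat.sub_ne_zero_of_lt h)]

theorem exists_bipoly_ne_zero {n : ℕ} {c : ℕ × ℕ → ℂ} {q : ℕ × ℕ} (hq : q ∈ tri n) (h0 : c q ≠ 0) :
    ∃ t x : ℂ, ∑ p ∈ tri n, c p * (t ^ p.1 * x ^ p.2) ≠ 0 := by
  by_contra! h
  refine h0 ?_
  rw [← bitaylorCoeff_zero (c := c) hq]
  exact bitaylorCoeff_eq_zero_of_norm_le (e := n) (C := 0) one_pos (fun s _ σ _ => by simp [h]) q hq

/-- The homogenization of degree `k` of the polynomial with coefficients `c`. -/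
def homogenization (b : Module.Basis (Fin 3) ℂ (Fin 3 → ℂ)) (k : ℕ) (c : ℕ × ℕ → ℂ) (y : Fin 3 → ℂ) : ℂ :=
  ∑ p ∈ tri (k + 1), c p * (b.coord 0 y ^ p.1 * b.coord 1 y ^ p.2 * b.coord 2 y ^ (k - (p.1 + p.2)))

theorem differentiable_homogenization (b : Module.Basis (Fin 3) ℂ (Fin 3 → ℂ)) (k : ℕ) (c : ℕ × ℕ → ℂ) :
    Differentiable ℂ (homogenization b k c) := by
  have h : ∀ i, Differentiable ℂ (b.coord i) := fun i => (b.coord i).toContinuousLinearMap.differentiable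
  have h0 := h 0
  have h1 := h 1
  have h2 := h 2
  unfold homogenization
  fun_prop

theorem homogenization_smul (b : Module.Basis (Fin 3) ℂ (Fin 3 → ℂ)) (k : ℕ) (c : ℕ × ℕ → ℂ) (r : ℂ) (y : Fin 3 → ℂ) :
    homogenization b k c (r • y) = r ^ k * homogenization b k c y := by
  rw [homogenization, homogenization, Finset.mul_sum]
  refine Finset.sum_congr rfl fun p hp => ?_
  rw [mem_tri] at hp
  simp only [map_smul, smul_eq_mul, mul_pow]
  have : r ^ k = r ^ p.1 * r ^ p.2 * r ^ (k - (p.1 + p.2)) := by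
    rw [← pow_add, ← pow_add]
    congr 1
    omega
  rw [this]
  ring

theorem homogenization_chart (b : Module.Basis (Fin 3) ℂ (Fin 3 → ℂ)) (k : ℕ) (c : ℕ × ℕ → ℂ) (t x : ℂ) :
    homogenization b k c (b 2 + t • b 0 + x • b 1) = ∑ p ∈ tri (k + 1), c p * (t ^ p.1 * x ^ p.2) := by
  have h0 : b.coord 0 (b 2 + t • b 0 + x • b 1) = t := by simp
  have h1 : b.coord 1 (b 2 + t • b 0 + x • b 1) = x := by simp
  have h2 : b.coord 2 (b 2 + t • b 0 + x • b 1) = 1 := by simp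
  simp only [homogenization, h0, h1, h2, one_pow, mul_one]

theorem formsAt_chart {b : Module.Basis (Fin 3) ℂ (Fin 3 → ℂ)} (hb : ∀ i, ℓ i (b 1) ≠ 0) (t x : ℂ) :
    formsAt ℓ (b 2 + t • b 0 + x • b 1) =
      Finset.univ.filter fun i => x = -ℓ i (b 2) / ℓ i (b 1) + -ℓ i (b 0) / ℓ i (b 1) * t := by
  ext i
  have := hb i
  simp only [mem_formsAt, Finset.mem_filter, Finset.mem_univ, true_and, map_add, map_smul, smul_eq_mul]
  rw [div_mul_eq_mul_div, ← add_div, eq_div_iff this]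
  constructor <;> intro h <;> linear_combination h

theorem eq_of_chart_lines_eq (hnp : ∀ i j, i ≠ j → ∀ c : ℂ, ℓ i ≠ c • ℓ j) {b : Module.Basis (Fin 3) ℂ (Fin 3 → ℂ)}
    (hb : ∀ i, ℓ i (b 1) ≠ 0) (i j : ι) (h2 : -ℓ i (b 2) / ℓ i (b 1) = -ℓ j (b 2) / ℓ j (b 1))
    (h0 : -ℓ i (b 0) / ℓ i (b 1) = -ℓ j (b 0) / ℓ j (b 1)) : i = j := by
  by_contra hij
  refine hnp i j hij (ℓ i (b 1) / ℓ j (b 1)) (b.ext fun m => ?_)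
  have hi := hb i
  have hj := hb j
  rw [div_eq_div_iff hi hj] at h0 h2
  rw [LinearMap.smul_apply, smul_eq_mul, div_mul_eq_mul_div, eq_div_iff hj]
  fin_cases m <;> simp only [Fin.zero_eta, Fin.mk_one, Fin.reduceFinMk]
  · linear_combination -h0
  · linear_combination -h2

theorem exists_jumpWitness_zero_of_choose_ne [Nonempty ι] (hne : ∀ i, ℓ i ≠ 0)
    (hnp : ∀ i j, i ≠ j → ∀ c : ℂ, ℓ i ≠ c • ℓ j) {α : ℝ} (hα : 0 < α) (hα1 : α < 1) {T : Type*} [Fintype T]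
    (v : T → Fin 3 → ℂ) (hv0 : ∀ q, v q ≠ 0) (hv : ∀ q q' (c : ℂ), v q = c • v q' → q = q')
    (hvs : ∀ x, x ≠ 0 → 3 ≤ (formsAt ℓ x).card → ∃ q, ∃ c : ℂ, x = c • v q) (e : T → ℕ)
    (he : ∀ q, e q = 0 ∨ e q + 1 < α * (formsAt ℓ (v q)).card) (he' : ∀ q, α * (formsAt ℓ (v q)).card ≤ e q + 2)
    {k : ℕ} (hk : α * Fintype.card ι = k + 3) (h : (k + 2).choose 2 ≠ ∑ q, (e q + 1).choose 2) :
    ∃ ρ g, JumpWitness ℓ α 0 ρ g := by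
  obtain ⟨b, t, x, c, hb, ht, hvb⟩ := exists_generic_basis hne v hv0 hv
  have hfv : ∀ q, formsAt ℓ (b 2 + t q • b 0 + x q • b 1) = formsAt ℓ (v q) := fun q => by
    rw [(hvb q).2, formsAt_smul (hvb q).1]
  obtain ⟨cc, ⟨p, hp, hp0⟩, hcc⟩ := (exists_bitaylorCoeff_eq_zero_iff _ _ (eq_of_chart_lines_eq hnp hb) hα1 hk t x ht e
    fun q => by rw [← formsAt_chart hb, hfv]; exact he q).2 h
  have hGd := differentiable_homogenization b k cc
  refine exists_jumpWitness_zero hne hnp hα hα1 hk hGd (homogenization_smul b k cc) ?_ fun y hy => ?_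
  · obtain ⟨t, x, htx⟩ := exists_bipoly_ne_zero hp hp0
    exact ⟨_, by rwa [← homogenization_chart b] at htx⟩
  by_cases h3 : 3 ≤ (formsAt ℓ y).card
  · obtain ⟨q, r, hyq⟩ := hvs y hy h3
    obtain ⟨e', he0, he1, he2⟩ := exists_chart_basis b (t q) (x q)
    obtain ⟨M, hM, hbd⟩ := norm_bipoly_add_le (hcc q)
    refine ⟨e', r * c q, by rw [hyq, he0, mul_smul, ← (hvb q).2], e q, by rw [he0, hfv]; exact he' q, M, hM, fun s hs σ hσ => ?_⟩
    rw [mem_ball_zero_iff] at hs hσ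
    have hsσ : ‖s * σ‖ ≤ 2 * ‖s‖ := by
      rw [norm_mul, mul_comm]
      gcongr
    have hs2 : ‖s‖ ≤ 2 * ‖s‖ := by linarith [norm_nonneg s]
    rw [he0, he1, he2,
      show b 2 + t q • b 0 + x q • b 1 + s • (b 0 + σ • b 1) = b 2 + (t q + s) • b 0 + (x q + s * σ) • b 1 by module,
      show b 2 + t q • b 0 + x q • b 1 + s • (b 1 + σ • b 0) = b 2 + (t q + s * σ) • b 0 + (x q + s) • b 1 by module,
      homogenization_chart, homogenization_chart]
    exact ⟨hbd s s (s * σ) hs hs2 hsσ, hbd s (s * σ) s hs hsσ hs2⟩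
  · obtain ⟨e', he0⟩ := exists_basis_zero_eq hy
    obtain ⟨C, hC⟩ := (isCompact_closedBall (0 : Fin 3 → ℂ) (‖e' 0‖ + (‖e' 1‖ + 2 * ‖e' 2‖) + (‖e' 2‖ + 2 * ‖e' 1‖))).exists_bound_of_continuousOn
      hGd.continuous.continuousOn
    have hC' : ∀ z ∈ Metric.closedBall (0 : Fin 3 → ℂ) (‖e' 0‖ + (‖e' 1‖ + 2 * ‖e' 2‖) + (‖e' 2‖ + 2 * ‖e' 1‖)),
        ‖homogenization b k cc z‖ ≤ max C 1 * 1 := fun z hz => by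
      simpa using Or.inl (hC z hz)
    refine ⟨e', 1, by rw [one_smul, he0], 0, ?_, max C 1, by positivity, fun s hs σ hσ => ?_⟩
    · have : ((formsAt ℓ y).card : ℝ) ≤ 2 := by exact_mod_cast (by omega : (formsAt ℓ y).card ≤ 2)
      rw [he0]
      push_cast
      nlinarith
    rw [mem_ball_zero_iff] at hs hσ
    have hbd : ∀ u w : Fin 3 → ℂ, ‖s • (u + σ • w)‖ ≤ ‖u‖ + 2 * ‖w‖ := fun u w => by
      rw [norm_smul]
      have h1 : ‖u + σ • w‖ ≤ ‖u‖ + 2 * ‖w‖ := (norm_add_le _ _).trans (by rw [norm_smul]; gcongr)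
      nlinarith [norm_nonneg (u + σ • w)]
    rw [pow_zero]
    have n1 := norm_nonneg (e' 1)
    have n2 := norm_nonneg (e' 2)
    refine ⟨hC' _ ?_, hC' _ ?_⟩ <;> rw [mem_closedBall_zero_iff] <;> refine (norm_add_le _ _).trans ?_
    · linarith [hbd (e' 1) (e' 2)]
    · linarith [hbd (e' 2) (e' 1)]

theorem JumpWitness.exists_choose_ne [Nonempty ι] (hne : ∀ i, ℓ i ≠ 0)
    (hnp : ∀ i j, i ≠ j → ∀ c : ℂ, ℓ i ≠ c • ℓ j) {α : ℝ} (hα : 0 < α) (hα1 : α < 1) {T : Type*} [Fintype T]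
    (v : T → Fin 3 → ℂ) (hv0 : ∀ q, v q ≠ 0) (hv : ∀ q q' (c : ℂ), v q = c • v q' → q = q') (e : T → ℕ)
    (he : ∀ q, e q = 0 ∨ e q + 1 < α * (formsAt ℓ (v q)).card) {ρ : ℝ} {g : (Fin 3 → ℂ) → ℂ} (h : JumpWitness ℓ α 0 ρ g)
    (hna : ∀ x, x ≠ 0 → ∀ k : ℕ, α * (formsAt ℓ x).card ≠ k + 2) :
    ∃ k : ℕ, α * Fintype.card ι = k + 3 ∧ (k + 2).choose 2 ≠ ∑ q, (e q + 1).choose 2 := by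
  obtain ⟨k, hk, G, hhom, hGd, ⟨C, hC⟩, ⟨y, hy⟩, hjet⟩ := h.exists_leading_part hne hnp hα hα1 hna
  refine ⟨k, hk, ?_⟩
  obtain ⟨b, t, x, c, hb, ht, hvb⟩ := exists_generic_basis hne v hv0 hv
  have hfv : ∀ q, formsAt ℓ (b 2 + t q • b 0 + x q • b 1) = formsAt ℓ (v q) := fun q => by
    rw [(hvb q).2, formsAt_smul (hvb q).1]
  have hC0 : 0 ≤ C := by simpa using (norm_nonneg _).trans (hC 0)
  obtain ⟨cc, hcc⟩ := exists_bipoly_of_growth (P := fun t x => G (b 2 + t • b 0 + x • b 1)) (k := k)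
    (C := C * (1 + ‖b 0‖ + ‖b 1‖ + ‖b 2‖) ^ k) (fun a a' c c' => by
      have h1 := hGd (b 2 + a • b 0 + c • b 1) (a' • b 0 + c' • b 1)
      have h2 : ∀ τ : ℂ, b 2 + a • b 0 + c • b 1 + τ • (a' • b 0 + c' • b 1) =
          b 2 + (a + τ * a') • b 0 + (c + τ * c') • b 1 := fun τ => by module
      simpa only [h2] using h1) (fun t x => by
      refine (hC _).trans ?_
      rw [mul_assoc, ← mul_pow]
      gcongr
      have h1 : ‖b 2 + t • b 0 + x • b 1‖ ≤ ‖b 2‖ + ‖t‖ * ‖b 0‖ + ‖x‖ * ‖b 1‖ :=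
        (norm_add₃_le).trans (by rw [norm_smul, norm_smul])
      nlinarith [norm_nonneg t, norm_nonneg x, norm_nonneg (b 0), norm_nonneg (b 1), norm_nonneg (b 2),
        mul_nonneg (norm_nonneg t) (norm_nonneg (b 1)), mul_nonneg (norm_nonneg t) (norm_nonneg (b 2)),
        mul_nonneg (norm_nonneg x) (norm_nonneg (b 0)), mul_nonneg (norm_nonneg x) (norm_nonneg (b 2))])
  refine (exists_bitaylorCoeff_eq_zero_iff _ _ (eq_of_chart_lines_eq hnp hb) hα1 hk t x ht e
    fun q => by rw [← formsAt_chart hb, hfv]; exact he q).1 ⟨cc, ?_, fun q => ?_⟩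
  · by_contra! hcc0
    have hzero : ∀ t x, G (b 2 + t • b 0 + x • b 1) = 0 := fun t x =>
      (hcc t x).trans (Finset.sum_eq_zero fun p hp => by rw [hcc0 p hp, zero_mul])
    have hzero' : ∀ z, b.coord 2 z ≠ 0 → G z = 0 := fun z hz => by
      have : z = b.coord 2 z • (b 2 + ((b.coord 2 z)⁻¹ * b.coord 0 z) • b 0 + ((b.coord 2 z)⁻¹ * b.coord 1 z) • b 1) := by
        conv_lhs => rw [basis_eq_coeffs b z]
        rw [smul_add, smul_add, smul_smul, smul_smul, mul_inv_cancel_left₀ hz, mul_inv_cancel_left₀ hz]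
        abel
      rw [this, hhom, hzero, mul_zero]
    refine hy ?_
    have hcont : Continuous fun τ : ℂ => G (y + τ • b 2) := (hGd y (b 2)).continuous
    have hev : ∀ τ : ℂ, τ ≠ -b.coord 2 y → G (y + τ • b 2) = 0 := fun τ hτ => hzero' _ (by
      have : b.coord 2 (y + τ • b 2) = b.coord 2 y + τ := by simp
      rw [this]
      exact fun h => hτ (by linear_combination h))
    have := hcont.ext_on (s := {-b.coord 2 y}ᶜ) (dense_compl_singleton _) continuous_const
      (g := fun _ => (0 : ℂ)) fun τ hτ => hev τ hτ
    simpa using congrFun this 0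
  · obtain ⟨e', he0, he1, he2⟩ := exists_chart_basis b (t q) (x q)
    obtain ⟨C', ε, hε, hbd⟩ := hjet e' (e q) (by rw [he0, hfv]; exact_mod_cast he q)
    refine bitaylorCoeff_eq_zero_of_norm_le (C := C') hε fun s hs σ hσ => ?_
    have := hbd s hs σ hσ
    rw [he0, he1, he2,
      show b 2 + t q • b 0 + x q • b 1 + s • (b 0 + σ • b 1) = b 2 + (t q + s) • b 0 + (x q + s * σ) • b 1 by module] at this
    rwa [← hcc]

end

namespace Arrangement

theorem f_eq_formProd {D : Arrangement 3} (hred : D.Reduced) : D.f = formProd D.g := by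
  ext x
  exact Finset.prod_congr rfl fun i _ => by rw [hred i, pow_one]

theorem degree_eq_card {D : Arrangement 3} (hred : D.Reduced) : D.degree = Fintype.card D.ι := by
  rw [degree, Finset.sum_congr rfl fun i _ => hred i]
  simp

theorem muRed_span (D : Arrangement 3) (x : Fin 3 → ℂ) : D.muRed (ℂ ∙ x) = (formsAt D.g x).card := by
  simp only [muRed, formsAt, Submodule.span_singleton_le_iff_mem, LinearMap.mem_ker]

theorem span_mem_edges (D : Arrangement 3) {x : Fin 3 → ℂ} (hx : x ≠ 0) (h : 2 ≤ (formsAt D.g x).card) :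
    (ℂ ∙ x) ∈ D.edges := by
  obtain ⟨i, hi, j, hj, hij⟩ := Finset.one_lt_card.1 h
  rw [mem_formsAt] at hi hj
  refine ⟨{i | D.g i x = 0}, ⟨i, hi⟩, le_antisymm ?_ fun y hy => ?_⟩
  · rw [Submodule.span_singleton_le_iff_mem]
    simp
  · have hy' : ∀ i, D.g i x = 0 → D.g i y = 0 := by simpa using hy
    by_contra hxy
    obtain ⟨z, hz⟩ := exists_notMem_submodules (W := fun _ : Unit => Submodule.span ℂ {x, y}) fun _ => span_pair_ne_top _ _
    have hz' : ∀ c c' : ℂ, c • x + c' • y ≠ z := fun c c' h => hz () (Submodule.mem_span_pair.2 ⟨c, c', h⟩)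
    have hxy' : ∀ c : ℂ, c • x ≠ y := fun c h => hxy (Submodule.mem_span_singleton.2 ⟨c, h⟩)
    obtain ⟨e, he⟩ := exists_basis_of_coeff (v := ![x, y, z]) (fun c0 c1 c2 h => by
      simp only [Matrix.cons_val] at h
      have h2 : c2 = 0 := by
        by_contra h2
        have h' : c2⁻¹ • (-c0 • x + -c1 • y) = z := by
          rw [inv_smul_eq_iff₀ h2]
          linear_combination (norm := module) (-1 : ℂ) • h
        rw [smul_add, smul_smul, smul_smul] at h'
        exact hz' _ _ h'
      rw [h2, zero_smul, add_zero] at h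
      have h1 : c1 = 0 := by
        by_contra h1
        have h' : c1⁻¹ • (-c0 • x) = y := by
          rw [inv_smul_eq_iff₀ h1]
          linear_combination (norm := module) (-1 : ℂ) • h
        rw [smul_smul] at h'
        exact hxy' _ h'
      rw [h1, zero_smul, add_zero] at h
      exact ⟨(smul_eq_zero.1 h).resolve_right hx, h1, h2⟩)
    have e0 : e 0 = x := by rw [he]; rfl
    have e1 : e 1 = y := by rw [he]; rfl
    have hj2 : D.g j (e 2) ≠ 0 := fun h2 => D.g_ne j (form_eq_zero_of_basis e (by rw [e0, hj]) (by rw [e1, hy' j hj]) h2)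
    refine D.nonproportional i j hij (D.g i (e 2) / D.g j (e 2)) (sub_eq_zero.1 (form_eq_zero_of_basis e ?_ ?_ ?_))
    · simp [e0, hi, hj]
    · simp [e1, hy' i hi, hy' j hj]
    · simp [hj2]

theorem finite_edges (D : Arrangement 3) : D.edges.Finite :=
  (Set.finite_range fun I : Set D.ι => ⨅ i ∈ I, LinearMap.ker (D.g i)).subset (by
    rintro V ⟨I, -, rfl⟩
    exact ⟨I, rfl⟩)

/-- The one-dimensional edges contained in at least three hyperplanes. -/
def multipleLines (D : Arrangement 3) : Set (Submodule ℂ (Fin 3 → ℂ)) :=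
  {V | V ∈ D.edges ∧ Module.finrank ℂ V = 1 ∧ 3 ≤ D.muRed V}

theorem finite_multipleLines (D : Arrangement 3) : D.multipleLines.Finite :=
  D.finite_edges.subset fun _ h => h.1

theorem exists_generator {V : Submodule ℂ (Fin 3 → ℂ)} (hV : Module.finrank ℂ V = 1) : ∃ x, x ≠ 0 ∧ V = ℂ ∙ x := by
  obtain ⟨x, hx, hV'⟩ := finrank_eq_one_iff'.1 hV
  refine ⟨x, by simpa using hx, le_antisymm (fun y hy => ?_) ?_⟩
  · obtain ⟨c, hc⟩ := hV' ⟨y, hy⟩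
    exact Submodule.mem_span_singleton.2 ⟨c, congrArg Subtype.val hc⟩
  · rw [Submodule.span_singleton_le_iff_mem]
    exact x.2

theorem span_mem_multipleLines (D : Arrangement 3) {x : Fin 3 → ℂ} (hx : x ≠ 0) (h : 3 ≤ (formsAt D.g x).card) :
    (ℂ ∙ x) ∈ D.multipleLines :=
  ⟨D.span_mem_edges hx (by omega), finrank_span_singleton hx, by rwa [muRed_span]⟩

/-- The vanishing order along `V` imposed by integrability at exponent `α`. -/
def jumpOrder (D : Arrangement 3) (α : ℝ) (V : Submodule ℂ (Fin 3 → ℂ)) : ℕ :=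
  (⌈α * D.muRed V⌉ - 2).toNat

theorem jumpOrder_eq_zero_or_lt (D : Arrangement 3) (α : ℝ) (V : Submodule ℂ (Fin 3 → ℂ)) :
    D.jumpOrder α V = 0 ∨ D.jumpOrder α V + 1 < α * D.muRed V := by
  rcases le_or_gt ⌈α * D.muRed V⌉ 2 with h | h
  · left
    rw [jumpOrder]
    omega
  · right
    have h1 : ((D.jumpOrder α V : ℕ) : ℤ) + 1 < ⌈α * D.muRed V⌉ := by
      rw [jumpOrder, Int.toNat_of_nonneg (by omega)]
      omega
    have := Int.lt_ceil.1 h1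
    push_cast at this
    exact this

theorem le_jumpOrder_add_two (D : Arrangement 3) (α : ℝ) (V : Submodule ℂ (Fin 3 → ℂ)) :
    α * D.muRed V ≤ D.jumpOrder α V + 2 := by
  have h1 : ⌈α * D.muRed V⌉ ≤ ((D.jumpOrder α V : ℕ) : ℤ) + 2 := by
    have := Int.self_le_toNat (⌈α * D.muRed V⌉ - 2)
    rw [jumpOrder]
    omega
  have := Int.ceil_le.1 h1
  push_cast at this
  exact this

theorem jumpOrder_choose (D : Arrangement 3) {α : ℝ} {i d : ℕ} (h : α = (i : ℝ) / d) (V : Submodule ℂ (Fin 3 → ℂ)) :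
    (D.jumpOrder α V + 1).choose 2 = (⌈(i * D.muRed V : ℚ) / (d : ℚ)⌉ - 1).toNat.choose 2 := by
  have hc : ⌈(i * D.muRed V : ℚ) / (d : ℚ)⌉ = ⌈α * D.muRed V⌉ := by
    rw [← Rat.ceil_cast (α := ℝ), h]
    push_cast
    rw [mul_div_right_comm]
  rw [hc, jumpOrder]
  rcases le_or_gt 2 ⌈α * D.muRed V⌉ with h2 | h2
  · congr 1
    omega
  · rw [show (⌈α * D.muRed V⌉ - 2).toNat = 0 by omega, show (⌈α * D.muRed V⌉ - 1).toNat = 0 by omega]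
    rfl

theorem finsum_choose_eq (D : Arrangement 3) {α : ℝ} {i d : ℕ} (h : α = (i : ℝ) / d) [Fintype D.multipleLines] :
    ∑ᶠ V ∈ {V | V ∈ D.edges ∧ Module.finrank ℂ V = 1 ∧ 3 ≤ D.muRed V},
      (((⌈(i * D.muRed V : ℚ) / (d : ℚ)⌉ - 1).toNat.choose 2 : ℤ)) =
    ((∑ V : D.multipleLines, (D.jumpOrder α V + 1).choose 2 : ℕ) : ℤ) := by
  change ∑ᶠ V ∈ D.multipleLines, _ = _
  rw [← finsum_set_coe_eq_finsum_mem, finsum_eq_sum_of_fintype, Nat.cast_sum]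
  exact Finset.sum_congr rfl fun V _ => by rw [jumpOrder_choose D h]

end Arrangement

/-- **Corollary 1.** Combinatorial description of the jumping coefficients in `(0,1)` of a
reduced essential central hyperplane arrangement in `ℂ³`. -/
theorem jc_dim3_criterion (D : Arrangement 3) (hred : D.Reduced) (hess : D.Essential)
    (hd : 3 < D.degree) (α : ℝ) (h0 : 0 < α) (h1 : α < 1) :
    α ∈ D.JC ↔
      ((∃ V ∈ D.edges, Module.finrank ℂ V = 1 ∧ 3 ≤ D.muRed V ∧
          ∃ k : ℤ, (D.muRed V : ℝ) * α = (k : ℝ) ∧ 2 ≤ k ∧ k < (D.muRed V : ℤ)) ∨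
       (∃ i : ℕ, 3 ≤ i ∧ i < D.degree ∧ α = (i : ℝ) / (D.degree : ℝ) ∧
          (((i - 1).choose 2 : ℤ) -
            ∑ᶠ V ∈ {V | V ∈ D.edges ∧ Module.finrank ℂ V = 1 ∧ 3 ≤ D.muRed V},
              (((⌈(i * D.muRed V : ℚ) / (D.degree : ℚ)⌉ - 1).toNat.choose 2 : ℤ))) ≠ 0)) := by
  have hne := D.g_ne
  have hnp := D.nonproportional
  have := D.nonemptyι
  have : Fintype D.multipleLines := D.finite_multipleLines.fintype
  have hgen : ∀ V : D.multipleLines, ∃ x : Fin 3 → ℂ, x ≠ 0 ∧ V.1 = ℂ ∙ x := fun V => Arrangement.exists_generator V.2.2.1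
  choose v hv0 hvs using hgen
  have hmu : ∀ V : D.multipleLines, D.muRed V = (formsAt D.g (v V)).card := fun V => by
    conv_lhs => rw [hvs V]
    exact D.muRed_span _
  have hinj : ∀ V V' (c : ℂ), v V = c • v V' → V = V' := fun V V' c h => by
    have hc : c ≠ 0 := fun hc => hv0 V (by rw [h, hc, zero_smul])
    exact Subtype.ext (by rw [hvs V, hvs V', h, Submodule.span_singleton_smul_eq (IsUnit.mk0 c hc)])
  have he : ∀ V : D.multipleLines, D.jumpOrder α V = 0 ∨ D.jumpOrder α V + 1 < α * (formsAt D.g (v V)).card := fun V => by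
    rw [← hmu]
    exact D.jumpOrder_eq_zero_or_lt α V
  have he' : ∀ V : D.multipleLines, α * (formsAt D.g (v V)).card ≤ D.jumpOrder α V + 2 := fun V => by
    rw [← hmu]
    exact D.le_jumpOrder_add_two α V
  have hcard := D.degree_eq_card hred
  have hdpos : (0 : ℝ) < D.degree := by exact_mod_cast (by omega : 0 < D.degree)
  constructor
  · rintro ⟨-, x, hx⟩
    rw [D.f_eq_formProd hred, jumpingAtOf_iff] at hx
    obtain ⟨ρ, g, hw⟩ := hx
    by_cases hna : ∀ x, x ≠ 0 → ∀ k : ℕ, α * (formsAt D.g x).card ≠ k + 2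
    · right
      have hx0 : x = 0 := by
        by_contra hx
        obtain ⟨k, hk⟩ := hw.exists_eq_of_ne_zero hne hnp h0 h1 hx
        exact hna x hx k hk
      subst hx0
      obtain ⟨k, hk, hch⟩ := hw.exists_choose_ne hne hnp h0 h1 v hv0 hinj (fun V => D.jumpOrder α V) he hna
      rw [← hcard] at hk
      have hα : α = ((k + 3 : ℕ) : ℝ) / (D.degree : ℝ) := by
        rw [eq_div_iff hdpos.ne', hk]
        push_cast
        ring
      refine ⟨k + 3, by omega, ?_, hα, ?_⟩
      · have : ((k + 3 : ℕ) : ℝ) < D.degree := by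
          push_cast
          nlinarith
        exact_mod_cast this
      · rw [D.finsum_choose_eq hα, sub_ne_zero]
        exact_mod_cast hch
    · left
      push Not at hna
      obtain ⟨y, hy, k, hk⟩ := hna
      have hlt : ((k + 2 : ℕ) : ℝ) < (formsAt D.g y).card := by
        push_cast
        have hpos : (0 : ℝ) < (formsAt D.g y).card := by
          by_contra h
          have : (0 : ℝ) < k + 2 := by positivity
          nlinarith
        nlinarith
      have hlt' : k + 2 < (formsAt D.g y).card := by exact_mod_cast hlt
      obtain ⟨hV, hV1, hV3⟩ := D.span_mem_multipleLines hy (by omega)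
      refine ⟨ℂ ∙ y, hV, hV1, hV3, k + 2, ?_, by omega, ?_⟩
      · rw [D.muRed_span, mul_comm, hk]
        push_cast
        ring
      · rw [D.muRed_span]
        omega
  · rintro (⟨V, hV, hV1, hV3, k, hk, hk2, -⟩ | ⟨i, hi3, hid, hα, hch⟩)
    · obtain ⟨x, hx, rfl⟩ := Arrangement.exists_generator hV1
      obtain ⟨m, hm⟩ := Int.eq_ofNat_of_zero_le (by omega : 0 ≤ k - 2)
      obtain rfl : k = (m : ℤ) + 2 := by omega
      rw [D.muRed_span] at hk
      refine ⟨h0, x, ?_⟩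
      rw [D.f_eq_formProd hred, jumpingAtOf_iff]
      refine exists_jumpWitness_of_ne_zero hne hnp h0 h1 hx (k := m) ?_
      rw [mul_comm, hk]
      push_cast
      ring
    · refine ⟨h0, 0, ?_⟩
      rw [D.f_eq_formProd hred, jumpingAtOf_iff]
      obtain ⟨k, rfl⟩ := Nat.exists_eq_add_of_le' hi3
      refine exists_jumpWitness_zero_of_choose_ne hne hnp h0 h1 v hv0 hinj (fun x hx h3 => ?_) (fun V => D.jumpOrder α V)
        he he' (k := k) ?_ ?_
      · refine ⟨⟨ℂ ∙ x, D.span_mem_multipleLines hx h3⟩, ?_⟩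
        have hmem : x ∈ ℂ ∙ v ⟨ℂ ∙ x, D.span_mem_multipleLines hx h3⟩ := by
          rw [← hvs ⟨ℂ ∙ x, D.span_mem_multipleLines hx h3⟩]
          exact Submodule.mem_span_singleton_self x
        obtain ⟨c, hc⟩ := Submodule.mem_span_singleton.1 hmem
        exact ⟨c, hc.symm⟩
      · rw [← hcard, hα, div_mul_cancel₀ _ hdpos.ne']
        push_cast
        ring
      · rw [D.finsum_choose_eq hα, sub_ne_zero] at hch
        exact_mod_cast hch
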